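/- Let d = 4, p = 7, ℓ = 1 + 4/(p−1) = 5/3. There exists a strictly decreasing sequence (γ_k) of real numbers with γ_k > ℓ^{-1/2} for every k and lim_{k→∞} γ_k = ℓ^{-1/2}, such that for each k one has b_k = (d−1)/(ℓ(γ_k+1)) − 1 > 0 and the (Z,V)-ODE with parameter γ = γ_k admits a solution V ∈ C^∞([0,∞)) with V(0) = 0 which satisfies V(Z) ∈ (−1,1) and V(Z) < Z for every Z > 0, and which has the form V(Z) = Z·g(Z²) for some function g ∈ C^∞([0,∞)). -/

import Mathlib

noncomputable section

open Set

namespace Stmt0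

/-- `Δ_V(Z,V)` for `d = 4`, `ℓ = 5/3`, with parameter `γ`. -/
def DelV (γ Z V : ℝ) : ℝ :=
  (4 - 1) * (1 - V ^ 2) * ((1 / (γ + 1)) * (1 - V ^ 2) * Z - V * (1 - V * Z))

/-- `Δ_Z(Z,V)` for `ℓ = 5/3`. -/
def DelZ (Z V : ℝ) : ℝ := Z * ((1 - Z * V) ^ 2 - (5/3) * (V - Z) ^ 2)

section

open Filter Topology NNReal

/-- A vector field that is bounded, continuous in time and uniformly Lipschitz in space has a
global integral curve through every point. -/
lemma exists_global_solution {f : ℝ → ℝ → ℝ} {K L : ℝ≥0} (hK : ∀ t, LipschitzWith K (f t))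
    (hc : ∀ y, Continuous fun t => f t y) (hL : ∀ t y, |f t y| ≤ L) (t₀ y₀ : ℝ) :
    ∃ y : ℝ → ℝ, y t₀ = y₀ ∧ ∀ t, HasDerivAt y (f t (y t)) t := by
  have hloc : ∀ n : ℕ, ∃ y : ℝ → ℝ, y t₀ = y₀ ∧
      ∀ t ∈ Ioo (t₀ - (n + 1)) (t₀ + (n + 1)), HasDerivAt y (f t (y t)) t := by
    intro n
    have hn : (0 : ℝ) < n + 1 := by positivity
    have hpl : IsPicardLindelof f (tmin := t₀ - (n + 1)) (tmax := t₀ + (n + 1))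
        ⟨t₀, by constructor <;> linarith⟩ y₀ (L * (n + 1)) 0 L K :=
      { lipschitzOnWith := fun t _ => (hK t).lipschitzOnWith
        continuousOn := fun y _ => (hc y).continuousOn
        norm_le := fun t _ y _ => hL t y
        mul_max_le := by
          simp }
    obtain ⟨y, hy0, hy⟩ := hpl.exists_eq_forall_mem_Icc_hasDerivWithinAt₀
    exact ⟨y, hy0, fun t ht => (hy t (Ioo_subset_Icc_self ht)).hasDerivAt (Icc_mem_nhds ht.1 ht.2)⟩
  choose y hy0 hy using hloc
  have huniq : ∀ m n : ℕ, m ≤ n → EqOn (y m) (y n) (Ioo (t₀ - (m + 1)) (t₀ + (m + 1))) := by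
    intro m n hmn
    have hm : (0 : ℝ) < m + 1 := by positivity
    have hmn' : (m : ℝ) ≤ n := by exact_mod_cast hmn
    refine ODE_solution_unique_of_mem_Ioo (v := f) (s := fun _ => univ) (K := K) (t₀ := t₀)
      (fun t _ => (hK t).lipschitzOnWith) (by constructor <;> linarith)
      (fun t ht => ⟨hy m t ht, mem_univ _⟩)
      (fun t ht => ⟨hy n t ⟨by linarith [ht.1], by linarith [ht.2]⟩, mem_univ _⟩) ?_
    rw [hy0, hy0]
  have hmem : ∀ t : ℝ, t ∈ Ioo (t₀ - ((⌈|t - t₀|⌉₊ : ℝ) + 1)) (t₀ + ((⌈|t - t₀|⌉₊ : ℝ) + 1)) := by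
    intro t
    have := Nat.le_ceil |t - t₀|
    have h1 := le_abs_self (t - t₀)
    have h2 := neg_abs_le (t - t₀)
    constructor <;> linarith
  refine ⟨fun t => y ⌈|t - t₀|⌉₊ t, hy0 _, fun t => ?_⟩
  set n := ⌈|t - t₀|⌉₊ + 1 with hn
  have heq : ∀ᶠ s in 𝓝 t, y ⌈|s - t₀|⌉₊ s = y n s := by
    have : ∀ᶠ s in 𝓝 t, |s - t₀| < |t - t₀| + 1 :=
      (by fun_prop : Continuous fun s => |s - t₀|).continuousAt.eventually_lt_const (by linarith)
    filter_upwards [this] with s hs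
    refine huniq _ n ?_ (hmem s)
    rw [hn, Nat.ceil_le]
    push_cast
    linarith [Nat.le_ceil |t - t₀|]
  have hd : HasDerivAt (y n) (f t (y n t)) t := by
    refine hy n t ?_
    have := hmem t
    have h2 : (n : ℝ) = (⌈|t - t₀|⌉₊ : ℝ) + 1 := by rw [hn]; push_cast; rfl
    rw [h2]
    exact ⟨by linarith [this.1], by linarith [this.2]⟩
  have := hd.congr_of_eventuallyEq heq
  simpa only [heq.self_of_nhds] using this

/-- If the derivative of `g` is negative at each of its zeros, then `g` stays negative. -/
lemma neg_of_deriv_neg_at_zeros {g : ℝ → ℝ} {a b : ℝ} (hg : ContinuousOn g (Icc a b))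
    (ha : g a < 0)
    (hd : ∀ t ∈ Ioc a b, g t = 0 → ∃ d < 0, HasDerivWithinAt g d (Icc a b) t) :
    ∀ t ∈ Icc a b, g t < 0 := by
  by_contra! hcon
  obtain ⟨t₁, ht₁, hgt₁⟩ := hcon
  set S := {t | t ∈ Icc a t₁ ∧ 0 ≤ g t} with hS
  have hsub : Icc a t₁ ⊆ Icc a b := Icc_subset_Icc_right ht₁.2
  have hclosed : IsClosed S :=
    (hg.mono hsub).preimage_isClosed_of_isClosed isClosed_Icc isClosed_Ici
  have hne : S.Nonempty := ⟨t₁, ⟨ht₁.1, le_rfl⟩, hgt₁⟩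
  have hbdd : BddBelow S := ⟨a, fun t ht => ht.1.1⟩
  set t := sInf S with ht
  have htS : t ∈ S := hclosed.csInf_mem hne hbdd
  have hta : a < t := lt_of_le_of_ne htS.1.1 (by rintro h; rw [← h] at htS; linarith [htS.2])
  have hlt : ∀ s ∈ Ico a t, g s < 0 := by
    intro s hs
    by_contra! h
    exact absurd (csInf_le hbdd (show s ∈ S from ⟨⟨hs.1, hs.2.le.trans htS.1.2⟩, h⟩))
      (not_le.mpr hs.2)
  have htb : t ∈ Icc a b := hsub htS.1
  have h0 : g t = 0 := by
    refine le_antisymm ?_ htS.2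
    have hc : ContinuousWithinAt g (Ico a t) t :=
      (hg t htb).mono (Ico_subset_Icc_self.trans (Icc_subset_Icc_right htb.2))
    have : (𝓝[Ico a t] t).NeBot := by
      rw [← mem_closure_iff_nhdsWithin_neBot, closure_Ico hta.ne]
      exact ⟨hta.le, le_rfl⟩
    exact le_of_tendsto hc (eventually_mem_nhdsWithin.mono fun s hs => (hlt s hs).le)
  obtain ⟨d, hd0, hd⟩ := hd t ⟨hta, htb.2⟩ h0
  have hd' : HasDerivWithinAt g d (Ico a t) t :=
    hd.mono (Ico_subset_Icc_self.trans (Icc_subset_Icc_right htb.2))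
  rw [hasDerivWithinAt_iff_tendsto_slope' (by simp)] at hd'
  have : (𝓝[Ico a t] t).NeBot := by
    rw [← mem_closure_iff_nhdsWithin_neBot, closure_Ico hta.ne]
    exact ⟨hta.le, le_rfl⟩
  have : 0 ≤ d := by
    refine ge_of_tendsto hd' (eventually_mem_nhdsWithin.mono fun s hs => ?_)
    rw [slope_def_field, h0]
    exact div_nonneg_of_nonpos (by linarith [hlt s hs]) (by linarith [hs.2])
  linarith

/-- Projection of the real line onto `[c, d]`. -/
def clamp (c d y : ℝ) : ℝ := max c (min d y)

lemma clamp_of_mem {c d y : ℝ} (h : y ∈ Icc c d) : clamp c d y = y := by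
  rw [clamp, min_eq_right h.2, max_eq_right h.1]

lemma clamp_mem {c d : ℝ} (h : c ≤ d) (y : ℝ) : clamp c d y ∈ Icc c d :=
  ⟨le_max_left _ _, max_le h (min_le_left _ _)⟩

lemma lipschitz_clamp (c d : ℝ) : LipschitzWith 1 (clamp c d) :=
  ((LipschitzWith.id.const_min d).const_max c)

lemma continuous_clamp (c d : ℝ) : Continuous (clamp c d) := (lipschitz_clamp c d).continuous

/-- A `C¹` vector field on a rectangle, clamped to that rectangle, has a global integral curve. -/
lemma exists_clamped_solution {f : ℝ → ℝ → ℝ} {a b c d : ℝ} (hab : a ≤ b) (hcd : c ≤ d)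
    (hf : ContDiffOn ℝ 1 (Function.uncurry f) (Icc a b ×ˢ Icc c d)) (t₀ y₀ : ℝ) :
    (∃ K : ℝ≥0, ∀ t, LipschitzWith K (fun y => f (clamp a b t) (clamp c d y))) ∧
    ∃ y : ℝ → ℝ, y t₀ = y₀ ∧
      ∀ t, HasDerivAt y (f (clamp a b t) (clamp c d (y t))) t := by
  have hcomp : IsCompact (Icc a b ×ˢ Icc c d) := isCompact_Icc.prod isCompact_Icc
  obtain ⟨K, hK⟩ := hf.exists_lipschitzOnWith one_ne_zero
    ((convex_Icc a b).prod (convex_Icc c d)) hcomp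
  obtain ⟨L, hL⟩ := hcomp.exists_bound_of_continuousOn hf.continuousOn
  have hlip : ∀ t, LipschitzWith K (fun y => f (clamp a b t) (clamp c d y)) := by
    intro t
    refine LipschitzWith.of_dist_le_mul fun x y => ?_
    have h := hK.dist_le_mul (clamp a b t, clamp c d x) ⟨clamp_mem hab t, clamp_mem hcd x⟩
      (clamp a b t, clamp c d y) ⟨clamp_mem hab t, clamp_mem hcd y⟩
    refine h.trans ?_
    gcongr
    rw [Prod.dist_eq]
    simpa using (lipschitz_clamp c d).dist_le_mul x y
  refine ⟨⟨K, hlip⟩, exists_global_solution (L := L.toNNReal) hlip (fun y => ?_)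
    (fun t y => ?_) t₀ y₀⟩
  · exact hf.continuousOn.comp_continuous (f := fun t => (clamp a b t, clamp c d y))
      ((continuous_clamp a b).prodMk continuous_const)
      (fun t => ⟨clamp_mem hab t, clamp_mem hcd y⟩)
  · exact (hL (clamp a b t, clamp c d y) ⟨clamp_mem hab t, clamp_mem hcd y⟩).trans
      (Real.le_coe_toNNReal L)

/-- The weighted dilation average `∫₀¹ t ^ μ H (t x) dt`, the bounded inverse of `x d/dx + μ + 1`. -/
def dilAvg (μ : ℝ) (H : ℝ → ℝ) (x : ℝ) : ℝ := ∫ t in (0 : ℝ)..1, t ^ μ * H (t * x)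

lemma mul_mem_Ioo_of_mem {δ t x : ℝ} (hx : x ∈ Ioo (-δ) δ) (ht : t ∈ Icc (0 : ℝ) 1) :
    t * x ∈ Ioo (-δ) δ := by
  have h : |x| < δ := abs_lt.mpr hx
  refine abs_lt.mp ?_
  rw [abs_mul, abs_of_nonneg ht.1]
  nlinarith [abs_nonneg x, ht.2]

lemma continuousOn_dilAvg_integrand {μ δ : ℝ} (hμ : 0 < μ) {H : ℝ → ℝ}
    (hH : ContinuousOn H (Ioo (-δ) δ)) {x : ℝ} (hx : x ∈ Ioo (-δ) δ) :
    ContinuousOn (fun t : ℝ => t ^ μ * H (t * x)) (Icc 0 1) := by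
  refine (Real.continuous_rpow_const hμ.le).continuousOn.mul ?_
  exact hH.comp (by fun_prop) fun t ht => mul_mem_Ioo_of_mem hx ht

lemma hasDerivAt_dilAvg {μ δ : ℝ} (hμ : 0 < μ) {H : ℝ → ℝ}
    (hH : ContDiffOn ℝ 1 H (Ioo (-δ) δ)) {x : ℝ} (hx : x ∈ Ioo (-δ) δ) :
    HasDerivAt (dilAvg μ H) (dilAvg (μ + 1) (deriv H) x) x := by
  obtain ⟨ε, hε1, hε2⟩ := exists_between (abs_lt.mpr hx)
  have hε0 : 0 < ε := (abs_nonneg x).trans_lt hε1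
  have hd : ContinuousOn (deriv H) (Ioo (-δ) δ) :=
    hH.continuousOn_deriv_of_isOpen isOpen_Ioo le_rfl
  have hsub : Icc (-ε) ε ⊆ Ioo (-δ) δ := fun y hy => ⟨by linarith [hy.1], by linarith [hy.2]⟩
  obtain ⟨C, hC⟩ := isCompact_Icc.exists_bound_of_continuousOn (hd.mono hsub)
  have hxs : Ioo (-ε) ε ∈ 𝓝 x := isOpen_Ioo.mem_nhds (abs_lt.mp hε1)
  have hIoo : Ioo (-ε) ε ⊆ Ioo (-δ) δ := Ioo_subset_Icc_self.trans hsub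
  have hmeas : ∀ {ν : ℝ} {K : ℝ → ℝ} {y : ℝ}, 0 < ν → ContinuousOn K (Ioo (-δ) δ) →
      y ∈ Ioo (-δ) δ → MeasureTheory.AEStronglyMeasurable (fun t : ℝ => t ^ ν * K (t * y))
        (MeasureTheory.volume.restrict (uIoc 0 1)) := by
    intro ν K y hν hK hy
    rw [uIoc_of_le zero_le_one]
    exact ((continuousOn_dilAvg_integrand hν hK hy).mono
      Ioc_subset_Icc_self).aestronglyMeasurable measurableSet_Ioc
  have key := intervalIntegral.hasDerivAt_integral_of_dominated_loc_of_deriv_le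
    (μ := MeasureTheory.volume) (a := (0 : ℝ)) (b := 1)
    (F := fun y t => t ^ μ * H (t * y)) (F' := fun y t => t ^ (μ + 1) * deriv H (t * y))
    (x₀ := x) (s := Ioo (-ε) ε) (bound := fun _ => C) hxs ?_ ?_ ?_ ?_ ?_ ?_
  · exact key.2
  · filter_upwards [hxs] with y hy
    exact hmeas hμ hH.continuousOn (hIoo hy)
  · refine ContinuousOn.intervalIntegrable ?_
    rw [uIcc_of_le zero_le_one]
    exact continuousOn_dilAvg_integrand hμ hH.continuousOn hx
  · exact hmeas (by linarith) hd hx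
  · refine Eventually.of_forall fun t ht y hy => ?_
    rw [uIoc_of_le zero_le_one] at ht
    have hty := mul_mem_Ioo_of_mem hy ⟨ht.1.le, ht.2⟩
    rw [norm_mul, Real.norm_of_nonneg (Real.rpow_nonneg ht.1.le _)]
    have h1 := Real.rpow_le_one ht.1.le ht.2 (show 0 ≤ μ + 1 by linarith)
    have h2 := hC _ (Ioo_subset_Icc_self hty)
    nlinarith [norm_nonneg (deriv H (t * y)), Real.rpow_nonneg ht.1.le (μ + 1)]
  · simp
  · refine Eventually.of_forall fun t ht y hy => ?_
    rw [uIoc_of_le zero_le_one] at ht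
    have hty := hIoo (mul_mem_Ioo_of_mem hy ⟨ht.1.le, ht.2⟩)
    have hdH : HasDerivAt H (deriv H (t * y)) (t * y) :=
      ((hH.differentiableOn one_ne_zero).differentiableAt (isOpen_Ioo.mem_nhds hty)).hasDerivAt
    have h1 : HasDerivAt (fun y => t * y) t y := by
      simpa using (hasDerivAt_id y).const_mul t
    have h2 := (hdH.comp y h1).const_mul (t ^ μ)
    refine h2.congr_deriv ?_
    rw [Real.rpow_add ht.1, Real.rpow_one]
    ring

lemma contDiffOn_dilAvg {δ : ℝ} (n : ℕ) : ∀ {μ : ℝ} (_ : 0 < μ) {H : ℝ → ℝ}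
    (_ : ContDiffOn ℝ (n + 1) H (Ioo (-δ) δ)), ContDiffOn ℝ (n + 1) (dilAvg μ H) (Ioo (-δ) δ) := by
  have hone : ∀ {μ : ℝ} (_ : 0 < μ) {H : ℝ → ℝ} (_ : ContDiffOn ℝ 1 H (Ioo (-δ) δ)),
      DifferentiableOn ℝ (dilAvg μ H) (Ioo (-δ) δ) ∧
      EqOn (deriv (dilAvg μ H)) (dilAvg (μ + 1) (deriv H)) (Ioo (-δ) δ) := fun hμ H hH =>
    ⟨fun x hx => (hasDerivAt_dilAvg hμ hH hx).differentiableAt.differentiableWithinAt,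
      fun x hx => (hasDerivAt_dilAvg hμ hH hx).deriv⟩
  induction n with
  | zero =>
    intro μ hμ H hH
    simp only [Nat.cast_zero, zero_add] at hH ⊢
    obtain ⟨h1, h2⟩ := hone hμ hH
    have h01 : (1 : WithTop ℕ∞) = 0 + 1 := by simp
    rw [h01, contDiffOn_succ_iff_deriv_of_isOpen isOpen_Ioo]
    refine ⟨h1, by simp, contDiffOn_zero.mpr (ContinuousOn.congr ?_ h2)⟩
    have hd : ContinuousOn (deriv H) (Ioo (-δ) δ) :=
      hH.continuousOn_deriv_of_isOpen isOpen_Ioo le_rfl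
    intro x hx
    obtain ⟨ε, hε1, hε2⟩ := exists_between (abs_lt.mpr hx)
    have hsub : Icc (-ε) ε ⊆ Ioo (-δ) δ := fun y hy => ⟨by linarith [hy.1], by linarith [hy.2]⟩
    have hIoo : Ioo (-ε) ε ⊆ Ioo (-δ) δ := Ioo_subset_Icc_self.trans hsub
    obtain ⟨C, hC⟩ := isCompact_Icc.exists_bound_of_continuousOn (hd.mono hsub)
    refine ContinuousAt.continuousWithinAt ?_
    have hxs : Ioo (-ε) ε ∈ 𝓝 x := isOpen_Ioo.mem_nhds (abs_lt.mp hε1)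
    refine intervalIntegral.continuousAt_of_dominated_interval (bound := fun _ => C) ?_ ?_ ?_ ?_
    · filter_upwards [hxs] with y hy
      rw [uIoc_of_le zero_le_one]
      exact ((continuousOn_dilAvg_integrand (show 0 < μ + 1 by linarith) hd (hIoo hy)).mono
        Ioc_subset_Icc_self).aestronglyMeasurable measurableSet_Ioc
    · filter_upwards [hxs] with y hy
      refine Eventually.of_forall fun t ht => ?_
      rw [uIoc_of_le zero_le_one] at ht
      have hty := mul_mem_Ioo_of_mem hy ⟨ht.1.le, ht.2⟩
      rw [norm_mul, Real.norm_of_nonneg (Real.rpow_nonneg ht.1.le _)]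
      have h1 := Real.rpow_le_one ht.1.le ht.2 (show 0 ≤ μ + 1 by linarith)
      have h2 := hC _ (Ioo_subset_Icc_self hty)
      nlinarith [norm_nonneg (deriv H (t * y)), Real.rpow_nonneg ht.1.le (μ + 1)]
    · simp
    · refine Eventually.of_forall fun t ht => ?_
      rw [uIoc_of_le zero_le_one] at ht
      have hty := mul_mem_Ioo_of_mem hx ⟨ht.1.le, ht.2⟩
      refine ContinuousAt.mul continuousAt_const ?_
      exact ContinuousAt.comp (f := fun y => t * y) (hd.continuousAt (isOpen_Ioo.mem_nhds hty))
        (by fun_prop)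
  | succ n ih =>
    intro μ hμ H hH
    have hle : (1 : WithTop ℕ∞) ≤ ((n + 1 : ℕ) : WithTop ℕ∞) + 1 := by
      exact_mod_cast (by omega : 1 ≤ n + 1 + 1)
    obtain ⟨h1, h2⟩ := hone hμ (hH.of_le hle)
    rw [contDiffOn_succ_iff_deriv_of_isOpen isOpen_Ioo] at hH ⊢
    refine ⟨h1, by simp, ContDiffOn.congr ?_ h2⟩
    have := ih (μ := μ + 1) (by linarith) (H := deriv H) (by simpa using hH.2.2)
    simpa using this

/-- For continuous `H`, the function `w = x · dilAvg μ H` solves `x w' = -μ w + x H`. -/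
lemma hasDerivAt_mul_dilAvg {μ : ℝ} (hμ : 0 < μ) {H : ℝ → ℝ} (hH : Continuous H) (x : ℝ) :
    HasDerivAt (fun x => x * dilAvg μ H x) (H x - μ * dilAvg μ H x) x := by
  have hpos : ∀ {H : ℝ → ℝ} (_ : Continuous H) {x : ℝ} (_ : 0 < x),
      HasDerivAt (fun x => x * dilAvg μ H x) (H x - μ * dilAvg μ H x) x := by
    intro H hH x hx
    have hform : ∀ y : ℝ, 0 < y →
        y * dilAvg μ H y = y ^ (-μ) * ∫ s in (0 : ℝ)..y, s ^ μ * H s := by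
      intro y hy
      have h1 := intervalIntegral.mul_integral_comp_mul_right (a := 0) (b := 1)
        (f := fun s => s ^ μ * H s) y
      simp only [zero_mul, one_mul] at h1
      rw [← h1, dilAvg]
      have h2 : ∫ t in (0 : ℝ)..1, (t * y) ^ μ * H (t * y) =
          ∫ t in (0 : ℝ)..1, y ^ μ * (t ^ μ * H (t * y)) := by
        refine intervalIntegral.integral_congr fun t ht => ?_
        rw [uIcc_of_le zero_le_one] at ht
        rw [Real.mul_rpow ht.1 hy.le]
        ring
      rw [h2, intervalIntegral.integral_const_mul]
      have h3 : y ^ (-μ) * y ^ μ = 1 := by rw [← Real.rpow_add hy]; simp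
      calc _ = y * (y ^ (-μ) * y ^ μ) * ∫ t in (0 : ℝ)..1, t ^ μ * H (t * y) := by rw [h3]; ring
        _ = _ := by ring
    have hcont : Continuous fun s : ℝ => s ^ μ * H s :=
      (Real.continuous_rpow_const hμ.le).mul hH
    have hI : HasDerivAt (fun y => ∫ s in (0 : ℝ)..y, s ^ μ * H s) (x ^ μ * H x) x :=
      intervalIntegral.integral_hasDerivAt_right (hcont.intervalIntegrable _ _)
        (hcont.stronglyMeasurableAtFilter _ _) hcont.continuousAt
    have hP : HasDerivAt (fun y : ℝ => y ^ (-μ)) (-μ * x ^ (-μ - 1)) x :=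
      Real.hasDerivAt_rpow_const (Or.inl hx.ne')
    have := (hP.mul hI).congr_of_eventuallyEq
      (f₁ := fun x => x * dilAvg μ H x) (by
        filter_upwards [lt_mem_nhds hx] with y hy
        exact hform y hy)
    refine this.congr_deriv ?_
    have h3 : x ^ (-μ) * x ^ μ = 1 := by rw [← Real.rpow_add hx]; simp
    have h4 : dilAvg μ H x = x ^ (-μ - 1) * ∫ s in (0 : ℝ)..x, s ^ μ * H s := by
      have := hform x hx
      rw [Real.rpow_sub hx, Real.rpow_one]
      field_simp
      linarith
    rw [h4]
    linear_combination (H x) * h3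
  rcases lt_trichotomy x 0 with hx | hx | hx
  · have h := hpos (H := fun y => H (-y)) (hH.comp continuous_neg) (x := -x) (by linarith)
    have hrefl : ∀ y, dilAvg μ (fun y => H (-y)) (-y) = dilAvg μ H y := by
      intro y
      simp [dilAvg]
    have h2 := (h.comp x (hasDerivAt_neg x)).neg
    rw [hrefl] at h2
    simp only [neg_neg] at h2
    refine (h2.congr_of_eventuallyEq (Eventually.of_forall fun y => ?_)).congr_deriv (by ring)
    simp only [Pi.neg_apply, Function.comp_apply, hrefl]
    ring
  · subst hx
    have hc : Continuous (dilAvg μ H) := by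
      unfold dilAvg
      refine intervalIntegral.continuous_parametric_intervalIntegral_of_continuous' ?_ 0 1
      exact ((Real.continuous_rpow_const hμ.le).comp continuous_snd).mul
        (hH.comp (by fun_prop))
    have h0 : dilAvg μ H 0 = H 0 / (μ + 1) := by
      simp only [dilAvg, mul_zero]
      rw [intervalIntegral.integral_mul_const, integral_rpow (Or.inl (by linarith))]
      rw [Real.one_rpow, Real.zero_rpow (by linarith)]
      ring
    have : HasDerivAt (fun x => x * dilAvg μ H x) (dilAvg μ H 0) 0 := by
      rw [hasDerivAt_iff_tendsto_slope]
      refine (hc.continuousAt.tendsto.mono_left nhdsWithin_le_nhds).congr' ?_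
      filter_upwards [self_mem_nhdsWithin] with y hy
      have hy : y ≠ 0 := hy
      rw [slope_def_field]
      simp [hy]
    refine this.congr_deriv ?_
    rw [h0]
    field_simp
    ring
  · exact hpos hH hx

lemma abs_dilAvg_sub_le {μ C : ℝ} (hμ : 0 < μ) {H K : ℝ → ℝ} (hH : Continuous H)
    (hK : Continuous K) (hC : ∀ x, |H x - K x| ≤ C) (x : ℝ) :
    |dilAvg μ H x - dilAvg μ K x| ≤ C := by
  have hint : ∀ {H : ℝ → ℝ} (_ : Continuous H),
      IntervalIntegrable (fun t : ℝ => t ^ μ * H (t * x)) MeasureTheory.volume 0 1 := fun hH =>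
    ((Real.continuous_rpow_const hμ.le).mul (hH.comp (by fun_prop))).intervalIntegrable _ _
  rw [dilAvg, dilAvg, ← intervalIntegral.integral_sub (hint hH) (hint hK)]
  have := intervalIntegral.norm_integral_le_of_norm_le_const (a := (0 : ℝ)) (b := 1) (C := C)
    (f := fun t : ℝ => t ^ μ * H (t * x) - t ^ μ * K (t * x)) fun t ht => by
      rw [uIoc_of_le zero_le_one] at ht
      rw [← mul_sub, norm_mul, Real.norm_of_nonneg (Real.rpow_nonneg ht.1.le _)]
      have h1 := Real.rpow_le_one ht.1.le ht.2 hμ.le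
      have h2 := hC (t * x)
      rw [Real.norm_eq_abs]
      nlinarith [abs_nonneg (H (t * x) - K (t * x)), Real.rpow_nonneg ht.1.le μ]
  simpa using this

lemma continuous_dilAvg {μ : ℝ} (hμ : 0 < μ) {H : ℝ → ℝ} (hH : Continuous H) :
    Continuous (dilAvg μ H) := by
  unfold dilAvg
  refine intervalIntegral.continuous_parametric_intervalIntegral_of_continuous' ?_ 0 1
  exact ((Real.continuous_rpow_const hμ.le).comp continuous_snd).mul (hH.comp (by fun_prop))

open BoundedContinuousFunction in
/-- Regular solutions of the Briot–Bouquet equation `x y' = x G(α, x, y) - μ y`, written as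
`y = x v`, exist near `x = 0`, are smooth, and depend continuously on the parameter `α`. -/
theorem exists_briotBouquet_solution {μ a α₀ α₁ : ℝ} (hμ : 0 < μ) (ha : 0 < a) (hα : α₀ ≤ α₁)
    {G : ℝ × ℝ × ℝ → ℝ}
    (hG : ContDiffOn ℝ (⊤ : ℕ∞) G (Icc α₀ α₁ ×ˢ Icc (-a) a ×ˢ Icc (-a) a)) :
    ∃ δ ∈ Ioo 0 a, ∃ v : ℝ → ℝ → ℝ,
      (∀ α ∈ Icc α₀ α₁, ∀ x ∈ Ioo (-δ) δ, |x * v α x| ≤ a / 2) ∧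
      (∀ α ∈ Icc α₀ α₁, ContDiffOn ℝ (⊤ : ℕ∞) (v α) (Ioo (-δ) δ)) ∧
      (∀ α ∈ Icc α₀ α₁, ∀ x ∈ Ioo (-δ) δ,
        HasDerivAt (fun x => x * v α x) (G (α, x, x * v α x) - μ * v α x) x) ∧
      ∀ x, ContinuousOn (fun α => v α x) (Icc α₀ α₁) := by
  set S := Icc α₀ α₁ ×ˢ Icc (-a) a ×ˢ Icc (-a) a with hS
  have hcomp : IsCompact S := isCompact_Icc.prod (isCompact_Icc.prod isCompact_Icc)
  obtain ⟨L, hL⟩ := (hG.of_le (by exact_mod_cast le_top : (1 : WithTop ℕ∞) ≤ _)).exists_lipschitzOnWith one_ne_zero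
    ((convex_Icc _ _).prod ((convex_Icc _ _).prod (convex_Icc _ _))) hcomp
  obtain ⟨M, hM⟩ := hcomp.exists_bound_of_continuousOn hG.continuousOn
  have hM0 : 0 ≤ M := (norm_nonneg _).trans (hM (α₀, 0, 0)
    ⟨⟨le_rfl, hα⟩, ⟨by simp [ha.le], by simp [ha.le]⟩, ⟨by simp [ha.le], by simp [ha.le]⟩⟩)
  obtain ⟨δ, hδ0, hδa, hδM, hδL⟩ : ∃ δ : ℝ, 0 < δ ∧ δ < a ∧ δ * M ≤ a / 2 ∧ L * δ ≤ 1 / 2 := by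
    refine ⟨min (a / 2) (min (a / 2 / (M + 1)) (1 / 2 / (L + 1))), by positivity, ?_, ?_, ?_⟩
    · exact (min_le_left _ _).trans_lt (by linarith)
    · have h1 : min (a / 2) (min (a / 2 / (M + 1)) (1 / 2 / ((L : ℝ) + 1))) ≤ a / 2 / (M + 1) :=
        (min_le_right _ _).trans (min_le_left _ _)
      calc _ ≤ a / 2 / (M + 1) * (M + 1) := by
            refine mul_le_mul h1 (by linarith) hM0 (by positivity)
        _ = a / 2 := by field_simp
    · have h1 : min (a / 2) (min (a / 2 / (M + 1)) (1 / 2 / ((L : ℝ) + 1))) ≤ 1 / 2 / (L + 1) :=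
        (min_le_right _ _).trans (min_le_right _ _)
      calc _ ≤ ((L : ℝ) + 1) * (1 / 2 / (L + 1)) := by
            refine mul_le_mul (by linarith) h1 (by positivity) (by positivity)
        _ = 1 / 2 := by field_simp
  set φ : ℝ → ℝ → ℝ → ℝ := fun α x y =>
    G (clamp α₀ α₁ α, clamp (-δ) δ x, clamp (-a) a (clamp (-δ) δ x * y)) with hφ
  have hmem : ∀ α x y, (clamp α₀ α₁ α, clamp (-δ) δ x, clamp (-a) a (clamp (-δ) δ x * y)) ∈ S := by
    intro α x y
    refine ⟨clamp_mem hα _, ?_, clamp_mem (by linarith) _⟩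
    have := clamp_mem (show -δ ≤ δ by linarith) x
    exact ⟨by linarith [this.1], by linarith [this.2]⟩
  have habs : ∀ x, |clamp (-δ) δ x| ≤ δ := fun x => abs_le.mpr (clamp_mem (by linarith) x)
  have hφM : ∀ α x y, |φ α x y| ≤ M := fun α x y => hM _ (hmem α x y)
  have hclamp : ∀ c d x y : ℝ, |clamp c d x - clamp c d y| ≤ |x - y| := fun c d x y => by
    simpa [Real.dist_eq] using (lipschitz_clamp c d).dist_le_mul x y
  have hφL : ∀ α x y y', |φ α x y - φ α x y'| ≤ 1 / 2 * |y - y'| := by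
    intro α x y y'
    have h1 := hL.dist_le_mul _ (hmem α x y) _ (hmem α x y')
    have h2 : dist (clamp α₀ α₁ α, clamp (-δ) δ x, clamp (-a) a (clamp (-δ) δ x * y))
        (clamp α₀ α₁ α, clamp (-δ) δ x, clamp (-a) a (clamp (-δ) δ x * y')) ≤ δ * |y - y'| := by
      rw [Prod.dist_eq, Prod.dist_eq]
      simp only [dist_self, Real.dist_eq]
      refine max_le (by positivity) (max_le (by positivity) ((hclamp _ _ _ _).trans ?_))
      rw [← mul_sub, abs_mul]
      exact mul_le_mul_of_nonneg_right (habs x) (abs_nonneg _)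
    calc _ ≤ (L : ℝ) * (δ * |y - y'|) := h1.trans (mul_le_mul_of_nonneg_left h2 L.2)
      _ = (L * δ) * |y - y'| := by ring
      _ ≤ _ := mul_le_mul_of_nonneg_right hδL (abs_nonneg _)
  have hφα : ∀ α β x y, |φ α x y - φ β x y| ≤ L * |α - β| := by
    intro α β x y
    have h1 := hL.dist_le_mul _ (hmem α x y) _ (hmem β x y)
    refine h1.trans (mul_le_mul_of_nonneg_left ?_ L.2)
    rw [Prod.dist_eq]
    simp only [dist_self, Real.dist_eq]
    exact max_le (hclamp _ _ _ _) (abs_nonneg _)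
  have hφc : ∀ α (v : ℝ → ℝ), Continuous v → Continuous fun x => φ α x (v x) := by
    intro α v hv
    refine hG.continuousOn.comp_continuous (f := fun x => (clamp α₀ α₁ α, clamp (-δ) δ x,
      clamp (-a) a (clamp (-δ) δ x * v x))) ?_ fun x => hmem α x (v x)
    have h1 := continuous_clamp (-δ) δ
    have h2 := continuous_clamp (-a) a
    exact continuous_const.prodMk (h1.prodMk (h2.comp (h1.mul hv)))
  have hbound : ∀ α (v : ℝ → ℝ), Continuous v → ∀ x, |dilAvg μ (fun x => φ α x (v x)) x| ≤ M := by
    intro α v hv x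
    have := abs_dilAvg_sub_le hμ (hφc α v hv) (continuous_const (y := (0 : ℝ))) (C := M)
      (fun x => by simpa using hφM α x (v x)) x
    simpa [dilAvg] using this
  let T : ℝ → (ℝ →ᵇ ℝ) → (ℝ →ᵇ ℝ) := fun α v =>
    ofNormedAddCommGroup (dilAvg μ fun x => φ α x (v x))
      (continuous_dilAvg hμ (hφc α v v.continuous)) M fun x => hbound α v v.continuous x
  have hT : ∀ α v x, T α v x = dilAvg μ (fun x => φ α x (v x)) x := fun _ _ _ => rfl
  have hTc : ∀ α, ContractingWith (1 / 2) (T α) := by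
    intro α
    refine ⟨by rw [← NNReal.coe_lt_coe]; norm_num, LipschitzWith.of_dist_le_mul fun v w => ?_⟩
    refine (dist_le (by positivity)).mpr fun x => ?_
    rw [hT, hT, Real.dist_eq]
    refine abs_dilAvg_sub_le hμ (hφc α v v.continuous) (hφc α w w.continuous) (fun x => ?_) x
    refine (hφL α x _ _).trans ?_
    simp only [NNReal.coe_div, NNReal.coe_one, NNReal.coe_ofNat]
    have h := dist_coe_le_dist (f := v) (g := w) x
    rw [Real.dist_eq] at h
    exact mul_le_mul_of_nonneg_left h (by norm_num)
  let u : ℝ → (ℝ →ᵇ ℝ) := fun α => ContractingWith.fixedPoint (T α) (hTc α)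
  have hu : ∀ α x, u α x = dilAvg μ (fun x => φ α x (u α x)) x := by
    intro α x
    rw [← hT]
    exact (congrArg (fun w : ℝ →ᵇ ℝ => w x) (hTc α).fixedPoint_isFixedPt).symm
  have huM : ∀ α x, |u α x| ≤ M := fun α x => by
    rw [hu]; exact hbound α _ (u α).continuous x
  have hxu : ∀ α, ∀ x ∈ Ioo (-δ) δ, |x * u α x| ≤ a / 2 := by
    intro α x hx
    rw [abs_mul]
    exact (mul_le_mul (abs_lt.mpr hx).le (huM α x) (abs_nonneg _) hδ0.le).trans hδM
  have hφG : ∀ α ∈ Icc α₀ α₁, ∀ x ∈ Ioo (-δ) δ, φ α x (u α x) = G (α, x, x * u α x) := by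
    intro α hα x hx
    have h := abs_le.mp (hxu α x hx)
    simp only [hφ]
    rw [clamp_of_mem hα, clamp_of_mem (Ioo_subset_Icc_self hx),
      clamp_of_mem ⟨by linarith [h.1], by linarith [h.2]⟩]
  have hderiv : ∀ α ∈ Icc α₀ α₁, ∀ x ∈ Ioo (-δ) δ,
      HasDerivAt (fun x => x * u α x) (G (α, x, x * u α x) - μ * u α x) x := by
    intro α hα x hx
    have h := hasDerivAt_mul_dilAvg hμ (hφc α (u α) (u α).continuous) x
    rw [hφG α hα x hx, ← hu] at h
    exact h.congr_of_eventuallyEq (Eventually.of_forall fun x => by simp only [← hu])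
  refine ⟨δ, ⟨hδ0, hδa⟩, fun α => u α, fun α _ => hxu α, ?_, hderiv, ?_⟩
  · intro α hα
    rw [contDiffOn_infty]
    intro n
    induction n with
    | zero => exact contDiffOn_zero.mpr (u α).continuous.continuousOn
    | succ n ih =>
      have hGy : ∀ {k : ℕ}, ContDiffOn ℝ k (fun x => x * u α x) (Ioo (-δ) δ) →
          ContDiffOn ℝ k (fun x => G (α, x, x * u α x)) (Ioo (-δ) δ) := by
        intro k hk
        refine (hG.of_le (by exact_mod_cast le_top)).comp (f := fun x => (α, x, x * u α x))
          (contDiffOn_const.prodMk (contDiffOn_id.prodMk hk)) fun x hx => ?_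
        have h := abs_le.mp (hxu α x hx)
        exact ⟨hα, ⟨by linarith [hx.1], by linarith [hx.2]⟩,
          ⟨by linarith [h.1], by linarith [h.2]⟩⟩
      have hy : ContDiffOn ℝ n (fun x => x * u α x) (Ioo (-δ) δ) := contDiffOn_id.mul ih
      have hy' : ContDiffOn ℝ (n + 1 : ℕ) (fun x => x * u α x) (Ioo (-δ) δ) := by
        push_cast
        rw [contDiffOn_succ_iff_deriv_of_isOpen isOpen_Ioo]
        refine ⟨fun x hx => (hderiv α hα x hx).differentiableAt.differentiableWithinAt,
          by simp, ContDiffOn.congr ?_ fun x hx => (hderiv α hα x hx).deriv⟩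
        exact (hGy hy).sub (contDiffOn_const.mul ih)
      have hH : ContDiffOn ℝ (n + 1) (fun x => φ α x (u α x)) (Ioo (-δ) δ) := by
        refine ContDiffOn.congr ?_ (hφG α hα)
        exact_mod_cast hGy hy'
      have := contDiffOn_dilAvg n hμ hH
      push_cast
      exact this.congr fun x _ => hu α x
  · intro x
    have hlip : LipschitzWith (2 * L) (fun α => u α x) := by
      refine LipschitzWith.of_dist_le_mul fun α β => ?_
      have h1 : dist (u α) (u β) ≤ L * |α - β| / (1 - (1 / 2 : ℝ≥0)) := by
        refine (hTc α).dist_fixedPoint_fixedPoint_of_dist_le' (T β) (hTc α).fixedPoint_isFixedPt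
          (hTc β).fixedPoint_isFixedPt fun w => ?_
        refine (dist_le (by positivity)).mpr fun y => ?_
        rw [hT, hT, Real.dist_eq]
        exact abs_dilAvg_sub_le hμ (hφc α w w.continuous) (hφc β w w.continuous)
          (fun y => hφα α β y _) y
      refine (dist_coe_le_dist x).trans (h1.trans (le_of_eq ?_))
      rw [Real.dist_eq]
      push_cast
      ring
    exact hlip.continuous.continuousOn

/-- Two bounded solutions of `x y' = x G(x, y) - μ y` on `(0, c]` coincide. -/
theorem briotBouquet_unique {μ a c : ℝ} (hμ : 0 < μ) {G : ℝ → ℝ → ℝ} {K : ℝ≥0}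
    (hK : ∀ x ∈ Ioc 0 c, LipschitzOnWith K (G x) (Icc (-a) a)) {y z : ℝ → ℝ}
    (hy : ∀ x ∈ Ioc 0 c, HasDerivAt y (G x (y x) - μ * (y x / x)) x)
    (hz : ∀ x ∈ Ioc 0 c, HasDerivAt z (G x (z x) - μ * (z x / x)) x)
    (hya : ∀ x ∈ Ioc 0 c, y x ∈ Icc (-a) a) (hza : ∀ x ∈ Ioc 0 c, z x ∈ Icc (-a) a) :
    ∀ x ∈ Ioc 0 c, y x = z x := by
  intro x₁ hx₁
  set E : ℝ → ℝ := fun x => x ^ (2 * μ) * (Real.exp (-(2 * K) * x) * (y x - z x) ^ 2) with hE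
  have hsub : ∀ x ∈ Ioc 0 x₁, x ∈ Ioc 0 c := fun x hx => ⟨hx.1, hx.2.trans hx₁.2⟩
  have hd : ∀ x ∈ Ioc 0 c, ∃ e ≤ 0, HasDerivAt E e x := by
    intro x hx
    have h1 : HasDerivAt (fun x : ℝ => x ^ (2 * μ)) (2 * μ * x ^ (2 * μ - 1)) x :=
      Real.hasDerivAt_rpow_const (Or.inl hx.1.ne')
    have h2 : HasDerivAt (fun x : ℝ => Real.exp (-(2 * K) * x))
        (Real.exp (-(2 * K) * x) * -(2 * K)) x := by
      have := ((hasDerivAt_id x).const_mul (-(2 * (K : ℝ)))).exp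
      simpa using this
    have h3 := ((hy x hx).sub (hz x hx)).pow 2
    refine ⟨_, ?_, h1.mul (h2.mul h3)⟩
    have h4 : |G x (y x) - G x (z x)| ≤ K * |y x - z x| := by
      simpa [Real.dist_eq] using (hK x hx).dist_le_mul _ (hya x hx) _ (hza x hx)
    rw [Real.rpow_sub hx.1, Real.rpow_one]
    have hx0 := hx.1
    simp only [Pi.sub_apply]
    set ex := Real.exp (-(2 * K) * x) with hex
    set P := x ^ (2 * μ) with hP
    have hex0 : 0 < ex := Real.exp_pos _
    have hP0 : 0 < P := Real.rpow_pos_of_pos hx.1 _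
    have h5 : (y x - z x) * (G x (y x) - G x (z x)) ≤ K * (y x - z x) ^ 2 := by
      calc _ ≤ |(y x - z x) * (G x (y x) - G x (z x))| := le_abs_self _
        _ = |y x - z x| * |G x (y x) - G x (z x)| := abs_mul _ _
        _ ≤ |y x - z x| * (K * |y x - z x|) := by gcongr
        _ = K * |y x - z x| ^ 2 := by ring
        _ = _ := by rw [sq_abs]
    have h6 : 2 * μ * (P / x) * (ex * (y x - z x) ^ 2) + P * (ex * -(2 * K) * (y x - z x) ^ 2 +
        ex * (2 * (y x - z x) * (G x (y x) - μ * (y x / x) - (G x (z x) - μ * (z x / x))))) =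
        2 * P * ex * ((y x - z x) * (G x (y x) - G x (z x)) - K * (y x - z x) ^ 2) := by
      field_simp
      ring
    have h7 : 2 * P * ex * ((y x - z x) * (G x (y x) - G x (z x)) - K * (y x - z x) ^ 2) ≤ 0 :=
      mul_nonpos_of_nonneg_of_nonpos (by positivity) (by linarith)
    rw [← h6] at h7
    simpa using h7
  have hanti : AntitoneOn E (Ioc 0 x₁) := by
    refine antitoneOn_of_deriv_nonpos (convex_Ioc _ _) ?_ ?_ ?_
    · intro x hx
      obtain ⟨e, -, he⟩ := hd x (hsub x hx)
      exact he.continuousAt.continuousWithinAt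
    · intro x hx
      rw [interior_Ioc] at hx
      obtain ⟨e, -, he⟩ := hd x (hsub x ⟨hx.1, hx.2.le⟩)
      exact he.differentiableAt.differentiableWithinAt
    · intro x hx
      rw [interior_Ioc] at hx
      obtain ⟨e, he0, he⟩ := hd x (hsub x ⟨hx.1, hx.2.le⟩)
      rwa [he.deriv]
  have hlim : Tendsto (fun x : ℝ => x ^ (2 * μ) * (2 * a) ^ 2) (𝓝[>] 0) (𝓝 0) := by
    have h1 : Tendsto (fun x : ℝ => x ^ (2 * μ) * (2 * a) ^ 2) (𝓝 0)
        (𝓝 ((0 : ℝ) ^ (2 * μ) * (2 * a) ^ 2)) :=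
      ((Real.continuousAt_rpow_const _ _ (Or.inr (by positivity))).tendsto).mul_const _
    rw [Real.zero_rpow (by positivity), zero_mul] at h1
    exact h1.mono_left nhdsWithin_le_nhds
  have hle : E x₁ ≤ 0 := by
    refine ge_of_tendsto hlim ?_
    filter_upwards [Ioc_mem_nhdsGT hx₁.1] with x hx
    refine (hanti hx ⟨hx₁.1, le_rfl⟩ hx.2).trans ?_
    refine mul_le_mul_of_nonneg_left ?_ (Real.rpow_nonneg hx.1.le _)
    have h1 : Real.exp (-(2 * K) * x) ≤ 1 := by
      rw [Real.exp_le_one_iff]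
      have := mul_nonneg K.2 hx.1.le
      simp only [NNReal.val_eq_coe] at this
      linarith
    have h2 : (y x - z x) ^ 2 ≤ (2 * a) ^ 2 := by
      have hy1 := hya x (hsub x hx)
      have hz1 := hza x (hsub x hx)
      refine sq_le_sq' ?_ ?_ <;> linarith [hy1.1, hy1.2, hz1.1, hz1.2]
    nlinarith [sq_nonneg (y x - z x)]
  have h8 : 0 < x₁ ^ (2 * μ) * Real.exp (-(2 * K) * x₁) :=
    mul_pos (Real.rpow_pos_of_pos hx₁.1 _) (Real.exp_pos _)
  have h9 : (y x₁ - z x₁) ^ 2 ≤ 0 := by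
    simp only [hE] at hle
    by_contra! hcon
    have := mul_pos h8 hcon
    linarith
  have := pow_eq_zero_iff (two_ne_zero) |>.mp (le_antisymm h9 (sq_nonneg _))
  linarith

open Polynomial in
/-- The polynomial with coefficients `a 0, a 1, a 2, a 3`. -/
def cubic (a : ℕ → ℝ) : ℝ[X] := C (a 0) + C (a 1) * X + C (a 2) * X ^ 2 + C (a 3) * X ^ 3

open Polynomial in
/-- The defect of `B` in the equation `(p + X) X ψ' = ∑ⱼ Aⱼ(X) ψʲ`, where `a i j` is the
coefficient of `Xⁱ ψʲ`. -/
def defect (a : ℕ → ℕ → ℝ) (p : ℝ) (B : ℝ[X]) : ℝ[X] :=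
  cubic (a · 0) + cubic (a · 1) * B + cubic (a · 2) * B ^ 2 + cubic (a · 3) * B ^ 3 -
    (C p + X) * X * derivative B

open Polynomial in
/-- Partial sums of the formal power series solution of `(p + X) X ψ' = ∑ⱼ Aⱼ(X) ψʲ`. -/
def partialSol (a : ℕ → ℕ → ℝ) (p : ℝ) : ℕ → ℝ[X]
  | 0 => 0
  | n + 1 => partialSol a p n +
      C (-(defect a p (partialSol a p n)).coeff (n + 1) / (a 0 1 - p * (n + 1))) * X ^ (n + 1)

/-- The numerator of the `n`-th coefficient of the formal solution. -/
def solNum (a : ℕ → ℕ → ℝ) (p : ℝ) (n : ℕ) : ℝ :=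
  -(defect a p (partialSol a p (n - 1))).coeff n

/-- The `n`-th coefficient of the formal solution. -/
def solCoeff (a : ℕ → ℕ → ℝ) (p : ℝ) : ℕ → ℝ
  | 0 => 0
  | n + 1 => solNum a p (n + 1) / (a 0 1 - p * (n + 1))

/-- The Cauchy square of a sequence. -/
def conv2 (t : ℕ → ℝ) (n : ℕ) : ℝ := ∑ i ∈ Finset.range (n + 1), t i * t (n - i)

/-- The Cauchy cube of a sequence. -/
def conv3 (t : ℕ → ℝ) (n : ℕ) : ℝ := ∑ i ∈ Finset.range (n + 1), t i * conv2 t (n - i)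

section
variable {a : ℕ → ℕ → ℝ} {p : ℝ}

open Polynomial

lemma coeff_cubic (b : ℕ → ℝ) (n : ℕ) : (cubic b).coeff n = if n ≤ 3 then b n else 0 := by
  simp only [cubic, coeff_add, coeff_C_mul, coeff_C, coeff_X, coeff_X_pow]
  rcases n with _ | _ | _ | _ | n <;> simp

lemma coeff_cubic_mul (b : ℕ → ℝ) (B : ℝ[X]) (n : ℕ) :
    (cubic b * B).coeff (n + 3) =
      b 0 * B.coeff (n + 3) + b 1 * B.coeff (n + 2) + b 2 * B.coeff (n + 1) + b 3 * B.coeff n := by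
  have h1 : (C (b 1) * X * B).coeff (n + 3) = b 1 * B.coeff (n + 2) := by
    rw [mul_assoc, coeff_C_mul, coeff_X_mul]
  have h2 : (C (b 2) * X ^ 2 * B).coeff (n + 3) = b 2 * B.coeff (n + 1) := by
    rw [mul_assoc, coeff_C_mul, show n + 3 = n + 1 + 2 from rfl, coeff_X_pow_mul]
  have h3 : (C (b 3) * X ^ 3 * B).coeff (n + 3) = b 3 * B.coeff n := by
    rw [mul_assoc, coeff_C_mul, coeff_X_pow_mul]
  simp only [cubic, add_mul, coeff_add, coeff_C_mul, h1, h2, h3]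

lemma partialSol_succ (n : ℕ) :
    partialSol a p (n + 1) = partialSol a p n + C (solCoeff a p (n + 1)) * X ^ (n + 1) := rfl

lemma coeff_partialSol (n j : ℕ) :
    (partialSol a p n).coeff j = if j ≤ n then solCoeff a p j else 0 := by
  induction n with
  | zero =>
    rcases j with _ | j <;> simp [partialSol, solCoeff]
  | succ n ih =>
    rw [partialSol_succ, coeff_add, ih, coeff_C_mul, coeff_X_pow]
    rcases lt_trichotomy j (n + 1) with h | h | h
    · simp [h.ne, h.le, Nat.lt_succ_iff.mp h]
    · subst h; simp
    · simp [h.ne', h.not_ge, (Nat.lt_of_succ_lt h).not_ge]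

lemma eval_partialSol (n : ℕ) (x : ℝ) :
    (partialSol a p n).eval x = ∑ j ∈ Finset.range (n + 1), solCoeff a p j * x ^ j := by
  induction n with
  | zero => simp [partialSol, solCoeff]
  | succ n ih => rw [Finset.sum_range_succ, partialSol_succ, eval_add, ih]; simp

lemma X_dvd_partialSol (n : ℕ) : X ∣ partialSol a p n := by
  rw [X_dvd_iff, coeff_partialSol]
  simp [solCoeff]

lemma coeff_mul_X_deriv (B : ℝ[X]) (n : ℕ) :
    ((C p + X) * X * derivative B).coeff (n + 1) = p * (n + 1) * B.coeff (n + 1) + n * B.coeff n := by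
  have h1 : (C p + X) * X * derivative B =
    C p * (X * derivative B) + X * (X * derivative B) := by ring
  rw [h1, coeff_add, coeff_C_mul, coeff_X_mul, coeff_X_mul, coeff_derivative]
  rcases n with _ | n
  · simp
  · rw [coeff_X_mul, coeff_derivative]; push_cast; ring

/-- Adding a monomial changes the defect to leading order by the linearised operator. -/
lemma defect_add_monomial (B : ℝ[X]) (hB : X ∣ B) (s : ℝ) (n : ℕ) :
    X ^ (n + 2) ∣ defect a p (B + C s * X ^ (n + 1)) - defect a p B -
      C ((a 0 1 - p * (n + 1)) * s) * X ^ (n + 1) := by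
  obtain ⟨D, rfl⟩ := hB
  have hd : derivative (X * D + C s * X ^ (n + 1)) =
      derivative (X * D) + C (s * (n + 1)) * X ^ n := by
    simp
    ring
  refine ⟨C s * (C (a 1 1) + C (a 2 1) * X + C (a 3 1) * X ^ 2) +
    cubic (a · 2) * (C s * (2 * D + C s * X ^ n)) +
    cubic (a · 3) * (C s * (3 * X * D ^ 2 + 3 * D * C s * X ^ (n + 1) + C s ^ 2 * X ^ (2 * n + 1))) -
    C (s * (n + 1)), ?_⟩
  simp only [defect]
  rw [hd]
  simp only [cubic, map_mul, map_sub, map_add, map_one, map_natCast]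
  ring

lemma coeff_defect_partialSol (ha : a 0 0 = 0) {n : ℕ}
    (hl : ∀ j, 1 ≤ j → j ≤ n → a 0 1 - p * j ≠ 0) :
    ∀ j ≤ n, (defect a p (partialSol a p n)).coeff j = 0 := by
  induction n with
  | zero =>
    intro j hj
    obtain rfl : j = 0 := by omega
    simp [defect, partialSol, coeff_cubic, ha]
  | succ n ih =>
    intro j hj
    have h := defect_add_monomial (a := a) (p := p) (partialSol a p n) (X_dvd_partialSol n)
      (solCoeff a p (n + 1)) n
    rw [← partialSol_succ, X_pow_dvd_iff] at h
    have h1 := h j (by omega)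
    rw [coeff_sub, coeff_sub, coeff_C_mul, coeff_X_pow] at h1
    rcases Nat.lt_succ_iff_lt_or_eq.mp (Nat.lt_succ_iff.mpr hj) with h2 | rfl
    · rw [ih (fun i h3 h4 => hl i h3 (by omega)) j (by omega), if_neg h2.ne] at h1
      linarith
    · have h3 := hl (n + 1) (by omega) le_rfl
      push_cast at h3
      rw [if_pos rfl, solCoeff, mul_div_cancel₀ _ h3, solNum, Nat.add_sub_cancel] at h1
      linarith

lemma X_pow_dvd_defect (ha : a 0 0 = 0) {n : ℕ}
    (hl : ∀ j, 1 ≤ j → j ≤ n → a 0 1 - p * j ≠ 0) :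
    X ^ (n + 1) ∣ defect a p (partialSol a p n) :=
  X_pow_dvd_iff.mpr fun j hj => coeff_defect_partialSol ha hl j (by omega)

lemma coeff_sq_partialSol {n m : ℕ} (hm : m ≤ n + 1) :
    (partialSol a p n ^ 2).coeff m = conv2 (solCoeff a p) m := by
  rw [sq, coeff_mul, Finset.Nat.sum_antidiagonal_eq_sum_range_succ
    (fun i j => (partialSol a p n).coeff i * (partialSol a p n).coeff j), conv2]
  refine Finset.sum_congr rfl fun i hi => ?_
  have hi := Finset.mem_range.mp hi
  rw [coeff_partialSol, coeff_partialSol]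
  rcases Nat.lt_or_ge n i with h | h
  · have : m - i = 0 := by omega
    simp [this, solCoeff]
  rcases Nat.lt_or_ge n (m - i) with h' | h'
  · have : i = 0 := by omega
    simp [this, solCoeff]
  rw [if_pos h, if_pos h']

lemma coeff_cube_partialSol {n m : ℕ} (hm : m ≤ n + 1) :
    (partialSol a p n ^ 3).coeff m = conv3 (solCoeff a p) m := by
  rw [show partialSol a p n ^ 3 = partialSol a p n * partialSol a p n ^ 2 by ring, coeff_mul,
    Finset.Nat.sum_antidiagonal_eq_sum_range_succ
    (fun i j => (partialSol a p n).coeff i * (partialSol a p n ^ 2).coeff j), conv3]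
  refine Finset.sum_congr rfl fun i hi => ?_
  have hi := Finset.mem_range.mp hi
  rw [coeff_partialSol, coeff_sq_partialSol (by omega)]
  rcases Nat.lt_or_ge n i with h | h
  · have : m - i = 0 := by omega
    simp [this, conv2, solCoeff]
  rw [if_pos h]

lemma solNum_add_four (n : ℕ) : solNum a p (n + 4) =
    (n + 3) * solCoeff a p (n + 3) -
    (a 1 1 * solCoeff a p (n + 3) + a 2 1 * solCoeff a p (n + 2) + a 3 1 * solCoeff a p (n + 1)) -
    (a 0 2 * conv2 (solCoeff a p) (n + 4) + a 1 2 * conv2 (solCoeff a p) (n + 3) +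
      a 2 2 * conv2 (solCoeff a p) (n + 2) + a 3 2 * conv2 (solCoeff a p) (n + 1)) -
    (a 0 3 * conv3 (solCoeff a p) (n + 4) + a 1 3 * conv3 (solCoeff a p) (n + 3) +
      a 2 3 * conv3 (solCoeff a p) (n + 2) + a 3 3 * conv3 (solCoeff a p) (n + 1)) := by
  rw [solNum, show n + 4 - 1 = n + 3 from rfl, defect, coeff_sub, coeff_add, coeff_add, coeff_add,
    show n + 4 = n + 1 + 3 from rfl, coeff_cubic_mul, coeff_cubic_mul, coeff_cubic_mul,
    show n + 1 + 3 = n + 3 + 1 from rfl, coeff_mul_X_deriv, coeff_cubic]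
  simp only [coeff_sq_partialSol (show n + 3 + 1 ≤ n + 3 + 1 by omega),
    coeff_sq_partialSol (show n + 1 + 2 ≤ n + 3 + 1 by omega),
    coeff_sq_partialSol (show n + 1 + 1 ≤ n + 3 + 1 by omega),
    coeff_sq_partialSol (show n + 1 ≤ n + 3 + 1 by omega),
    coeff_cube_partialSol (show n + 3 + 1 ≤ n + 3 + 1 by omega),
    coeff_cube_partialSol (show n + 1 + 2 ≤ n + 3 + 1 by omega),
    coeff_cube_partialSol (show n + 1 + 1 ≤ n + 3 + 1 by omega),
    coeff_cube_partialSol (show n + 1 ≤ n + 3 + 1 by omega), coeff_partialSol]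
  simp only [show ¬ n + 3 + 1 ≤ n + 3 by omega, show n + 3 ≤ n + 3 by omega,
    show n + 1 + 1 ≤ n + 3 by omega, show n + 1 ≤ n + 3 by omega,
    show ¬ n + 3 + 1 ≤ 3 by omega, if_true, if_false]
  push_cast
  ring

lemma solNum_one : solNum a p 1 = -a 1 0 := by
  simp [solNum, defect, partialSol, coeff_cubic]

lemma solNum_two : solNum a p 2 = solCoeff a p 1 - a 2 0 - a 1 1 * solCoeff a p 1 -
    a 0 2 * solCoeff a p 1 ^ 2 := by
  have h1 : partialSol a p 1 = C (solCoeff a p 1) * X := by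
    rw [partialSol_succ]; simp [partialSol]
  have h2 : defect a p (partialSol a p 1) = cubic (a · 0) + X * (C (solCoeff a p 1) * cubic (a · 1))
      + X ^ 2 * (C (solCoeff a p 1) ^ 2 * cubic (a · 2)) +
      X ^ 3 * (C (solCoeff a p 1) ^ 3 * cubic (a · 3)) -
      (C p + X) * X * derivative (partialSol a p 1) := by
    rw [defect, h1]; ring
  rw [solNum, h2, coeff_sub, coeff_add, coeff_add, coeff_add, coeff_mul_X_deriv, coeff_X_mul,
    coeff_X_pow_mul', coeff_X_pow_mul', ← C_pow, coeff_C_mul, coeff_C_mul, coeff_cubic, coeff_cubic,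
    coeff_cubic, coeff_partialSol, coeff_partialSol]
  simp
  ring

lemma solNum_three : solNum a p 3 =
    2 * solCoeff a p 2 - a 3 0 - (a 1 1 * solCoeff a p 2 + a 2 1 * solCoeff a p 1) -
    (a 0 2 * conv2 (solCoeff a p) 3 + a 1 2 * conv2 (solCoeff a p) 2) -
      a 0 3 * conv3 (solCoeff a p) 3 := by
  rw [solNum, show 3 - 1 = 2 from rfl, defect, coeff_sub, coeff_add, coeff_add, coeff_add,
    show 3 = 0 + 3 from rfl, coeff_cubic_mul, coeff_cubic_mul, coeff_cubic_mul,
    show 0 + 3 = 2 + 1 from rfl, coeff_mul_X_deriv, coeff_cubic]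
  simp only [coeff_sq_partialSol (show 2 + 1 ≤ 2 + 1 by omega),
    coeff_sq_partialSol (show 0 + 2 ≤ 2 + 1 by omega),
    coeff_sq_partialSol (show 0 + 1 ≤ 2 + 1 by omega),
    coeff_sq_partialSol (show 0 ≤ 2 + 1 by omega),
    coeff_cube_partialSol (show 2 + 1 ≤ 2 + 1 by omega),
    coeff_cube_partialSol (show 0 + 2 ≤ 2 + 1 by omega),
    coeff_cube_partialSol (show 0 + 1 ≤ 2 + 1 by omega),
    coeff_cube_partialSol (show 0 ≤ 2 + 1 by omega), coeff_partialSol]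
  simp [conv2, conv3, Finset.sum_range_succ, solCoeff]
  ring

lemma solCoeff_zero : solCoeff a p 0 = 0 := rfl

lemma solCoeff_succ (n : ℕ) :
    solCoeff a p (n + 1) = solNum a p (n + 1) / (a 0 1 - p * (n + 1)) := rfl

end

open Polynomial in
/-- The coefficients of a family of polynomials depend continuously on the parameter at `p₀`. -/
def CoeffContinuousAt (B : ℝ → ℝ[X]) (p₀ : ℝ) : Prop :=
  ∀ m, ContinuousAt (fun p => (B p).coeff m) p₀

section
open Polynomial
variable {B D : ℝ → ℝ[X]} {p₀ : ℝ}

lemma CoeffContinuousAt.add (hB : CoeffContinuousAt B p₀) (hD : CoeffContinuousAt D p₀) :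
    CoeffContinuousAt (fun p => B p + D p) p₀ := fun m => by
  simp only [coeff_add]
  exact (hB m).add (hD m)

lemma CoeffContinuousAt.sub (hB : CoeffContinuousAt B p₀) (hD : CoeffContinuousAt D p₀) :
    CoeffContinuousAt (fun p => B p - D p) p₀ := fun m => by
  simp only [coeff_sub]
  exact (hB m).sub (hD m)

lemma CoeffContinuousAt.mul (hB : CoeffContinuousAt B p₀) (hD : CoeffContinuousAt D p₀) :
    CoeffContinuousAt (fun p => B p * D p) p₀ := fun m => by
  simp only [coeff_mul]
  exact tendsto_finsetSum _ fun i _ => (hB i.1).mul (hD i.2)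

lemma coeffContinuousAt_const (B : ℝ[X]) : CoeffContinuousAt (fun _ => B) p₀ :=
  fun _ => continuousAt_const

lemma coeffContinuousAt_C {f : ℝ → ℝ} (hf : ContinuousAt f p₀) :
    CoeffContinuousAt (fun p => C (f p)) p₀ := fun m => by
  simp only [coeff_C]
  rcases m with _ | m
  · simpa using hf
  · simpa using continuousAt_const

lemma CoeffContinuousAt.pow (hB : CoeffContinuousAt B p₀) (n : ℕ) :
    CoeffContinuousAt (fun p => B p ^ n) p₀ := by
  induction n with
  | zero => simpa using coeffContinuousAt_const 1
  | succ n ih => simpa only [pow_succ] using ih.mul hB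

lemma CoeffContinuousAt.derivative (hB : CoeffContinuousAt B p₀) :
    CoeffContinuousAt (fun p => derivative (B p)) p₀ := fun m => by
  simp only [coeff_derivative]
  exact (hB (m + 1)).mul continuousAt_const

/-- Joint continuity of the values of a family of polynomials of bounded degree. -/
lemma CoeffContinuousAt.eval {N : ℕ} (hB : CoeffContinuousAt B p₀)
    (hN : ∀ p, (B p).natDegree < N) (x₀ : ℝ) :
    ContinuousAt (fun q : ℝ × ℝ => (B q.1).eval q.2) (p₀, x₀) := by
  have h : (fun q : ℝ × ℝ => (B q.1).eval q.2) =
      fun q : ℝ × ℝ => ∑ i ∈ Finset.range N, (B q.1).coeff i * q.2 ^ i := by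
    ext q
    exact eval_eq_sum_range' (hN q.1) q.2
  rw [h]
  refine tendsto_finsetSum _ fun i _ => ?_
  have h1 : ContinuousAt (fun q : ℝ × ℝ => (B q.1).coeff i) (p₀, x₀) :=
    ContinuousAt.comp (x := (p₀, x₀)) (g := fun p => (B p).coeff i) (f := Prod.fst) (hB i)
      continuousAt_fst
  exact h1.mul (continuousAt_snd.pow i)

lemma CoeffContinuousAt.divX_iterate (hB : CoeffContinuousAt B p₀) (n : ℕ) :
    CoeffContinuousAt (fun p => divX^[n] (B p)) p₀ := by
  induction n with
  | zero => exact hB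
  | succ n ih =>
    intro m
    simp only [Function.iterate_succ_apply', coeff_divX]
    exact ih (m + 1)

lemma coeff_divX_iterate (B : ℝ[X]) (n m : ℕ) : (divX^[n] B).coeff m = B.coeff (m + n) := by
  induction n generalizing m with
  | zero => rfl
  | succ n ih => rw [Function.iterate_succ_apply', coeff_divX, ih]; congr 1; omega

lemma X_pow_mul_divX_iterate {B : ℝ[X]} {n : ℕ} (h : X ^ n ∣ B) : X ^ n * divX^[n] B = B := by
  rw [X_pow_dvd_iff] at h
  ext m
  rw [coeff_X_pow_mul', coeff_divX_iterate]
  split_ifs with hm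
  · congr 1; omega
  · exact (h m (by omega)).symm

lemma natDegree_divX_iterate_le (B : ℝ[X]) (n : ℕ) : (divX^[n] B).natDegree ≤ B.natDegree := by
  refine natDegree_le_iff_coeff_eq_zero.mpr fun m hm => ?_
  rw [coeff_divX_iterate]
  exact coeff_eq_zero_of_natDegree_lt (by omega)

lemma natDegree_cubic_le (b : ℕ → ℝ) : (cubic b).natDegree ≤ 3 := by
  refine natDegree_le_iff_coeff_eq_zero.mpr fun m hm => ?_
  rw [coeff_cubic, if_neg (by omega)]

lemma natDegree_partialSol_le (a : ℕ → ℕ → ℝ) (p : ℝ) (n : ℕ) :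
    (partialSol a p n).natDegree ≤ n := by
  refine natDegree_le_iff_coeff_eq_zero.mpr fun m hm => ?_
  rw [coeff_partialSol, if_neg (by omega)]

lemma natDegree_defect_le (a : ℕ → ℕ → ℝ) (p : ℝ) {B : ℝ[X]} {n : ℕ} (hB : B.natDegree ≤ n) :
    (defect a p B).natDegree < 3 * n + 4 := by
  have hp : ∀ k, (B ^ k).natDegree ≤ k * n := fun k =>
    natDegree_pow_le.trans (Nat.mul_le_mul_left _ hB)
  have h0 := natDegree_cubic_le (a · 0)
  have h1 : (cubic (a · 1) * B).natDegree ≤ 3 + n :=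
    natDegree_mul_le_of_le (natDegree_cubic_le _) hB
  have h2 : (cubic (a · 2) * B ^ 2).natDegree ≤ 3 + 2 * n :=
    natDegree_mul_le_of_le (natDegree_cubic_le _) (hp 2)
  have h3 : (cubic (a · 3) * B ^ 3).natDegree ≤ 3 + 3 * n :=
    natDegree_mul_le_of_le (natDegree_cubic_le _) (hp 3)
  have h4 : (C p + X : ℝ[X]).natDegree ≤ 1 := by
    rw [add_comm, natDegree_X_add_C]
  have h5 : ((C p + X) * X * derivative B).natDegree ≤ 1 + 1 + (n - 1) :=
    natDegree_mul_le_of_le (natDegree_mul_le_of_le h4 natDegree_X_le)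
      ((natDegree_derivative_le B).trans (by omega))
  rw [defect]
  refine Nat.lt_succ_of_le ((natDegree_sub_le _ _).trans (max_le ?_ (by omega)))
  refine (natDegree_add_le _ _).trans (max_le ?_ (by omega))
  refine (natDegree_add_le _ _).trans (max_le ?_ (by omega))
  exact (natDegree_add_le _ _).trans (max_le (by omega) (by omega))

variable {a : ℝ → ℕ → ℕ → ℝ}

lemma coeffContinuousAt_cubic {b : ℝ → ℕ → ℝ} (hb : ∀ i, ContinuousAt (fun p => b p i) p₀) :
    CoeffContinuousAt (fun p => cubic (b p)) p₀ := fun m => by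
  simp only [coeff_cubic]
  split_ifs
  · exact hb m
  · exact continuousAt_const

lemma CoeffContinuousAt.defect (ha : ∀ i j, ContinuousAt (fun p => a p i j) p₀)
    (hB : CoeffContinuousAt B p₀) : CoeffContinuousAt (fun p => defect (a p) p (B p)) p₀ := by
  unfold Stmt0.defect
  have h := fun j => coeffContinuousAt_cubic (b := fun p i => a p i j) fun i => ha i j
  refine (((((h 0).add ((h 1).mul hB)).add ((h 2).mul (hB.pow 2))).add
    ((h 3).mul (hB.pow 3)))).sub (CoeffContinuousAt.mul (CoeffContinuousAt.mul ?_ ?_) hB.derivative)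
  · exact (coeffContinuousAt_C continuousAt_id).add (coeffContinuousAt_const X)
  · exact coeffContinuousAt_const X

lemma coeffContinuousAt_partialSol (ha : ∀ i j, ContinuousAt (fun p => a p i j) p₀) {n : ℕ}
    (hl : ∀ j, 1 ≤ j → j ≤ n → a p₀ 0 1 - p₀ * j ≠ 0) :
    CoeffContinuousAt (fun p => partialSol (a p) p n) p₀ := by
  induction n with
  | zero => exact coeffContinuousAt_const 0
  | succ n ih =>
    have ih := ih fun j h1 h2 => hl j h1 (by omega)
    refine ih.add (CoeffContinuousAt.mul (coeffContinuousAt_C ?_) (coeffContinuousAt_const _))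
    refine ((CoeffContinuousAt.defect ha ih (n + 1)).neg).div ?_ ?_
    · exact (ha 0 1).sub (continuousAt_id.mul continuousAt_const)
    · exact_mod_cast hl (n + 1) (by omega) le_rfl

lemma continuousAt_solNum (ha : ∀ i j, ContinuousAt (fun p => a p i j) p₀) {n : ℕ}
    (hl : ∀ j, 1 ≤ j → j ≤ n → a p₀ 0 1 - p₀ * j ≠ 0) :
    ContinuousAt (fun p => solNum (a p) p (n + 1)) p₀ :=
  ((CoeffContinuousAt.defect ha (coeffContinuousAt_partialSol ha hl)) (n + 1)).neg

lemma continuousAt_solCoeff (ha : ∀ i j, ContinuousAt (fun p => a p i j) p₀) {n : ℕ}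
    (hl : ∀ j, 1 ≤ j → j ≤ n → a p₀ 0 1 - p₀ * j ≠ 0) :
    ContinuousAt (fun p => solCoeff (a p) p n) p₀ := by
  have h := coeffContinuousAt_partialSol ha hl n
  simpa only [coeff_partialSol, le_refl, if_true] using h

/-- The defect of a partial sum divided by the power of `X` it contains. -/
def defectQuot (a : ℕ → ℕ → ℝ) (p : ℝ) (n : ℕ) : ℝ[X] :=
  divX^[n + 1] (Stmt0.defect a p (partialSol a p n))

lemma defect_partialSol_eq {a : ℕ → ℕ → ℝ} {p : ℝ} (ha : a 0 0 = 0) {n : ℕ}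
    (hl : ∀ j, 1 ≤ j → j ≤ n → a 0 1 - p * j ≠ 0) :
    Stmt0.defect a p (partialSol a p n) = X ^ (n + 1) * defectQuot a p n :=
  (X_pow_mul_divX_iterate (X_pow_dvd_defect ha hl)).symm

lemma eval_zero_defectQuot (a : ℕ → ℕ → ℝ) (p : ℝ) (n : ℕ) :
    (defectQuot a p n).eval 0 = -solNum a p (n + 1) := by
  rw [← coeff_zero_eq_eval_zero, defectQuot, coeff_divX_iterate, solNum]
  simp

lemma continuousAt_defectQuot (ha : ∀ i j, ContinuousAt (fun p => a p i j) p₀) {n : ℕ}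
    (hl : ∀ j, 1 ≤ j → j ≤ n → a p₀ 0 1 - p₀ * j ≠ 0) (x₀ : ℝ) :
    ContinuousAt (fun q : ℝ × ℝ => (defectQuot (a q.1) q.1 n).eval q.2) (p₀, x₀) :=
  ((CoeffContinuousAt.defect ha (coeffContinuousAt_partialSol ha hl)).divX_iterate (n + 1)).eval
    (fun _ => (natDegree_divX_iterate_le _ _).trans_lt
      (natDegree_defect_le _ _ (natDegree_partialSol_le _ _ n))) x₀

end

lemma mul_le_mul_shift {t : ℕ → ℝ} {N : ℕ} (hpos : ∀ j, 1 ≤ j → j ≤ N → 0 < t j)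
    (hlc : ∀ j, 1 ≤ j → j + 2 ≤ N → t (j + 1) ^ 2 ≤ t j * t (j + 2)) {a b k : ℕ} (ha : 1 ≤ a)
    (hab : a ≤ b) (hb : b + k ≤ N) : t (a + k) * t b ≤ t a * t (b + k) := by
  have h1 : ∀ a b : ℕ, 1 ≤ a → a ≤ b → b + 1 ≤ N → t (a + 1) * t b ≤ t a * t (b + 1) := by
    intro a b ha hab
    induction b, hab using Nat.le_induction with
    | base => intro _; exact (mul_comm _ _).le
    | succ b hab ih =>
      intro hb
      have i1 := ih (by omega)
      have i2 := hlc b (by omega) (by omega)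
      have p1 := hpos b (by omega) (by omega)
      have p2 := hpos (b + 1) (by omega) (by omega)
      have p3 := hpos a (by omega) (by omega)
      have p4 := hpos (a + 1) (by omega) (by omega)
      refine le_of_mul_le_mul_right ?_ (mul_pos p1 p2)
      have i3 : t (b + 1) * t (b + 1) ≤ t b * t (b + 2) := by rw [← sq]; exact i2
      calc t (a + 1) * t (b + 1) * (t b * t (b + 1))
          = (t (a + 1) * t b) * (t (b + 1) * t (b + 1)) := by ring
        _ ≤ (t a * t (b + 1)) * (t b * t (b + 2)) :=
            mul_le_mul i1 i3 (by positivity) (by positivity)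
        _ = _ := by ring_nf
  induction k with
  | zero => rfl
  | succ k ih =>
    have i1 := ih (by omega)
    have i2 := h1 (a + k) (b + k) (by omega) (by omega) (by omega)
    have p1 := hpos (b + k) (by omega) (by omega)
    have p2 := hpos (b + k + 1) (by omega) (by omega)
    have p3 := hpos b (by omega) (by omega)
    refine le_of_mul_le_mul_right ?_ p1
    calc t (a + (k + 1)) * t b * t (b + k) = t (a + k + 1) * t (b + k) * t b := by ring_nf
      _ ≤ t (a + k) * t (b + k + 1) * t b := by gcongr
      _ = t (a + k) * t b * t (b + k + 1) := by ring
      _ ≤ t a * t (b + k) * t (b + k + 1) := by gcongr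
      _ = _ := by ring_nf

lemma conv2_zero {t : ℕ → ℝ} (h0 : t 0 = 0) : conv2 t 0 = 0 := by simp [conv2, h0]

lemma conv2_nonneg {t : ℕ → ℝ} {n : ℕ} (h0 : t 0 = 0) (h : ∀ j < n, 0 ≤ t j) : 0 ≤ conv2 t n :=
  Finset.sum_nonneg fun i hi => by
    rw [Finset.mem_range] at hi
    rcases Nat.eq_zero_or_pos i with rfl | hi0
    · simp [h0]
    rcases (show i = n ∨ i < n by omega) with rfl | hin
    · simp [h0]
    exact mul_nonneg (h i (by omega)) (h _ (by omega))

lemma conv3_nonneg {t : ℕ → ℝ} {n : ℕ} (h0 : t 0 = 0) (h : ∀ j < n, 0 ≤ t j) : 0 ≤ conv3 t n :=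
  Finset.sum_nonneg fun i hi => by
    rw [Finset.mem_range] at hi
    rcases (show i = n ∨ i < n by omega) with rfl | hin
    · simp [conv2_zero h0]
    exact mul_nonneg (h i (by omega)) (conv2_nonneg h0 fun j hj => h j (by omega))

lemma conv3_le {t : ℕ → ℝ} {n : ℕ} {β : ℝ} (h0 : t 0 = 0) (h : ∀ j < n, 0 ≤ t j)
    (hc : ∀ m, 1 ≤ m → m ≤ n → conv2 t m ≤ β * t (m - 1)) : conv3 t n ≤ β * conv2 t (n - 1) := by
  rcases n with _ | n
  · simp [conv3, conv2, h0]
  · rw [conv3, Finset.sum_range_succ, Nat.sub_self, conv2_zero h0, mul_zero, add_zero, conv2,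
      Finset.mul_sum, Nat.add_sub_cancel]
    refine Finset.sum_le_sum fun i hi => ?_
    rw [Finset.mem_range] at hi
    have := hc (n + 1 - i) (by omega) (by omega)
    rw [show n + 1 - i - 1 = n - i by omega] at this
    calc t i * conv2 t (n + 1 - i) ≤ t i * (β * t (n - i)) :=
          mul_le_mul_of_nonneg_left this (h i (by omega))
      _ = _ := by ring

/-- The first four terms on each side of a Cauchy square. -/
lemma conv2_split {t : ℕ → ℝ} (h0 : t 0 = 0) (m : ℕ) : conv2 t (m + 9) =
    2 * (t 1 * t (m + 8) + t 2 * t (m + 7) + t 3 * t (m + 6) + t 4 * t (m + 5)) +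
      ∑ i ∈ Finset.range m, t (i + 5) * t (m + 4 - i) := by
  rw [conv2, show m + 9 + 1 = m + 5 + 5 by ring]
  rw [Finset.sum_range_succ, Finset.sum_range_succ, Finset.sum_range_succ, Finset.sum_range_succ,
    Finset.sum_range_succ]
  rw [Finset.sum_range_succ', Finset.sum_range_succ', Finset.sum_range_succ',
    Finset.sum_range_succ', Finset.sum_range_succ']
  rw [show m + 5 + 4 = m + 9 by ring, show m + 5 + 3 = m + 8 by ring,
    show m + 5 + 2 = m + 7 by ring, show m + 5 + 1 = m + 6 by ring,
    show m + 9 - (m + 9) = 0 by omega, show m + 9 - (m + 8) = 1 by omega,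
    show m + 9 - (m + 7) = 2 by omega, show m + 9 - (m + 6) = 3 by omega,
    show m + 9 - (m + 5) = 4 by omega]
  simp only [h0, zero_mul, mul_zero, add_zero]
  rw [show m + 9 - (0 + 1) = m + 8 by omega, show m + 9 - (0 + 1 + 1) = m + 7 by omega,
    show m + 9 - (0 + 1 + 1 + 1) = m + 6 by omega,
    show m + 9 - (0 + 1 + 1 + 1 + 1) = m + 5 by omega]
  have : ∀ i ∈ Finset.range m, t (i + 1 + 1 + 1 + 1 + 1) * t (m + 9 - (i + 1 + 1 + 1 + 1 + 1)) =
      t (i + 5) * t (m + 4 - i) := fun i _ => by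
    rw [show m + 9 - (i + 1 + 1 + 1 + 1 + 1) = m + 4 - i by omega]
  rw [Finset.sum_congr rfl this]
  norm_num
  ring

lemma conv2_le_of_logConvex {t : ℕ → ℝ} (h0 : t 0 = 0) {m : ℕ}
    (hpos : ∀ j, 1 ≤ j → j ≤ m + 8 → 0 < t j)
    (hlc : ∀ j, 1 ≤ j → j + 2 ≤ m + 8 → t (j + 1) ^ 2 ≤ t j * t (j + 2)) : conv2 t (m + 9) ≤
    2 * (t 1 * t (m + 8) + t 2 * t (m + 7) + t 3 * t (m + 6) + t 4 * t (m + 5)) +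
      m * (t 5 * t (m + 4)) := by
  rw [conv2_split h0]
  gcongr
  calc _ ≤ ∑ i ∈ Finset.range m, t 5 * t (m + 4) := by
        refine Finset.sum_le_sum fun i hi => ?_
        rw [Finset.mem_range] at hi
        have hi' : m + 4 - i + i = m + 4 := by omega
        have := mul_le_mul_shift hpos hlc (a := 5) (b := m + 4 - i) (k := i) (by norm_num)
          (by omega) (by omega)
        rwa [hi', add_comm 5 i] at this
    _ = _ := by simp

/-- Numerical bounds on the coefficients of the equation and on the first coefficients of its
formal solution. -/
structure SeriesBase (a : ℕ → ℕ → ℝ) (p : ℝ) : Prop where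
  p_nonneg : 0 ≤ p
  a01 : a 0 1 ∈ Ioo 1.151 1.1525
  a02 : a 0 2 ∈ Ioo 2.007 2.0085
  a03 : a 0 3 ∈ Ioo 0.874 0.8755
  a11 : a 1 1 ∈ Ioo (-2.7772) (-2.7762)
  a12 : a 1 2 ∈ Ioo (-2.15) (-2.14)
  a13 : a 1 3 ∈ Ioo (-0.001) 0.001
  a21 : a 2 1 ∈ Ioo (-0.354) (-0.353)
  a22 : a 2 2 ∈ Ioo (-1.4) (-1.39)
  a23 : a 2 3 ∈ Ioo (-0.8755) (-0.874)
  a31 : a 3 1 ∈ Ioo (-0.001) 0.001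
  a32 : a 3 2 ∈ Ioo (-0.001) 0.001
  a33 : a 3 3 ∈ Ioo (-0.001) 0.001
  t1 : solCoeff a p 1 ∈ Ioo 0.315 0.3153
  t2 : solCoeff a p 2 ∈ Ioo 0.881 0.882
  t3 : solCoeff a p 3 ∈ Ioo 2.94 2.946
  t4 : solCoeff a p 4 ∈ Ioo 11.3 11.41
  t5 : solCoeff a p 5 ∈ Ioo 50 50.9
  pos : ∀ j ∈ Icc 1 12, 0 < solCoeff a p j
  logConvex : ∀ j ∈ Icc 1 10,
    solCoeff a p (j + 1) ^ 2 < solCoeff a p j * solCoeff a p (j + 2)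
  conv2_lt : ∀ j ∈ Icc 1 11, conv2 (solCoeff a p) (j + 1) < 1.25 * solCoeff a p j
  lower : ∀ j ∈ Icc (8 : ℕ) 11, (j + 1 - 0.45 : ℝ) * solCoeff a p j < solNum a p (j + 1)
  upper : ∀ j ∈ Icc (3 : ℕ) 11, solNum a p (j + 1) < (j + 1 + 0.55 : ℝ) * solCoeff a p j

/-- Growth properties of the coefficients of the formal solution up to the order `n`. -/
structure SeriesGrowth (a : ℕ → ℕ → ℝ) (p : ℝ) (n : ℕ) : Prop where
  pos : ∀ j, 1 ≤ j → j ≤ n → 0 < solCoeff a p j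
  logConvex : ∀ j, 1 ≤ j → j + 2 ≤ n →
    solCoeff a p (j + 1) ^ 2 ≤ solCoeff a p j * solCoeff a p (j + 2)
  conv2_le : ∀ j, 1 ≤ j → j + 1 ≤ n → conv2 (solCoeff a p) (j + 1) ≤ 1.25 * solCoeff a p j
  lower : ∀ j : ℕ, 8 ≤ j → j + 1 ≤ n → (j + 1 - 0.45 : ℝ) * solCoeff a p j ≤ solNum a p (j + 1)
  upper : ∀ j : ℕ, 3 ≤ j → j + 1 ≤ n → solNum a p (j + 1) ≤ (j + 1 + 0.55 : ℝ) * solCoeff a p j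
  sharp : ∀ j : ℕ, 17 ≤ j → j + 1 ≤ n → (j + 1 : ℝ) * solCoeff a p j ≤ solNum a p (j + 1)

section
variable {a : ℕ → ℕ → ℝ} {p : ℝ}

lemma SeriesGrowth.nonneg {n : ℕ} (h : SeriesGrowth a p n) {j : ℕ} (hj : j ≤ n) :
    0 ≤ solCoeff a p j := by
  rcases Nat.eq_zero_or_pos j with rfl | h0
  · exact le_rfl
  · exact (h.pos j h0 hj).le

/-- Consecutive coefficients: `(j + 1 - 0.45) t_j ≤ 1.1525 t_{j+1}`. -/
lemma SeriesGrowth.le_succ {n : ℕ} (hB : SeriesBase a p) (h : SeriesGrowth a p n)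
    (hl : ∀ j : ℕ, j ≤ n → 0 < a 0 1 - p * j) {j : ℕ} (hj : 8 ≤ j) (hn : j + 1 ≤ n) :
    (j + 1 - 0.45 : ℝ) * solCoeff a p j ≤ 1.1525 * solCoeff a p (j + 1) := by
  have h1 := h.lower j hj hn
  have h2 := hl (j + 1) hn
  have h3 := h.pos (j + 1) (by omega) hn
  have h4 : solNum a p (j + 1) = (a 0 1 - p * (j + 1 : ℕ)) * solCoeff a p (j + 1) := by
    rw [solCoeff_succ]
    push_cast at h2 ⊢
    field_simp
  rw [h4] at h1
  refine h1.trans (mul_le_mul_of_nonneg_right ?_ h3.le)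
  have := hB.a01.2
  have := mul_nonneg hB.p_nonneg (Nat.cast_nonneg (α := ℝ) (j + 1))
  linarith

set_option maxHeartbeats 1000000 in
/-- Bounds on the next numerator when the growth properties hold up to the order `m + 8`. -/
lemma SeriesGrowth.next (hB : SeriesBase a p) {m : ℕ} (hm : 4 ≤ m) (h : SeriesGrowth a p (m + 8))
    (hl : ∀ j : ℕ, j ≤ m + 8 → 0 < a 0 1 - p * j) :
    conv2 (solCoeff a p) (m + 9) ≤ 1.25 * solCoeff a p (m + 8) ∧
    (m + 9 - 0.45 : ℝ) * solCoeff a p (m + 8) ≤ solNum a p (m + 9) ∧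
    solNum a p (m + 9) ≤ (m + 9 + 0.55 : ℝ) * solCoeff a p (m + 8) ∧
    (9 ≤ m → (m + 9 : ℝ) * solCoeff a p (m + 8) ≤ solNum a p (m + 9)) := by
  have h0 : solCoeff a p 0 = 0 := rfl
  have hm' : (4 : ℝ) ≤ m := by exact_mod_cast hm
  have hc := conv2_le_of_logConvex h0 (m := m) h.pos h.logConvex
  have hnn : ∀ j ≤ m + 8, 0 ≤ solCoeff a p j := fun j hj => h.nonneg hj
  have e1 := h.le_succ hB hl (j := m + 7) (by omega) (by omega)
  have e2 := h.le_succ hB hl (j := m + 6) (by omega) (by omega)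
  have e3 := h.le_succ hB hl (j := m + 5) (by omega) (by omega)
  have e4 := h.le_succ hB hl (j := m + 4) (by omega) (by omega)
  have p0 := h.pos (m + 8) (by omega) (by omega)
  have p1 := h.pos (m + 7) (by omega) (by omega)
  have p2 := h.pos (m + 6) (by omega) (by omega)
  have p3 := h.pos (m + 5) (by omega) (by omega)
  have p4 := h.pos (m + 4) (by omega) (by omega)
  have c1 := h.conv2_le (m + 7) (by omega) (by omega)
  have c2 := h.conv2_le (m + 6) (by omega) (by omega)
  have c3 := h.conv2_le (m + 5) (by omega) (by omega)
  have c4 := h.conv2_le (m + 4) (by omega) (by omega)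
  have hcv : ∀ m' : ℕ, 1 ≤ m' → m' ≤ m + 8 →
      conv2 (solCoeff a p) m' ≤ 1.25 * solCoeff a p (m' - 1) := by
    intro m' h1 h2
    rcases m' with _ | _ | m'
    · omega
    · simp [conv2, Finset.sum_range_succ, h0]
    · exact h.conv2_le (m' + 1) (by omega) (by omega)
  have n0 := conv2_nonneg (n := m + 8) h0 fun j hj => hnn j (by omega)
  have n1 := conv2_nonneg (n := m + 7) h0 fun j hj => hnn j (by omega)
  have n2 := conv2_nonneg (n := m + 6) h0 fun j hj => hnn j (by omega)
  have q := conv3_nonneg (n := m + 9) h0 fun j hj => hnn j (by omega)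
  have q0 := conv3_nonneg (n := m + 8) h0 fun j hj => hnn j (by omega)
  have q1 := conv3_nonneg (n := m + 7) h0 fun j hj => hnn j (by omega)
  have q2 := conv3_nonneg (n := m + 6) h0 fun j hj => hnn j (by omega)
  have d0 : conv3 (solCoeff a p) (m + 8) ≤ 1.25 * conv2 (solCoeff a p) (m + 7) :=
    conv3_le (n := m + 8) h0 (fun j hj => hnn j (by omega)) fun m' h1 h2 => hcv m' h1 (by omega)
  have d1 : conv3 (solCoeff a p) (m + 7) ≤ 1.25 * conv2 (solCoeff a p) (m + 6) :=
    conv3_le (n := m + 7) h0 (fun j hj => hnn j (by omega)) fun m' h1 h2 => hcv m' h1 (by omega)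
  have d2 : conv3 (solCoeff a p) (m + 6) ≤ 1.25 * conv2 (solCoeff a p) (m + 5) :=
    conv3_le (n := m + 6) h0 (fun j hj => hnn j (by omega)) fun m' h1 h2 => hcv m' h1 (by omega)
  have d : conv2 (solCoeff a p) (m + 9) ≤ 1.25 * solCoeff a p (m + 8) →
      conv3 (solCoeff a p) (m + 9) ≤ 1.25 * conv2 (solCoeff a p) (m + 8) := fun hh =>
    conv3_le (n := m + 9) h0 (fun j hj => hnn j (by omega)) fun m' h1 h2 => by
      rcases (show m' = m + 9 ∨ m' ≤ m + 8 by omega) with rfl | h3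
      · exact hh
      · exact hcv m' h1 h3
  have hlow : 2 * (solCoeff a p 1 * solCoeff a p (m + 8) + solCoeff a p 2 * solCoeff a p (m + 7)) ≤
      conv2 (solCoeff a p) (m + 9) := by
    rw [conv2_split h0]
    have s1 : 0 ≤ ∑ i ∈ Finset.range m, solCoeff a p (i + 5) * solCoeff a p (m + 4 - i) :=
      Finset.sum_nonneg fun i hi => by
        rw [Finset.mem_range] at hi
        exact mul_nonneg (hnn _ (by omega)) (hnn _ (by omega))
    have s2 := mul_nonneg (hnn 3 (by omega)) p2.le
    have s3 := mul_nonneg (hnn 4 (by omega)) p3.le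
    linarith
  have hP := solNum_add_four (a := a) (p := p) (m + 5)
  simp only [add_assoc, Nat.reduceAdd] at hP c1 c2 c3 c4 e1 e2 e3 e4
  push_cast at hP e1 e2 e3 e4
  obtain ⟨t1l, t1u⟩ := hB.t1
  obtain ⟨t2l, t2u⟩ := hB.t2
  obtain ⟨t3l, t3u⟩ := hB.t3
  obtain ⟨t4l, t4u⟩ := hB.t4
  obtain ⟨t5l, t5u⟩ := hB.t5
  obtain ⟨b02l, b02u⟩ := hB.a02
  obtain ⟨b03l, b03u⟩ := hB.a03
  obtain ⟨b11l, b11u⟩ := hB.a11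
  obtain ⟨b12l, b12u⟩ := hB.a12
  obtain ⟨b13l, b13u⟩ := hB.a13
  obtain ⟨b21l, b21u⟩ := hB.a21
  obtain ⟨b22l, b22u⟩ := hB.a22
  obtain ⟨b23l, b23u⟩ := hB.a23
  obtain ⟨b31l, b31u⟩ := hB.a31
  obtain ⟨b32l, b32u⟩ := hB.a32
  obtain ⟨b33l, b33u⟩ := hB.a33
  generalize solCoeff a p (m + 8) = x0 at *
  generalize solCoeff a p (m + 7) = x1 at *
  generalize solCoeff a p (m + 6) = x2 at *
  generalize solCoeff a p (m + 5) = x3 at *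
  generalize solCoeff a p (m + 4) = x4 at *
  generalize solCoeff a p 1 = t1 at *
  generalize solCoeff a p 2 = t2 at *
  generalize solCoeff a p 3 = t3 at *
  generalize solCoeff a p 4 = t4 at *
  generalize solCoeff a p 5 = t5 at *
  generalize conv2 (solCoeff a p) (m + 9) = C0 at *
  generalize conv2 (solCoeff a p) (m + 8) = C1 at *
  generalize conv2 (solCoeff a p) (m + 7) = C2 at *
  generalize conv2 (solCoeff a p) (m + 6) = C3 at *
  generalize conv2 (solCoeff a p) (m + 5) = C4 at *
  generalize conv3 (solCoeff a p) (m + 9) = D0 at *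
  generalize conv3 (solCoeff a p) (m + 8) = D1 at *
  generalize conv3 (solCoeff a p) (m + 7) = D2 at *
  generalize conv3 (solCoeff a p) (m + 6) = D3 at *
  clear hcv hnn
  have f1 : x1 ≤ 0.1 * x0 := by linarith [mul_le_mul_of_nonneg_right hm' p1.le]
  have f2 : x2 ≤ 0.11 * x1 := by linarith [mul_le_mul_of_nonneg_right hm' p2.le]
  have f3 : x3 ≤ 0.121 * x2 := by linarith [mul_le_mul_of_nonneg_right hm' p3.le]
  have f4 : x4 ≤ 0.135 * x3 := by linarith [mul_le_mul_of_nonneg_right hm' p4.le]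
  have u1 : t1 * x0 ≤ 0.3153 * x0 := mul_le_mul_of_nonneg_right t1u.le p0.le
  have u2 : t2 * x1 ≤ 0.882 * x1 := mul_le_mul_of_nonneg_right t2u.le p1.le
  have u3 : t3 * x2 ≤ 2.946 * x2 := mul_le_mul_of_nonneg_right t3u.le p2.le
  have u4 : t4 * x3 ≤ 11.41 * x3 := mul_le_mul_of_nonneg_right t4u.le p3.le
  have u5 : m * (t5 * x4) ≤ 50.9 * (1.1525 * x3) := by
    have g1 : m * x4 ≤ 1.1525 * x3 := by linarith
    have g2 := mul_le_mul_of_nonneg_right t5u.le (mul_nonneg (by linarith : (0 : ℝ) ≤ m) p4.le)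
    linarith
  have l1 : 0.315 * x0 ≤ t1 * x0 := mul_le_mul_of_nonneg_right t1l.le p0.le
  have l2 : 0.881 * x1 ≤ t2 * x1 := mul_le_mul_of_nonneg_right t2l.le p1.le
  have hC0 : C0 ≤ 0.981 * x0 := by linarith
  have d := d (by linarith)
  have i11 : a 1 1 * x0 ≤ -2.7762 * x0 := mul_le_mul_of_nonneg_right b11u.le p0.le
  have j11 : -2.7772 * x0 ≤ a 1 1 * x0 := mul_le_mul_of_nonneg_right b11l.le p0.le
  have i21 : a 2 1 * x1 ≤ -0.353 * x1 := mul_le_mul_of_nonneg_right b21u.le p1.le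
  have j21 : -0.354 * x1 ≤ a 2 1 * x1 := mul_le_mul_of_nonneg_right b21l.le p1.le
  have i31 : a 3 1 * x2 ≤ 0.001 * x2 := mul_le_mul_of_nonneg_right b31u.le p2.le
  have j31 : -0.001 * x2 ≤ a 3 1 * x2 := mul_le_mul_of_nonneg_right b31l.le p2.le
  have hC0' : 0 ≤ C0 := by linarith
  have i02 : a 0 2 * C0 ≤ 2.0085 * C0 := mul_le_mul_of_nonneg_right b02u.le hC0'
  have j02 : 2.007 * C0 ≤ a 0 2 * C0 := mul_le_mul_of_nonneg_right b02l.le hC0'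
  have i12 : a 1 2 * C1 ≤ -2.14 * C1 := mul_le_mul_of_nonneg_right b12u.le n0
  have j12 : -2.15 * C1 ≤ a 1 2 * C1 := mul_le_mul_of_nonneg_right b12l.le n0
  have i22 : a 2 2 * C2 ≤ -1.39 * C2 := mul_le_mul_of_nonneg_right b22u.le n1
  have j22 : -1.4 * C2 ≤ a 2 2 * C2 := mul_le_mul_of_nonneg_right b22l.le n1
  have i32 : a 3 2 * C3 ≤ 0.001 * C3 := mul_le_mul_of_nonneg_right b32u.le n2
  have j32 : -0.001 * C3 ≤ a 3 2 * C3 := mul_le_mul_of_nonneg_right b32l.le n2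
  have i03 : a 0 3 * D0 ≤ 0.8755 * D0 := mul_le_mul_of_nonneg_right b03u.le q
  have j03 : 0.874 * D0 ≤ a 0 3 * D0 := mul_le_mul_of_nonneg_right b03l.le q
  have i13 : a 1 3 * D1 ≤ 0.001 * D1 := mul_le_mul_of_nonneg_right b13u.le q0
  have j13 : -0.001 * D1 ≤ a 1 3 * D1 := mul_le_mul_of_nonneg_right b13l.le q0
  have i23 : a 2 3 * D2 ≤ -0.874 * D2 := mul_le_mul_of_nonneg_right b23u.le q1
  have j23 : -0.8755 * D2 ≤ a 2 3 * D2 := mul_le_mul_of_nonneg_right b23l.le q1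
  have i33 : a 3 3 * D3 ≤ 0.001 * D3 := mul_le_mul_of_nonneg_right b33u.le q2
  have j33 : -0.001 * D3 ≤ a 3 3 * D3 := mul_le_mul_of_nonneg_right b33l.le q2
  refine ⟨by linarith, ?_, ?_, fun hm9 => ?_⟩
  · rw [hP]; linarith
  · rw [hP]; linarith
  · have hm9' : (9 : ℝ) ≤ m := by exact_mod_cast hm9
    have f1 : x1 ≤ 0.07 * x0 := by linarith [mul_le_mul_of_nonneg_right hm9' p1.le]
    have f2 : x2 ≤ 0.075 * x1 := by linarith [mul_le_mul_of_nonneg_right hm9' p2.le]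
    have f3 : x3 ≤ 0.08 * x2 := by linarith [mul_le_mul_of_nonneg_right hm9' p3.le]
    rw [hP]; linarith

end

lemma sq_le_mul_of_ratio_bounds {x y z l l' A : ℝ} (hl : 0 < l) (hll : l ≤ l') (hx : 0 ≤ x)
    (hy : 0 ≤ y) (h1 : A * y ≤ l * z) (h2 : l' * y ≤ A * x) : y ^ 2 ≤ x * z := by
  refine le_of_mul_le_mul_right ?_ hl
  calc y ^ 2 * l ≤ y ^ 2 * l' := by gcongr
    _ = y * (l' * y) := by ring
    _ ≤ y * (A * x) := by gcongr
    _ = x * (A * y) := by ring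
    _ ≤ x * (l * z) := by gcongr
    _ = _ := by ring

section
variable {a : ℕ → ℕ → ℝ} {p : ℝ}

lemma solNum_succ_eq {n : ℕ} (hl : 0 < a 0 1 - p * (n + 1 : ℕ)) :
    solNum a p (n + 1) = (a 0 1 - p * (n + 1 : ℕ)) * solCoeff a p (n + 1) := by
  rw [solCoeff_succ]
  push_cast at hl ⊢
  field_simp

lemma SeriesBase.growth (hB : SeriesBase a p) : ∀ n, 12 ≤ n →
    (∀ j : ℕ, j ≤ n → 0 < a 0 1 - p * j) → SeriesGrowth a p n := by
  intro n hn
  induction n, hn using Nat.le_induction with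
  | base =>
    intro _
    refine ⟨fun j h1 h2 => hB.pos j ⟨h1, h2⟩, fun j h1 h2 => (hB.logConvex j ⟨h1, by omega⟩).le,
      fun j h1 h2 => (hB.conv2_lt j ⟨h1, by omega⟩).le,
      fun j h1 h2 => (hB.lower j ⟨h1, by omega⟩).le,
      fun j h1 h2 => (hB.upper j ⟨h1, by omega⟩).le, fun j h1 h2 => by omega⟩
  | succ n hn ih =>
    intro hl
    have hl' : ∀ j : ℕ, j ≤ n → 0 < a 0 1 - p * j := fun j hj => hl j (by omega)
    obtain ⟨m, rfl⟩ : ∃ m, n = m + 8 := ⟨n - 8, by omega⟩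
    have ih := ih hl'
    obtain ⟨h1, h2, h3, h4⟩ := ih.next hB (by omega) hl'
    have l9 := hl (m + 8 + 1) le_rfl
    have l8 := hl (m + 7 + 1) (by omega)
    have e9 := solNum_succ_eq l9
    have e8 := solNum_succ_eq l8
    have p8 := ih.pos (m + 8) (by omega) le_rfl
    have p7 := ih.pos (m + 7) (by omega) (by omega)
    have hm : (0 : ℝ) ≤ m := Nat.cast_nonneg m
    have p9 : 0 < solCoeff a p (m + 8 + 1) := by
      refine pos_of_mul_pos_right (a := a 0 1 - p * (m + 8 + 1 : ℕ)) ?_ l9.le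
      rw [← e9]
      exact lt_of_lt_of_le (mul_pos (by linarith) p8) h2
    refine ⟨fun j g1 g2 => ?_, fun j g1 g2 => ?_, fun j g1 g2 => ?_, fun j g1 g2 => ?_,
      fun j g1 g2 => ?_, fun j g1 g2 => ?_⟩
    · rcases (show j = m + 8 + 1 ∨ j ≤ m + 8 by omega) with rfl | h
      · exact p9
      · exact ih.pos j g1 h
    · rcases (show j = m + 7 ∨ j + 2 ≤ m + 8 by omega) with rfl | h
      · have u8 := ih.upper (m + 7) (by omega) (by omega)
        rw [e8] at u8
        rw [show m + 9 = m + 8 + 1 from rfl, e9] at h2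
        refine sq_le_mul_of_ratio_bounds l9 ?_ p7.le p8.le h2 (u8.trans_eq ?_)
        · push_cast
          nlinarith [hB.p_nonneg]
        · push_cast
          ring
      · exact ih.logConvex j g1 h
    · rcases (show j = m + 8 ∨ j + 1 ≤ m + 8 by omega) with rfl | h
      · exact h1
      · exact ih.conv2_le j g1 h
    · rcases (show j = m + 8 ∨ j + 1 ≤ m + 8 by omega) with rfl | h
      · refine le_trans (le_of_eq ?_) h2
        push_cast; ring
      · exact ih.lower j g1 h
    · rcases (show j = m + 8 ∨ j + 1 ≤ m + 8 by omega) with rfl | h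
      · refine h3.trans (le_of_eq ?_)
        push_cast; ring
      · exact ih.upper j g1 h
    · rcases (show j = m + 8 ∨ j + 1 ≤ m + 8 by omega) with rfl | h
      · refine le_trans (le_of_eq ?_) (h4 (by omega))
        push_cast; ring
      · exact ih.sharp j g1 h

/-- The numerator after the last coefficient in the range of positivity is positive. -/
lemma SeriesBase.solNum_pos (hB : SeriesBase a p) {n : ℕ} (hn : 12 ≤ n)
    (hl : ∀ j : ℕ, j ≤ n → 0 < a 0 1 - p * j) : 0 < solNum a p (n + 1) := by
  obtain ⟨m, rfl⟩ : ∃ m, n = m + 8 := ⟨n - 8, by omega⟩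
  have hg := hB.growth _ hn hl
  obtain ⟨-, h2, -, -⟩ := hg.next hB (by omega) hl
  have hm : (0 : ℝ) ≤ m := Nat.cast_nonneg m
  exact lt_of_lt_of_le (mul_pos (by linarith) (hg.pos (m + 8) (by omega) le_rfl)) h2

end

/-- The smaller root of `r² - 8 r + 1`. -/
def r0 : ℝ := 4 - √15

lemma r0_sq : r0 ^ 2 = 8 * r0 - 1 := by
  have := Real.sq_sqrt (show (0 : ℝ) ≤ 15 by norm_num)
  rw [r0]; linear_combination this

lemma r0_bounds : r0 ∈ Ioo 0.1270166537 0.1270166538 := by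
  have h1 : √15 < 3.8729833463 := by
    rw [Real.sqrt_lt' (by norm_num)]; norm_num
  have h2 : 3.8729833462 < √15 := by
    rw [Real.lt_sqrt (by norm_num)]; norm_num
  rw [r0]
  constructor <;> linarith

lemma r0_pos : 0 < r0 := lt_trans (by norm_num) r0_bounds.1

lemma r0_lt : r0 < 0.13 := r0_bounds.2.trans (by norm_num)

/-- The coefficient of `Xⁱ θʲ` in the right-hand side of the desingularized equation. -/
def fCoef (p : ℝ) : ℕ → ℕ → ℝ
  | 0, 0 => -((4 - r0) / 30)
  | 0, 1 => (1 - r0 * p) ^ 2 * ((8 - r0) / 9) - 2 * ((4 - r0) / 30) * (1 - p ^ 2) - p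
  | 1, 1 => -((1 - r0 * p) * r0 * ((8 - r0) / 9)) - 2 * ((4 - r0) / 30) * (r0 - p) - 2
  | 0, 2 => 2 * (1 - r0 * p) ^ 2 * (1 - p ^ 2) * ((8 - r0) / 9) -
      (4 - r0) / 30 * (1 - p ^ 2) ^ 2 - p * (1 - p ^ 2)
  | 1, 2 => -((1 - r0 * p) * ((8 - r0) / 9) * (3 * p * (1 - r0 * p) + r0 * (1 - p ^ 2))) -
      2 * ((4 - r0) / 30) * (1 - p ^ 2) * (r0 - p) - 2 * (1 - p ^ 2)
  | 2, 2 => (1 - r0 * p) * ((8 - r0) / 9) * (r0 * p - (1 - r0 * p)) -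
      (4 - r0) / 30 * (r0 - p) ^ 2 - (r0 - p)
  | 0, 3 => (1 - r0 * p) ^ 2 * ((8 - r0) / 9) * (1 - p ^ 2) ^ 2
  | 1, 3 => -((1 - r0 * p) ^ 2 * ((8 - r0) / 9) * (3 * p * (1 - p ^ 2)))
  | 2, 3 => (1 - r0 * p) ^ 2 * ((8 - r0) / 9) * (3 * p ^ 2 - 1)
  | 3, 3 => (1 - r0 * p) ^ 2 * ((8 - r0) / 9) * p
  | _, _ => 0

/-- The quadratic coefficient of the equation for the sonic value of `θ`. -/
def quadA (p : ℝ) : ℝ := (1 - p ^ 2) * (1 - r0 * p) ^ 2 * ((8 - r0) / 9)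

/-- The linear coefficient of the equation for the sonic value of `θ`. -/
def quadB (p : ℝ) : ℝ := (1 - r0 * p) ^ 2 * ((8 - r0) / 9) - (1 - p ^ 2) * ((4 - r0) / 30) - p

/-- The value of `θ` at the sonic point. -/
def th0 (p : ℝ) : ℝ :=
  (-quadB p + √(quadB p ^ 2 + 4 * quadA p * ((4 - r0) / 30))) / (2 * quadA p)

/-- The coefficient of `Xⁱ ψʲ` in the equation shifted by `θ = th0 p + ψ`. -/
def aCoef (p : ℝ) (i : ℕ) : ℕ → ℝ
  | 0 => fCoef p i 0 + fCoef p i 1 * th0 p + fCoef p i 2 * th0 p ^ 2 + fCoef p i 3 * th0 p ^ 3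
  | 1 => fCoef p i 1 + 2 * fCoef p i 2 * th0 p + 3 * fCoef p i 3 * th0 p ^ 2
  | 2 => fCoef p i 2 + 3 * fCoef p i 3 * th0 p
  | 3 => fCoef p i 3
  | _ => 0

lemma quadA_pos {p : ℝ} (hp : |p| < 1) : 0 < quadA p := by
  have := abs_lt.mp hp
  have h1 : 0 < 1 - p ^ 2 := by nlinarith
  have h2 : 0 < 1 - r0 * p := by nlinarith [r0_pos, r0_lt]
  have h3 : 0 < (8 - r0) / 9 := by linarith [r0_lt]
  unfold quadA
  positivity

lemma quad_th0 {p : ℝ} (hp : |p| < 1) :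
    quadA p * th0 p ^ 2 + quadB p * th0 p - (4 - r0) / 30 = 0 := by
  have hA := quadA_pos hp
  have hd : 0 ≤ quadB p ^ 2 + 4 * quadA p * ((4 - r0) / 30) := by
    have : 0 < (4 - r0) / 30 := by linarith [r0_lt]
    positivity
  have hs := Real.sq_sqrt hd
  rw [th0]
  set s := √(quadB p ^ 2 + 4 * quadA p * ((4 - r0) / 30))
  field_simp
  linear_combination 30 * hs

lemma th0_pos {p : ℝ} (hp : |p| < 1) : 0 < th0 p := by
  have hA := quadA_pos hp
  have hr : 0 < (4 - r0) / 30 := by linarith [r0_lt]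
  rw [th0]
  refine div_pos ?_ (by positivity)
  have : |quadB p| < √(quadB p ^ 2 + 4 * quadA p * ((4 - r0) / 30)) := by
    rw [← Real.sqrt_sq_eq_abs]
    exact Real.sqrt_lt_sqrt (sq_nonneg _) (by nlinarith [mul_pos hA hr])
  linarith [le_abs_self (quadB p)]

lemma continuousAt_th0 {p : ℝ} (hp : |p| < 1) : ContinuousAt th0 p := by
  have hA : Continuous quadA := by unfold quadA; fun_prop
  have hB : Continuous quadB := by unfold quadB; fun_prop
  have hA0 := quadA_pos hp
  unfold th0
  exact ContinuousAt.div (by fun_prop) (by fun_prop) (by positivity)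

lemma continuous_fCoef (i j : ℕ) : Continuous fun p => fCoef p i j := by
  unfold fCoef
  split <;> fun_prop

lemma continuousAt_aCoef {p : ℝ} (hp : |p| < 1) (i j : ℕ) :
    ContinuousAt (fun p => aCoef p i j) p := by
  have h := continuousAt_th0 hp
  have hf := fun j => (continuous_fCoef i j).continuousAt (x := p)
  unfold aCoef
  split
  · exact (((hf 0).add ((hf 1).mul h)).add ((hf 2).mul (h.pow 2))).add ((hf 3).mul (h.pow 3))
  · exact ((hf 1).add ((continuousAt_const.mul (hf 2)).mul h)).add
      ((continuousAt_const.mul (hf 3)).mul (h.pow 2))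
  · exact (hf 2).add ((continuousAt_const.mul (hf 3)).mul h)
  · exact hf 3
  · exact continuousAt_const

lemma aCoef_zero_zero {p : ℝ} (hp : |p| < 1) : aCoef p 0 0 = 0 := by
  have h := quad_th0 hp
  simp only [aCoef, fCoef, quadA, quadB] at h ⊢
  linear_combination (1 + (1 - p ^ 2) * th0 p) * h

lemma th0_zero : th0 0 = 3 / 10 - 6 / 5 * r0 := by
  have hA : quadA 0 = (8 - r0) / 9 := by simp [quadA]
  have hB : quadB 0 = (8 - r0) / 9 - (4 - r0) / 30 := by simp [quadB]
  have h1 := r0_pos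
  have h2 := r0_lt
  have h3 : √(quadB 0 ^ 2 + 4 * quadA 0 * ((4 - r0) / 30)) = (8 - r0) / 9 + (4 - r0) / 30 := by
    rw [hA, hB, show ((8 - r0) / 9 - (4 - r0) / 30) ^ 2 + 4 * ((8 - r0) / 9) * ((4 - r0) / 30) =
      ((8 - r0) / 9 + (4 - r0) / 30) ^ 2 by ring]
    exact Real.sqrt_sq (by linarith)
  rw [th0, h3, hA, hB, div_eq_iff (by linarith)]
  linear_combination (-4 / 15) * r0_sq

lemma aCoef_at_zero :
    aCoef 0 0 1 = 52 / 45 - 1 / 36 * r0 ∧ aCoef 0 0 2 = 92 / 45 - 13 / 45 * r0 ∧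
    aCoef 0 0 3 = 8 / 9 - 1 / 9 * r0 ∧ aCoef 0 1 0 = -41 / 150 - 53 / 75 * r0 ∧
    aCoef 0 1 1 = -128 / 45 + 8 / 15 * r0 ∧ aCoef 0 1 2 = -98 / 45 + 4 / 15 * r0 ∧
    aCoef 0 1 3 = 0 ∧ aCoef 0 2 0 = -9 / 25 + 66 / 25 * r0 ∧
    aCoef 0 2 1 = -4 / 15 - 41 / 60 * r0 ∧ aCoef 0 2 2 = -64 / 45 + 11 / 45 * r0 ∧
    aCoef 0 2 3 = -8 / 9 + 1 / 9 * r0 ∧ aCoef 0 3 0 = 0 ∧ aCoef 0 3 1 = 0 ∧ aCoef 0 3 2 = 0 ∧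
    aCoef 0 3 3 = 0 := by
  have h := r0_sq
  simp only [aCoef, fCoef, th0_zero]
  refine ⟨?_, ?_, ?_, ?_, ?_, ?_, ?_, ?_, ?_, ?_, ?_, ?_, ?_, ?_, ?_⟩
  · linear_combination (52 / 75 - 12 / 25 * r0) * h
  · linear_combination (2 / 5) * h
  · ring
  · linear_combination (-38 / 75 + 16 / 375 * r0 + 32 / 125 * r0 ^ 2) * h
  · linear_combination (-16 / 45 - 32 / 75 * r0) * h
  · linear_combination (8 / 45) * h
  · ring
  · linear_combination (32 / 125 + 259 / 1000 * r0 - 3 / 125 * r0 ^ 2 + 6 / 125 * r0 ^ 3) * h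
  · linear_combination (-38 / 75 + 9 / 50 * r0 - 2 / 25 * r0 ^ 2) * h
  · linear_combination (-4 / 15 + 1 / 30 * r0) * h
  all_goals ring

lemma conv2_mono {s t : ℕ → ℝ} {n : ℕ} (hs : s 0 = 0) (ht : t 0 = 0)
    (h : ∀ i < n, 0 ≤ s i ∧ s i ≤ t i) : conv2 s n ≤ conv2 t n :=
  Finset.sum_le_sum fun i hi => by
    rw [Finset.mem_range] at hi
    rcases Nat.eq_zero_or_pos i with rfl | hi0
    · simp [hs, ht]
    rcases (show i = n ∨ i < n by omega) with rfl | hin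
    · simp [hs, ht]
    have h1 := h i hin
    have h2 := h (n - i) (by omega)
    exact mul_le_mul h1.2 h2.2 h2.1 (h1.1.trans h1.2)

lemma conv3_mono {s t : ℕ → ℝ} {n : ℕ} (hs : s 0 = 0) (ht : t 0 = 0)
    (h : ∀ i < n, 0 ≤ s i ∧ s i ≤ t i) : conv3 s n ≤ conv3 t n :=
  Finset.sum_le_sum fun i hi => by
    rw [Finset.mem_range] at hi
    rcases Nat.eq_zero_or_pos i with rfl | hi0
    · simp [hs, ht]
    rcases (show i = n ∨ i < n by omega) with rfl | hin
    · simp [conv2_zero hs, conv2_zero ht]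
    have h1 := h i hin
    exact mul_le_mul h1.2 (conv2_mono hs ht fun j hj => h j (by omega))
      (conv2_nonneg hs fun j hj => (h j (by omega)).1) (h1.1.trans h1.2)

/-- Lower bounds for the first coefficients of the formal solution at `p = 0`. -/
def tLo : ℕ → ℝ
  | 0 => 0
  | 1 => 0.3151763
  | 2 => 0.8815422
  | 3 => 2.9445254
  | 4 => 11.400878
  | 5 => 50.766582
  | 6 => 259.86906
  | 7 => 1528.8017
  | 8 => 10296.037
  | 9 => 78732.13
  | 10 => 676160.73
  | 11 => 6446897.7
  | 12 => 67519135
  | _ => 0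

/-- Upper bounds for the first coefficients of the formal solution at `p = 0`. -/
def tUp : ℕ → ℝ
  | 0 => 0
  | 1 => 0.3151764
  | 2 => 0.8815428
  | 3 => 2.9445292
  | 4 => 11.400907
  | 5 => 50.766821
  | 6 => 259.87121
  | 7 => 1528.8227
  | 8 => 10296.258
  | 9 => 78734.613
  | 10 => 676190.57
  | 11 => 6447280.1
  | 12 => 67524342
  | _ => 0

lemma aCoef_zero_bounds :
    aCoef 0 0 1 ∈ Icc 1.15202731 1.15202732 ∧ aCoef 0 0 2 ∈ Icc 2.00775074 2.00775075 ∧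
    aCoef 0 0 3 ∈ Icc 0.87477592 0.87477593 ∧ -aCoef 0 1 0 ∈ Icc 0.36309176 0.36309177 ∧
    -aCoef 0 1 1 ∈ Icc 2.77670222 2.77670223 ∧ -aCoef 0 1 2 ∈ Icc 2.14390666 2.14390668 ∧
    -aCoef 0 2 0 ∈ Icc 0.024676033 0.024676035 ∧
    -aCoef 0 2 1 ∈ Icc 0.35346138 0.35346139 ∧ -aCoef 0 2 2 ∈ Icc 1.39117370 1.39117371 ∧
    -aCoef 0 2 3 ∈ Icc 0.87477592 0.87477593 := by
  obtain ⟨h01, h02, h03, h10, h11, h12, -, h20, h21, h22, h23, -⟩ := aCoef_at_zero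
  obtain ⟨l, u⟩ := r0_bounds
  rw [h01, h02, h03, h10, h11, h12, h20, h21, h22, h23]
  simp only [mem_Icc]
  refine ⟨⟨?_, ?_⟩, ⟨?_, ?_⟩, ⟨?_, ?_⟩, ⟨?_, ?_⟩, ⟨?_, ?_⟩, ⟨?_, ?_⟩, ⟨?_, ?_⟩, ⟨?_, ?_⟩, ⟨?_, ?_⟩,
    ⟨?_, ?_⟩⟩ <;> linarith

/-- One step of interval arithmetic for the recursion at `p = 0`. -/
lemma solCoeff_zero_mem_step {n : ℕ}
    (hb : ∀ i < n + 4, 0 ≤ tLo i ∧ tLo i ≤ solCoeff (aCoef 0) 0 i ∧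
      solCoeff (aCoef 0) 0 i ≤ tUp i)
    (h0 : 0 ≤ tLo (n + 4)) (h0' : 0 ≤ tUp (n + 4))
    (hlo : tLo (n + 4) * 1.15202732 + 2.00775075 * conv2 tUp (n + 4) +
        0.87477593 * conv3 tUp (n + 4) ≤
      (n + 3 + 2.77670222) * tLo (n + 3) + 0.35346138 * tLo (n + 2) +
        2.14390666 * conv2 tLo (n + 3) + 1.39117370 * conv2 tLo (n + 2) +
        0.87477592 * conv3 tLo (n + 2))
    (hup : (n + 3 + 2.77670223) * tUp (n + 3) + 0.35346139 * tUp (n + 2) +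
        2.14390668 * conv2 tUp (n + 3) + 1.39117371 * conv2 tUp (n + 2) +
        0.87477593 * conv3 tUp (n + 2) ≤
      tUp (n + 4) * 1.15202731 + 2.00775074 * conv2 tLo (n + 4) +
        0.87477592 * conv3 tLo (n + 4)) :
    ∀ i < n + 5, 0 ≤ tLo i ∧ tLo i ≤ solCoeff (aCoef 0) 0 i ∧ solCoeff (aCoef 0) 0 i ≤ tUp i := by
  intro i hi
  rcases (show i = n + 4 ∨ i < n + 4 by omega) with rfl | h
  swap
  · exact hb i h
  set t := solCoeff (aCoef 0) 0 with ht
  have t0 : t 0 = 0 := rfl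
  have L : ∀ k, k ≤ n + 4 → ∀ i < k, 0 ≤ tLo i ∧ tLo i ≤ t i := fun k hk i hi =>
    ⟨(hb i (by omega)).1, (hb i (by omega)).2.1⟩
  have U : ∀ k, k ≤ n + 4 → ∀ i < k, 0 ≤ t i ∧ t i ≤ tUp i := fun k hk i hi =>
    ⟨(hb i (by omega)).1.trans (hb i (by omega)).2.1, (hb i (by omega)).2.2⟩
  have l3 := hb (n + 3) (by omega)
  have l2 := hb (n + 2) (by omega)
  have cl4 := conv2_mono rfl t0 (L (n + 4) (by omega))
  have cl3 := conv2_mono rfl t0 (L (n + 3) (by omega))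
  have cl2 := conv2_mono rfl t0 (L (n + 2) (by omega))
  have dl4 := conv3_mono rfl t0 (L (n + 4) (by omega))
  have dl2 := conv3_mono rfl t0 (L (n + 2) (by omega))
  have cu4 := conv2_mono (t := tUp) t0 rfl (U (n + 4) (by omega))
  have cu3 := conv2_mono (t := tUp) t0 rfl (U (n + 3) (by omega))
  have cu2 := conv2_mono (t := tUp) t0 rfl (U (n + 2) (by omega))
  have du4 := conv3_mono (t := tUp) t0 rfl (U (n + 4) (by omega))
  have du2 := conv3_mono (t := tUp) t0 rfl (U (n + 2) (by omega))
  have c4 := conv2_nonneg t0 fun j hj => (U (n + 4) (by omega) j hj).1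
  have c3 := conv2_nonneg t0 fun j hj => (U (n + 3) (by omega) j hj).1
  have c2 := conv2_nonneg t0 fun j hj => (U (n + 2) (by omega) j hj).1
  have d4 := conv3_nonneg t0 fun j hj => (U (n + 4) (by omega) j hj).1
  have d2 := conv3_nonneg t0 fun j hj => (U (n + 2) (by omega) j hj).1
  have n3 : 0 ≤ t (n + 3) := l3.1.trans l3.2.1
  have n2 : 0 ≤ t (n + 2) := l2.1.trans l2.2.1
  obtain ⟨a01, a02, a03, -, a11, a12, -, a21, a22, a23⟩ := aCoef_zero_bounds
  obtain ⟨-, -, -, -, -, -, a13, -, -, -, -, -, a31, a32, a33⟩ := aCoef_at_zero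
  have hP := solNum_add_four (a := aCoef 0) (p := 0) n
  have hK : aCoef 0 0 1 * t (n + 4) = solNum (aCoef 0) 0 (n + 4) := by
    rw [ht, show n + 4 = n + 3 + 1 from rfl, solCoeff_succ, zero_mul, sub_zero,
      mul_div_cancel₀ _ (by linarith [a01.1] : aCoef 0 0 1 ≠ 0)]
  rw [hP, a13, a31, a32, a33] at hK
  have hn : (0 : ℝ) ≤ n := Nat.cast_nonneg n
  have m11 := mul_le_mul_of_nonneg_right a11.1 n3
  have M11 := mul_le_mul_of_nonneg_right a11.2 n3
  have m21 := mul_le_mul_of_nonneg_right a21.1 n2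
  have M21 := mul_le_mul_of_nonneg_right a21.2 n2
  have m02 := mul_le_mul_of_nonneg_right a02.1 c4
  have M02 := mul_le_mul_of_nonneg_right a02.2 c4
  have m12 := mul_le_mul_of_nonneg_right a12.1 c3
  have M12 := mul_le_mul_of_nonneg_right a12.2 c3
  have m22 := mul_le_mul_of_nonneg_right a22.1 c2
  have M22 := mul_le_mul_of_nonneg_right a22.2 c2
  have m03 := mul_le_mul_of_nonneg_right a03.1 d4
  have M03 := mul_le_mul_of_nonneg_right a03.2 d4
  have m23 := mul_le_mul_of_nonneg_right a23.1 d2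
  have M23 := mul_le_mul_of_nonneg_right a23.2 d2
  have k1 := mul_le_mul_of_nonneg_left l3.2.1 hn
  have k2 := mul_le_mul_of_nonneg_left l3.2.2 hn
  have q1 : tLo (n + 4) * aCoef 0 0 1 ≤ tLo (n + 4) * 1.15202732 :=
    mul_le_mul_of_nonneg_left a01.2 h0
  have q2 : tUp (n + 4) * 1.15202731 ≤ tUp (n + 4) * aCoef 0 0 1 :=
    mul_le_mul_of_nonneg_left a01.1 h0'
  have hKp : 0 < aCoef 0 0 1 := by linarith [a01.1]
  refine ⟨h0, le_of_mul_le_mul_left ?_ hKp, le_of_mul_le_mul_left ?_ hKp⟩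
  · rw [hK]; linarith
  · rw [hK]; linarith

lemma solCoeff_zero_mem_small : ∀ i < 4, 0 ≤ tLo i ∧ tLo i ≤ solCoeff (aCoef 0) 0 i ∧
    solCoeff (aCoef 0) 0 i ≤ tUp i := by
  obtain ⟨a01, a02, a03, a10, a11, a12, a20, a21, -⟩ := aCoef_zero_bounds
  obtain ⟨-, -, -, -, -, -, -, -, -, -, -, a30, -⟩ := aCoef_at_zero
  simp only [mem_Icc] at *
  have hKp : 0 < aCoef 0 0 1 := by linarith [a01.1]
  have hK : ∀ n, aCoef 0 0 1 * solCoeff (aCoef 0) 0 (n + 1) = solNum (aCoef 0) 0 (n + 1) := by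
    intro n
    rw [solCoeff_succ, zero_mul, sub_zero, mul_div_cancel₀ _ hKp.ne']
  have k1 := hK 0
  have k2 := hK 1
  have k3 := hK 2
  rw [show 0 + 1 = 1 from rfl, solNum_one] at k1
  rw [show 1 + 1 = 2 from rfl, solNum_two] at k2
  rw [show 2 + 1 = 3 from rfl, solNum_three, a30] at k3
  simp only [conv3, conv2, Finset.sum_range_succ, Finset.sum_range_zero, solCoeff_zero] at k3
  norm_num at k3
  set t1 := solCoeff (aCoef 0) 0 1
  set t2 := solCoeff (aCoef 0) 0 2
  set t3 := solCoeff (aCoef 0) 0 3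
  rw [show solCoeff (aCoef 0) 0 0 = 0 from rfl] at k3
  have h1 : tLo 1 ≤ t1 ∧ t1 ≤ tUp 1 := by
    norm_num only [tLo, tUp]
    constructor <;> nlinarith
  have h2 : tLo 2 ≤ t2 ∧ t2 ≤ tUp 2 := by
    norm_num only [tLo, tUp] at h1 ⊢
    have e1 : t1 ^ 2 ≤ 0.3151765 ^ 2 := pow_le_pow_left₀ (by linarith) (by linarith) 2
    constructor <;> nlinarith
  have h3 : tLo 3 ≤ t3 ∧ t3 ≤ tUp 3 := by
    norm_num only [tLo, tUp] at h1 h2 ⊢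
    have n1 : 0 ≤ t1 := by linarith
    have n2 : 0 ≤ t2 := by linarith
    have b1 : 0.3151763 * 0.8815422 ≤ t1 * t2 := mul_le_mul (by linarith) (by linarith)
      (by norm_num) n1
    have b2 : t1 * t2 ≤ 0.3151764 * 0.8815428 := mul_le_mul (by linarith) (by linarith) n2
      (by norm_num)
    have b3 : 0.3151763 ^ 2 ≤ t1 ^ 2 := pow_le_pow_left₀ (by norm_num) (by linarith) 2
    have b4 : t1 ^ 2 ≤ 0.3151764 ^ 2 := pow_le_pow_left₀ n1 (by linarith) 2
    have b5 : 0.3151763 ^ 3 ≤ t1 ^ 3 := pow_le_pow_left₀ (by norm_num) (by linarith) 3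
    have b6 : t1 ^ 3 ≤ 0.3151764 ^ 3 := pow_le_pow_left₀ n1 (by linarith) 3
    have m02 := mul_le_mul_of_nonneg_right a02.1 (mul_nonneg n1 n2)
    have M02 := mul_le_mul_of_nonneg_right a02.2 (mul_nonneg n1 n2)
    have m03 := mul_le_mul_of_nonneg_right a03.1 (pow_nonneg n1 3)
    have M03 := mul_le_mul_of_nonneg_right a03.2 (pow_nonneg n1 3)
    have m11 := mul_le_mul_of_nonneg_right a11.1 n2
    have M11 := mul_le_mul_of_nonneg_right a11.2 n2
    have m12 := mul_le_mul_of_nonneg_right a12.1 (pow_nonneg n1 2)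
    have M12 := mul_le_mul_of_nonneg_right a12.2 (pow_nonneg n1 2)
    have m21 := mul_le_mul_of_nonneg_right a21.1 n1
    have M21 := mul_le_mul_of_nonneg_right a21.2 n1
    constructor
    · refine le_of_mul_le_mul_left ?_ hKp
      rw [k3]
      linarith [a01.2]
    · refine le_of_mul_le_mul_left ?_ hKp
      rw [k3]
      linarith [a01.1]
  intro i hi
  interval_cases i
  · exact ⟨le_rfl, le_rfl, le_rfl⟩
  · exact ⟨by norm_num [tLo], h1⟩
  · exact ⟨by norm_num [tLo], h2⟩
  · exact ⟨by norm_num [tLo], h3⟩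

lemma conv2_tLo :
    conv2 tLo 0 = 0 ∧
    conv2 tLo 1 = 0 ∧
    conv2 tLo 2 = 0.09933610008169 ∧
    conv2 tLo 3 = 0.55568241777972 ∧
    conv2 tLo 4 = 2.63320589203688 ∧
    conv2 tLo 5 = 12.37801988772656 ∧
    conv2 tLo 6 = 60.77178693616156 ∧
    conv2 tLo 7 = 320.4552561026792 ∧
    conv2 tLo 8 = 1850.8022117193336 ∧
    conv2 tLo 9 = 11873.48943201592 ∧
    conv2 tLo 10 = 85287.692686019244 ∧
    conv2 tLo 11 = 686909.64051014064 ∧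
    conv2 tLo 12 = 6177128.4007626704 := by
  refine ⟨?_, ?_, ?_, ?_, ?_, ?_, ?_, ?_, ?_, ?_, ?_, ?_, ?_⟩ <;>
    simp only [conv2, Finset.sum_range_succ, Finset.sum_range_zero, Nat.reduceAdd, Nat.reduceSub,
      tLo] <;>
    norm_num only

lemma conv2_tUp :
    conv2 tUp 0 = 0 ∧
    conv2 tUp 1 = 0 ∧
    conv2 tUp 2 = 0.09933616311696 ∧
    conv2 tUp 3 = 0.55568297229984 ∧
    conv2 tUp 4 = 2.6332099341336 ∧
    conv2 tUp 5 = 12.37805068128912 ∧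
    conv2 tUp 6 = 60.77203493274064 ∧
    conv2 tUp 7 = 320.4574030617344 ∧
    conv2 tUp 8 = 1850.8223119281314 ∧
    conv2 tUp 9 = 11873.692689127478 ∧
    conv2 tUp 10 = 85289.899247517861 ∧
    conv2 tUp 11 = 686935.34744506062 ∧
    conv2 tUp 12 = 6177448.9966026207 := by
  refine ⟨?_, ?_, ?_, ?_, ?_, ?_, ?_, ?_, ?_, ?_, ?_, ?_, ?_⟩ <;>
    simp only [conv2, Finset.sum_range_succ, Finset.sum_range_zero, Nat.reduceAdd, Nat.reduceSub,
      tUp] <;>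
    norm_num only

lemma conv3_tLo_tUp_step (n : ℕ) (hn : n < 9) :
    (0 ≤ tLo (n + 4) ∧ 0 ≤ tUp (n + 4)) ∧
    tLo (n + 4) * 1.15202732 + 2.00775075 * conv2 tUp (n + 4) +
        0.87477593 * conv3 tUp (n + 4) ≤
      (n + 3 + 2.77670222) * tLo (n + 3) + 0.35346138 * tLo (n + 2) +
        2.14390666 * conv2 tLo (n + 3) + 1.39117370 * conv2 tLo (n + 2) +
        0.87477592 * conv3 tLo (n + 2) ∧
    (n + 3 + 2.77670223) * tUp (n + 3) + 0.35346139 * tUp (n + 2) +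
        2.14390668 * conv2 tUp (n + 3) + 1.39117371 * conv2 tUp (n + 2) +
        0.87477593 * conv3 tUp (n + 2) ≤
      tUp (n + 4) * 1.15202731 + 2.00775074 * conv2 tLo (n + 4) +
        0.87477592 * conv3 tLo (n + 4) := by
  obtain ⟨l0, l1, l2, l3, l4, l5, l6, l7, l8, l9, l10, l11, l12⟩ := conv2_tLo
  obtain ⟨u0, u1, u2, u3, u4, u5, u6, u7, u8, u9, u10, u11, u12⟩ := conv2_tUp
  interval_cases n <;>
    simp only [conv3, Finset.sum_range_succ, Finset.sum_range_zero, Nat.reduceAdd, Nat.reduceSub,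
      tLo, tUp, l0, l1, l2, l3, l4, l5, l6, l7, l8, l9, l10, l11, l12, u0, u1, u2, u3, u4, u5, u6,
      u7, u8, u9, u10, u11, u12] <;>
    norm_num only [and_self]

lemma solCoeff_zero_mem : ∀ i < 13, 0 ≤ tLo i ∧ tLo i ≤ solCoeff (aCoef 0) 0 i ∧
    solCoeff (aCoef 0) 0 i ≤ tUp i := by
  have h : ∀ n ≤ 9, ∀ i < n + 4, 0 ≤ tLo i ∧ tLo i ≤ solCoeff (aCoef 0) 0 i ∧
      solCoeff (aCoef 0) 0 i ≤ tUp i := by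
    intro n hn
    induction n with
    | zero => exact solCoeff_zero_mem_small
    | succ n ih =>
      obtain ⟨⟨h0, h0'⟩, hlo, hup⟩ := conv3_tLo_tUp_step n (by omega)
      exact solCoeff_zero_mem_step (ih (by omega)) h0 h0' hlo hup
  exact h 9 le_rfl

lemma seriesBase_zero : SeriesBase (aCoef 0) 0 := by
  obtain ⟨a01, a02, a03, a10, a11, a12, a20, a21, a22, a23⟩ := aCoef_zero_bounds
  obtain ⟨-, -, -, -, -, -, a13, -, -, -, -, -, a31, a32, a33⟩ := aCoef_at_zero
  have hb := solCoeff_zero_mem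
  simp only [mem_Icc] at a01 a02 a03 a11 a12 a21 a22 a23
  have hKp : 0 < aCoef 0 0 1 := by linarith [a01.1]
  have hK : ∀ n, solNum (aCoef 0) 0 (n + 1) = aCoef 0 0 1 * solCoeff (aCoef 0) 0 (n + 1) := by
    intro n
    rw [solCoeff_succ, zero_mul, sub_zero, mul_div_cancel₀ _ hKp.ne']
  obtain ⟨-, -, u2, u3, u4, u5, u6, u7, u8, u9, u10, u11, u12⟩ := conv2_tUp
  have b := fun i hi => (hb i hi).2
  refine ⟨le_rfl, ?_, ?_, ?_, ?_, ?_, ?_, ?_, ?_, ?_, ?_, ?_, ?_, ?_, ?_, ?_, ?_, ?_, ?_, ?_, ?_,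
    ?_, ?_⟩
  any_goals constructor <;> linarith
  · have := b 1 (by norm_num); norm_num [tLo, tUp] at this; constructor <;> linarith
  · have := b 2 (by norm_num); norm_num [tLo, tUp] at this; constructor <;> linarith
  · have := b 3 (by norm_num); norm_num [tLo, tUp] at this; constructor <;> linarith
  · have := b 4 (by norm_num); norm_num [tLo, tUp] at this; constructor <;> linarith
  · have := b 5 (by norm_num); norm_num [tLo, tUp] at this; constructor <;> linarith
  · rintro j ⟨h1, h2⟩
    refine lt_of_lt_of_le ?_ (hb j (by omega)).2.1
    interval_cases j <;> norm_num [tLo]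
  · rintro j ⟨h1, h2⟩
    have e1 := hb (j + 1) (by omega)
    have e0 := hb j (by omega)
    have e2 := hb (j + 2) (by omega)
    calc solCoeff (aCoef 0) 0 (j + 1) ^ 2 ≤ tUp (j + 1) ^ 2 :=
          pow_le_pow_left₀ (e1.1.trans e1.2.1) e1.2.2 2
      _ < tLo j * tLo (j + 2) := by interval_cases j <;> norm_num [tLo, tUp]
      _ ≤ _ := mul_le_mul e0.2.1 e2.2.1 e2.1 (e0.1.trans e0.2.1)
  · rintro j ⟨h1, h2⟩
    refine (conv2_mono rfl (t := tUp) rfl fun i hi => ⟨?_, (hb i (by omega)).2.2⟩).trans_lt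
      (lt_of_lt_of_le ?_ (mul_le_mul_of_nonneg_left (hb j (by omega)).2.1 (by norm_num)))
    · exact (hb i (by omega)).1.trans (hb i (by omega)).2.1
    · interval_cases j <;>
        simp only [Nat.reduceAdd, u2, u3, u4, u5, u6, u7, u8, u9, u10, u11, u12, tLo] <;>
        norm_num
  · rintro j ⟨h1, h2⟩
    rw [hK]
    have e0 := hb j (by omega)
    have e1 := hb (j + 1) (by omega)
    calc ((j : ℝ) + 1 - 0.45) * solCoeff (aCoef 0) 0 j ≤ (j + 1 - 0.45) * tUp j :=
          mul_le_mul_of_nonneg_left e0.2.2 (by linarith [(Nat.cast_nonneg j : (0 : ℝ) ≤ j)])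
      _ < 1.15202731 * tLo (j + 1) := by interval_cases j <;> norm_num [tLo, tUp]
      _ ≤ _ := mul_le_mul a01.1 e1.2.1 e1.1 hKp.le
  · rintro j ⟨h1, h2⟩
    rw [hK]
    have e0 := hb j (by omega)
    have e1 := hb (j + 1) (by omega)
    calc aCoef 0 0 1 * solCoeff (aCoef 0) 0 (j + 1) ≤ 1.15202732 * tUp (j + 1) :=
          mul_le_mul a01.2 e1.2.2 (e1.1.trans e1.2.1) (by norm_num)
      _ < ((j : ℝ) + 1 + 0.55) * tLo j := by interval_cases j <;> norm_num [tLo, tUp]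
      _ ≤ _ := mul_le_mul_of_nonneg_left e0.2.1 (by positivity)

lemma eventually_seriesBase : ∀ᶠ p in 𝓝[≥] (0 : ℝ), SeriesBase (aCoef p) p := by
  have h0 := seriesBase_zero
  have ca : ∀ i j, ContinuousAt (fun p => aCoef p i j) 0 := fun i j =>
    continuousAt_aCoef (by simp) i j
  have cn : ∀ n, ContinuousAt (fun p => solNum (aCoef p) p (n + 1)) 0 := fun n =>
    continuousAt_solNum ca fun j _ _ => by
      have := h0.a01.1
      rw [zero_mul, sub_zero]; linarith
  have ct : ∀ n, ContinuousAt (fun p => solCoeff (aCoef p) p n) 0 := fun n =>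
    continuousAt_solCoeff ca fun j _ _ => by
      have := h0.a01.1
      rw [zero_mul, sub_zero]; linarith
  have cc : ∀ n, ContinuousAt (fun p => conv2 (solCoeff (aCoef p) p) n) 0 := fun n => by
    unfold conv2
    exact tendsto_finsetSum _ fun i _ => (ct i).mul (ct _)
  have ev : ∀ {f : ℝ → ℝ} {l u : ℝ}, ContinuousAt f 0 → f 0 ∈ Ioo l u →
      ∀ᶠ p in 𝓝 (0 : ℝ), f p ∈ Ioo l u := fun hf hm => hf.eventually (Ioo_mem_nhds hm.1 hm.2)
  have E : ∀ᶠ p in 𝓝 (0 : ℝ), 0 ≤ p → SeriesBase (aCoef p) p := by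
    filter_upwards [ev (ca 0 1) h0.a01, ev (ca 0 2) h0.a02, ev (ca 0 3) h0.a03,
      ev (ca 1 1) h0.a11, ev (ca 1 2) h0.a12, ev (ca 1 3) h0.a13, ev (ca 2 1) h0.a21,
      ev (ca 2 2) h0.a22, ev (ca 2 3) h0.a23, ev (ca 3 1) h0.a31, ev (ca 3 2) h0.a32,
      ev (ca 3 3) h0.a33, ev (ct 1) h0.t1, ev (ct 2) h0.t2, ev (ct 3) h0.t3, ev (ct 4) h0.t4,
      ev (ct 5) h0.t5,
      (eventually_all_finite (finite_Icc 1 12)).2 fun j hj =>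
        continuousAt_const.eventually_lt (ct j) (h0.pos j hj),
      (eventually_all_finite (finite_Icc 1 10)).2 fun j hj =>
        ((ct (j + 1)).pow 2).eventually_lt ((ct j).mul (ct (j + 2))) (h0.logConvex j hj),
      (eventually_all_finite (finite_Icc 1 11)).2 fun j hj =>
        (cc (j + 1)).eventually_lt (continuousAt_const.mul (ct j)) (h0.conv2_lt j hj),
      (eventually_all_finite (finite_Icc 8 11)).2 fun j hj =>
        (continuousAt_const.mul (ct j)).eventually_lt (cn j) (h0.lower j hj),
      (eventually_all_finite (finite_Icc 3 11)).2 fun j hj =>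
        (cn j).eventually_lt (continuousAt_const.mul (ct j)) (h0.upper j hj)]
      with p a01 a02 a03 a11 a12 a13 a21 a22 a23 a31 a32 a33 t1 t2 t3 t4 t5 f1 f2 f3 f4 f5 hp
    exact ⟨hp, a01, a02, a03, a11, a12, a13, a21, a22, a23, a31, a32, a33, t1, t2, t3, t4, t5,
      f1, f2, f3, f4, f5⟩
  exact eventually_nhdsWithin_iff.2 E

section

lemma pos_of_deriv_neg_at_zeros {g : ℝ → ℝ} {a b : ℝ} (hg : ContinuousOn g (Icc a b))
    (hb : 0 < g b) (h : ∀ t ∈ Ico a b, g t = 0 → ∃ d < 0, HasDerivAt g d t) :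
    ∀ t ∈ Icc a b, 0 < g t := by
  have hm : ∀ t ∈ Icc a b, a + b - t ∈ Icc a b := fun t ht => ⟨by linarith [ht.2], by linarith [ht.1]⟩
  intro t ht
  have key := neg_of_deriv_neg_at_zeros (g := fun t => -g (a + b - t)) (a := a) (b := b)
    ((hg.comp (by fun_prop) hm).neg) (by simpa using hb) ?_ _ (hm t ht)
  · simpa using key
  · intro s hs h0
    obtain ⟨d, hd, hd'⟩ := h (a + b - s) ⟨by linarith [hs.2], by linarith [hs.1]⟩ (by simpa using h0)
    refine ⟨d, hd, ?_⟩
    have h1 : HasDerivAt (fun t => a + b - t) (-1) s := by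
      simpa using (hasDerivAt_id s).const_sub (a + b)
    have h2 := (HasDerivAt.comp s hd' h1).neg
    exact (h2.congr_deriv (by ring)).hasDerivWithinAt

/-- The right-hand side `∑ a i j Xⁱ yʲ`. -/
def rhs (a : ℕ → ℕ → ℝ) (x y : ℝ) : ℝ :=
  (cubic (a · 0)).eval x + (cubic (a · 1)).eval x * y + (cubic (a · 2)).eval x * y ^ 2 +
    (cubic (a · 3)).eval x * y ^ 3

lemma eval_cubic (b : ℕ → ℝ) (x : ℝ) :
    (cubic b).eval x = b 0 + b 1 * x + b 2 * x ^ 2 + b 3 * x ^ 3 := by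
  simp [cubic]

open Polynomial in
lemma eval_defect (a : ℕ → ℕ → ℝ) (p : ℝ) (B : ℝ[X]) (x : ℝ) :
    (defect a p B).eval x = rhs a x (B.eval x) - (p + x) * x * (derivative B).eval x := by
  simp [defect, rhs]

/-- `ψ` solves `(p + x) x ψ' = ∑ a i j xⁱ ψʲ` on `(0, c]`. -/
def IsSol (a : ℕ → ℕ → ℝ) (p : ℝ) (ψ : ℝ → ℝ) (c : ℝ) : Prop :=
  ∀ x ∈ Ioc 0 c, HasDerivAt ψ (rhs a x (ψ x) / ((p + x) * x)) x

variable {a : ℕ → ℕ → ℝ} {p c : ℝ} {ψ : ℝ → ℝ}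

open Polynomial in
lemma IsSol.hasDerivAt_sub (h : IsSol a p ψ c) (hp : 0 < p) (B : ℝ[X]) {x : ℝ} (hx : x ∈ Ioc 0 c)
    (h0 : ψ x = B.eval x) :
    HasDerivAt (fun x => ψ x - B.eval x) ((defect a p B).eval x / ((p + x) * x)) x := by
  refine ((h x hx).sub (B.hasDerivAt x)).congr_deriv ?_
  have := hx.1
  rw [eval_defect, h0]
  field_simp

open Polynomial in
lemma IsSol.continuousOn_sub (h : IsSol a p ψ c) (B : ℝ[X]) {x y : ℝ} (hx : 0 < x) (hy : y ≤ c) :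
    ContinuousOn (fun x => ψ x - B.eval x) (Icc x y) := fun z hz =>
  ((h z ⟨hx.trans_le hz.1, hz.2.trans hy⟩).continuousAt.sub
    B.continuous.continuousAt).continuousWithinAt

open Polynomial in
lemma IsSol.above_of_defect_neg (h : IsSol a p ψ c) (hp : 0 < p) {B : ℝ[X]} {b : ℝ} (hb : b ∈ Ioc 0 c)
    (hB : ∀ x ∈ Ioc 0 b, (defect a p B).eval x < 0) (h0 : B.eval b < ψ b) :
    ∀ x ∈ Ioc 0 b, B.eval x < ψ x := by
  intro x hx
  have := pos_of_deriv_neg_at_zeros (h.continuousOn_sub B hx.1 hb.2) (by linarith) ?_ x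
    (left_mem_Icc.2 hx.2)
  · linarith
  · intro t ht h0
    have ht0 := hx.1.trans_le ht.1
    refine ⟨_, div_neg_of_neg_of_pos (hB t ⟨ht0, ht.2.le⟩) (by positivity),
      h.hasDerivAt_sub hp B ⟨ht0, ht.2.le.trans hb.2⟩ (by linarith)⟩

open Polynomial in
lemma IsSol.below_of_defect_pos (h : IsSol a p ψ c) (hp : 0 < p) {B : ℝ[X]} {b : ℝ} (hb : b ∈ Ioc 0 c)
    (hB : ∀ x ∈ Ioc 0 b, 0 < (defect a p B).eval x) (h0 : ψ b < B.eval b) :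
    ∀ x ∈ Ioc 0 b, ψ x < B.eval x := by
  intro x hx
  have := pos_of_deriv_neg_at_zeros (h.continuousOn_sub B hx.1 hb.2).neg (by simp; linarith) ?_ x
    (left_mem_Icc.2 hx.2)
  · simp at this; linarith
  · intro t ht h0
    have ht0 := hx.1.trans_le ht.1
    simp only [Pi.neg_apply, neg_eq_zero] at h0
    refine ⟨_, neg_neg_of_pos (div_pos (hB t ⟨ht0, ht.2.le⟩) (by positivity : 0 < (p + t) * t)),
      (h.hasDerivAt_sub hp B ⟨ht0, ht.2.le.trans hb.2⟩ (by linarith)).neg⟩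

end

section

lemma monotoneOn_Ioc_of_hasDerivAt {f f' : ℝ → ℝ} {b c : ℝ}
    (h : ∀ x ∈ Ioc b c, HasDerivAt f (f' x) x) (h' : ∀ x ∈ Ioc b c, 0 ≤ f' x) :
    MonotoneOn f (Ioc b c) := by
  refine monotoneOn_of_deriv_nonneg (convex_Ioc b c)
    (fun x hx => (h x hx).continuousAt.continuousWithinAt) ?_ ?_
  · rw [interior_Ioc]
    exact fun x hx => (h x ⟨hx.1, hx.2.le⟩).differentiableAt.differentiableWithinAt
  · rw [interior_Ioc]
    exact fun x hx => by
      rw [(h x ⟨hx.1, hx.2.le⟩).deriv]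
      exact h' x ⟨hx.1, hx.2.le⟩

/-- The slope of the right-hand side between two values of `y`. -/
def slopeRhs (a : ℕ → ℕ → ℝ) (x y z : ℝ) : ℝ :=
  (cubic (a · 1)).eval x + (cubic (a · 2)).eval x * (y + z) +
    (cubic (a · 3)).eval x * (y ^ 2 + y * z + z ^ 2)

lemma rhs_sub_rhs (a : ℕ → ℕ → ℝ) (x y z : ℝ) :
    rhs a x y - rhs a x z = slopeRhs a x y z * (y - z) := by
  simp only [rhs, slopeRhs]; ring

variable {a : ℕ → ℕ → ℝ} {p c : ℝ} {ψ : ℝ → ℝ} {n : ℕ}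

lemma exists_slope_bound (a : ℕ → ℕ → ℝ) (p : ℝ) (n : ℕ) (M : ℝ) : ∃ C > 0, ∀ x ∈ Icc (0 : ℝ) 1,
    ∀ y ∈ Icc (-M) M, |slopeRhs a x ((partialSol a p n).eval x) y -
      (a 0 1 + a 0 2 * y + a 0 3 * y ^ 2)| ≤ C * x ∧ |(partialSol a p n).eval x| ≤ C * x := by
  obtain ⟨D, hD⟩ := X_dvd_partialSol (a := a) (p := p) n
  let G : ℝ × ℝ → ℝ := fun q =>
    (a 1 1 + a 2 1 * q.1 + a 3 1 * q.1 ^ 2) + (a 1 2 + a 2 2 * q.1 + a 3 2 * q.1 ^ 2) * q.2 +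
    (cubic (a · 2)).eval q.1 * D.eval q.1 +
    (a 1 3 + a 2 3 * q.1 + a 3 3 * q.1 ^ 2) * q.2 ^ 2 +
    (cubic (a · 3)).eval q.1 * (q.1 * D.eval q.1 ^ 2 + D.eval q.1 * q.2)
  have hG : Continuous G := by
    have h1 := D.continuous
    have h2 := (cubic (a · 2)).continuous
    have h3 := (cubic (a · 3)).continuous
    fun_prop
  obtain ⟨C1, hC1⟩ := (isCompact_Icc (a := (0 : ℝ)) (b := 1)).prod (isCompact_Icc (a := -M) (b := M))
    |>.exists_bound_of_continuousOn hG.continuousOn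
  obtain ⟨C2, hC2⟩ := (isCompact_Icc (a := (0 : ℝ)) (b := 1)).exists_bound_of_continuousOn
    D.continuous.continuousOn
  refine ⟨max (max C1 C2) 1, by positivity, fun x hx y hy => ⟨?_, ?_⟩⟩
  · have : slopeRhs a x ((partialSol a p n).eval x) y - (a 0 1 + a 0 2 * y + a 0 3 * y ^ 2) =
        G (x, y) * x := by
      simp only [slopeRhs, hD, G, eval_cubic, Polynomial.eval_mul, Polynomial.eval_X]; ring
    rw [this, abs_mul, abs_of_nonneg hx.1]
    exact mul_le_mul_of_nonneg_right ((hC1 (x, y) ⟨hx, hy⟩).trans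
      ((le_max_left _ _).trans (le_max_left _ _))) hx.1
  · rw [hD, Polynomial.eval_mul, Polynomial.eval_X, abs_mul, abs_of_nonneg hx.1, mul_comm]
    exact mul_le_mul_of_nonneg_right ((hC2 x hx).trans
      ((le_max_right _ _).trans (le_max_left _ _))) hx.1

/-- At resonance a solution bounded below crosses above the truncated series. -/
lemma IsSol.exists_gt_of_resonance (h : IsSol a p ψ c) (hp : 0 < p) (hc : 0 < c)
    (ha : a 0 0 = 0) (hK : a 0 1 = p * (n + 1)) (hP : 0 < solNum a p (n + 1)) {θ q : ℝ}
    (hq : 0 < q) (hψ : ∀ x ∈ Ioc 0 c, -θ ≤ ψ x)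
    (hsec : ∀ y, -θ ≤ y → q ≤ a 0 1 + a 0 2 * y + a 0 3 * y ^ 2) {x₀ : ℝ} (hx₀ : 0 < x₀) :
    ∃ x ∈ Ioc 0 x₀, (partialSol a p n).eval x < ψ x := by
  by_contra! hcon
  set T := partialSol a p n with hT
  have hl : ∀ j : ℕ, 1 ≤ j → j ≤ n → a 0 1 - p * j ≠ 0 := fun j _ hj => by
    have : (j : ℝ) ≤ n := by exact_mod_cast hj
    have : 0 < p * (n + 1 - j) := mul_pos hp (by linarith)
    rw [hK]; linarith
  have hdef := defect_partialSol_eq (p := p) ha hl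
  rw [← hT] at hdef
  have hQ0 := eval_zero_defectQuot a p n
  set Q := defectQuot a p n
  set P := solNum a p (n + 1)
  obtain ⟨C0, hC0, hb0⟩ := exists_slope_bound a p n 0
  obtain ⟨C, hC, hb⟩ := exists_slope_bound a p n (|θ| + C0)
  rw [← hT] at hb hb0
  have hev : ∀ᶠ x in 𝓝[>] (0 : ℝ), x ∈ Ioc 0 (min 1 (min c x₀)) ∧ C * x ≤ q / 2 ∧
      Q.eval x < -P / 2 := by
    refine Eventually.and (Ioc_mem_nhdsGT (by positivity)) (Eventually.filter_mono nhdsWithin_le_nhds ?_)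
    refine Eventually.and ?_ ?_
    · exact (continuousAt_const.mul continuousAt_id).eventually_le_const (by simpa using by linarith)
    · exact Q.continuous.continuousAt.eventually_lt_const (by
        change Q.eval 0 < _
        rw [hQ0]; linarith)
  obtain ⟨x₁, hx₁0, hx₁⟩ := mem_nhdsGT_iff_exists_Ioc_subset.1 hev
  have hx₁0 : 0 < x₁ := hx₁0
  have f1 : ∀ x ∈ Ioc 0 x₁, x ≤ 1 := fun x hx => (hx₁ hx).1.2.trans (min_le_left _ _)
  have fc : ∀ x ∈ Ioc 0 x₁, x ∈ Ioc 0 c := fun x hx =>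
    ⟨hx.1, (hx₁ hx).1.2.trans ((min_le_right _ _).trans (min_le_left _ _))⟩
  have fw : ∀ x ∈ Ioc 0 x₁, ψ x ≤ T.eval x := fun x hx => hcon x
    ⟨hx.1, (hx₁ hx).1.2.trans ((min_le_right _ _).trans (min_le_right _ _))⟩
  have fb : ∀ x ∈ Ioc 0 x₁, ψ x ∈ Icc (-(|θ| + C0)) (|θ| + C0) := fun x hx => by
    have h1 := (hb0 x ⟨hx.1.le, f1 x hx⟩ 0 (by simp)).2
    have h2 := fw x hx
    have h3 := hψ x (fc x hx)
    have h4 := f1 x hx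
    have h5 := le_abs_self (T.eval x)
    have h6 := le_abs_self θ
    have h7 := abs_nonneg θ
    constructor <;> nlinarith
  set S := fun x => slopeRhs a x (T.eval x) (ψ x) with hS
  have fS : ∀ x ∈ Ioc 0 x₁, q / 2 ≤ S x := fun x hx => by
    have h1 := (hb x ⟨hx.1.le, f1 x hx⟩ _ (fb x hx)).1
    have h2 := hsec _ (hψ x (fc x hx))
    have h3 := (hx₁ hx).2.1
    have h4 := (abs_le.1 h1).1
    simp only [hS]; linarith
  set w := fun x => T.eval x - ψ x with hw
  have w0 : ∀ x ∈ Ioc 0 x₁, 0 ≤ w x := fun x hx => sub_nonneg.2 (fw x hx)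
  have hwd : ∀ x ∈ Ioc 0 x₁,
      HasDerivAt w ((S x * w x - x ^ (n + 1) * Q.eval x) / ((p + x) * x)) x := fun x hx => by
    have hd := eval_defect a p T x
    rw [hdef, Polynomial.eval_mul, Polynomial.eval_pow, Polynomial.eval_X] at hd
    refine ((T.hasDerivAt x).sub (h x (fc x hx))).congr_deriv ?_
    have hx0 := hx.1
    have := rhs_sub_rhs a x (T.eval x) (ψ x)
    rw [hd, show S x * w x = rhs a x (T.eval x) - rhs a x (ψ x) from this.symm]
    field_simp
    ring
  have fQ : ∀ x ∈ Ioc 0 x₁, P / 2 ≤ - Q.eval x := fun x hx => by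
    have := (hx₁ hx).2.2; linarith
  -- decay of the difference
  obtain ⟨e, he0, he1, heq⟩ : ∃ e > 0, e ≤ 1 ∧ e * (p + 1) ≤ q / 2 :=
    ⟨min 1 (q / 2 / (p + 1)), by positivity, min_le_left _ _, by
      calc _ ≤ q / 2 / (p + 1) * (p + 1) := by gcongr; exact min_le_right _ _
        _ = q / 2 := by field_simp⟩
  have hmono : MonotoneOn (fun x => w x * x ^ (-e)) (Ioc 0 x₁) := by
    refine monotoneOn_Ioc_of_hasDerivAt
      (fun x hx => (hwd x hx).mul (Real.hasDerivAt_rpow_const (Or.inl hx.1.ne'))) fun x hx => ?_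
    have hx0 := hx.1
    have hvx : 0 < (p + x) * x := by positivity
    have e1 : x ^ (-e - 1) = x ^ (-e) / x := by
      rw [Real.rpow_sub hx0, Real.rpow_one]
    rw [e1, show (S x * w x - x ^ (n + 1) * Q.eval x) / ((p + x) * x) * x ^ (-e) +
      w x * (-e * (x ^ (-e) / x)) = x ^ (-e) * (((S x - e * (p + x)) * w x +
        x ^ (n + 1) * -Q.eval x) / ((p + x) * x)) by field_simp; ring]
    have h1 : 0 ≤ S x - e * (p + x) := by
      have := fS x hx
      have : e * (p + x) ≤ e * (p + 1) := by have := f1 x hx; gcongr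
      linarith
    have h2 := w0 x hx
    have h3 : 0 ≤ -Q.eval x := le_trans (by linarith) (fQ x hx)
    positivity
  have hx₁m : x₁ ∈ Ioc 0 x₁ := ⟨hx₁0, le_rfl⟩
  set W := w x₁ * x₁ ^ (-e) with hW
  have W0 : 0 ≤ W := mul_nonneg (w0 _ hx₁m) (by positivity)
  have fdecay : ∀ x ∈ Ioc 0 x₁, w x ≤ W * x ^ e := fun x hx => by
    have := hmono hx hx₁m hx.2
    simp only at this
    rw [Real.rpow_neg hx.1.le, ← div_eq_mul_inv, div_le_iff₀ (Real.rpow_pos_of_pos hx.1 _)] at this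
    exact this
  -- improved slope bound
  set N : ℝ := |θ| + C0 with hN
  have N0 : 0 ≤ N := by positivity
  set L := C + (|a 0 2| + |a 0 3| * N) * (C + W) + (n + 1) with hL
  have L0 : 0 < L := by positivity
  have fS2 : ∀ x ∈ Ioc 0 x₁, -(L * x ^ e) ≤ S x - (n + 1) * (p + x) := fun x hx => by
    have hx0 := hx.1
    have hxe : x ≤ x ^ e := by
      simpa using Real.rpow_le_rpow_of_exponent_ge hx0 (f1 x hx) he1
    have h1 := hb x ⟨hx.1.le, f1 x hx⟩ _ (fb x hx)
    have h2 : |ψ x| ≤ (C + W) * x ^ e := by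
      have e1 : ψ x = T.eval x - w x := by simp [hw]
      rw [e1]
      calc |T.eval x - w x| ≤ |T.eval x| + |w x| := abs_sub _ _
        _ ≤ C * x ^ e + W * x ^ e := by
          rw [abs_of_nonneg (w0 x hx)]
          exact add_le_add (h1.2.trans (by gcongr)) (fdecay x hx)
        _ = _ := by ring
    have h3 : |ψ x| ≤ N := abs_le.2 (fb x hx)
    have h4 : |a 0 2 * ψ x + a 0 3 * ψ x ^ 2| ≤ (|a 0 2| + |a 0 3| * N) * ((C + W) * x ^ e) := by
      rw [show a 0 2 * ψ x + a 0 3 * ψ x ^ 2 = (a 0 2 + a 0 3 * ψ x) * ψ x by ring, abs_mul]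
      refine mul_le_mul ((abs_add_le _ _).trans ?_) h2 (abs_nonneg _) (by positivity)
      rw [abs_mul]; gcongr
    have h5 := (abs_le.1 h1.1).1
    have h6 := (abs_le.1 h4).1
    have h7 : C * x ≤ C * x ^ e := by gcongr
    have h8 : (n + 1 : ℝ) * x ≤ (n + 1) * x ^ e := by gcongr
    simp only [hS, hL]
    rw [hK] at h5
    nlinarith
  -- logarithmic growth
  set c₀ := P / (2 * (p + 1)) with hc₀
  have c₀pos : 0 < c₀ := by positivity
  set k := L / (p * e) with hk
  have hmono2 : MonotoneOn (fun x => w x * x ^ (-(n + 1 : ℝ)) * Real.exp (k * x ^ e) -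
      c₀ * Real.log x) (Ioc 0 x₁) := by
    refine monotoneOn_Ioc_of_hasDerivAt (fun x hx => (((hwd x hx).mul
      (Real.hasDerivAt_rpow_const (Or.inl hx.1.ne'))).mul
        (((Real.hasDerivAt_rpow_const (p := e) (Or.inl hx.1.ne')).const_mul k).exp)).sub
      ((Real.hasDerivAt_log hx.1.ne').const_mul c₀)) fun x hx => ?_
    have hx0 := hx.1
    have hx1 := f1 x hx
    have e1 : x ^ (-(n + 1 : ℝ) - 1) = x ^ (-(n + 1 : ℝ)) / x := by
      rw [Real.rpow_sub hx0, Real.rpow_one]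
    have e2 : x ^ (e - 1) = x ^ e / x := by
      rw [Real.rpow_sub hx0, Real.rpow_one]
    have e3 : x ^ (-(n + 1 : ℝ)) = (x ^ (n + 1))⁻¹ := by
      rw [Real.rpow_neg hx0.le]; congr 1; exact_mod_cast Real.rpow_natCast x (n + 1)
    rw [Pi.mul_apply, e1, e2, e3]
    have hxe : 0 < x ^ e := Real.rpow_pos_of_pos hx0 _
    have hE : 1 ≤ Real.exp (k * x ^ e) := Real.one_le_exp (by positivity)
    set E := Real.exp (k * x ^ e)
    set y := x ^ e
    have hw0 := w0 x hx
    have hkey : c₀ ≤ ((S x - (n + 1) * (p + x) + k * e * y * (p + x)) * w x / x ^ (n + 1) +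
        -Q.eval x) / (p + x) * E := by
      have g1 : 0 ≤ S x - (n + 1) * (p + x) + k * e * y * (p + x) := by
        have g2 := fS2 x hx
        have g3 : k * e * p = L := by rw [hk]; field_simp
        have g4 : 0 ≤ k * e * y * x := by positivity
        have g5 : k * e * y * p = L * y := by rw [← g3]; ring
        linarith
      have g6 := fQ x hx
      calc c₀ = P / 2 / (p + 1) * 1 := by rw [hc₀]; field_simp
        _ ≤ _ := by
          refine mul_le_mul ?_ hE (by positivity) ?_
          · refine div_le_div₀ ?_ ?_ (by positivity) (by linarith)
            · have : 0 ≤ -Q.eval x := by linarith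
              positivity
            · have : 0 ≤ (S x - (n + 1) * (p + x) + k * e * y * (p + x)) * w x / x ^ (n + 1) := by
                positivity
              linarith
          · have : 0 ≤ -Q.eval x := by linarith
            positivity
    have hfin : ((S x * w x - x ^ (n + 1) * Q.eval x) / ((p + x) * x) * (x ^ (n + 1))⁻¹ +
        w x * (-(n + 1 : ℝ) * ((x ^ (n + 1))⁻¹ / x))) * E +
        w x * (x ^ (n + 1))⁻¹ * (E * (k * (e * (y / x)))) - c₀ * x⁻¹ =
        (((S x - (n + 1) * (p + x) + k * e * y * (p + x)) * w x / x ^ (n + 1) +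
        -Q.eval x) / (p + x) * E - c₀) / x := by
      field_simp
      ring
    rw [hfin]
    exact div_nonneg (by linarith) hx0.le
  set Y := w x₁ * x₁ ^ (-(n + 1 : ℝ)) * Real.exp (k * x₁ ^ e) - c₀ * Real.log x₁
  obtain ⟨x, hx, hxlog⟩ : ∃ x ∈ Ioc 0 x₁, Real.log x < -Y / c₀ :=
    (Eventually.and (Ioc_mem_nhdsGT hx₁0)
      (Real.tendsto_log_nhdsGT_zero.eventually_lt_atBot _)).exists
  have hle : w x * x ^ (-(n + 1 : ℝ)) * Real.exp (k * x ^ e) - c₀ * Real.log x ≤ Y :=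
    hmono2 hx hx₁m hx.2
  have : 0 ≤ w x * x ^ (-(n + 1 : ℝ)) * Real.exp (k * x ^ e) :=
    mul_nonneg (mul_nonneg (w0 x hx) (Real.rpow_nonneg hx.1.le _)) (Real.exp_pos _).le
  rw [lt_div_iff₀ c₀pos] at hxlog
  linarith

end

section

section
variable {a : ℝ → ℕ → ℕ → ℝ} {p₀ : ℝ}

lemma continuousAt_eval_partialSol (ha : ∀ i j, ContinuousAt (fun p => a p i j) p₀) {n : ℕ}
    (hl : ∀ j, 1 ≤ j → j ≤ n → a p₀ 0 1 - p₀ * j ≠ 0) (x : ℝ) :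
    ContinuousAt (fun p => (partialSol (a p) p n).eval x) p₀ := by
  have h := (coeffContinuousAt_partialSol ha hl).eval (N := n + 1)
    (fun _ => Nat.lt_succ_of_le (natDegree_partialSol_le _ _ n)) x
  exact h.comp (f := fun p : ℝ => (p, x)) (by fun_prop)

lemma exists_defectQuot_bound {l u : ℝ}
    (ha : ∀ p ∈ Icc l u, ∀ i j, ContinuousAt (fun p => a p i j) p) {n : ℕ}
    (hl : ∀ p ∈ Icc l u, ∀ j, 1 ≤ j → j ≤ n → a p 0 1 - p * j ≠ 0) :
    ∃ C, ∀ p ∈ Icc l u, ∀ x ∈ Icc (0 : ℝ) 1,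
      |(defectQuot (a p) p n).eval x + solNum (a p) p (n + 1)| ≤ C * x := by
  have hc : ContinuousOn (fun q : ℝ × ℝ => (Polynomial.divX (defectQuot (a q.1) q.1 n)).eval q.2)
      (Icc l u ×ˢ Icc (0 : ℝ) 1) := fun q hq => by
    have := (((CoeffContinuousAt.defect (ha q.1 hq.1) (coeffContinuousAt_partialSol (ha q.1 hq.1)
      (hl q.1 hq.1))).divX_iterate (n + 2))).eval
        (fun _ => (natDegree_divX_iterate_le _ _).trans_lt
          (natDegree_defect_le _ _ (natDegree_partialSol_le _ _ n))) q.2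
    simp only [Function.iterate_succ_apply' _ (n + 1)] at this
    exact this.continuousWithinAt
  obtain ⟨C, hC⟩ := (isCompact_Icc.prod isCompact_Icc).exists_bound_of_continuousOn hc
  refine ⟨C, fun p hp x hx => ?_⟩
  have h0 := eval_zero_defectQuot (a p) p n
  rw [← Polynomial.coeff_zero_eq_eval_zero] at h0
  have h1 : (defectQuot (a p) p n).eval x =
      (Polynomial.divX (defectQuot (a p) p n)).eval x * x - solNum (a p) p (n + 1) := by
    conv_lhs => rw [← Polynomial.divX_mul_X_add (defectQuot (a p) p n), h0]
    simp [sub_eq_add_neg]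
  rw [h1, sub_add_cancel, abs_mul, abs_of_nonneg hx.1]
  exact mul_le_mul_of_nonneg_right (hC (p, x) ⟨hp, hx⟩) hx.1

end

variable {a : ℕ → ℕ → ℝ} {p : ℝ}

lemma SeriesBase.eval_partialSol_nonneg (hB : SeriesBase a p) {n : ℕ} (hn : 12 ≤ n)
    (hl : ∀ j : ℕ, j ≤ n → 0 < a 0 1 - p * j) {x : ℝ} (hx : 0 ≤ x) :
    0 ≤ (partialSol a p n).eval x := by
  rw [eval_partialSol]
  refine Finset.sum_nonneg fun j hj => mul_nonneg ?_ (pow_nonneg hx _)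
  rw [Finset.mem_range] at hj
  rcases Nat.eq_zero_or_pos j with rfl | h
  · exact le_rfl
  · exact ((hB.growth n hn hl).pos j h (by omega)).le

lemma SeriesBase.cubic_bounds (hB : SeriesBase a p) {x : ℝ} (hx : 0 ≤ x) (hx2 : x ≤ 1 / 2) :
    a 0 1 - 4 * x ≤ (cubic (a · 1)).eval x ∧ 0 ≤ (cubic (a · 2)).eval x ∧
      0 ≤ (cubic (a · 3)).eval x := by
  obtain ⟨-, a01, a02, a03, a11, a12, a13, a21, a22, a23, a31, a32, a33, -⟩ := hB
  have x2 : x ^ 2 ≤ 1 / 2 * x := by nlinarith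
  have x3 : x ^ 3 ≤ 1 / 4 * x := by
    have : x ^ 3 = x ^ 2 * x := by ring
    nlinarith
  have x2' : 0 ≤ x ^ 2 := by positivity
  have x3' : 0 ≤ x ^ 3 := by positivity
  have L : ∀ {b l y : ℝ}, l < b → 0 ≤ y → l * y ≤ b * y := fun h hy =>
    mul_le_mul_of_nonneg_right h.le hy
  simp only [eval_cubic]
  refine ⟨?_, ?_, ?_⟩
  · have := L a11.1 hx
    have := L a21.1 x2'
    have := L a31.1 x3'
    linarith
  · have := L a12.1 hx
    have := L a22.1 x2'
    have := L a32.1 x3'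
    linarith [a02.1]
  · have := L a13.1 hx
    have := L a23.1 x2'
    have := L a33.1 x3'
    linarith [a03.1]

open Polynomial in
/-- The truncated series lowered by a higher order term. -/
def lowered (a : ℕ → ℕ → ℝ) (p : ℝ) (n : ℕ) (t D : ℝ) : ℝ[X] :=
  partialSol a p n + C t * X ^ (n + 1) - C D * X ^ (n + 2)

lemma eval_lowered (n : ℕ) (t D x : ℝ) : (lowered a p n t D).eval x =
    (partialSol a p n).eval x + t * x ^ (n + 1) - D * x ^ (n + 2) := by
  simp [lowered]

lemma SeriesBase.defect_lowered_pos (hB : SeriesBase a p) (ha : a 0 0 = 0) {n : ℕ} (hn : 12 ≤ n)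
    (hl : ∀ j : ℕ, j ≤ n → 0 < a 0 1 - p * j) {t D K x : ℝ}
    (ht : solNum a p (n + 1) = (a 0 1 - p * (n + 1)) * t)
    (hx : 0 < x) (hx2 : x ≤ 1 / 2) (hK : |(defectQuot a p n).eval x + solNum a p (n + 1)| ≤ K * x)
    (hD : K + (5 + n) * t < D * (p * (n + 2) - a 0 1)) (hD0 : 0 ≤ D) (hDt : D * x ≤ t) :
    0 < (defect a p (lowered a p n t D)).eval x := by
  have hT := hB.eval_partialSol_nonneg hn hl hx.le
  have hdT := congrArg (Polynomial.eval x) (defect_partialSol_eq (p := p) ha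
    (n := n) fun j _ h2 => (hl j h2).ne')
  have hdT2 := eval_defect a p (partialSol a p n) x
  have hdB := eval_defect a p (lowered a p n t D) x
  rw [hdT, Polynomial.eval_mul, Polynomial.eval_pow, Polynomial.eval_X] at hdT2
  have hder : (Polynomial.derivative (lowered a p n t D)).eval x =
      (Polynomial.derivative (partialSol a p n)).eval x + (n + 1) * t * x ^ n -
        (n + 2) * D * x ^ (n + 1) := by
    simp [lowered]; ring
  have hr := rhs_sub_rhs a x ((lowered a p n t D).eval x) ((partialSol a p n).eval x)
  rw [hder] at hdB
  rw [eval_lowered] at hdB hr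
  set T := (partialSol a p n).eval x
  set Q := (defectQuot a p n).eval x
  set P := solNum a p (n + 1)
  set u := t * x ^ (n + 1) - D * x ^ (n + 2) with hu
  rw [show T + t * x ^ (n + 1) - D * x ^ (n + 2) = T + u by rw [hu]; ring] at hdB hr
  have hu0 : 0 ≤ u := by
    have : u = x ^ (n + 1) * (t - D * x) := by rw [hu]; ring
    rw [this]
    exact mul_nonneg (by positivity) (by linarith)
  have hut : u ≤ t * x ^ (n + 1) := by
    rw [hu]; have : 0 ≤ D * x ^ (n + 2) := by positivity
    linarith
  have hslope : a 0 1 - 4 * x ≤ slopeRhs a x (T + u) T := by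
    obtain ⟨A1, A2, A3⟩ := hB.cubic_bounds hx.le hx2
    rw [slopeRhs]
    have h2 : 0 ≤ (cubic (a · 2)).eval x * (T + u + T) := by positivity
    have h3 : 0 ≤ (cubic (a · 3)).eval x * ((T + u) ^ 2 + (T + u) * T + T ^ 2) := by positivity
    linarith
  have hsu : (a 0 1 - 4 * x) * u ≤ rhs a x (T + u) - rhs a x T := by
    rw [hr, add_sub_cancel_left]; gcongr
  have hQ : -(K * x) - P ≤ Q := by linarith [(abs_le.1 hK).1]
  have hxQ := mul_le_mul_of_nonneg_left hQ (by positivity : 0 ≤ x ^ (n + 1))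
  have h4 : 4 * x * u ≤ 4 * x * (t * x ^ (n + 1)) := by gcongr
  have hfin : 0 < x ^ (n + 2) * (D * (p * (n + 2) - a 0 1) - K - (5 + n) * t) :=
    mul_pos (by positivity) (by linarith)
  have hlast : 0 ≤ (n + 2) * D * x ^ (n + 3) := by positivity
  rw [hdB]
  have hkey : x ^ (n + 1) * (-(K * x) - P) + (a 0 1 * u - 4 * x * (t * x ^ (n + 1))) -
      (p + x) * x * ((n + 1) * t * x ^ n - (n + 2) * D * x ^ (n + 1)) =
      x ^ (n + 2) * (D * (p * (n + 2) - a 0 1) - K - (5 + n) * t) +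
        (n + 2) * D * x ^ (n + 3) := by
    rw [ht, hu]; ring
  linarith

end

section

variable {a : ℝ → ℕ → ℕ → ℝ} {pb pa c : ℝ} {ψ : ℝ → ℝ → ℝ} {n : ℕ}

lemma eventually_crossing {I : Set ℝ} {p₀ b : ℝ} (hp₀ : p₀ ∈ I) (hI : ∀ p ∈ I, 0 < p)
    (ha : ∀ i j, ContinuousAt (fun p => a p i j) p₀) (ha0 : ∀ p ∈ I, a p 0 0 = 0)
    (hl : ∀ᶠ p in 𝓝[I] p₀, ∀ j : ℕ, 1 ≤ j → j ≤ n → a p 0 1 - p * j ≠ 0)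
    (hP : 0 < solNum (a p₀) p₀ (n + 1))
    (hsol : ∀ p ∈ I, IsSol (a p) p (ψ p) c)
    (hcont : ∀ x ∈ Ioc 0 c, ContinuousWithinAt (fun p => ψ p x) I p₀) (hb : b ∈ Ioc 0 c)
    (hgt : ∀ x₀ > 0, ∃ x ∈ Ioc 0 x₀, (partialSol (a p₀) p₀ n).eval x < ψ p₀ x) :
    ∀ᶠ p in 𝓝[I] p₀, ∃ x₀ ∈ Ioc 0 b, ∀ x ∈ Ioc 0 x₀, (partialSol (a p) p n).eval x < ψ p x := by
  have hl0 := hl.self_of_nhdsWithin hp₀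
  have hQ := continuousAt_defectQuot ha hl0 0
  have hQneg : ∀ᶠ q : ℝ × ℝ in 𝓝 (p₀, 0), (defectQuot (a q.1) q.1 n).eval q.2 < 0 :=
    hQ.eventually_lt_const (by
      change (defectQuot (a p₀) p₀ n).eval 0 < 0
      rw [eval_zero_defectQuot]; linarith)
  rw [nhds_prod_eq, eventually_prod_iff] at hQneg
  obtain ⟨pr, hpr, pr', hpr', hneg⟩ := hQneg
  obtain ⟨η, hη, hη'⟩ := Metric.eventually_nhds_iff.1 hpr'
  obtain ⟨x₀, hx₀, hgt₀⟩ := hgt (min (η / 2) b) (lt_min (by linarith) hb.1)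
  have hx₀c : x₀ ∈ Ioc 0 c := ⟨hx₀.1, hx₀.2.trans ((min_le_right _ _).trans hb.2)⟩
  have hlt : ∀ᶠ p in 𝓝[I] p₀, (partialSol (a p) p n).eval x₀ < ψ p x₀ :=
    (continuousAt_eval_partialSol ha hl0 x₀).continuousWithinAt.eventually_lt (hcont x₀ hx₀c) hgt₀
  filter_upwards [hlt, hpr.filter_mono nhdsWithin_le_nhds, self_mem_nhdsWithin, hl]
    with p h1 h2 hpI hlp
  refine ⟨x₀, ⟨hx₀.1, hx₀.2.trans (min_le_right _ _)⟩, (hsol p hpI).above_of_defect_neg (hI p hpI)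
    hx₀c (fun x hx => ?_) h1⟩
  rw [defect_partialSol_eq (ha0 p hpI) hlp, Polynomial.eval_mul, Polynomial.eval_pow,
    Polynomial.eval_X]
  refine mul_neg_of_pos_of_neg (pow_pos hx.1 _) (hneg h2 (hη' ?_))
  rw [Real.dist_eq, sub_zero, abs_of_pos hx.1]
  have := hx.2.trans (hx₀.2.trans (min_le_left _ _))
  linarith

/-- Shooting in the parameter between two resonances. -/
theorem exists_parameter_of_resonances (hb0 : 0 < pb) (hba : pb < pa) (hc : 0 < c) (hn : 12 ≤ n)
    (hbase : ∀ p ∈ Icc pb pa, SeriesBase (a p) p) (ha0 : ∀ p ∈ Icc pb pa, a p 0 0 = 0)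
    (hac : ∀ p ∈ Icc pb pa, ∀ i j, ContinuousAt (fun p => a p i j) p)
    (hKb : a pb 0 1 = pb * (n + 2)) (hKa : a pa 0 1 = pa * (n + 1))
    (hK : ∀ p ∈ Ioo pb pa, a p 0 1 ∈ Ioo (p * (n + 1)) (p * (n + 2)))
    (hsol : ∀ p ∈ Icc pb pa, IsSol (a p) p (ψ p) c)
    (hcont : ∀ x ∈ Ioc 0 c, ContinuousOn (fun p => ψ p x) (Icc pb pa)) {θ M q : ℝ} (hq : 0 < q)
    (hψ : ∀ x ∈ Ioc 0 c, -θ ≤ ψ pb x) (hM : ∀ p ∈ Icc pb pa, ∀ x ∈ Ioc 0 c, ψ p x ≤ M)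
    (hsec : ∀ y, -θ ≤ y → q ≤ a pb 0 1 + a pb 0 2 * y + a pb 0 3 * y ^ 2) :
    ∃ p ∈ Ioo pb pa, ∃ D, ∃ x₀ ∈ Ioc 0 c, ∀ x ∈ Ioc 0 x₀,
      |ψ p x - (partialSol (a p) p (n + 1)).eval x| ≤ D * x ^ (n + 2) := by
  have hpos : ∀ p ∈ Icc pb pa, 0 < p := fun p hp => hb0.trans_le hp.1
  have hge : ∀ p ∈ Icc pb pa, p * (n + 1) ≤ a p 0 1 := by
    intro p hp
    rcases hp.1.eq_or_lt with rfl | h1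
    · rw [hKb]; nlinarith
    rcases hp.2.eq_or_lt with rfl | h2
    · exact hKa.ge
    · exact (hK p ⟨h1, h2⟩).1.le
  have hgt : ∀ p ∈ Ico pb pa, p * (n + 1) < a p 0 1 := by
    intro p hp
    rcases hp.1.eq_or_lt with rfl | h1
    · rw [hKb]; nlinarith
    · exact (hK p ⟨h1, hp.2⟩).1
  have hlt : ∀ p ∈ Ioc pb pa, a p 0 1 < p * (n + 2) := by
    intro p hp
    rcases hp.2.eq_or_lt with rfl | h2
    · rw [hKa]; nlinarith [hp.1]
    · exact (hK p ⟨hp.1, h2⟩).2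
  have hl : ∀ p ∈ Icc pb pa, ∀ j : ℕ, j ≤ n → 0 < a p 0 1 - p * j := by
    intro p hp j hj
    have h1 := hge p hp
    have h2 : (j : ℝ) ≤ n := by exact_mod_cast hj
    nlinarith [hpos p hp]
  have hl1 : ∀ p ∈ Ico pb pa, ∀ j : ℕ, j ≤ n + 1 → 0 < a p 0 1 - p * j := by
    intro p hp j hj
    have h1 := hgt p hp
    have h2 : (j : ℝ) ≤ n + 1 := by exact_mod_cast hj
    nlinarith [hpos p (Ico_subset_Icc_self hp)]
  have hlne : ∀ p ∈ Icc pb pa, ∀ j : ℕ, 1 ≤ j → j ≤ n → a p 0 1 - p * j ≠ 0 := fun p hp j _ h =>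
    (hl p hp j h).ne'
  have hP : ∀ p ∈ Icc pb pa, 0 < solNum (a p) p (n + 1) := fun p hp =>
    (hbase p hp).solNum_pos hn (hl p hp)
  have hP1 : ∀ p ∈ Ico pb pa, 0 < solNum (a p) p (n + 1 + 1) := fun p hp =>
    (hbase p (Ico_subset_Icc_self hp)).solNum_pos (by omega) (hl1 p hp)
  have hcross : ∀ I ⊆ Ico pb pa, ∀ p ∈ I, ∀ b ∈ Ioc 0 c,
      (∀ x₀ > 0, ∃ x ∈ Ioc 0 x₀, (partialSol (a p) p (n + 1)).eval x < ψ p x) →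
      ∀ᶠ p' in 𝓝[I] p, ∃ x₀ ∈ Ioc 0 b, ∀ x ∈ Ioc 0 x₀,
        (partialSol (a p') p' (n + 1)).eval x < ψ p' x := by
    intro I hI p hp b hb h
    have hI' : I ⊆ Icc pb pa := hI.trans Ico_subset_Icc_self
    refine eventually_crossing hp (fun q hq => hpos q (hI' hq)) (hac p (hI' hp))
      (fun q hq => ha0 q (hI' hq)) ?_ (hP1 p (hI hp)) (fun q hq => hsol q (hI' hq))
      (fun x hx => (hcont x hx p (hI' hp)).mono hI') hb h
    filter_upwards [self_mem_nhdsWithin] with q hq j _ h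
    exact (hl1 q (hI hq) j h).ne'
  have hcm : c ∈ Ioc 0 c := ⟨hc, le_rfl⟩
  -- a parameter above the lower end where the solution crosses
  obtain ⟨pl, hpl, hplU⟩ : ∃ pl ∈ Ioo pb pa, ∃ x₀ ∈ Ioc 0 c, ∀ x ∈ Ioc 0 x₀,
      (partialSol (a pl) pl (n + 1)).eval x < ψ pl x := by
    have h1 := hcross (Ico pb pa) Subset.rfl pb ⟨le_rfl, hba⟩ c hcm fun x₀ hx₀ =>
      (hsol pb ⟨le_rfl, hba.le⟩).exists_gt_of_resonance hb0 hc (ha0 pb ⟨le_rfl, hba.le⟩)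
        (by rw [hKb]; push_cast; ring) (hP1 pb ⟨le_rfl, hba⟩) hq hψ hsec hx₀
    have h2 : ∀ᶠ p in 𝓝[>] pb, ∃ x₀ ∈ Ioc 0 c, ∀ x ∈ Ioc 0 x₀,
        (partialSol (a p) p (n + 1)).eval x < ψ p x := by
      rw [← nhdsWithin_Ioo_eq_nhdsGT hba]
      exact h1.filter_mono (nhdsWithin_mono _ Ioo_subset_Ico_self)
    exact (Eventually.and (Ioo_mem_nhdsGT hba) h2).exists
  have hsub : Icc pl pa ⊆ Icc pb pa := Icc_subset_Icc_left hpl.1.le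
  -- uniform constants
  have hKc : ContinuousOn (fun p => a p 0 1) (Icc pl pa) := fun p hp =>
    (hac p (hsub hp) 0 1).continuousWithinAt
  obtain ⟨δ, hδ, hδ'⟩ : ∃ δ > 0, ∀ p ∈ Icc pl pa, δ ≤ p * (n + 2) - a p 0 1 := by
    obtain ⟨p₁, hp₁, hmin⟩ := isCompact_Icc.exists_isMinOn (nonempty_Icc.2 hpl.2.le)
      (f := fun p => p * (n + 2) - a p 0 1) ((by fun_prop : ContinuousOn _ _).sub hKc)
    exact ⟨_, sub_pos.2 (hlt p₁ ⟨hpl.1.trans_le hp₁.1, hp₁.2⟩), fun p hp => hmin hp⟩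
  obtain ⟨P₀, hP₀, hP₀'⟩ : ∃ P₀ > 0, ∀ p ∈ Icc pl pa, P₀ ≤ solNum (a p) p (n + 1) := by
    obtain ⟨p₁, hp₁, hmin⟩ := isCompact_Icc.exists_isMinOn (nonempty_Icc.2 hpl.2.le)
      (f := fun p => solNum (a p) p (n + 1)) fun p hp =>
        (continuousAt_solNum (hac p (hsub hp)) (hlne p (hsub hp))).continuousWithinAt
    exact ⟨_, hP p₁ (hsub hp₁), fun p hp => hmin hp⟩
  obtain ⟨K₁, hK₁⟩ := exists_defectQuot_bound (fun p hp => hac p (hsub hp))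
    (fun p hp => hlne p (hsub hp))
  set t := fun p => solCoeff (a p) p (n + 1) with ht
  have htP : ∀ p ∈ Ico pl pa, solNum (a p) p (n + 1) = (a p 0 1 - p * (n + 1)) * t p := by
    intro p hp
    have := solNum_succ_eq (hl1 p ⟨hpl.1.le.trans hp.1, hp.2⟩ (n + 1) le_rfl)
    rw [this]; push_cast; rfl
  set τ := P₀ / 2 with hτ
  have hτ0 : 0 < τ := by positivity
  have htτ : ∀ p ∈ Ico pl pa, τ ≤ t p := by
    intro p hp
    have h1 := htP p hp
    have h2 := hP₀' p (Ico_subset_Icc_self hp)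
    have hp' := hsub (Ico_subset_Icc_self hp)
    have h3 := (hbase p hp').a01.2
    have h4 := hgt p ⟨hp'.1, hp.2⟩
    have h5 : 0 ≤ p * (n + 1) := mul_nonneg (hpos p hp').le (by positivity)
    by_contra! h6
    have h7 : (a p 0 1 - p * (n + 1)) * t p ≤ (a p 0 1 - p * (n + 1)) * τ := by
      gcongr
    nlinarith
  set C := (|K₁| + 6 + n) / δ with hC
  have hC0 : 0 < C := by positivity
  set D := fun p => C * (1 + t p) with hD
  set x₃ := min (min (1 / 2) c) (min (τ / (C * (1 + τ))) (1 / (2 * C))) with hx₃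
  have hx₃0 : 0 < x₃ := by positivity
  have hx₃c : x₃ ∈ Ioc 0 c := ⟨hx₃0, (min_le_left _ _).trans (min_le_right _ _)⟩
  have hx₃C : C * x₃ ≤ 1 / 2 := by
    calc C * x₃ ≤ C * (1 / (2 * C)) := by gcongr; exact (min_le_right _ _).trans (min_le_right _ _)
      _ = 1 / 2 := by field_simp
  have hx₃τ : C * (1 + τ) * x₃ ≤ τ := by
    calc C * (1 + τ) * x₃ ≤ C * (1 + τ) * (τ / (C * (1 + τ))) := by
          gcongr; exact (min_le_right _ _).trans (min_le_left _ _)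
      _ = τ := by field_simp
  set B := fun p => lowered (a p) p n (t p) (D p) with hB
  have hBT : ∀ p x, (B p).eval x = (partialSol (a p) p (n + 1)).eval x - D p * x ^ (n + 2) := by
    intro p x
    simp only [hB, eval_lowered, partialSol_succ, ht]
    simp
  have hBdef : ∀ p ∈ Ico pl pa, ∀ x ∈ Ioc 0 x₃, 0 < (defect (a p) p (B p)).eval x := by
    intro p hp x hx
    have hp' := Ico_subset_Icc_self hp
    have hx2 : x ≤ 1 / 2 := hx.2.trans ((min_le_left _ _).trans (min_le_left _ _))
    have ht0 : τ ≤ t p := htτ p hp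
    refine (hbase p (hsub hp')).defect_lowered_pos (ha0 p (hsub hp')) hn (hl p (hsub hp'))
      (htP p hp) hx.1 hx2 (hK₁ p hp' x ⟨hx.1.le, by linarith⟩) ?_ ?_ ?_
    · have h1 := hδ' p hp'
      have h2 : D p * δ = (|K₁| + 6 + n) * (1 + t p) := by
        simp only [hD, hC]; field_simp
      have h3 : D p * δ ≤ D p * (p * (n + 2) - a p 0 1) := by
        have : 0 ≤ D p := by simp only [hD]; exact mul_nonneg hC0.le (by linarith)
        gcongr
      refine lt_of_lt_of_le ?_ h3
      rw [h2]
      have h4 := le_abs_self K₁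
      have h5 : 0 ≤ |K₁| * t p := mul_nonneg (abs_nonneg _) (by linarith)
      have h6 : (0 : ℝ) ≤ n := Nat.cast_nonneg n
      nlinarith
    · exact mul_nonneg hC0.le (by linarith)
    · have h1 : C * x ≤ 1 / 2 := le_trans (by gcongr; exact hx.2) hx₃C
      have h2 : C * (1 + τ) * x ≤ τ := le_trans (by gcongr; exact hx.2) hx₃τ
      have : D p * x = C * (1 + τ) * x + C * x * (t p - τ) := by simp only [hD]; ring
      rw [this]
      nlinarith
  set U : Set ℝ := {p | ∃ x₀ ∈ Ioc 0 c, ∀ x ∈ Ioc 0 x₀,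
    (partialSol (a p) p (n + 1)).eval x < ψ p x} with hU
  set L : Set ℝ := {p | ∃ x ∈ Ioc 0 x₃, ψ p x < (B p).eval x} with hL
  have hLdown : ∀ p ∈ Ico pl pa, ∀ x ∈ Ioc 0 x₃, ψ p x < (B p).eval x →
      ∀ y ∈ Ioc 0 x, ψ p y < (B p).eval y := by
    intro p hp x hx h
    have hp' := hsub (Ico_subset_Icc_self hp)
    exact (hsol p hp').below_of_defect_pos (hpos p hp') ⟨hx.1, hx.2.trans hx₃c.2⟩
      (fun y hy => hBdef p hp y ⟨hy.1, hy.2.trans hx.2⟩) h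
  -- a parameter near the upper end where the solution drops below
  obtain ⟨pr, hpr, hprL⟩ : ∃ pr ∈ Ioo pl pa, pr ∈ L := by
    set m := (|M| + C * x₃ ^ (n + 2)) / (x₃ ^ (n + 1) / 2) + 1 with hm
    have hm0 : 0 < m := by positivity
    have hev : ∀ᶠ p in 𝓝[<] pa, a p 0 1 - p * (n + 1) < P₀ / m := by
      have hcont : ContinuousAt (fun p => a p 0 1 - p * (n + 1)) pa :=
        (hac pa ⟨hba.le, le_rfl⟩ 0 1).sub (by fun_prop)
      refine Eventually.filter_mono nhdsWithin_le_nhds (hcont.tendsto.eventually_lt_const ?_)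
      rw [hKa, sub_self]; positivity
    obtain ⟨p, hp, hlt⟩ := (Eventually.and (Ioo_mem_nhdsLT hpl.2) hev).exists
    refine ⟨p, hp, x₃, ⟨hx₃0, le_rfl⟩, ?_⟩
    have hp' : p ∈ Ico pl pa := ⟨hp.1.le, hp.2⟩
    have hpc := hsub (Ico_subset_Icc_self hp')
    have htm : m ≤ t p := by
      have h1 := htP p hp'
      have h2 := hP₀' p (Ico_subset_Icc_self hp')
      have h4 := hgt p ⟨hpc.1, hp.2⟩
      rw [lt_div_iff₀ hm0] at hlt
      by_contra! h6
      have h7 : (a p 0 1 - p * (n + 1)) * t p ≤ (a p 0 1 - p * (n + 1)) * m := by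
        gcongr
      linarith
    have hT := (hbase p hpc).eval_partialSol_nonneg hn (hl p hpc) hx₃0.le
    have hup := hM p hpc x₃ hx₃c
    rw [hB, eval_lowered]
    have h1 : t p * x₃ ^ (n + 1) - D p * x₃ ^ (n + 2) =
        t p * x₃ ^ (n + 1) * (1 - C * x₃) - C * x₃ ^ (n + 2) := by simp only [hD]; ring
    have ht0 : 0 ≤ t p := hm0.le.trans htm
    have h2 : t p * x₃ ^ (n + 1) * (1 / 2) ≤ t p * x₃ ^ (n + 1) * (1 - C * x₃) := by
      gcongr; linarith
    have h3 : m * (x₃ ^ (n + 1) / 2) ≤ t p * (x₃ ^ (n + 1) / 2) := by gcongr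
    have h4 : m * (x₃ ^ (n + 1) / 2) = |M| + C * x₃ ^ (n + 2) + x₃ ^ (n + 1) / 2 := by
      rw [hm]; field_simp
    have h5 : 0 < x₃ ^ (n + 1) / 2 := by positivity
    linarith [le_abs_self M]
  have hIsub : Icc pl pr ⊆ Ico pb pa := fun p hp =>
    ⟨hpl.1.le.trans hp.1, hp.2.trans_lt hpr.2⟩
  have hIco : ∀ p ∈ Icc pl pr, p ∈ Ico pl pa := fun p hp => ⟨hp.1, hp.2.trans_lt hpr.2⟩
  have hdisj : ∀ p ∈ Icc pl pr, p ∈ L → p ∉ U := by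
    rintro p hp ⟨x, hx, hlt⟩ ⟨x₀, hx₀, hgt⟩
    have hm0 : 0 < min x x₀ := lt_min hx.1 hx₀.1
    have h1 := hLdown p (hIco p hp) x hx hlt (min x x₀) ⟨hm0, min_le_left _ _⟩
    have h2 := hgt (min x x₀) ⟨hm0, min_le_right _ _⟩
    rw [hBT] at h1
    have h3 : 0 < D p := mul_pos hC0 (by linarith [htτ p (hIco p hp)])
    have h4 : 0 < D p * min x x₀ ^ (n + 2) := by positivity
    linarith
  obtain ⟨p, hp, hpU, hpL⟩ : ∃ p ∈ Icc pl pr, p ∉ U ∧ p ∉ L := by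
    by_contra! hcon
    have hconst := (isPreconnected_Icc (a := pl) (b := pr)).induction₂'
      (fun p q => p ∈ U ↔ q ∈ U) (fun p hp => ?_) (fun _ _ _ _ _ _ h1 h2 => h1.trans h2)
      (left_mem_Icc.2 hpr.1.le) (right_mem_Icc.2 hpr.1.le)
    · exact hdisj pr (right_mem_Icc.2 hpr.1.le) hprL (hconst.1 hplU)
    · by_cases hpU : p ∈ U
      · obtain ⟨x₀, hx₀, h⟩ := hpU
        have hev := hcross (Icc pl pr) hIsub p hp c hcm fun x₁ hx₁ =>
          ⟨min x₀ x₁, ⟨lt_min hx₀.1 hx₁, min_le_right _ _⟩, h _ ⟨lt_min hx₀.1 hx₁, min_le_left _ _⟩⟩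
        filter_upwards [hev] with q hq
        exact ⟨⟨fun _ => hq, fun _ => ⟨x₀, hx₀, h⟩⟩, ⟨fun _ => ⟨x₀, hx₀, h⟩, fun _ => hq⟩⟩
      · obtain ⟨x, hx, hlt⟩ := hcon p hp hpU
        have hxc : x ∈ Ioc 0 c := ⟨hx.1, hx.2.trans hx₃c.2⟩
        have hpb : p ∈ Icc pb pa := Ico_subset_Icc_self (hIsub hp)
        have hlne1 : ∀ j : ℕ, 1 ≤ j → j ≤ n + 1 → a p 0 1 - p * j ≠ 0 := fun j _ h =>
          (hl1 p (hIsub hp) j h).ne'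
        have hBc : ContinuousAt (fun p => (B p).eval x) p := by
          simp only [hBT]
          have h1 := continuousAt_eval_partialSol (hac p hpb) hlne1 x
          have h2 : ContinuousAt t p := continuousAt_solCoeff (hac p hpb) hlne1
          exact h1.sub ((continuousAt_const.mul (continuousAt_const.add h2)).mul continuousAt_const)
        have hev : ∀ᶠ q in 𝓝[Icc pl pr] p, ψ q x < (B q).eval x :=
          ((hcont x hxc p hpb).mono (hIsub.trans Ico_subset_Icc_self)).eventually_lt
            hBc.continuousWithinAt hlt
        filter_upwards [hev, self_mem_nhdsWithin] with q hq hqI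
        have := hdisj q hqI ⟨x, hx, hq⟩
        exact ⟨⟨fun h => absurd h hpU, fun h => absurd h this⟩,
          ⟨fun h => absurd h this, fun h => absurd h hpU⟩⟩
  have hpb : p ∈ Ico pb pa := hIsub hp
  have hab : ∃ x₁ > 0, ∀ x ∈ Ioc 0 x₁, ψ p x ≤ (partialSol (a p) p (n + 1)).eval x := by
    by_contra! hcon
    have hev := hcross (Icc pl pr) hIsub p hp c hcm fun x₁ hx₁ => hcon x₁ hx₁
    exact hpU (hev.self_of_nhdsWithin hp)
  obtain ⟨x₁, hx₁, hup⟩ := hab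
  refine ⟨p, ⟨hpl.1.trans_le hp.1, hpb.2⟩, D p, min x₁ x₃, ⟨lt_min hx₁ hx₃0,
    (min_le_right _ _).trans hx₃c.2⟩, fun x hx => ?_⟩
  have h1 := hup x ⟨hx.1, hx.2.trans (min_le_left _ _)⟩
  have h2 : (B p).eval x ≤ ψ p x := by
    by_contra! h
    exact hpL ⟨x, ⟨hx.1, hx.2.trans (min_le_right _ _)⟩, h⟩
  rw [hBT] at h2
  rw [abs_le]
  have h3 : 0 < D p := mul_pos hC0 (by linarith [htτ p (hIco p hp)])
  have h4 : 0 < D p * x ^ (n + 2) := mul_pos h3 (pow_pos hx.1 _)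
  constructor <;> linarith

end

/-- Between consecutive resonances `K p = p (m + 1)` and `K p = p m` the quotient `K p / p` lies
strictly between `m` and `m + 1`. -/
lemma exists_resonance_interval {K : ℝ → ℝ} {p₀ m : ℝ} (hp₀ : 0 < p₀)
    (hK : ContinuousOn K (Icc 0 p₀)) (hpos : ∀ p ∈ Icc 0 p₀, 0 < K p) (h : K p₀ < p₀ * m) :
    ∃ pb pa, 0 < pb ∧ pb < pa ∧ pa ≤ p₀ ∧ K pb = pb * (m + 1) ∧ K pa = pa * m ∧
      ∀ p ∈ Ioo pb pa, K p ∈ Ioo (p * m) (p * (m + 1)) := by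
  have hcont : ∀ k : ℝ, ContinuousOn (fun p => K p - p * k) (Icc 0 p₀) := fun k =>
    hK.sub (by fun_prop)
  set A := Icc 0 p₀ ∩ (fun p => K p - p * (m + 1)) ⁻¹' Ici 0 with hA
  have hAc : IsCompact A := isCompact_Icc.of_isClosed_subset
    ((hcont _).preimage_isClosed_of_isClosed isClosed_Icc isClosed_Ici) inter_subset_left
  have h0A : (0 : ℝ) ∈ A := ⟨⟨le_rfl, hp₀.le⟩, by
    have := hpos 0 ⟨le_rfl, hp₀.le⟩
    simpa using this.le⟩
  obtain ⟨pb, hpbA, hpb⟩ := hAc.exists_isGreatest ⟨0, h0A⟩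
  have hpb0 : pb ≠ p₀ := by
    rintro rfl
    have := hpbA.2
    simp only [mem_preimage, mem_Ici] at this
    nlinarith
  have hlt : pb < p₀ := lt_of_le_of_ne hpbA.1.2 hpb0
  have hgt : ∀ p ∈ Ioc pb p₀, K p < p * (m + 1) := by
    intro p hp
    by_contra! hcon
    have : p ∈ A := ⟨⟨hpbA.1.1.trans hp.1.le, hp.2⟩, by simp only [mem_preimage, mem_Ici]; linarith⟩
    exact absurd (hpb this) (not_le.2 hp.1)
  have heq : K pb = pb * (m + 1) := by
    refine le_antisymm ?_ (by have := hpbA.2; simp only [mem_preimage, mem_Ici] at this; linarith)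
    have hc : ContinuousWithinAt (fun p => K p - p * (m + 1)) (Ioc pb p₀) pb :=
      ((hcont _) pb hpbA.1).mono fun p hp => ⟨hpbA.1.1.trans hp.1.le, hp.2⟩
    have : (𝓝[Ioc pb p₀] pb).NeBot := left_nhdsWithin_Ioc_neBot hlt
    have := le_of_tendsto hc.tendsto (eventually_mem_nhdsWithin.mono fun p hp =>
      (sub_neg.2 (hgt p hp)).le)
    linarith
  have hpb0' : 0 < pb := by
    rcases hpbA.1.1.eq_or_lt with h1 | h1
    · rw [← h1] at heq
      have := hpos 0 ⟨le_rfl, hp₀.le⟩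
      linarith
    · exact h1
  set B := Icc pb p₀ ∩ (fun p => K p - p * m) ⁻¹' Iic 0 with hB
  have hBc : IsCompact B := isCompact_Icc.of_isClosed_subset
    (((hcont _).mono (Icc_subset_Icc_left hpb0'.le)).preimage_isClosed_of_isClosed isClosed_Icc
      isClosed_Iic) inter_subset_left
  have h0B : p₀ ∈ B := ⟨⟨hlt.le, le_rfl⟩, by simp only [mem_preimage, mem_Iic]; linarith⟩
  obtain ⟨pa, hpaB, hpa⟩ := hBc.exists_isLeast ⟨p₀, h0B⟩
  have hne : pb ≠ pa := by
    rintro rfl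
    have := hpaB.2
    simp only [mem_preimage, mem_Iic] at this
    nlinarith
  have hba : pb < pa := lt_of_le_of_ne hpaB.1.1 hne
  have hgt' : ∀ p ∈ Ico pb pa, p * m < K p := by
    intro p hp
    by_contra! hcon
    have : p ∈ B := ⟨⟨hp.1, hp.2.le.trans hpaB.1.2⟩, by
      simp only [mem_preimage, mem_Iic]; linarith⟩
    exact absurd (hpa this) (not_le.2 hp.2)
  refine ⟨pb, pa, hpb0', hba, hpaB.1.2, heq, ?_, fun p hp => ⟨hgt' p ⟨hp.1.le, hp.2⟩,
    hgt p ⟨hp.1, hp.2.le.trans hpaB.1.2⟩⟩⟩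
  refine le_antisymm (by have := hpaB.2; simp only [mem_preimage, mem_Iic] at this; linarith) ?_
  have hc : ContinuousWithinAt (fun p => K p - p * m) (Ico pb pa) pa :=
    ((hcont _) pa ⟨hpb0'.le.trans hba.le, hpaB.1.2⟩).mono fun p hp =>
      ⟨hpb0'.le.trans hp.1, hp.2.le.trans hpaB.1.2⟩
  have : (𝓝[Ico pb pa] pa).NeBot := right_nhdsWithin_Ico_neBot hba
  have := ge_of_tendsto hc.tendsto (eventually_mem_nhdsWithin.mono fun p hp =>
    (sub_pos.2 (hgt' p hp)).le)
  linarith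

section
variable {a : ℕ → ℕ → ℝ} {p c : ℝ} {ψ : ℝ → ℝ} {N : ℕ}

open Polynomial

/-- The difference quotient `(slopeRhs - a 0 1) / x` along `T + S x ^ (N + 1) y`, where
`T` is the partial sum of order `N + 1`. -/
def reducedSlope (a : ℕ → ℕ → ℝ) (p : ℝ) (N : ℕ) (S x y : ℝ) : ℝ :=
  a 1 1 + a 2 1 * x + a 3 1 * x ^ 2 +
    (cubic (a · 2)).eval x * (2 * (divX (partialSol a p (N + 1))).eval x + x ^ N * S * y) +
    (cubic (a · 3)).eval x * (3 * (divX (partialSol a p (N + 1))).eval x *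
      (partialSol a p (N + 1)).eval x +
      3 * (divX (partialSol a p (N + 1))).eval x * (x ^ (N + 1) * S * y) +
      x ^ N * S * y * (x ^ (N + 1) * S * y))

/-- The right-hand side of the equation for the rescaled remainder of order `N + 2`. -/
def remainderRhs (a : ℕ → ℕ → ℝ) (p : ℝ) (N : ℕ) (S x y : ℝ) : ℝ :=
  ((defectQuot a p (N + 1)).eval x / S + (reducedSlope a p N S x y - a 0 1 / p) * y) / (p + x)

lemma rhs_partialSol_add (ha : a 0 0 = 0)
    (hl : ∀ j, 1 ≤ j → j ≤ N + 1 → a 0 1 - p * j ≠ 0) (S x y : ℝ) :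
    rhs a x ((partialSol a p (N + 1)).eval x + S * x ^ (N + 1) * y) =
      (p + x) * x * (derivative (partialSol a p (N + 1))).eval x +
      x ^ (N + 2) * (defectQuot a p (N + 1)).eval x +
      (a 0 1 + x * reducedSlope a p N S x y) * (S * x ^ (N + 1) * y) := by
  have h1 := congrArg (eval x) (defect_partialSol_eq (a := a) (p := p) ha hl)
  rw [eval_defect, eval_mul, eval_pow, eval_X] at h1
  have h2 : (partialSol a p (N + 1)).eval x = x * (divX (partialSol a p (N + 1))).eval x := by
    conv_lhs => rw [← divX_mul_X_add (partialSol a p (N + 1)), coeff_partialSol]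
    simp [solCoeff_zero, mul_comm]
  have h3 := rhs_sub_rhs a x ((partialSol a p (N + 1)).eval x + S * x ^ (N + 1) * y)
    ((partialSol a p (N + 1)).eval x)
  have h4 : slopeRhs a x ((partialSol a p (N + 1)).eval x + S * x ^ (N + 1) * y)
      ((partialSol a p (N + 1)).eval x) = a 0 1 + x * reducedSlope a p N S x y := by
    simp only [slopeRhs, reducedSlope, h2, eval_cubic]
    ring
  rw [h4, add_sub_cancel_left] at h3
  linear_combination h1 + h3

lemma hasDerivAt_remainder (ha : a 0 0 = 0)
    (hl : ∀ j, 1 ≤ j → j ≤ N + 1 → a 0 1 - p * j ≠ 0) {S x : ℝ} (hp : 0 < p) (hS : 0 < S)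
    (hx : x ≠ 0) (hpx : 0 < p + x) (h : HasDerivAt ψ (rhs a x (ψ x) / ((p + x) * x)) x) :
    HasDerivAt (fun x => (ψ x - (partialSol a p (N + 1)).eval x) / (S * x ^ (N + 1)))
      (remainderRhs a p N S x ((ψ x - (partialSol a p (N + 1)).eval x) / (S * x ^ (N + 1))) -
        (N + 1 - a 0 1 / p) *
          ((ψ x - (partialSol a p (N + 1)).eval x) / (S * x ^ (N + 1)) / x)) x := by
  have hd : HasDerivAt (fun x : ℝ => S * x ^ (N + 1)) (S * ((N + 1 : ℕ) * x ^ N)) x :=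
    (hasDerivAt_pow (N + 1) x).const_mul S
  have hne : S * x ^ (N + 1) ≠ 0 := by positivity
  refine ((h.sub ((partialSol a p (N + 1)).hasDerivAt x)).div hd hne).congr_deriv ?_
  obtain ⟨y, hy⟩ : ∃ y, y = (ψ x - (partialSol a p (N + 1)).eval x) / (S * x ^ (N + 1)) := ⟨_, rfl⟩
  have hψ : ψ x = (partialSol a p (N + 1)).eval x + S * x ^ (N + 1) * y := by
    rw [hy]; field_simp; ring
  have key := rhs_partialSol_add (a := a) (p := p) (N := N) ha hl S x y
  simp only [Pi.sub_apply, ← hy]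
  rw [hψ, key, remainderRhs]
  push_cast
  have := hpx.ne'
  field_simp
  ring

lemma hasDerivAt_of_remainder (ha : a 0 0 = 0)
    (hl : ∀ j, 1 ≤ j → j ≤ N + 1 → a 0 1 - p * j ≠ 0) {S x : ℝ} (hp : 0 < p) (hS : 0 < S)
    (hx : x ≠ 0) (hpx : 0 < p + x) {y : ℝ → ℝ}
    (h : HasDerivAt y (remainderRhs a p N S x (y x) - (N + 1 - a 0 1 / p) * (y x / x)) x) :
    HasDerivAt (fun x => (partialSol a p (N + 1)).eval x + S * x ^ (N + 1) * y x)
      (rhs a x ((partialSol a p (N + 1)).eval x + S * x ^ (N + 1) * y x) / ((p + x) * x)) x := by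
  have hd : HasDerivAt (fun x : ℝ => S * x ^ (N + 1)) (S * ((N + 1 : ℕ) * x ^ N)) x :=
    (hasDerivAt_pow (N + 1) x).const_mul S
  refine (((partialSol a p (N + 1)).hasDerivAt x).add (hd.mul h)).congr_deriv ?_
  rw [rhs_partialSol_add ha hl, remainderRhs]
  push_cast
  have := hpx.ne'
  field_simp
  ring

lemma contDiff_eval (B : ℝ[X]) : ContDiff ℝ (⊤ : ℕ∞) fun x : ℝ => B.eval x := by
  simpa using B.contDiff_aeval (𝕜 := ℝ) (⊤ : ℕ∞)

lemma contDiffOn_remainderRhs (S : ℝ) {b : ℝ} (hb : b < p) :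
    ContDiffOn ℝ (⊤ : ℕ∞) (fun q : ℝ × ℝ × ℝ => remainderRhs a p N S q.2.1 q.2.2)
      (Icc 0 0 ×ˢ Icc (-b) b ×ˢ Icc (-b) b) := by
  have hP : ∀ B : ℝ[X], ContDiff ℝ (⊤ : ℕ∞) fun q : ℝ × ℝ × ℝ => B.eval q.2.1 := fun B =>
    (contDiff_eval B).comp (contDiff_fst.comp contDiff_snd)
  unfold remainderRhs reducedSlope
  refine ContDiffOn.div ?_ (by fun_prop) fun q hq => ?_
  · have h1 := hP (defectQuot a p (N + 1))
    have h2 := hP (cubic (a · 2))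
    have h3 := hP (cubic (a · 3))
    have h4 := hP (divX (partialSol a p (N + 1)))
    have h5 := hP (partialSol a p (N + 1))
    fun_prop
  · have := hq.2.1.1
    linarith

theorem IsSol.exists_smooth_extension (h : IsSol a p ψ c) (hp : 0 < p) (ha : a 0 0 = 0)
    (hl : ∀ j, 1 ≤ j → j ≤ N + 1 → a 0 1 - p * j ≠ 0) (hK : a 0 1 < p * (N + 1)) {D x₀ : ℝ}
    (hx₀ : x₀ ∈ Ioc 0 c)
    (hD : ∀ x ∈ Ioc 0 x₀, |ψ x - (partialSol a p N).eval x| ≤ D * x ^ (N + 1)) :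
    ∃ δ ∈ Ioo 0 p, δ ≤ c ∧ ∃ φ v : ℝ → ℝ, ContDiffOn ℝ (⊤ : ℕ∞) φ (Ioo (-δ) δ) ∧
      (∀ x ∈ Ioo 0 δ, φ x = ψ x) ∧ ContinuousAt v 0 ∧
      (∀ x, φ x = (partialSol a p (N + 1)).eval x + x ^ (N + 2) * v x) ∧
      ∀ x ∈ Ioo (-δ) δ, x ≠ 0 → HasDerivAt φ (rhs a x (φ x) / ((p + x) * x)) x := by
  set b := p / 2 with hb
  have hb0 : 0 < b := by positivity
  set D' := |D| + |solCoeff a p (N + 1)| with hD'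
  set S := (D' + 1) / b with hS
  have hD0 : 0 ≤ D' := by positivity
  have hS0 : 0 < S := by positivity
  set μ := (N + 1 - a 0 1 / p : ℝ) with hμ
  have hμ0 : 0 < μ := by
    rw [hμ, sub_pos, div_lt_iff₀ hp]; linarith
  have hG := contDiffOn_remainderRhs (a := a) (p := p) (N := N) S (b := b) (by linarith)
  obtain ⟨δ, hδ, v, hv1, hv2, hv3, -⟩ := exists_briotBouquet_solution hμ0 hb0 le_rfl hG
  have h00 : (0 : ℝ) ∈ Icc (0 : ℝ) 0 := ⟨le_rfl, le_rfl⟩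
  replace hv1 := hv1 0 h00
  replace hv2 := hv2 0 h00
  replace hv3 := hv3 0 h00
  simp only at hv3
  have hdb := hδ.2
  set e := min (δ / 2) x₀ with he
  have he0 : 0 < e := lt_min (by linarith [hδ.1]) hx₀.1
  have heδ : e < δ := (min_le_left _ _).trans_lt (by linarith [hδ.1])
  have hex : e ≤ x₀ := min_le_right _ _
  set φ := fun x => (partialSol a p (N + 1)).eval x + S * x ^ (N + 1) * (x * v 0 x) with hφ
  have hsub : Ioo (-e) e ⊆ Ioo (-δ) δ := Ioo_subset_Ioo (by linarith) heδ.le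
  refine ⟨e, ⟨he0, by linarith⟩, hex.trans hx₀.2, φ, fun x => S * v 0 x, ?_, ?_, ?_, ?_, ?_⟩
  · have h1 : ContDiff ℝ (⊤ : ℕ∞) fun x => (partialSol a p (N + 1)).eval x :=
      contDiff_eval _
    have h2 := hv2.mono hsub
    simp only [hφ]
    fun_prop
  · obtain ⟨K, hK⟩ := (hG.of_le (m := 1) (by exact_mod_cast le_top)).exists_lipschitzOnWith
      one_ne_zero (((convex_Icc (0 : ℝ) 0)).prod ((convex_Icc (-b) b).prod (convex_Icc (-b) b)))
      (isCompact_Icc.prod (isCompact_Icc.prod isCompact_Icc))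
    have huniq := briotBouquet_unique hμ0 (c := e) (a := b) (K := K)
      (G := fun x y => remainderRhs a p N S x y) (y := fun x => x * v 0 x)
      (z := fun x => (ψ x - (partialSol a p (N + 1)).eval x) / (S * x ^ (N + 1))) ?_ ?_ ?_ ?_ ?_
    · intro x hx
      have h1 := huniq x ⟨hx.1, hx.2.le⟩
      have := hx.1.ne'
      simp only [hφ, h1]
      field_simp
      ring
    · intro x hx y hy z hz
      have := hK (x := ((0 : ℝ), x, y)) ⟨h00, ⟨by linarith [hx.1], by linarith [hx.2]⟩, hy⟩
        (y := ((0 : ℝ), x, z)) ⟨h00, ⟨by linarith [hx.1], by linarith [hx.2]⟩, hz⟩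
      simpa [Prod.edist_eq] using this
    · intro x hx
      have := hv3 x ⟨by linarith [hx.1], by linarith [hx.2]⟩
      rwa [show x * v 0 x / x = v 0 x from mul_div_cancel_left₀ _ hx.1.ne']
    · intro x hx
      exact hasDerivAt_remainder ha hl hp hS0 hx.1.ne' (by linarith [hx.1])
        (h x ⟨hx.1, hx.2.trans (hex.trans hx₀.2)⟩)
    · intro x hx
      have := abs_le.1 (hv1 x ⟨by linarith [hx.1], by linarith [hx.2]⟩)
      constructor <;> linarith
    · intro x hx
      have hx0 := hx.1
      have h1 := hD x ⟨hx.1, hx.2.trans hex⟩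
      have h2 : |ψ x - (partialSol a p (N + 1)).eval x| ≤ D' * x ^ (N + 1) := by
        rw [partialSol_succ, eval_add, eval_mul, eval_C, eval_pow, eval_X]
        have h3 : ψ x - ((partialSol a p N).eval x + solCoeff a p (N + 1) * x ^ (N + 1)) =
          (ψ x - (partialSol a p N).eval x) + -(solCoeff a p (N + 1) * x ^ (N + 1)) := by ring
        rw [h3]
        refine (abs_add_le _ _).trans ?_
        rw [abs_neg, abs_mul, abs_of_pos (pow_pos hx0 _), hD']
        have h4 : D * x ^ (N + 1) ≤ |D| * x ^ (N + 1) := by gcongr; exact le_abs_self D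
        linarith
      refine abs_le.1 ?_
      rw [abs_div, abs_of_pos (show 0 < S * x ^ (N + 1) by positivity),
        div_le_iff₀ (by positivity)]
      refine h2.trans ?_
      have h5 : b * S = D' + 1 := by rw [hS]; field_simp
      rw [← mul_assoc, h5]
      gcongr
      linarith
  · have : ContinuousAt (v 0) 0 :=
      (hv2.continuousOn).continuousAt (Ioo_mem_nhds (by linarith [hδ.1]) hδ.1)
    exact continuousAt_const.mul this
  · intro x
    simp only [hφ]
    ring
  · intro x hx hx0
    refine hasDerivAt_of_remainder ha hl hp hS0 hx0 (by linarith [hx.1]) ?_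
    have := hv3 x (hsub hx)
    rwa [show x * v 0 x / x = v 0 x from mul_div_cancel_left₀ _ hx0]

end

section
open Polynomial

/-- `Q` dominates `P` coefficientwise. -/
def Majorizes (Q P : ℝ[X]) : Prop := ∀ m, |P.coeff m| ≤ Q.coeff m

lemma Majorizes.nonneg {P Q : ℝ[X]} (h : Majorizes Q P) (m : ℕ) : 0 ≤ Q.coeff m :=
  (abs_nonneg _).trans (h m)

lemma Majorizes.add {P Q P' Q' : ℝ[X]} (h : Majorizes Q P) (h' : Majorizes Q' P') :
    Majorizes (Q + Q') (P + P') := fun m => by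
  rw [coeff_add, coeff_add]
  exact (abs_add_le _ _).trans (add_le_add (h m) (h' m))

lemma Majorizes.mul {P Q P' Q' : ℝ[X]} (h : Majorizes Q P) (h' : Majorizes Q' P') :
    Majorizes (Q * Q') (P * P') := fun m => by
  rw [coeff_mul, coeff_mul]
  refine (Finset.abs_sum_le_sum_abs _ _).trans (Finset.sum_le_sum fun i _ => ?_)
  rw [abs_mul]
  exact mul_le_mul (h _) (h' _) (abs_nonneg _) (h.nonneg _)

lemma majorizes_self {P : ℝ[X]} (h : ∀ m, 0 ≤ P.coeff m) : Majorizes P P := fun m => by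
  rw [abs_of_nonneg (h m)]

lemma majorizes_cubic {b d : ℕ → ℝ} (h : ∀ i ≤ 3, |b i| ≤ d i) :
    Majorizes (cubic d) (cubic b) := fun m => by
  rw [coeff_cubic, coeff_cubic]
  split_ifs with hm
  · exact h m hm
  · simp

/-- A polynomial starting at order `k` and dominated from there on by `Q` is at most
`(|x| / y) ^ k * Q(y)` at `x`. -/
lemma abs_eval_le_of_majorized {P Q : ℝ[X]} {k : ℕ} (h0 : ∀ m < k, P.coeff m = 0)
    (h : ∀ m, k ≤ m → |P.coeff m| ≤ Q.coeff m) (hQ : ∀ m, 0 ≤ Q.coeff m) {x y : ℝ} (hy : 0 < y)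
    (hxy : |x| ≤ y) : |P.eval x| ≤ (|x| / y) ^ k * Q.eval y := by
  set N := max P.natDegree Q.natDegree + 1
  have hP : P.natDegree < N := Nat.lt_succ_of_le (le_max_left _ _)
  have hQN : Q.natDegree < N := Nat.lt_succ_of_le (le_max_right _ _)
  rw [eval_eq_sum_range' hP, eval_eq_sum_range' hQN, Finset.mul_sum]
  refine (Finset.abs_sum_le_sum_abs _ _).trans (Finset.sum_le_sum fun m _ => ?_)
  rw [abs_mul, abs_pow]
  have hr : 0 ≤ |x| / y := by positivity
  rcases lt_or_ge m k with hm | hm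
  · rw [h0 m hm, abs_zero, zero_mul]
    have := hQ m
    positivity
  · have h1 : |x| ^ m = (|x| / y) ^ k * ((|x| / y) ^ (m - k) * y ^ m) := by
      rw [← mul_assoc, ← pow_add, Nat.add_sub_cancel' hm, div_pow]
      field_simp
    have h2 : (|x| / y) ^ (m - k) * y ^ m ≤ y ^ m :=
      mul_le_of_le_one_left (by positivity) (pow_le_one₀ hr ((div_le_one hy).2 hxy))
    rw [h1]
    calc |P.coeff m| * ((|x| / y) ^ k * ((|x| / y) ^ (m - k) * y ^ m))
        ≤ Q.coeff m * ((|x| / y) ^ k * y ^ m) := by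
          refine mul_le_mul (h m hm) (by gcongr) (by positivity) (hQ m)
      _ = _ := by ring

variable {a : ℕ → ℕ → ℝ} {p : ℝ} {n : ℕ}

/-- The part of the right-hand side that contributes to the tail of the defect. -/
def tailPart (b : ℕ → ℕ → ℝ) (T : ℝ[X]) : ℝ[X] :=
  cubic (b · 1) * T + cubic (b · 2) * (T * T) + cubic (b · 3) * (T * (T * T))

/-- Coefficients dominating those of `SeriesBase`, with the terms `a 0 1` and `a 1 1` dropped. -/
def tailBound : ℕ → ℕ → ℝ
  | 0, 1 => 0
  | 1, 1 => 0
  | _, 1 => 1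
  | _, 2 => 3
  | _, _ => 1

/-- The coefficients `a` with the terms `a 0 1` and `a 1 1` dropped. -/
def tailCoef (a : ℕ → ℕ → ℝ) : ℕ → ℕ → ℝ
  | 0, 1 => 0
  | 1, 1 => 0
  | i, j => a i j

lemma SeriesBase.majorizes_tailPart (hB : SeriesBase a p) {T : ℝ[X]} (hT : ∀ m, 0 ≤ T.coeff m) :
    Majorizes (tailPart tailBound T) (tailPart (tailCoef a) T) := by
  obtain ⟨-, a01, a02, a03, a11, a12, a13, a21, a22, a23, a31, a32, a33, -⟩ := hB
  have hT' := majorizes_self hT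
  refine (((majorizes_cubic ?_).mul hT').add ((majorizes_cubic ?_).mul (hT'.mul hT'))).add
    ((majorizes_cubic ?_).mul (hT'.mul (hT'.mul hT'))) <;>
  · intro i hi
    simp only [mem_Ioo] at *
    interval_cases i <;> norm_num [tailBound, tailCoef, abs_le] <;> constructor <;> linarith

lemma coeff_defect_tail {n : ℕ} (hn : 3 ≤ n) {m : ℕ} (hm : n + 2 ≤ m) :
    (Stmt0.defect a p (partialSol a p n)).coeff m =
      (tailPart (tailCoef a) (partialSol a p n)).coeff m := by
  obtain ⟨m, rfl⟩ : ∃ k, m = k + 3 := ⟨m - 3, by omega⟩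
  set T := partialSol a p n with hT
  have h1 : ∀ j, n < j → T.coeff j = 0 := fun j hj => by
    rw [hT, coeff_partialSol, if_neg (by omega)]
  have h2 : ((C p + X) * X * derivative T).coeff (m + 3) = 0 := by
    rw [show (C p + X) * X * derivative T = C p * (X * derivative T) + X * (X * derivative T) by
      ring, coeff_add, coeff_C_mul, coeff_X_mul, coeff_X_mul, coeff_X_mul, coeff_derivative,
      coeff_derivative, h1 (m + 2 + 1) (by omega), h1 (m + 1 + 1) (by omega)]
    ring
  have h3 : (cubic (a · 0)).coeff (m + 3) = 0 := by
    rw [coeff_cubic, if_neg (by omega)]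
  rw [Stmt0.defect, tailPart, coeff_sub, h2, coeff_add, coeff_add, coeff_add, h3, coeff_add,
    coeff_add, sq, show T ^ 3 = T * (T * T) by ring]
  simp only [coeff_cubic_mul, tailCoef]
  rw [h1 (m + 3) (by omega), h1 (m + 2) (by omega)]
  ring

/-- The defect of a partial sum is its leading term up to a dominated tail. -/
lemma SeriesBase.abs_defect_partialSol_le (hB : SeriesBase a p) (ha : a 0 0 = 0) {n : ℕ} (hn : 3 ≤ n)
    (hl : ∀ j, 1 ≤ j → j ≤ n → a 0 1 - p * j ≠ 0) (ht : ∀ j ≤ n, 0 ≤ solCoeff a p j) {x y : ℝ}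
    (hy : 0 < y) (hxy : |x| ≤ y) :
    |(Stmt0.defect a p (partialSol a p n)).eval x + solNum a p (n + 1) * x ^ (n + 1)| ≤
      (|x| / y) ^ (n + 2) * (tailPart tailBound (partialSol a p n)).eval y := by
  have hT : ∀ m, 0 ≤ (partialSol a p n).coeff m := fun m => by
    rw [coeff_partialSol]
    split_ifs with h
    · exact ht m h
    · exact le_rfl
  have hM := hB.majorizes_tailPart hT
  have := abs_eval_le_of_majorized
    (P := Stmt0.defect a p (partialSol a p n) + C (solNum a p (n + 1)) * X ^ (n + 1))
    (Q := tailPart tailBound (partialSol a p n)) (k := n + 2) ?_ ?_ hM.nonneg hy hxy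
  · simpa using this
  · intro m hm
    rw [coeff_add, coeff_C_mul, coeff_X_pow]
    rcases Nat.lt_succ_iff_lt_or_eq.1 hm with h | rfl
    · rw [coeff_defect_partialSol ha hl m (by omega), if_neg (by omega)]
      ring
    · rw [if_pos rfl, solNum, Nat.add_sub_cancel]
      ring
  · intro m hm
    rw [coeff_add, coeff_C_mul, coeff_X_pow, if_neg (by omega), mul_zero, add_zero,
      coeff_defect_tail hn hm]
    exact hM m

lemma eval_tailPart_tailBound (T : ℝ[X]) (y : ℝ) :
    (tailPart tailBound T).eval y = (y ^ 2 + y ^ 3) * T.eval y +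
      (1 + y + y ^ 2 + y ^ 3) * (3 * T.eval y ^ 2 + T.eval y ^ 3) := by
  simp only [tailPart, eval_add, eval_mul, eval_cubic, tailBound]
  ring

end

section
open Polynomial

/-- A positive log-convex sequence is bounded on an interval by its values at the endpoints. -/
lemma le_add_of_logConvex {b : ℕ → ℝ} {m n : ℕ} (hpos : ∀ j, m ≤ j → j ≤ n → 0 < b j)
    (hb : ∀ j, m ≤ j → j + 2 ≤ n → b (j + 1) ^ 2 ≤ b j * b (j + 2)) {i : ℕ} (hmi : m ≤ i)
    (hin : i ≤ n) : b i ≤ b m + b n := by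
  have key : ∀ k, i ≤ k → k ≤ n → b i ≤ b m ∨ ∀ j, i ≤ j → j < k → b j ≤ b (j + 1) := by
    by_cases h : b i ≤ b m
    · exact fun k _ _ => Or.inl h
    intro k hk hkn
    right
    have hex : ∃ j, m ≤ j ∧ j < i ∧ b j ≤ b (j + 1) := by
      by_contra! hcon
      refine h ?_
      have : ∀ j, m ≤ j → j ≤ i → b j ≤ b m := by
        intro j hj
        induction j, hj using Nat.le_induction with
        | base => exact fun _ => le_rfl
        | succ j hj ih => exact fun hji => (hcon j hj (by omega)).le.trans (ih (by omega))
      exact this i hmi le_rfl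
    obtain ⟨j₀, hj₀m, hj₀i, hj₀⟩ := hex
    have : ∀ j, j₀ ≤ j → j < k → b j ≤ b (j + 1) := by
      intro j hj
      induction j, hj using Nat.le_induction with
      | base => exact fun _ => hj₀
      | succ j hj ih =>
        intro hjk
        have h1 := ih (by omega)
        have h2 := hb j (by omega) (by omega)
        have h3 := hpos (j + 1) (by omega) (by omega)
        have h4 := hpos (j + 2) (by omega) (by omega)
        by_contra! h5
        nlinarith
    exact fun j hj hjk => this j (by omega) hjk
  have hm := hpos m le_rfl (hmi.trans hin)
  have hn := hpos n (hmi.trans hin) le_rfl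
  rcases key n hin le_rfl with h | h
  · linarith
  · have : ∀ j, i ≤ j → j ≤ n → b i ≤ b j := by
      intro j hj
      induction j, hj using Nat.le_induction with
      | base => exact fun _ => le_rfl
      | succ j hj ih => exact fun hjn => (ih (by omega)).trans (h j hj (by omega))
    linarith [this n hin le_rfl]

variable {a : ℕ → ℕ → ℝ} {p : ℝ} {n : ℕ}

lemma SeriesGrowth.le_succ_of_one_le (hB : SeriesBase a p) (h : SeriesGrowth a p n) :
    ∀ j, 1 ≤ j → j + 1 ≤ n → solCoeff a p j ≤ solCoeff a p (j + 1) := by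
  intro j hj
  induction j, hj using Nat.le_induction with
  | base =>
    intro _
    have := hB.t1.2
    have := hB.t2.1
    norm_num
    linarith
  | succ j hj ih =>
    intro hn
    have h1 := h.logConvex j hj (by omega)
    have h2 := ih (by omega)
    have h3 := h.pos (j + 1) (by omega) (by omega)
    have h4 := h.pos (j + 2) (by omega) (by omega)
    by_contra! h5
    rw [show j + 1 + 1 = j + 2 from rfl] at h5
    nlinarith

lemma SeriesGrowth.choose_mul_le (h : SeriesGrowth a p n) (hl : ∀ j : ℕ, j ≤ n → 0 < a 0 1 - p * j)
    (hp : 0 < p) (hK : a 0 1 < p * (n + 1)) {j : ℕ} (hj : 17 ≤ j) (hjn : j + 1 ≤ n) :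
    n.choose j * (solCoeff a p j * p ^ j) ≤
      n.choose (j + 1) * (solCoeff a p (j + 1) * p ^ (j + 1)) := by
  have h1 := h.sharp j hj hjn
  have hl' := hl (j + 1) hjn
  rw [solNum_succ_eq hl'] at h1
  have h2 : (n.choose (j + 1) : ℝ) * (j + 1) = n.choose j * (n - j) := by
    have := Nat.choose_succ_right_eq n j
    have h' : ((n - j : ℕ) : ℝ) = n - j := by rw [Nat.cast_sub (by omega)]
    rw [← h']
    exact_mod_cast this
  have h3 := h.pos (j + 1) (by omega) hjn
  have h4 : (j + 1 : ℝ) * solCoeff a p j ≤ p * (n - j) * solCoeff a p (j + 1) := by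
    refine h1.trans (mul_le_mul_of_nonneg_right ?_ h3.le)
    push_cast
    nlinarith
  have h5 : (0 : ℝ) < j + 1 := by positivity
  have h6 : 0 ≤ (n.choose j : ℝ) * p ^ j := by positivity
  refine le_of_mul_le_mul_right ?_ h5
  calc (n.choose j : ℝ) * (solCoeff a p j * p ^ j) * (j + 1)
      = (n.choose j : ℝ) * p ^ j * ((j + 1) * solCoeff a p j) := by ring
    _ ≤ (n.choose j : ℝ) * p ^ j * (p * (n - j) * solCoeff a p (j + 1)) := by gcongr
    _ = (n.choose j * (n - j)) * (solCoeff a p (j + 1) * p ^ (j + 1)) := by ring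
    _ = _ := by rw [← h2]; ring

lemma SeriesGrowth.le_choose_mul (h : SeriesGrowth a p n) (hl : ∀ j : ℕ, j ≤ n → 0 < a 0 1 - p * j)
    (hp : 0 < p) (hK : p * n < a 0 1) {j : ℕ} (hj : 3 ≤ j) (hjn : j + 1 ≤ n) :
    n.choose (j + 2) * (solCoeff a p (j + 1) * p ^ (j + 1)) ≤
      n.choose (j + 1) * (solCoeff a p j * p ^ j) := by
  have h1 := h.upper j hj hjn
  have hl' := hl (j + 1) hjn
  rw [solNum_succ_eq hl'] at h1
  have h2 : (n.choose (j + 2) : ℝ) * (j + 2) = n.choose (j + 1) * (n - (j + 1)) := by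
    have := Nat.choose_succ_right_eq n (j + 1)
    have h' : ((n - (j + 1) : ℕ) : ℝ) = n - (j + 1) := by
      rw [Nat.cast_sub (by omega)]; push_cast; ring
    rw [← h', show (j : ℝ) + 2 = (j + 1 + 1 : ℕ) by push_cast; ring]
    exact_mod_cast this
  have h3 := h.pos (j + 1) (by omega) hjn
  have h3' := h.pos j (by omega) (by omega)
  have h4 : p * (n - (j + 1)) * solCoeff a p (j + 1) ≤ (j + 2 : ℝ) * solCoeff a p j := by
    refine le_trans (mul_le_mul_of_nonneg_right ?_ h3.le) (h1.trans
      (mul_le_mul_of_nonneg_right ?_ h3'.le))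
    · push_cast; nlinarith
    · linarith
  have h5 : (0 : ℝ) < j + 2 := by positivity
  have h6 : 0 ≤ (n.choose (j + 1) : ℝ) * p ^ j := by positivity
  refine le_of_mul_le_mul_right ?_ h5
  calc (n.choose (j + 2) : ℝ) * (solCoeff a p (j + 1) * p ^ (j + 1)) * (j + 2)
      = (n.choose (j + 2) * (j + 2)) * (solCoeff a p (j + 1) * p ^ (j + 1)) := by ring
    _ = (n.choose (j + 1) : ℝ) * p ^ j * (p * (n - (j + 1)) * solCoeff a p (j + 1)) := by
        rw [h2]; ring
    _ ≤ (n.choose (j + 1) : ℝ) * p ^ j * ((j + 2) * solCoeff a p j) := by gcongr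
    _ = _ := by ring

/-- A lower bound for the last positive term of the formal solution at `x = p`. -/
def barrierHeight : ℝ := 1 / (2 ^ 19 * (Nat.factorial 17 : ℕ))

lemma barrierHeight_pos : 0 < barrierHeight := by
  unfold barrierHeight
  positivity

lemma barrierHeight_le : barrierHeight ≤ 1 / 1000 := by
  unfold barrierHeight
  rw [div_le_div_iff_of_pos_left one_pos (by positivity) (by norm_num)]
  norm_num [Nat.factorial]

lemma SeriesGrowth.barrierHeight_lt (hB : SeriesBase a p) (h : SeriesGrowth a p n)
    (hl : ∀ j : ℕ, j ≤ n → 0 < a 0 1 - p * j) (hp : 0 < p) (hn : 34 ≤ n) (hK : a 0 1 < p * (n + 1))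
    (hnp : 1 ≤ p * n) : barrierHeight < solCoeff a p n * p ^ n := by
  have h1 : ∀ j, 17 ≤ j → j ≤ n →
      (n.choose 17 : ℝ) * (solCoeff a p 17 * p ^ 17) ≤ n.choose j * (solCoeff a p j * p ^ j) := by
    intro j hj
    induction j, hj using Nat.le_induction with
    | base => exact fun _ => le_rfl
    | succ j hj ih =>
      exact fun hjn => (ih (by omega)).trans (h.choose_mul_le hl hp hK hj hjn)
  have h2 := h1 n (by omega) le_rfl
  rw [Nat.choose_self, Nat.cast_one, one_mul] at h2
  have h3 : ∀ j, 1 ≤ j → j ≤ n → solCoeff a p 1 ≤ solCoeff a p j := by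
    intro j hj
    induction j, hj using Nat.le_induction with
    | base => exact fun _ => le_rfl
    | succ j hj ih =>
      exact fun hjn => (ih (by omega)).trans (h.le_succ_of_one_le hB j hj hjn)
  have h4 := h3 17 (by norm_num) (by omega)
  have h5 := hB.t1.1
  have h6 : ((n + 1 - 17 : ℕ) ^ 17 : ℝ) / (Nat.factorial 17 : ℕ) ≤ n.choose 17 := by
    exact_mod_cast Nat.pow_le_choose (α := ℝ) 17 n
  have h7 : (n : ℝ) / 2 ≤ (n + 1 - 17 : ℕ) := by
    rw [Nat.cast_sub (by omega)]
    have : (34 : ℝ) ≤ n := by exact_mod_cast hn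
    push_cast
    linarith
  have hF : (0 : ℝ) < (Nat.factorial 17 : ℕ) := by positivity
  have h8 : ((1 : ℝ) / 2) ^ 17 / (Nat.factorial 17 : ℕ) ≤ n.choose 17 * p ^ 17 := by
    calc ((1 : ℝ) / 2) ^ 17 / (Nat.factorial 17 : ℕ)
        ≤ (n / 2 * p) ^ 17 / (Nat.factorial 17 : ℕ) := by gcongr; linarith
      _ = (n / 2 : ℝ) ^ 17 / (Nat.factorial 17 : ℕ) * p ^ 17 := by ring
      _ ≤ ((n + 1 - 17 : ℕ) : ℝ) ^ 17 / (Nat.factorial 17 : ℕ) * p ^ 17 := by gcongr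
      _ ≤ _ := by gcongr
  refine lt_of_lt_of_le ?_ h2
  calc barrierHeight < ((1 : ℝ) / 2) ^ 17 / (Nat.factorial 17 : ℕ) * 0.315 := by
        unfold barrierHeight
        rw [show (1 : ℝ) / (2 ^ 19 * (Nat.factorial 17 : ℕ)) =
          (1 / 2) ^ 19 / (Nat.factorial 17 : ℕ) by field_simp, div_mul_eq_mul_div]
        gcongr
        norm_num
    _ ≤ n.choose 17 * p ^ 17 * solCoeff a p 17 := by
        gcongr
        linarith
    _ = _ := by ring

end

section
open Polynomial

variable {a : ℕ → ℕ → ℝ} {p : ℝ} {n : ℕ}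

lemma SeriesGrowth.pow_le_of_half (hB : SeriesBase a p) (h : SeriesGrowth a p (n + 1))
    (hl : ∀ j : ℕ, j ≤ n + 1 → 0 < a 0 1 - p * j) (hp : 0 < p) (hn : 34 ≤ n) :
    solCoeff a p n * (p / 2) ^ n ≤ 6 * p ^ 3 := by
  have hK : p * (n + 1 : ℕ) < a 0 1 := by linarith [hl (n + 1) le_rfl]
  have h1 : ∀ j, 3 ≤ j → j ≤ n → ((n + 1).choose (j + 1) : ℝ) * (solCoeff a p j * p ^ j) ≤
      (n + 1).choose 4 * (solCoeff a p 3 * p ^ 3) := by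
    intro j hj
    induction j, hj using Nat.le_induction with
    | base => exact fun _ => le_rfl
    | succ j hj ih =>
      exact fun hjn => (h.le_choose_mul hl hp hK hj (by omega)).trans (ih (by omega))
  have h2 := h1 n (by omega) le_rfl
  rw [Nat.choose_self, Nat.cast_one, one_mul] at h2
  have h3 : ((n + 1).choose 4 : ℝ) ≤ 2 ^ (n + 1) := by
    exact_mod_cast Nat.choose_le_two_pow (n + 1) 4
  have h4 := hB.t3.2
  have h5 := h.pos 3 (by norm_num) (by omega)
  have h6 : ((n + 1).choose 4 : ℝ) * (solCoeff a p 3 * p ^ 3) ≤ 2 ^ (n + 1) * (3 * p ^ 3) := by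
    gcongr
    linarith
  rw [div_pow, ← mul_div_assoc, div_le_iff₀ (by positivity)]
  calc _ ≤ _ := h2.trans h6
    _ = _ := by ring

set_option maxHeartbeats 400000 in
/-- On the relevant range of arguments the partial sums are of size `O(p)`. -/
lemma SeriesGrowth.eval_partialSol_le (hB : SeriesBase a p) (h : SeriesGrowth a p (n + 1))
    (hl : ∀ j : ℕ, j ≤ n + 1 → 0 < a 0 1 - p * j) (hp : 0 < p) (hp' : p < 0.01) (hn : 34 ≤ n)
    (hK : a 0 1 < p * (n + 1 + 1)) {y : ℝ} (hy : y ∈ Icc (p / 2) p)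
    (hyn : solCoeff a p (n + 1) * y ^ (n + 1) ≤ 1 / 8 ∨ y = p / 2) :
    (partialSol a p n).eval y ≤ 40 * p := by
  obtain ⟨hy1, hy2⟩ := hy
  have hy0 : 0 < y := by linarith
  have hKn : p * (n + 1) < a 0 1 := by
    have := hl (n + 1) le_rfl
    push_cast at this
    linarith
  have hK1 := hB.a01.1
  have hK2 := hB.a01.2
  have hnR : (34 : ℝ) ≤ n := by exact_mod_cast hn
  have hnp : 1 ≤ p * (n + 1) := by linarith
  set b : ℕ → ℝ := fun j => solCoeff a p j * y ^ j with hb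
  have hbpos : ∀ j, 1 ≤ j → j ≤ n + 1 → 0 < b j := fun j h1 h2 => by
    have := h.pos j h1 h2
    positivity
  have hblog : ∀ j, 1 ≤ j → j + 2 ≤ n + 1 → b (j + 1) ^ 2 ≤ b j * b (j + 2) := fun j h1 h2 => by
    have h3 := h.logConvex j h1 h2
    calc b (j + 1) ^ 2 = solCoeff a p (j + 1) ^ 2 * (y ^ j * y ^ (j + 2)) := by
          simp only [hb]; ring
      _ ≤ solCoeff a p j * solCoeff a p (j + 2) * (y ^ j * y ^ (j + 2)) := by gcongr
      _ = _ := by simp only [hb]; ring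
  obtain ⟨m, rfl⟩ : ∃ m, n = m + 3 := ⟨n - 3, by omega⟩
  have hmid : ∀ j, 3 ≤ j → j ≤ m + 2 → b j ≤ b 3 + b (m + 2) := fun j h1 h2 =>
    le_add_of_logConvex (fun j h1 h2 => hbpos j (by omega) (by omega))
      (fun j h1 h2 => hblog j (by omega) (by omega)) h1 h2
  have hsum : (partialSol a p (m + 3)).eval y ≤ b 1 + b 2 + m * (b 3 + b (m + 2)) + b (m + 3) := by
    rw [eval_partialSol, Finset.sum_range_succ]
    change ∑ j ∈ Finset.range (m + 3), b j + b (m + 3) ≤ _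
    rw [add_comm m 3, Finset.sum_range_add]
    have h1 : ∑ j ∈ Finset.range m, b (3 + j) ≤ ∑ _j ∈ Finset.range m, (b 3 + b (m + 2)) :=
      Finset.sum_le_sum fun j hj => hmid _ (by omega) (by
        have := Finset.mem_range.1 hj; omega)
    rw [Finset.sum_const, Finset.card_range, nsmul_eq_mul] at h1
    have h2 : ∑ j ∈ Finset.range 3, b j = b 1 + b 2 := by
      simp [Finset.sum_range_succ, hb, solCoeff]
    linarith
  have hb1 : b 1 ≤ 0.32 * p := by
    have := hB.t1.2
    have := h.pos 1 le_rfl (by omega)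
    simp only [hb, pow_one]
    refine mul_le_mul ?_ hy2 hy0.le (by norm_num)
    linarith
  have hb2 : b 2 ≤ 0.9 * p ^ 2 := by
    have := hB.t2.2
    have := h.pos 2 (by norm_num) (by omega)
    simp only [hb]
    gcongr
    linarith
  have hb3 : b 3 ≤ 3 * p ^ 3 := by
    have := hB.t3.2
    have := h.pos 3 (by norm_num) (by omega)
    simp only [hb]
    gcongr
    linarith
  push_cast at *
  have hmb3 : m * b 3 ≤ 4 * p ^ 2 := by
    have h0 : p * m ≤ 1.1525 := by nlinarith
    calc m * b 3 ≤ m * (3 * p ^ 3) := by gcongr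
      _ = (p * m) * (3 * p ^ 2) := by ring
      _ ≤ 1.1525 * (3 * p ^ 2) := by gcongr
      _ ≤ _ := by nlinarith [sq_nonneg p]
  have hpos3 := h.pos (m + 3) (by omega) (by omega)
  have hpos2 := h.pos (m + 2) (by omega) (by omega)
  have hpos4 := h.pos (m + 3 + 1) (by omega) (by omega)
  have hlast : m * b (m + 2) ≤ 5 * b (m + 3) := by
    have h1 := h.lower (m + 2) (by omega) (by omega)
    have h2 : solNum a p (m + 2 + 1) = _ := solNum_succ_eq (hl (m + 2 + 1) (by omega))
    rw [h2] at h1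
    push_cast at h1
    have h3 : (m + 2 : ℝ) * solCoeff a p (m + 2) ≤ 2 * p * solCoeff a p (m + 3) := by
      refine le_trans (mul_le_mul_of_nonneg_right ?_ hpos2.le)
        (h1.trans (mul_le_mul_of_nonneg_right ?_ hpos3.le))
      · linarith
      · nlinarith
    have key : ∀ s t : ℝ, 0 < s → 0 < t → (m + 2 : ℝ) * s ≤ 2 * p * t →
        m * (s * y ^ (m + 2)) ≤ 5 * (t * y ^ (m + 3)) := fun s t hs ht h => by
      have h6 : m * s ≤ 5 * (t * y) := by nlinarith [mul_pos ht hy0]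
      calc m * (s * y ^ (m + 2)) = (m * s) * y ^ (m + 2) := by ring
        _ ≤ (5 * (t * y)) * y ^ (m + 2) := by gcongr
        _ = _ := by ring
    exact key _ _ hpos2 hpos3 h3
  have hbn : b (m + 3) ≤ p := by
    rcases hyn with hyn | rfl
    · have h1 := h.lower (m + 3) (by omega) (by omega)
      have h2 : solNum a p (m + 3 + 1) = _ := solNum_succ_eq (hl (m + 3 + 1) (by omega))
      rw [h2] at h1
      push_cast at h1
      have h3 : (1 / (2 * p)) * solCoeff a p (m + 3) ≤ p * solCoeff a p (m + 3 + 1) := by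
        refine le_trans (mul_le_mul_of_nonneg_right ?_ hpos3.le)
          (h1.trans (mul_le_mul_of_nonneg_right ?_ hpos4.le))
        · rw [div_le_iff₀ (by positivity)]; nlinarith
        · nlinarith
      have key : ∀ s t : ℝ, 0 < s → 0 < t → (1 / (2 * p)) * s ≤ p * t →
          t * y ^ (m + 3 + 1) ≤ 1 / 8 → s * y ^ (m + 3) ≤ p := fun s t hs ht h h' => by
        have h4 : s ≤ 4 * p * (t * y) := by
          have h5 : s = 2 * p * ((1 / (2 * p)) * s) := by field_simp
          nlinarith [mul_pos ht hp, mul_pos (mul_pos ht hp) hp, mul_pos (mul_pos ht hp) hy0]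
        calc s * y ^ (m + 3) ≤ (4 * p * (t * y)) * y ^ (m + 3) := by gcongr
          _ = 4 * p * (t * y ^ (m + 3 + 1)) := by ring
          _ ≤ 4 * p * (1 / 8) := by gcongr
          _ ≤ p := by linarith
      exact key _ _ hpos3 hpos4 h3 hyn
    · refine (h.pow_le_of_half hB hl hp (by omega)).trans ?_
      have : p * p ≤ 0.01 * 0.01 := by gcongr
      nlinarith
  nlinarith

end

section
open Polynomial

variable {a : ℕ → ℕ → ℝ} {p : ℝ} {n : ℕ}

lemma add_mul_pow_eq_rhs_sub (x τ u c dτ N : ℝ) :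
    rhs a x (τ + u) - (p + x) * (x * dτ + N * u) =
      (rhs a x τ - (p + x) * (x * dτ) + c * u) - N * x * u +
        u * ((cubic (a · 1)).eval x - c - p * N + 2 * (cubic (a · 2)).eval x * τ +
          3 * (cubic (a · 3)).eval x * τ ^ 2) +
        u ^ 2 * ((cubic (a · 2)).eval x + 3 * (cubic (a · 3)).eval x * τ) +
        u ^ 3 * (cubic (a · 3)).eval x := by
  rw [rhs, rhs]
  ring

lemma abs_eval_cubic_sub_le {b : ℕ → ℝ} {x : ℝ} (hx : 0 < x) (hx1 : x ≤ 1 / 1000) (h1 : |b 1| ≤ 3)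
    (h2 : |b 2| ≤ 3) (h3 : |b 3| ≤ 3) : |(cubic b).eval (-x) - b 0| ≤ 1 / 100 := by
  have e : ∀ i k, |b i| ≤ 3 → 1 ≤ k → |b i * (-x) ^ k| ≤ 3 * (1 / 1000) := fun i k hi hk => by
    rw [abs_mul, abs_pow, abs_neg, abs_of_pos hx]
    have : x ^ k ≤ x := pow_le_of_le_one hx.le (by linarith) (by omega)
    gcongr
    linarith
  have e1 := abs_le.1 (e 1 1 h1 le_rfl)
  have e2 := abs_le.1 (e 2 2 h2 (by norm_num))
  have e3 := abs_le.1 (e 3 3 h3 (by norm_num))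
  rw [pow_one] at e1
  rw [eval_cubic, abs_le]
  constructor <;> linarith

lemma SeriesBase.cubic_left_bounds (hB : SeriesBase a p) {x : ℝ} (hx : 0 < x) (hx1 : x ≤ 1 / 1000) :
    a 0 1 ≤ (cubic (a · 1)).eval (-x) ∧ (cubic (a · 2)).eval (-x) ∈ Icc 1.5 3 ∧
      (cubic (a · 3)).eval (-x) ∈ Icc 0.5 2 := by
  obtain ⟨-, a01, a02, a03, a11, a12, a13, a21, a22, a23, a31, a32, a33, -⟩ := hB
  rw [mem_Ioo] at a01 a02 a03 a11 a12 a13 a21 a22 a23 a31 a32 a33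
  have habs : ∀ y : ℝ, -3 ≤ y → y ≤ 3 → |y| ≤ 3 := fun y h1 h2 => abs_le.2 ⟨h1, h2⟩
  refine ⟨?_, ?_, ?_⟩
  · have hx2 : x ^ 2 ≤ x := by nlinarith
    have hx3 : x ^ 3 ≤ x := pow_le_of_le_one hx.le (by linarith) (by norm_num)
    have hx2' := pow_pos hx 2
    have hx3' := pow_pos hx 3
    rw [eval_cubic]
    have e1 : 2.7 * x ≤ a 1 1 * -x := by nlinarith
    have e2 : -x ≤ a 2 1 * (-x) ^ 2 := by rw [neg_sq]; nlinarith
    have e3 : -x ≤ a 3 1 * (-x) ^ 3 := by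
      rw [show a 3 1 * (-x) ^ 3 = -(a 3 1 * x ^ 3) by ring]; nlinarith
    linarith
  · have := abs_le.1 (abs_eval_cubic_sub_le (b := fun i => a i 2) hx hx1
      (habs (a 1 2) (by linarith) (by linarith)) (habs (a 2 2) (by linarith) (by linarith))
      (habs (a 3 2) (by linarith) (by linarith)))
    constructor <;> linarith
  · have := abs_le.1 (abs_eval_cubic_sub_le (b := fun i => a i 3) hx hx1
      (habs (a 1 3) (by linarith) (by linarith)) (habs (a 2 3) (by linarith) (by linarith))
      (habs (a 3 3) (by linarith) (by linarith)))
    constructor <;> linarith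

/-- Positivity of the defect of a partial sum of even degree to the left of the origin,
in terms of the size of the preceding partial sum. -/
lemma defect_pos_aux {A1 A2 A3 K τ u x N D : ℝ} (hx : 0 < x) (hu : 0 < u)
    (hA1 : K ≤ A1) (hA2 : A2 ∈ Icc 1.5 3) (hA3 : A3 ∈ Icc 0.5 2) (hτ : |τ| ≤ 80 * x)
    (hτ' : |τ| ≤ 1 / 100) (hN : 2000 ≤ N) (hD : |D| < N * x * u / 2) :
    0 < D + N * x * u + u * (A1 - K + 2 * A2 * τ + 3 * A3 * τ ^ 2) + u ^ 2 * (A2 + 3 * A3 * τ) +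
      u ^ 3 * A3 := by
  obtain ⟨hA2, hA2'⟩ := hA2
  obtain ⟨hA3, hA3'⟩ := hA3
  have h1 := abs_le.1 hτ
  have h2 := abs_le.1 hτ'
  have h3 := abs_lt.1 hD
  have h4 : 0 ≤ A2 + 3 * A3 * τ := by nlinarith
  have h5 : -(480 * x) ≤ 2 * A2 * τ := by nlinarith
  have h6 : 0 ≤ 3 * A3 * τ ^ 2 := by positivity
  have h7 : 0 ≤ u ^ 2 * (A2 + 3 * A3 * τ) := by positivity
  have h8 : 0 ≤ u ^ 3 * A3 := by positivity
  have h9 : u * (-(480 * x)) ≤ u * (A1 - K + 2 * A2 * τ + 3 * A3 * τ ^ 2) := by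
    gcongr
    linarith
  have h10 : u * (480 * x) ≤ N * x * u / 2 := by
    have := mul_pos hx hu
    nlinarith
  linarith

set_option maxHeartbeats 400000 in
/-- To the left of the origin a partial sum of even degree is a strict subsolution that climbs to a
height independent of `p`. -/
lemma SeriesBase.exists_right_barrier (hB : SeriesBase a p) (ha : a 0 0 = 0) (hn : Even (n + 1))
    (hl : ∀ j : ℕ, j ≤ n + 1 → 0 < a 0 1 - p * j) (hp : 0 < p) (hK : a 0 1 < p * (n + 1 + 1))
    (hpU : p ≤ barrierHeight / 10 ^ 6) :
    ∃ xe ∈ Ioo 0 p, barrierHeight / 2 ≤ (partialSol a p (n + 1)).eval (-xe) ∧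
      ∀ x ∈ Ioc 0 xe, 0 < (defect a p (partialSol a p (n + 1))).eval (-x) ∧
        |(partialSol a p (n + 1)).eval (-x)| ≤ 1 / 50 := by
  have hU := barrierHeight_pos
  have hU' := barrierHeight_le
  have hK1 := hB.a01.1
  have hK2 := hB.a01.2
  have hp1 : p ≤ 1 / 10 ^ 9 := by linarith
  have hN : 2000 ≤ (n : ℝ) + 1 := by
    by_contra! hcon
    have : p * (n + 1 + 1) ≤ 1 / 10 ^ 9 * 2001 := by gcongr; linarith
    linarith
  have hn' : 1999 ≤ n := by
    have : (1999 : ℝ) ≤ n := by linarith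
    exact_mod_cast this
  have hnp : 1 ≤ p * (n + 1) := by linarith
  have hG := hB.growth (n + 1) (by omega) hl
  have hlt := hG.barrierHeight_lt hB hl hp (by omega) (by push_cast; exact hK) (by push_cast; exact hnp)
  have hlne : ∀ j : ℕ, 1 ≤ j → j ≤ n → a 0 1 - p * j ≠ 0 := fun j _ hj => (hl j (by omega)).ne'
  have htpos := hG.pos (n + 1) (by omega) le_rfl
  have hsolNum : solNum a p (n + 1) = _ := solNum_succ_eq (hl (n + 1) le_rfl)
  have htn : ∀ j ≤ n, 0 ≤ solCoeff a p j := fun j hj => hG.nonneg (by omega)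
  have hT := fun y => hG.eval_partialSol_le (n := n) (y := y) hB hl hp (by linarith) (by omega) hK
  have hsucc : partialSol a p (n + 1) = partialSol a p n + C (solCoeff a p (n + 1)) * X ^ (n + 1) :=
    partialSol_succ n
  generalize solCoeff a p (n + 1) = t at *
  set T := partialSol a p n with hTdef
  obtain ⟨xe, hxe, hxeU⟩ : ∃ xe ∈ Ioo 0 p, t * xe ^ (n + 1) = barrierHeight := by
    have := intermediate_value_Ioo hp.le
      (f := fun x => t * x ^ (n + 1)) (by fun_prop)
    exact this ⟨by simpa using hU, hlt⟩
  set y := max xe (p / 2) with hy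
  have hyI : y ∈ Icc (p / 2) p := ⟨le_max_right _ _, max_le hxe.2.le (by linarith)⟩
  have hy0 : 0 < y := by linarith [hyI.1]
  have hTy : T.eval y ≤ 40 * p := by
    refine hT y hyI ?_
    rcases max_choice xe (p / 2) with h | h
    · left
      rw [hy, h, hxeU]
      linarith
    · right
      rw [hy, h]
  have hTcoeff : ∀ m, 0 ≤ T.coeff m := fun m => by
    rw [hTdef, coeff_partialSol]
    split_ifs with h
    · exact htn m h
    · exact le_rfl
  have hT0 : 0 ≤ T.eval y := by
    rw [hTdef, eval_partialSol]
    exact Finset.sum_nonneg fun j hj => mul_nonneg (htn j (by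
      have := Finset.mem_range.1 hj; omega)) (by positivity)
  have hyU : barrierHeight ≤ t * y ^ (n + 1) := by
    rw [← hxeU]
    have := hxe.1
    have : xe ≤ y := le_max_left _ _
    gcongr
  have hR : (tailPart tailBound T).eval y < barrierHeight / 4 := by
    rw [eval_tailPart_tailBound]
    have hyp := hyI.2
    have e1 : y ^ 2 + y ^ 3 ≤ 2 * p := by nlinarith [pow_pos hy0 2, pow_pos hy0 3]
    have e2 : 1 + y + y ^ 2 + y ^ 3 ≤ 2 := by nlinarith [pow_pos hy0 2, pow_pos hy0 3]
    have e3 : 3 * T.eval y ^ 2 + T.eval y ^ 3 ≤ 4 * (40 * p) ^ 2 := by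
      have : T.eval y ^ 2 ≤ (40 * p) ^ 2 := by gcongr
      have h1 : T.eval y ≤ 1 := by linarith
      have : T.eval y ^ 3 ≤ T.eval y ^ 2 := pow_le_pow_of_le_one hT0 h1 (by norm_num)
      linarith
    calc _ ≤ 2 * p * (40 * p) + 2 * (4 * (40 * p) ^ 2) := by gcongr
      _ < _ := by nlinarith
  have habs : ∀ x ∈ Ioc 0 xe, |T.eval (-x)| ≤ x / y * (40 * p) := fun x hx => by
    have h1 : |-x| ≤ y := by
      rw [abs_neg, abs_of_pos hx.1]
      exact hx.2.trans (le_max_left _ _)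
    have := abs_eval_le_of_majorized (P := T) (Q := T) (k := 1) (fun m hm => by
      rw [Nat.lt_one_iff.1 hm, hTdef, coeff_partialSol, if_pos (Nat.zero_le _)]
      rfl) (fun m _ => majorizes_self hTcoeff m) hTcoeff hy0 h1
    rw [abs_neg, abs_of_pos hx.1, pow_one] at this
    exact this.trans (by have := hx.1; gcongr)
  have hval : ∀ x, (partialSol a p (n + 1)).eval (-x) = T.eval (-x) + t * x ^ (n + 1) := fun x => by
    rw [hsucc]
    simp [hn.neg_pow]
  have hxy : ∀ x ∈ Ioc 0 xe, x / y ≤ 1 := fun x hx =>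
    (div_le_one hy0).2 (hx.2.trans (le_max_left _ _))
  have habs' : ∀ x ∈ Ioc 0 xe, |T.eval (-x)| ≤ 40 * p := fun x hx =>
    (habs x hx).trans (mul_le_of_le_one_left (by positivity) (hxy x hx))
  refine ⟨xe, hxe, ?_, fun x hx => ⟨?_, ?_⟩⟩
  · rw [hval, hxeU]
    have := abs_le.1 (habs' xe ⟨hxe.1, le_rfl⟩)
    linarith
  · have hx0 := hx.1
    set u := t * x ^ (n + 1) with hu
    set D := (defect a p T).eval (-x) + solNum a p (n + 1) * (-x) ^ (n + 1) with hD
    have hDle : |D| ≤ (x / y) ^ (n + 2) * (tailPart tailBound T).eval y := by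
      have := hB.abs_defect_partialSol_le (n := n) ha (by omega) hlne htn (x := -x) hy0 (by
        rw [abs_neg, abs_of_pos hx0]
        exact hx.2.trans (le_max_left _ _))
      rwa [abs_neg, abs_of_pos hx0] at this
    have hNy : 1 / 2 ≤ (n + 1 : ℝ) * y := by nlinarith [hyI.1]
    have hDlt : |D| < (n + 1) * x * u / 2 := by
      refine hDle.trans_lt ?_
      have hxy0 : 0 < x / y := by positivity
      calc (x / y) ^ (n + 2) * (tailPart tailBound T).eval y
          < (x / y) ^ (n + 2) * (1 / 2 * barrierHeight / 2) := by
            refine mul_lt_mul_of_pos_left ?_ (by positivity)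
            linarith
        _ ≤ (x / y) ^ (n + 2) * ((n + 1) * y * (t * y ^ (n + 1)) / 2) := by gcongr
        _ = _ := by rw [hu, div_pow]; field_simp; ring
    have hkey := defect_pos_aux (A1 := (cubic (a · 1)).eval (-x)) (A2 := (cubic (a · 2)).eval (-x))
      (A3 := (cubic (a · 3)).eval (-x)) (K := a 0 1) (τ := T.eval (-x)) (u := u) (x := x)
      (N := n + 1) (D := D) hx0 (by positivity) ?_ ?_ ?_ ?_ ?_ hN hDlt
    · rw [eval_defect, hval, ← hu]
      rw [eval_defect, hsolNum, hn.neg_pow] at hD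
      have hder : -x * (derivative (partialSol a p (n + 1))).eval (-x) =
          -x * (derivative T).eval (-x) + (n + 1) * u := by
        rw [hsucc]
        simp only [derivative_add, derivative_C_mul, derivative_X_pow, eval_add, eval_mul, eval_C,
          eval_pow, eval_X, Nat.add_sub_cancel, hu]
        rw [← hn.neg_pow x]
        push_cast
        ring
      have := add_mul_pow_eq_rhs_sub (a := a) (p := p) (-x) (T.eval (-x)) u (a 0 1 - p * (n + 1))
        ((derivative T).eval (-x)) (n + 1)
      rw [← hder] at this
      rw [mul_assoc, this]
      convert hkey using 1
      rw [hD, hu]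
      push_cast
      ring
    · exact hB.cubic_left_bounds hx0 (by linarith [hx.2, hxe.2]) |>.1
    · exact hB.cubic_left_bounds hx0 (by linarith [hx.2, hxe.2]) |>.2.1
    · exact hB.cubic_left_bounds hx0 (by linarith [hx.2, hxe.2]) |>.2.2
    · refine (habs x hx).trans ?_
      have : x / y * (40 * p) ≤ x / y * (40 * (2 * y)) := by
        have := hyI.1
        gcongr
        linarith
      refine this.trans (le_of_eq ?_)
      field_simp
      norm_num
    · exact (habs' x hx).trans (by linarith)
  · rw [hval]
    have h1 := abs_le.1 (habs' x hx)
    have h2 : t * x ^ (n + 1) ≤ barrierHeight := by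
      rw [← hxeU]
      have := hx.1
      have := hx.2
      gcongr
    have h3 : 0 ≤ t * x ^ (n + 1) := by have := hx.1; positivity
    rw [abs_le]
    constructor <;> linarith

end

/-- Solutions of an ODE with smooth right-hand side are smooth. -/
lemma contDiffOn_of_hasDerivAt {f : ℝ × ℝ → ℝ} {U : Set (ℝ × ℝ)} {I : Set ℝ} {y : ℝ → ℝ}
    (hI : IsOpen I) (hf : ContDiffOn ℝ (⊤ : ℕ∞) f U) (hU : ∀ t ∈ I, (t, y t) ∈ U)
    (hy : ∀ t ∈ I, HasDerivAt y (f (t, y t)) t) : ContDiffOn ℝ (⊤ : ℕ∞) y I := by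
  have hderiv : EqOn (deriv y) (fun t => f (t, y t)) I := fun t ht => (hy t ht).deriv
  rw [contDiffOn_infty]
  intro n
  induction n with
  | zero =>
    exact contDiffOn_zero.2 fun t ht => (hy t ht).continuousAt.continuousWithinAt
  | succ n ih =>
    rw [Nat.cast_succ, contDiffOn_succ_iff_deriv_of_isOpen hI]
    refine ⟨fun t ht => (hy t ht).differentiableAt.differentiableWithinAt, by simp, ?_⟩
    refine ContDiffOn.congr ?_ hderiv
    exact (hf.of_le (by exact_mod_cast le_top)).comp (contDiffOn_id.prodMk ih) hU

/-- A left inverse of a smooth function with nonvanishing derivative. -/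
lemma contDiffAt_leftInverse {Z τ : ℝ → ℝ} {I : Set ℝ} (hI : IsOpen I)
    (hZ : ContDiffOn ℝ (⊤ : ℕ∞) Z I) (hτ : ∀ s ∈ I, τ (Z s) = s) {s : ℝ} (hs : s ∈ I) {Z' : ℝ}
    (hd : HasDerivAt Z Z' s) (h0 : Z' ≠ 0) :
    ContDiffAt ℝ (⊤ : ℕ∞) τ (Z s) ∧ (∀ᶠ w in 𝓝 (Z s), τ w ∈ I ∧ Z (τ w) = w) ∧
      HasDerivAt τ Z'⁻¹ (Z s) := by
  have hsm : ContDiffAt ℝ (⊤ : ℕ∞) Z s := hZ.contDiffAt (hI.mem_nhds hs)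
  have hne : ((⊤ : ℕ∞) : WithTop ℕ∞) ≠ 0 := by simp
  have hdf := hd.hasFDerivAt_equiv h0
  set g := hsm.localInverse hdf hne with hg
  have hg1 : ContDiffAt ℝ (⊤ : ℕ∞) g (Z s) := hsm.to_localInverse hdf hne
  have hgs : g (Z s) = s := (hsm.hasStrictFDerivAt' hdf hne).localInverse_apply_image
  have hgr : ∀ᶠ w in 𝓝 (Z s), Z (g w) = w :=
    (hsm.hasStrictFDerivAt' hdf hne).eventually_right_inverse
  have hgI : ∀ᶠ w in 𝓝 (Z s), g w ∈ I :=
    hg1.continuousAt.eventually_mem (by rw [hgs]; exact hI.mem_nhds hs)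
  have heq : τ =ᶠ[𝓝 (Z s)] g := by
    filter_upwards [hgr, hgI] with w h1 h2
    rw [← h1, hτ _ h2, h1]
  have hτs : ContDiffAt ℝ (⊤ : ℕ∞) τ (Z s) := hg1.congr_of_eventuallyEq heq
  have hev : ∀ᶠ w in 𝓝 (Z s), τ w ∈ I ∧ Z (τ w) = w := by
    filter_upwards [hgr, hgI, heq] with w h1 h2 h3
    rw [h3]
    exact ⟨h2, h1⟩
  refine ⟨hτs, hev, ?_⟩
  refine HasDerivAt.of_local_left_inverse (f := Z) hτs.continuousAt ?_ h0 (hev.mono fun w h => h.2)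
  rw [hτ s hs]
  exact hd

/-- A continuous function that starts below a level and ends above it first reaches it at some time. -/
lemma exists_first_hit {y : ℝ → ℝ} {a b H : ℝ} (hab : a ≤ b) (hy : ContinuousOn y (Icc a b))
    (ha : y a < H) (hb : H ≤ y b) : ∃ s ∈ Ioc a b, y s = H ∧ ∀ t ∈ Ico a s, y t < H := by
  set S := Icc a b ∩ y ⁻¹' {H} with hS
  have hcl : IsCompact S :=
    (hy.preimage_isClosed_of_isClosed isClosed_Icc isClosed_singleton |>
      isCompact_Icc.of_isClosed_subset) inter_subset_left
  obtain ⟨t₀, ht₀, ht₀H⟩ := intermediate_value_Icc hab hy ⟨ha.le, hb⟩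
  obtain ⟨s, ⟨hs, hsH⟩, hmin⟩ := hcl.exists_isLeast ⟨t₀, ht₀, ht₀H⟩
  have hsa : a < s := by
    rcases hs.1.eq_or_lt with rfl | h
    · exact absurd hsH ha.ne
    · exact h
  refine ⟨s, ⟨hsa, hs.2⟩, hsH, fun t ht => ?_⟩
  by_contra! hcon
  obtain ⟨u, hu, huH⟩ := intermediate_value_Icc ht.1
    (hy.mono (Icc_subset_Icc_right (ht.2.le.trans hs.2))) ⟨ha.le, hcon⟩
  have := hmin ⟨⟨hu.1, hu.2.trans (ht.2.le.trans hs.2)⟩, huH⟩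
  linarith [hu.2, ht.2]

section
open Polynomial

variable {a : ℕ → ℕ → ℝ} {p c : ℝ} {n : ℕ} {ψ φ v : ℝ → ℝ}

lemma hasDerivAt_comp_neg_id {f : ℝ → ℝ} {f' x : ℝ} (h : HasDerivAt f f' (-x)) :
    HasDerivAt (fun x => f (-x)) (-f') x := by
  have h2 : HasDerivAt (f ∘ fun x => -x) (f' * -1) x :=
    HasDerivAt.comp (h₂ := f) x h (hasDerivAt_neg x)
  simpa [Function.comp_def] using h2

lemma contDiff_rhs (a : ℕ → ℕ → ℝ) : ContDiff ℝ (⊤ : ℕ∞) (Function.uncurry (rhs a)) := by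
  unfold Function.uncurry rhs
  have := fun j => contDiff_eval (cubic (a · j))
  fun_prop

/-- A smooth continuation beyond a partial sum whose next coefficient is negative exceeds the
partial sum, if its degree is even, immediately to the left of the origin. -/
lemma exists_gt_left_of_coeff_neg (hn : Even (n + 1)) (ht : solCoeff a p (n + 2) < 0)
    (hv : ContinuousAt v 0)
    (hφ : ∀ x, φ x = (partialSol a p (n + 2)).eval x + x ^ (n + 3) * v x) :
    ∀ᶠ x in 𝓝[>] (0 : ℝ), (partialSol a p (n + 1)).eval (-x) < φ (-x) := by
  have h1 : ContinuousAt (fun x => solCoeff a p (n + 2) - x * v (-x)) 0 := by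
    have : ContinuousAt (fun x => v (-x)) 0 :=
      ContinuousAt.comp (f := fun x : ℝ => -x) (g := v) (by simpa using hv) (by fun_prop)
    exact continuousAt_const.sub (continuousAt_id.mul this)
  have h2 : ∀ᶠ x in 𝓝 (0 : ℝ), solCoeff a p (n + 2) - x * v (-x) < 0 :=
    h1.tendsto.eventually_lt_const (by simpa using ht)
  filter_upwards [nhdsWithin_le_nhds h2, self_mem_nhdsWithin] with x hx (hx0 : 0 < x)
  rw [hφ, partialSol_succ (n + 1)]
  have e1 : (-x) ^ (n + 2) = -x ^ (n + 2) := (hn.add_one).neg_pow x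
  have e2 : (-x) ^ (n + 3) = x ^ (n + 3) := by
    have : Even (n + 3) := by
      have := hn.add_one.add_one
      exact this
    exact this.neg_pow x
  simp only [eval_add, eval_mul, eval_C, eval_pow, eval_X, e1, e2]
  have : 0 < x ^ (n + 2) * -(solCoeff a p (n + 2) - x * v (-x)) :=
    mul_pos (by positivity) (by linarith)
  have e3 : x ^ (n + 3) = x ^ (n + 2) * x := pow_succ _ _
  rw [e3]
  linarith

set_option maxHeartbeats 1000000 in
theorem SeriesBase.exists_left_extension (hB : SeriesBase a p) (ha : a 0 0 = 0)
    (hn : Even (n + 1)) (hl : ∀ j : ℕ, j ≤ n + 1 → 0 < a 0 1 - p * j) (hp : 0 < p)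
    (hK : a 0 1 < p * (n + 1 + 1)) (hpU : p ≤ barrierHeight / 10 ^ 6) (h : IsSol a p ψ c) {D x₀ : ℝ}
    (hx₀ : x₀ ∈ Ioc 0 c)
    (hD : ∀ x ∈ Ioc 0 x₀, |ψ x - (partialSol a p (n + 1)).eval x| ≤ D * x ^ (n + 2)) :
    ∃ (Xe η : ℝ) (Φ : ℝ → ℝ), 0 < Xe ∧ 0 < η ∧ Xe + η < p ∧
      ContDiffOn ℝ (⊤ : ℕ∞) Φ (Ioo (-Xe - η) c) ∧ (∀ x ∈ Ioo 0 c, Φ x = ψ x) ∧ Φ 0 = 0 ∧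
      (∀ x ∈ Ioo (-Xe - η) c, x ≠ 0 → HasDerivAt Φ (rhs a x (Φ x) / ((p + x) * x)) x) ∧
      Φ (-Xe) = barrierHeight / 2 ∧ ∀ x ∈ Ioo (-Xe - η) 0, |Φ x| ≤ 1 / 25 := by
  have hU := barrierHeight_pos
  have hU' := barrierHeight_le
  have hK1 := hB.a01.1
  have hn12 : 12 ≤ n + 1 := by
    by_contra! hcon
    have h1 : (n : ℝ) + 1 ≤ 11 := by exact_mod_cast (by omega : n + 1 ≤ 11)
    have : p * (n + 1 + 1) ≤ 1 / 10 ^ 9 * 12 := by gcongr <;> linarith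
    linarith
  have hx₀0 := hx₀.1
  obtain ⟨xe, hxe, hxeU, hdef⟩ := hB.exists_right_barrier ha hn hl hp hK hpU
  have htneg : solCoeff a p (n + 2) < 0 := by
    have := hB.solNum_pos hn12 hl
    rw [solCoeff_succ]
    push_cast
    exact div_neg_of_pos_of_neg this (by linarith)
  obtain ⟨δ, hδ, hδc, φ, v, hφs, hφψ, hv, hφe, hφd⟩ :=
    h.exists_smooth_extension (N := n + 1) hp ha (fun j h1 h2 => by
      rcases Nat.lt_succ_iff_lt_or_eq.1 (Nat.lt_succ_of_le h2) with h3 | rfl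
      · exact (hl j (by omega)).ne'
      · push_cast; linarith) (by push_cast; linarith) hx₀ hD
  have hδ0 := hδ.1
  have hφ0 : φ 0 = 0 := by
    rw [hφe]
    have : (partialSol a p (n + 1 + 1)).eval 0 = 0 := by
      rw [← coeff_zero_eq_eval_zero, coeff_partialSol, if_pos (Nat.zero_le _)]
      rfl
    rw [this]
    simp
  have hφcont : ContinuousAt φ 0 :=
    (hφs.contDiffAt (Ioo_mem_nhds (by linarith) hδ0)).continuousAt
  have hsmall : ∀ᶠ x in 𝓝[>] (0 : ℝ), |φ (-x)| < barrierHeight / 2 := by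
    have h1 : ContinuousAt (fun x => |φ (-x)|) 0 :=
      (ContinuousAt.comp (f := fun x : ℝ => -x) (g := φ) (by simpa using hφcont)
        (by fun_prop)).abs
    exact nhdsWithin_le_nhds (h1.tendsto.eventually_lt_const (by simp [hφ0, hU]))
  obtain ⟨x₁, hx₁, hx₁b⟩ : ∃ x₁ ∈ Ioo 0 (min δ xe), ∀ x ∈ Ioc 0 x₁,
      (partialSol a p (n + 1)).eval (-x) < φ (-x) ∧ |φ (-x)| < barrierHeight / 2 := by
    obtain ⟨u, hu, hu'⟩ := mem_nhdsGT_iff_exists_Ioc_subset.1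
      ((exists_gt_left_of_coeff_neg hn htneg hv hφe).and hsmall)
    have : 0 < min δ xe := lt_min hδ0 hxe.1
    have hu0 : 0 < u := hu
    exact ⟨min u (min δ xe / 2), ⟨lt_min hu0 (by linarith), (min_le_right _ _).trans_lt
      (by linarith)⟩, fun x hx => hu' ⟨hx.1, hx.2.trans (min_le_left _ _)⟩⟩
  have hx₁0 := hx₁.1
  have hx₁δ := hx₁.2.trans_le (min_le_left _ _)
  have hx₁e := hx₁.2.trans_le (min_le_right _ _)
  set xm := (xe + p) / 2 with hxm
  have hxm1 : xe < xm := by linarith [hxe.2]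
  have hxm2 : xm < p := by linarith [hxe.2]
  set f : ℝ → ℝ → ℝ := fun x y => rhs a (-x) y / ((p - x) * x) with hf
  have hfs : ContDiffOn ℝ (⊤ : ℕ∞) (Function.uncurry f) (Ioo 0 p ×ˢ univ) := by
    have h1 : ContDiff ℝ (⊤ : ℕ∞) (fun q : ℝ × ℝ => rhs a (-q.1) q.2) :=
      (contDiff_rhs a).comp (by fun_prop : ContDiff ℝ (⊤ : ℕ∞) (fun q : ℝ × ℝ => (-q.1, q.2)))
    refine ContDiffOn.div h1.contDiffOn (by fun_prop) fun q hq => ?_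
    have := hq.1
    exact mul_ne_zero (by linarith [this.2]) this.1.ne'
  have hsub : Icc (x₁ / 2) xm ×ˢ Icc (-1 : ℝ) 1 ⊆ Ioo 0 p ×ˢ univ := fun q hq =>
    ⟨⟨by linarith [hq.1.1], by linarith [hq.1.2]⟩, mem_univ _⟩
  obtain ⟨⟨K, hLip⟩, y, hy1, hyd⟩ := exists_clamped_solution (f := f) (a := x₁ / 2) (b := xm)
    (c := -1) (d := 1) (by linarith) (by norm_num)
    ((hfs.mono hsub).of_le (by exact_mod_cast le_top)) x₁ (φ (-x₁))
  have hycont : Continuous y := continuous_iff_continuousAt.2 fun t => (hyd t).continuousAt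
  have hyd' : ∀ t ∈ Icc (x₁ / 2) xm, y t ∈ Icc (-1 : ℝ) 1 → HasDerivAt y (f t (y t)) t :=
    fun t ht hyt => by
      have := hyd t
      rwa [clamp_of_mem ht, clamp_of_mem hyt] at this
  have hneg : ∀ x ∈ Ioo 0 δ, HasDerivAt (fun x => φ (-x)) (f x (φ (-x))) x := fun x hx => by
    have h1 := hφd (-x) ⟨by linarith [hx.2], by linarith [hx.1]⟩ (by linarith [hx.1])
    convert hasDerivAt_comp_neg_id h1 using 1
    change _ / _ = _
    rw [show (p + -x) * -x = -((p - x) * x) by ring, div_neg]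
    ring
  -- above the barrier
  have habove : ∀ x ∈ Icc x₁ xe, (partialSol a p (n + 1)).eval (-x) - y x < 0 := by
    have hpoly : ∀ x, HasDerivAt (fun x => (partialSol a p (n + 1)).eval (-x))
        (-(derivative (partialSol a p (n + 1))).eval (-x)) x := fun x => by
      exact hasDerivAt_comp_neg_id ((partialSol a p (n + 1)).hasDerivAt (-x))
    refine neg_of_deriv_neg_at_zeros ?_ ?_ ?_
    · exact ((continuous_iff_continuousAt.2 fun x => (hpoly x).continuousAt).sub hycont).continuousOn
    · rw [hy1]
      linarith [(hx₁b x₁ ⟨hx₁0, le_rfl⟩).1]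
    · intro t ht h0
      have htB : (partialSol a p (n + 1)).eval (-t) = y t := by linarith
      obtain ⟨hd1, hd2⟩ := hdef t ⟨by linarith [ht.1], ht.2⟩
      rw [htB] at hd2
      have hd2 := abs_le.1 hd2
      have hyt := hyd' t ⟨by linarith [ht.1], by linarith [ht.2]⟩ ⟨by linarith, by linarith⟩
      refine ⟨_, ?_, ((hpoly t).sub hyt).hasDerivWithinAt⟩
      rw [eval_defect, htB] at hd1
      have ht0 : 0 < t := by linarith [ht.1]
      have hpt : 0 < p - t := by linarith [ht.2]
      simp only [hf]
      rw [sub_neg, lt_div_iff₀ (by positivity)]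
      linarith
  obtain ⟨Xe, hXe, hXeH, hXelt⟩ := exists_first_hit (y := y) (a := x₁) (b := xe)
    (H := barrierHeight / 2) hx₁e.le hycont.continuousOn (by
      rw [hy1]
      exact (abs_lt.1 (hx₁b x₁ ⟨hx₁0, le_rfl⟩).2).2) (by linarith [habove xe ⟨hx₁e.le, le_rfl⟩])
  have hyI : ∀ t ∈ Icc x₁ Xe, |y t| < 1 / 25 := fun t ht => by
    have h1 := habove t ⟨ht.1, ht.2.trans hXe.2⟩
    have h2 := abs_le.1 (hdef t ⟨by linarith [ht.1], ht.2.trans hXe.2⟩).2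
    have h3 : y t ≤ barrierHeight / 2 := by
      rcases ht.2.eq_or_lt with rfl | h3
      · exact hXeH.le
      · exact (hXelt t ⟨ht.1, h3⟩).le
    rw [abs_lt]
    constructor <;> linarith
  obtain ⟨η, hη, hηm, hyη⟩ : ∃ η > 0, Xe + η < xm ∧ ∀ t ∈ Ico Xe (Xe + η), |y t| < 1 / 25 := by
    have h1 : ∀ᶠ t in 𝓝 Xe, |y t| < 1 / 25 :=
      hycont.abs.continuousAt.tendsto.eventually_lt_const (hyI Xe ⟨hXe.1.le, le_rfl⟩)
    obtain ⟨ε, hε, hε'⟩ := Metric.eventually_nhds_iff.1 h1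
    have hpos : 0 < xm - Xe := by linarith [hXe.2]
    refine ⟨min ε ((xm - Xe) / 2), lt_min hε (by linarith), ?_, fun t ht => hε' ?_⟩
    · linarith [min_le_right ε ((xm - Xe) / 2)]
    · rw [Real.dist_eq, abs_lt]
      have := min_le_left ε ((xm - Xe) / 2)
      constructor <;> linarith [ht.1, ht.2]
  have hyI' : ∀ t ∈ Ico x₁ (Xe + η), |y t| < 1 / 25 := fun t ht => by
    rcases le_or_gt t Xe with h1 | h1
    · exact hyI t ⟨ht.1, h1⟩
    · exact hyη t ⟨h1.le, ht.2⟩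
  have hover : ∀ t ∈ Ioo (x₁ / 2) x₁, y t = φ (-t) := by
    -- both solve the same clamped equation near `x₁`
    set b := min δ xm with hb
    have hb1 : x₁ < b := lt_min hx₁δ (by linarith)
    have hEv : ∀ᶠ t in 𝓝 x₁, |φ (-t)| < 1 := by
      have h1 : ContinuousAt (fun x => |φ (-x)|) x₁ := (hneg x₁ ⟨hx₁0, hx₁δ⟩).continuousAt.abs
      refine h1.tendsto.eventually_lt_const ?_
      linarith [(hx₁b x₁ ⟨hx₁0, le_rfl⟩).2]
    obtain ⟨ε, hε, hε'⟩ := Metric.eventually_nhds_iff.1 hEv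
    set b' := min ((x₁ + b) / 2) (x₁ + ε / 2) with hb'
    have hb'1 : x₁ < b' := lt_min (by linarith) (by linarith)
    have hb'2 : b' < b := (min_le_left _ _).trans_lt (by linarith)
    have hb'3 : b' < x₁ + ε := (min_le_right _ _).trans_lt (by linarith)
    have hφI : ∀ t ∈ Icc (x₁ / 2) b', φ (-t) ∈ Icc (-1 : ℝ) 1 := fun t ht => by
      rcases le_or_gt t x₁ with h1 | h1
      · have := abs_lt.1 (hx₁b t ⟨by linarith [ht.1], h1⟩).2
        constructor <;> linarith
      · have : |φ (-t)| < 1 := hε' (by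
          rw [Real.dist_eq, abs_lt]
          constructor <;> linarith [ht.2])
        exact abs_le.1 this.le
    have hbδ : b ≤ δ := min_le_left _ _
    have hbm : b ≤ xm := min_le_right _ _
    have key := ODE_solution_unique_of_mem_Icc (K := K)
      (v := fun t y => f (clamp (x₁ / 2) xm t) (clamp (-1) 1 y)) (s := fun _ => univ)
      (a := x₁ / 2) (b := b') (t₀ := x₁) (f := y) (g := fun t => φ (-t))
      (fun t _ => (hLip t).lipschitzOnWith) ⟨by linarith, hb'1⟩ hycont.continuousOn
      (fun t _ => hyd t) (fun _ _ => mem_univ _)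
      (fun t ht => (hneg t ⟨by linarith [ht.1], by linarith [ht.2]⟩).continuousAt.continuousWithinAt)
      (fun t ht => by
        have h1 := hneg t ⟨by linarith [ht.1], by linarith [ht.2]⟩
        rwa [clamp_of_mem ⟨ht.1.le, by linarith [ht.2]⟩, clamp_of_mem (hφI t ⟨ht.1.le, ht.2.le⟩)])
      (fun _ _ => mem_univ _) hy1
    exact fun t ht => key ⟨ht.1.le, by linarith [ht.2]⟩
  set Φ : ℝ → ℝ := fun x => if x ≤ -x₁ then y (-x) else if x < δ then φ x else ψ x with hΦ
  have hΦy : ∀ x, x < -(x₁ / 2) → -xm < x → Φ x = y (-x) := fun x hx _ => by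
    simp only [hΦ]
    split_ifs with h1 h2
    · rfl
    · rw [hover (-x) ⟨by linarith, by linarith⟩, neg_neg]
    · exact absurd (by linarith) h2
  have hΦφ : ∀ x ∈ Ioo (-x₁) δ, Φ x = φ x := fun x hx => by
    simp only [hΦ]
    rw [if_neg (by linarith [hx.1]), if_pos hx.2]
  have hΦψ : ∀ x ∈ Ioo 0 c, Φ x = ψ x := fun x hx => by
    simp only [hΦ]
    rw [if_neg (by linarith [hx.1])]
    split_ifs with h1
    · exact hφψ x ⟨hx.1, h1⟩
    · rfl
  have hyd2 : ∀ t ∈ Ioo (x₁ / 2) (Xe + η), HasDerivAt y (f t (y t)) t := fun t ht => by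
    refine hyd' t ⟨ht.1.le, by linarith [ht.2]⟩ ?_
    rcases lt_or_ge t x₁ with h1 | h1
    · rw [hover t ⟨ht.1, h1⟩]
      have := abs_lt.1 (hx₁b t ⟨by linarith [ht.1], h1.le⟩).2
      constructor <;> linarith
    · have := abs_lt.1 (hyI' t ⟨h1, ht.2⟩)
      constructor <;> linarith
  have hevy : ∀ x ∈ Ioo (-Xe - η) (-(x₁ / 2)), Φ =ᶠ[𝓝 x] fun x => y (-x) := fun x hx => by
    filter_upwards [Ioo_mem_nhds hx.1 hx.2] with z hz
    exact hΦy z hz.2 (by linarith [hz.1])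
  have hevφ : ∀ x ∈ Ioo (-x₁) δ, Φ =ᶠ[𝓝 x] φ := fun x hx => by
    filter_upwards [Ioo_mem_nhds hx.1 hx.2] with z hz using hΦφ z hz
  have hevψ : ∀ x ∈ Ioo 0 c, Φ =ᶠ[𝓝 x] ψ := fun x hx => by
    filter_upwards [Ioo_mem_nhds hx.1 hx.2] with z hz using hΦψ z hz
  have hder : ∀ x ∈ Ioo (-Xe - η) c, x ≠ 0 →
      HasDerivAt Φ (rhs a x (Φ x) / ((p + x) * x)) x := fun x hx hx0 => by
    rcases lt_or_ge x (-(x₁ / 2)) with h1 | h1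
    · rw [(hevy x ⟨hx.1, h1⟩).self_of_nhds]
      refine HasDerivAt.congr_of_eventuallyEq ?_ (hevy x ⟨hx.1, h1⟩)
      refine (hasDerivAt_comp_neg_id (hyd2 (-x) ⟨by linarith, by linarith [hx.1]⟩)).congr_deriv ?_
      change -(rhs a (- -x) _ / _) = _
      rw [neg_neg]
      rw [show (p - -x) * -x = -((p + x) * x) by ring, div_neg]
      ring
    · rcases lt_or_ge x δ with h2 | h2
      · have hx' : x ∈ Ioo (-x₁) δ := ⟨by linarith, h2⟩
        rw [(hevφ x hx').self_of_nhds]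
        exact HasDerivAt.congr_of_eventuallyEq (hφd x ⟨by linarith, h2⟩ hx0) (hevφ x hx')
      · have hx' : x ∈ Ioo 0 c := ⟨by linarith, hx.2⟩
        rw [(hevψ x hx').self_of_nhds]
        exact HasDerivAt.congr_of_eventuallyEq (h x ⟨hx'.1, hx'.2.le⟩) (hevψ x hx')
  have hXe0 : 0 < Xe := hx₁0.trans hXe.1
  refine ⟨Xe, η, Φ, hXe0, hη, by linarith, ?_, hΦψ, ?_, hder, ?_, ?_⟩
  · intro x hx
    refine ContDiffAt.contDiffWithinAt ?_
    rcases eq_or_ne x 0 with rfl | hx0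
    · exact (hφs.contDiffAt (Ioo_mem_nhds (by linarith) hδ0)).congr_of_eventuallyEq
        (hevφ 0 ⟨by linarith, hδ0⟩)
    · have hopen : IsOpen (Ioo (-Xe - η) c \ {0}) := isOpen_Ioo.sdiff isClosed_singleton
      have hrhs : ContDiffOn ℝ (⊤ : ℕ∞)
          (fun q : ℝ × ℝ => rhs a q.1 q.2 / ((p + q.1) * q.1)) ((Ioo (-Xe - η) c \ {0}) ×ˢ univ) := by
        refine ContDiffOn.div (contDiff_rhs a).contDiffOn (by fun_prop) fun q hq => ?_
        exact mul_ne_zero (by linarith [hq.1.1.1]) hq.1.2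
      exact (contDiffOn_of_hasDerivAt hopen hrhs (fun t ht => ⟨ht, mem_univ _⟩)
        fun t ht => hder t ht.1 ht.2).contDiffAt (hopen.mem_nhds ⟨hx, hx0⟩)
  · rw [hΦφ 0 ⟨by linarith, hδ0⟩, hφ0]
  · rw [hΦy _ (by linarith [hXe.1]) (by linarith [hXe.2]), neg_neg, hXeH]
  · intro x hx
    rcases le_or_gt x (-x₁) with h1 | h1
    · rw [hΦy x (by linarith) (by linarith [hx.1])]
      exact (hyI' (-x) ⟨by linarith, by linarith [hx.1]⟩).le
    · rw [hΦφ x ⟨h1, by linarith [hx.2]⟩]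
      have := (hx₁b (-x) ⟨by linarith [hx.2], by linarith⟩).2
      rw [neg_neg] at this
      linarith

end

section
variable {γ m : ℝ}

/-- The reparametrized right-hand side for `dV/dz`, where `z = (1 - Z) / (1 + Z)`. -/
def farRhs (m z V : ℝ) : ℝ :=
  9 * r0 / 2 * (1 - V ^ 2) * ((1 - V) ^ 2 + m * (1 - V ^ 2) * (1 - z) - z * (1 + V) ^ 2) /
    ((1 - z) * (((1 - V) - r0 * z * (1 + V)) * (r0 * (1 - V) - z * (1 + V))))

lemma farRhs_denominators_pos {V₁ z V : ℝ} (hV₁ : V₁ < 1) (hz : z ∈ Icc (-1 : ℝ) 0)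
    (hV : V ∈ Icc (-1 : ℝ) V₁) :
    0 < 1 - z ∧ 0 < (1 - V) - r0 * z * (1 + V) ∧ 0 < r0 * (1 - V) - z * (1 + V) := by
  have h1 : 0 < 1 - V := by linarith [hV.2]
  have h2 : 0 ≤ -z * (1 + V) := mul_nonneg (by linarith [hz.2]) (by linarith [hV.1])
  have h3 := mul_nonneg r0_pos.le h2
  have h4 := mul_pos r0_pos h1
  refine ⟨by linarith [hz.2], ?_, ?_⟩ <;> nlinarith

lemma farRhs_nonneg (hm : 0 ≤ m) {V₁ z V : ℝ} (hV₁ : V₁ < 1) (hz : z ∈ Icc (-1 : ℝ) 0)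
    (hV : V ∈ Icc (-1 : ℝ) V₁) : 0 ≤ farRhs m z V := by
  obtain ⟨h1, h2, h3⟩ := farRhs_denominators_pos hV₁ hz hV
  have h4 : 0 ≤ 1 - V ^ 2 := by nlinarith [hV.1, hV.2]
  have h5 : 0 ≤ -z * (1 + V) ^ 2 := mul_nonneg (by linarith [hz.2]) (sq_nonneg _)
  have h6 := r0_pos
  have h7 : 0 ≤ (1 - V) ^ 2 + m * (1 - V ^ 2) * (1 - z) - z * (1 + V) ^ 2 := by
    have : 0 ≤ m * (1 - V ^ 2) * (1 - z) := by positivity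
    nlinarith [sq_nonneg (1 - V)]
  unfold farRhs
  positivity

lemma delZ_neg_of_far {Z V : ℝ} (hZ : 1 ≤ Z) (hV : V ∈ Ioo (-1 : ℝ) 1) : DelZ Z V < 0 := by
  have h1 : 0 ≤ (Z ^ 2 - 1) * (1 - V ^ 2) :=
    mul_nonneg (by nlinarith) (by nlinarith [hV.1, hV.2])
  have h2 : 0 < (V - Z) ^ 2 := sq_pos_of_neg (by linarith [hV.2])
  exact mul_neg_of_pos_of_neg (by linarith) (by linarith)

lemma characteristic_factors (Z V : ℝ) :
    ((1 - V) * (1 + Z) - r0 * (1 - Z) * (1 + V)) * (r0 * (1 - V) * (1 + Z) - (1 - Z) * (1 + V)) =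
      -(6 * r0) * ((1 - Z * V) ^ 2 - (5 / 3) * (V - Z) ^ 2) := by
  linear_combination (-(1 - V ^ 2) * (1 - Z ^ 2)) * r0_sq

lemma farRhs_eq (hγ : 1 / (γ + 1) = (1 + m) / 2) {Z V : ℝ} (hZ : 1 ≤ Z)
    (hV : V ∈ Ioo (-1 : ℝ) 1) :
    farRhs m ((1 - Z) / (1 + Z)) V * (-2 / (1 + Z) ^ 2) = DelV γ Z V / DelZ Z V := by
  have hD := (delZ_neg_of_far hZ hV).ne
  have hZ0 : Z ≠ 0 := by linarith
  have hZ1 : 1 + Z ≠ 0 := by linarith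
  have hr := r0_pos.ne'
  have hQ : (1 - Z * V) ^ 2 - (5 / 3) * (V - Z) ^ 2 ≠ 0 := right_ne_zero_of_mul hD
  have e1 : (1 - V - r0 * ((1 - Z) / (1 + Z)) * (1 + V)) *
      (r0 * (1 - V) - (1 - Z) / (1 + Z) * (1 + V)) =
      -(6 * r0) * ((1 - Z * V) ^ 2 - (5 / 3) * (V - Z) ^ 2) / (1 + Z) ^ 2 := by
    rw [← characteristic_factors]
    field_simp
  have e2 : 1 - (1 - Z) / (1 + Z) = 2 * Z / (1 + Z) := by field_simp; ring
  rw [farRhs, e1, e2, DelV, DelZ, hγ]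
  generalize (1 - Z * V) ^ 2 - (5 / 3) * (V - Z) ^ 2 = Q at *
  field_simp
  ring

/-- Continuation of the profile from the light cone `Z = 1` to infinity. -/
theorem exists_far_profile (hm : 0 ≤ m) (hγ : 1 / (γ + 1) = (1 + m) / 2) {V₁ : ℝ}
    (hV₁ : V₁ ∈ Ioo (-1 : ℝ) 1) :
    ∃ V : ℝ → ℝ, V 1 = V₁ ∧ ∀ Z, 1 ≤ Z → V Z ∈ Ioo (-1 : ℝ) 1 ∧
      HasDerivAt V (DelV γ Z (V Z) / DelZ Z (V Z)) Z := by
  have hsm : ContDiffOn ℝ 1 (Function.uncurry (farRhs m)) (Icc (-1) 0 ×ˢ Icc (-1) V₁) := by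
    unfold Function.uncurry farRhs
    refine ContDiffOn.div (by fun_prop) (by fun_prop) fun q hq => ?_
    obtain ⟨h1, h2, h3⟩ := farRhs_denominators_pos hV₁.2 hq.1 hq.2
    positivity
  obtain ⟨⟨K, hK⟩, y, hy0, hy⟩ := exists_clamped_solution (f := farRhs m) (by norm_num) hV₁.1.le
    hsm 0 V₁
  have hmono : Monotone y := by
    refine monotone_of_deriv_nonneg (fun t => (hy t).differentiableAt) fun t => ?_
    rw [(hy t).deriv]
    exact farRhs_nonneg hm hV₁.2 (clamp_mem (by norm_num) t) (clamp_mem hV₁.1.le _)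
  have hgt : ∀ t, -1 < y t := by
    intro t
    by_contra! hle
    have hcont : Continuous y := continuous_iff_continuousAt.2 fun t => (hy t).continuousAt
    obtain ⟨t₁, ht₁⟩ : ∃ t₁, y t₁ = -1 :=
      mem_range_of_exists_le_of_exists_ge hcont ⟨t, hle⟩ ⟨0, by rw [hy0]; exact hV₁.1.le⟩
    have := ODE_solution_unique_univ (f := y) (g := fun _ => -1) (t₀ := t₁) (s := fun _ => univ)
      (K := K) (v := fun t y => farRhs m (clamp (-1) 0 t) (clamp (-1) V₁ y))
      (fun t => (hK t).lipschitzOnWith) (fun t => ⟨hy t, mem_univ _⟩)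
      (fun t => ⟨by
        have : farRhs m (clamp (-1) 0 t) (clamp (-1) V₁ (-1)) = 0 := by
          rw [clamp_of_mem ⟨le_rfl, hV₁.1.le⟩]
          simp [farRhs]
        rw [this]
        exact hasDerivAt_const _ _, mem_univ _⟩) ht₁
    have h2 := congrFun this 0
    rw [hy0] at h2
    exact absurd h2 hV₁.1.ne'
  refine ⟨fun Z => y ((1 - Z) / (1 + Z)), by simp [hy0], fun Z hZ => ?_⟩
  have hZ1 : 0 < 1 + Z := by linarith
  have hz : (1 - Z) / (1 + Z) ∈ Icc (-1 : ℝ) 0 := by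
    constructor
    · rw [le_div_iff₀ hZ1]; linarith
    · exact div_nonpos_of_nonpos_of_nonneg (by linarith) hZ1.le
  have hle : y ((1 - Z) / (1 + Z)) ≤ V₁ := by
    have := hmono hz.2
    rwa [hy0] at this
  have hV : y ((1 - Z) / (1 + Z)) ∈ Ioo (-1 : ℝ) 1 := ⟨hgt _, hle.trans_lt hV₁.2⟩
  refine ⟨hV, ?_⟩
  have h1 := hy ((1 - Z) / (1 + Z))
  rw [clamp_of_mem hz, clamp_of_mem ⟨hV.1.le, hle⟩] at h1
  have h2 : HasDerivAt (fun Z : ℝ => (1 - Z) / (1 + Z)) (-2 / (1 + Z) ^ 2) Z := by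
    refine (((hasDerivAt_id Z).const_sub 1).div ((hasDerivAt_id Z).const_add 1)
      hZ1.ne').congr_deriv ?_
    simp only [id]
    field_simp
    ring
  rw [← farRhs_eq hγ hZ hV]
  exact HasDerivAt.comp (h₂ := y) Z h1 h2

end

lemma pos_of_hasDerivAt_mul {y B : ℝ → ℝ} {a b : ℝ}
    (hy : ∀ t ∈ Icc a b, HasDerivAt y (B t * y t) t) (hB : ContinuousOn B (Icc a b))
    (hb : 0 < y b) : ∀ t ∈ Icc a b, 0 < y t := by
  intro t ht
  by_contra! hle
  have hc : ContinuousOn y (Icc a b) := fun t ht => (hy t ht).continuousAt.continuousWithinAt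
  obtain ⟨t₁, ht₁, h0⟩ : (0 : ℝ) ∈ y '' Icc t b :=
    intermediate_value_Icc ht.2 (hc.mono (Icc_subset_Icc_left ht.1)) ⟨hle, hb.le⟩
  obtain ⟨K, hK⟩ := isCompact_Icc.exists_bound_of_continuousOn hB
  have hsub : Icc t₁ b ⊆ Icc a b := Icc_subset_Icc_left (ht.1.trans ht₁.1)
  have := ODE_solution_unique_of_mem_Icc_right (v := fun t y => B t * y) (s := fun _ => univ)
    (K := K.toNNReal) (f := y) (g := fun _ => 0) (a := t₁) (b := b)
    (fun s hs => (LipschitzWith.of_dist_le_mul fun x z => by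
      rw [Real.dist_eq, Real.dist_eq, ← mul_sub, abs_mul]
      gcongr
      exact (hK s (hsub (Ico_subset_Icc_self hs))).trans (Real.le_coe_toNNReal K)).lipschitzOnWith)
    (hc.mono hsub) (fun s hs => (hy s (hsub (Ico_subset_Icc_self hs))).hasDerivWithinAt)
    (fun _ _ => mem_univ _) continuousOn_const
    (fun s _ => by simpa using hasDerivWithinAt_const s (Ici s) (0 : ℝ))
    (fun _ _ => mem_univ _) h0
  have h2 := this (right_mem_Icc.2 ht₁.2)
  exact hb.ne' h2

/-- The value of `v` at `q = z / v` if `N / v = u (q - r₀)`. -/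
def coneV (m q u : ℝ) : ℝ := (u * (q - r0) - m + q) / (1 - m * q)

/-- The denominator in the equation for `dv/dq`. -/
def coneD (m q u : ℝ) : ℝ := (1 - q * coneV m q u) * (1 - r0 * q) - 9 * r0 * q * u

/-- The right-hand side of the equation for `du/dq`. -/
def coneRhs (m q u : ℝ) : ℝ :=
  ((1 - m * q) * (9 * r0 * u * coneV m q u / coneD m q u) - m * coneV m q u - 1 - u) / (q - r0)

section
variable {p m q u U κ : ℝ}

lemma mul_le_of_mem_r0 (hm : m ∈ Icc 0 r0) (hq : q ∈ Icc 0 r0) : 0 ≤ m * q ∧ m * q ≤ 0.017 := by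
  have h1 : m ≤ 0.13 := hm.2.trans r0_lt.le
  have h2 : q ≤ 0.13 := hq.2.trans r0_lt.le
  exact ⟨mul_nonneg hm.1 hq.1, by nlinarith [hm.1, hq.1]⟩

lemma coneV_mul (hm : m ∈ Icc 0 r0) (hq : q ∈ Icc 0 r0) :
    coneV m q u * (1 - m * q) = u * (q - r0) - m + q := by
  have := mul_le_of_mem_r0 hm hq
  rw [coneV, div_mul_cancel₀ _ (by linarith)]

lemma neg_le_coneV (hm : m ∈ Icc 0 r0) (hq : q ∈ Icc 0 r0) (hu : u ≤ 7) : -1.1 ≤ coneV m q u := by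
  have h := coneV_mul (u := u) hm hq
  have h1 := mul_le_of_mem_r0 hm hq
  have h2 : 7 * (q - r0) ≤ u * (q - r0) := mul_le_mul_of_nonpos_right hu (by linarith [hq.2])
  nlinarith [hm.2, hq.1, r0_lt]

lemma coneV_le_of_nonneg (hm : m ∈ Icc 0 r0) (hmp : r0 - m = p * (1 - m * r0)) (hp : 0 ≤ p)
    (hq : q ∈ Icc 0 r0) (hu : 0 ≤ u) : coneV m q u ≤ p := by
  have h := coneV_mul (u := u) hm hq
  have h1 := mul_le_of_mem_r0 hm hq
  have h2 : u * (q - r0) ≤ 0 := mul_nonpos_of_nonneg_of_nonpos hu (by linarith [hq.2])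
  have h3 : 0 ≤ (r0 - q) * (1 + p * m) :=
    mul_nonneg (by linarith [hq.2]) (by nlinarith [mul_nonneg hp hm.1])
  by_contra! hlt
  nlinarith [mul_pos (show 0 < coneV m q u - p by linarith) (show 0 < 1 - m * q by linarith)]

lemma coneV_le (hm : m ∈ Icc 0 r0) (hq : q ∈ Icc 0 r0) (hu : -2 ≤ u) : coneV m q u ≤ 0.27 := by
  have h := coneV_mul (u := u) hm hq
  have h1 := mul_le_of_mem_r0 hm hq
  have h2 : u * (q - r0) ≤ -2 * (q - r0) := mul_le_mul_of_nonpos_right hu (by linarith [hq.2])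
  nlinarith [hm.1, hq.1, r0_lt]

lemma one_sub_mul_coneV_pos (hm : m ∈ Icc 0 r0) (hq : q ∈ Icc 0 r0) (hu : -2 ≤ u) :
    0.96 ≤ 1 - q * coneV m q u := by
  have h := coneV_le hm hq hu
  have h1 : q ≤ 0.13 := hq.2.trans r0_lt.le
  nlinarith [mul_le_mul_of_nonneg_left h hq.1]

lemma coneD_of_nonpos (hm : m ∈ Icc 0 r0) (hq : q ∈ Icc 0 r0) (hu : -2 ≤ u) (hu0 : u ≤ 0) :
    0.94 ≤ coneD m q u := by
  have h1 := one_sub_mul_coneV_pos hm hq hu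
  have h2 := mul_le_of_mem_r0 ⟨r0_pos.le, le_rfl⟩ hq
  have h3 : 0 ≤ 9 * r0 * q * -u := mul_nonneg (by have := r0_pos; have := hq.1; positivity) (by linarith)
  unfold coneD
  nlinarith

lemma coneD_of_nonneg (hm : m ∈ Icc 0 r0) (hmp : r0 - m = p * (1 - m * r0)) (hp : 0 ≤ p)
    (hp1 : p ≤ 1) (hκ : κ ≤ (1 - r0 * p) * (1 - r0 ^ 2) - 9 * r0 ^ 2 * U)
    (hq : q ∈ Icc 0 r0) (hu0 : 0 ≤ u) (hu : u ≤ U) : κ ≤ coneD m q u := by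
  have h1 := coneV_le_of_nonneg hm hmp hp hq hu0
  have hr := r0_pos
  have hr' := r0_lt
  have h2 : 1 - r0 * p ≤ 1 - q * coneV m q u := by
    nlinarith [mul_le_mul_of_nonneg_left h1 hq.1, mul_le_mul_of_nonneg_right hq.2 hp]
  have h3 : 1 - r0 ^ 2 ≤ 1 - r0 * q := by nlinarith [hq.2]
  have h4 : 9 * r0 * q * u ≤ 9 * r0 ^ 2 * U := by
    have : q * u ≤ r0 * U := mul_le_mul hq.2 hu hu0 hr.le
    nlinarith
  have h5 : (1 - r0 * p) * (1 - r0 ^ 2) ≤ (1 - q * coneV m q u) * (1 - r0 * q) :=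
    mul_le_mul h2 h3 (by nlinarith) (by nlinarith)
  unfold coneD
  linarith

lemma coneD_pos (hm : m ∈ Icc 0 r0) (hmp : r0 - m = p * (1 - m * r0)) (hp : 0 ≤ p)
    (hp1 : p ≤ 1) (hκ0 : 0 < κ) (hκ : κ ≤ (1 - r0 * p) * (1 - r0 ^ 2) - 9 * r0 ^ 2 * U)
    (hq : q ∈ Icc 0 r0) (hu : u ∈ Icc (-2) U) : 0 < coneD m q u := by
  rcases le_total u 0 with h | h
  · linarith [coneD_of_nonpos hm hq hu.1 h]
  · linarith [coneD_of_nonneg hm hmp hp hp1 hκ hq h hu.2]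

/-- Continuation of the profile from the left of the sonic point to the light cone `z = 0`, with
`q = z / v` as the parameter. -/
theorem exists_cone_profile (hm : m ∈ Icc 0 r0) (hmp : r0 - m = p * (1 - m * r0)) (hp : 0 ≤ p)
    (hp1 : p ≤ 1) (hU : U ∈ Ioc 0 7) (hκ0 : 0 < κ)
    (hκ : κ ≤ (1 - r0 * p) * (1 - r0 ^ 2) - 9 * r0 ^ 2 * U) (hpκ : 18 * r0 * U * p ≤ κ)
    {qe ue : ℝ} (hqe : qe ∈ Ioo 0 r0) (hue : ue ∈ Ioo (-2) U) (hve : 0 < coneV m qe ue) :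
    ∃ v v' : ℝ → ℝ, v qe = coneV m qe ue ∧ ∀ q ∈ Icc 0 qe, 0 < v q ∧ q * v q < 1 ∧
      HasDerivAt v (v' q) q ∧ 0 < v q + q * v' q ∧
      (1 - q * v q) * (v q - r0 * (q * v q)) * (q * v q - r0 * v q) * v' q =
        9 * r0 * v q * (v q ^ 2 + m * v q - m * v q * (q * v q) - q * v q) * (v q + q * v' q) := by
  have hmem : ∀ q ∈ Icc 0 qe, q ∈ Icc 0 r0 := fun q hq => ⟨hq.1, hq.2.trans hqe.2.le⟩
  have hden : ∀ q ∈ Icc 0 qe, 0 < 1 - m * q := fun q hq => by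
    linarith [(mul_le_of_mem_r0 hm (hmem q hq)).2]
  have hD := fun q (hq : q ∈ Icc 0 qe) u (hu : u ∈ Icc (-2) U) =>
    coneD_pos hm hmp hp hp1 hκ0 hκ (hmem q hq) hu
  have hsmV : ContDiffOn ℝ 1 (fun x : ℝ × ℝ => coneV m x.1 x.2) (Icc 0 qe ×ˢ Icc (-2) U) := by
    unfold coneV
    exact ContDiffOn.div (by fun_prop) (by fun_prop) fun x hx => (hden x.1 hx.1).ne'
  have hsmD : ContDiffOn ℝ 1 (fun x : ℝ × ℝ => coneD m x.1 x.2) (Icc 0 qe ×ˢ Icc (-2) U) := by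
    unfold coneD
    fun_prop
  have hsm : ContDiffOn ℝ 1 (Function.uncurry (coneRhs m)) (Icc 0 qe ×ˢ Icc (-2) U) := by
    unfold Function.uncurry coneRhs
    refine ContDiffOn.div (((ContDiffOn.sub (ContDiffOn.mul (by fun_prop)
      (ContDiffOn.div (by fun_prop) hsmD fun x hx => (hD x.1 hx.1 x.2 hx.2).ne'))
      (by fun_prop)).sub (by fun_prop)).sub (by fun_prop)) (by fun_prop) fun x hx => ?_
    exact (show x.1 - r0 < 0 by linarith [hx.1.2, hqe.2]).ne
  obtain ⟨-, u, hu0, hu⟩ := exists_clamped_solution (f := coneRhs m) hqe.1.le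
    (show (-2 : ℝ) ≤ U by linarith [hU.1]) hsm qe ue
  have hu' : ∀ q ∈ Icc 0 qe, u q ∈ Icc (-2) U → HasDerivAt u (coneRhs m q (u q)) q :=
    fun q hq huq => by
      have := hu q
      rwa [clamp_of_mem hq, clamp_of_mem huq] at this
  have hcont : ContinuousOn u (Icc 0 qe) := fun q _ => (hu q).continuousAt.continuousWithinAt
  have hlt : ∀ q ∈ Icc 0 qe, 0 < U - u q := by
    refine pos_of_deriv_neg_at_zeros (continuousOn_const.sub hcont) (by rw [hu0]; linarith [hue.2])
      fun q hq h0 => ?_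
    have hq' := Ico_subset_Icc_self hq
    have hU' : u q = U := by linarith
    have hUm : U ∈ Icc (-2) U := ⟨by linarith [hU.1], le_rfl⟩
    refine ⟨_, ?_, (hu' q hq' (by rw [hU']; exact hUm)).const_sub U⟩
    rw [hU', neg_lt_zero]
    refine div_pos_of_neg_of_neg ?_ (by linarith [hqe.2, hq.2])
    have h1 := coneV_le_of_nonneg hm hmp hp (hmem q hq') hU.1.le
    have h2 := neg_le_coneV hm (hmem q hq') hU.2
    have h3 := coneD_of_nonneg hm hmp hp hp1 hκ (hmem q hq') hU.1.le le_rfl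
    have h4 : 9 * r0 * U * coneV m q U / coneD m q U ≤ 1 / 2 := by
      rw [div_le_iff₀ (by linarith)]
      have h5 : 0 ≤ 9 * r0 * U := by have := r0_pos; have := hU.1; positivity
      nlinarith [mul_le_mul_of_nonneg_left h1 h5]
    have h6 := mul_le_of_mem_r0 hm (hmem q hq')
    have h7 := mul_le_mul_of_nonneg_left h4 (hden q hq').le
    have h8 : -(m * coneV m q U) ≤ 0.2 := by
      have : m ≤ 0.13 := hm.2.trans r0_lt.le
      nlinarith [mul_le_mul_of_nonneg_left h2 hm.1]
    linarith [hU.1]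
  have hgt : ∀ q ∈ Icc 0 qe, 0 < u q + 2 := by
    refine pos_of_deriv_neg_at_zeros (hcont.add continuousOn_const) (by rw [hu0]; linarith [hue.1])
      fun q hq h0 => ?_
    have hq' := Ico_subset_Icc_self hq
    have hU' : u q = -2 := by linarith
    have hUm : (-2 : ℝ) ∈ Icc (-2) U := ⟨le_rfl, by linarith [hU.1]⟩
    refine ⟨_, ?_, (hu' q hq' (by rw [hU']; exact hUm)).add_const 2⟩
    rw [hU']
    refine div_neg_of_pos_of_neg ?_ (by linarith [hqe.2, hq.2])
    have h1 := coneV_le hm (hmem q hq') (le_refl (-2))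
    have h2 := coneD_of_nonpos hm (hmem q hq') (le_refl (-2)) (by norm_num)
    have h6 := mul_le_of_mem_r0 hm (hmem q hq')
    have hm' : m ≤ 0.13 := hm.2.trans r0_lt.le
    have h3 : 0 ≤ coneV m q (-2) := by
      have h := coneV_mul (u := -2) hm (hmem q hq')
      by_contra! hn
      nlinarith [mul_neg_of_neg_of_pos hn (hden q hq'), hm.2, hqe.2, hq.2]
    have h4 : -(0.68 : ℝ) ≤ 9 * r0 * (-2) * coneV m q (-2) / coneD m q (-2) := by
      rw [le_div_iff₀ (by linarith)]
      nlinarith [mul_le_mul_of_nonneg_left h1 r0_pos.le, r0_lt]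
    have h7 := mul_le_mul_of_nonneg_left h4 (hden q hq').le
    have h8 : m * coneV m q (-2) ≤ 0.13 * 0.27 := mul_le_mul hm' h1 h3 (by norm_num)
    linarith
  have huI : ∀ q ∈ Icc 0 qe, u q ∈ Icc (-2) U := fun q hq =>
    ⟨by linarith [hgt q hq], by linarith [hlt q hq]⟩
  set B : ℝ → ℝ := fun q => 9 * r0 * u q / coneD m q (u q) with hB
  have hv : ∀ q ∈ Icc 0 qe, HasDerivAt (fun q => coneV m q (u q)) (B q * coneV m q (u q)) q := by
    intro q hq
    have h1 := hu' q hq (huI q hq)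
    have h2 := (hden q hq).ne'
    have h3 : q - r0 ≠ 0 := (show q - r0 < 0 by linarith [hq.2, hqe.2]).ne
    have h4 := (((h1.mul ((hasDerivAt_id q).sub_const r0)).sub_const m).add (hasDerivAt_id q)).div
      (((hasDerivAt_id q).const_mul m).const_sub 1) h2
    refine h4.congr_deriv ?_
    have h5 : u q * (q - r0) - m + q = coneV m q (u q) * (1 - m * q) :=
      (coneV_mul hm (hmem q hq)).symm
    have h6 : coneRhs m q (u q) * (q - r0) =
        (1 - m * q) * (B q * coneV m q (u q)) - m * coneV m q (u q) - 1 - u q := by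
      rw [coneRhs, div_mul_cancel₀ _ h3, hB]
      ring
    simp only [id, mul_one, Pi.mul_apply, Pi.add_apply]
    rw [h6, h5]
    field_simp
    ring
  have hmaps : MapsTo (fun q => (q, u q)) (Icc 0 qe) (Icc 0 qe ×ˢ Icc (-2) U) :=
    fun q hq => ⟨hq, huI q hq⟩
  have hBc : ContinuousOn B (Icc 0 qe) := by
    refine ContinuousOn.div (by fun_prop) ?_ fun q hq => (hD q hq _ (huI q hq)).ne'
    exact hsmD.continuousOn.comp (f := fun q => (q, u q)) (continuousOn_id.prodMk hcont) hmaps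
  have hpos := pos_of_hasDerivAt_mul hv hBc (by simpa only [hu0] using hve)
  refine ⟨fun q => coneV m q (u q), fun q => B q * coneV m q (u q), by simp only [hu0],
    fun q hq => ⟨hpos q hq, ?_, hv q hq, ?_, ?_⟩⟩
  · linarith [one_sub_mul_coneV_pos hm (hmem q hq) (huI q hq).1]
  · have h1 := hD q hq _ (huI q hq)
    have h2 := one_sub_mul_coneV_pos hm (hmem q hq) (huI q hq).1
    have h3 := mul_le_of_mem_r0 ⟨r0_pos.le, le_rfl⟩ (hmem q hq)
    have h4 : coneV m q (u q) + q * (B q * coneV m q (u q)) = coneV m q (u q) *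
        ((1 - q * coneV m q (u q)) * (1 - r0 * q)) / coneD m q (u q) := by
      rw [eq_div_iff h1.ne', hB]
      field_simp
      rw [coneD]
      ring
    rw [h4]
    exact div_pos (mul_pos (hpos q hq) (mul_pos (by linarith) (by linarith))) h1
  · have h1 := (hD q hq _ (huI q hq)).ne'
    have h5 := coneV_mul (u := u q) hm (hmem q hq)
    have hBD : B q * coneD m q (u q) = 9 * r0 * u q := div_mul_cancel₀ _ h1
    rw [coneD] at hBD
    simp only
    generalize coneV m q (u q) = w at *
    generalize B q = b at *
    linear_combination (w ^ 3 * (q - r0)) * hBD - (9 * r0 * w ^ 2 * (w + q * (b * w))) * h5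

end

/-- `(Δ_Z / Z - 1) / Z²` in terms of `x = Z²` and `g = V / Z`. -/
def originQ (x g : ℝ) : ℝ := -2 * g + x * g ^ 2 - 5 / 3 * (g - 1) ^ 2

/-- The nonlinearity in the equation `x y' = x G - 2 y` for `V / Z = 3 α / 4 + y` as a function of
`x = Z²`. -/
def originG (q : ℝ × ℝ × ℝ) : ℝ :=
  (3 * ((3 * q.1 / 4 + q.2.2) ^ 2 * (1 - q.1) -
      (3 * q.1 / 4 + q.2.2) ^ 2 * (q.1 - (3 * q.1 / 4 + q.2.2)) -
      q.2.1 * (3 * q.1 / 4 + q.2.2) ^ 4 * (1 - q.1)) -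
    3 * (q.1 - (3 * q.1 / 4 + q.2.2)) * originQ q.2.1 (3 * q.1 / 4 + q.2.2)) /
  (2 * (1 + q.2.1 * originQ q.2.1 (3 * q.1 / 4 + q.2.2)))

lemma one_add_mul_originQ_pos {x g : ℝ} (hx : x ∈ Icc (-(1 / 10)) (1 / 10))
    (hg : g ∈ Icc 0 1) : 0 < 1 + x * originQ x g := by
  have h1 : |originQ x g| ≤ 4 := by
    have h2 : 0 ≤ (1 - x) * g ^ 2 ∧ (1 - x) * g ^ 2 ≤ 2 := by
      constructor
      · exact mul_nonneg (by linarith [hx.2]) (sq_nonneg _)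
      · nlinarith [hx.1, hx.2, hg.1, hg.2]
    unfold originQ
    rw [abs_le]
    constructor <;> nlinarith [hx.1, hx.2, hg.1, hg.2, h2.1, h2.2, sq_nonneg g]
  have h2 : |x * originQ x g| ≤ 1 / 10 * 4 := by
    rw [abs_mul]
    exact mul_le_mul (abs_le.2 hx) h1 (abs_nonneg _) (by norm_num)
  linarith [(abs_le.1 h2).1]

lemma delZ_origin (Z g : ℝ) : DelZ Z (Z * g) = Z * (1 + Z ^ 2 * originQ (Z ^ 2) g) := by
  unfold DelZ originQ
  ring

theorem exists_origin_profiles :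
    ∃ δ ∈ Ioo (0 : ℝ) (1 / 10), ∃ g : ℝ → ℝ → ℝ,
      (∀ x, ContinuousOn (fun α => g α x) (Icc (1 / 2) 0.57)) ∧
      ∀ α ∈ Icc (1 / 2 : ℝ) 0.57, ContDiffOn ℝ (⊤ : ℕ∞) (g α) (Ioo (-δ) δ) ∧
        (∀ x ∈ Ioo (-δ) δ, g α x ∈ Icc 0.3 (α - 0.07)) ∧
        ∀ γ, 1 / (γ + 1) = α → ∀ Z, 0 < Z → Z ^ 2 < δ → 0 < DelZ Z (Z * g α (Z ^ 2)) ∧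
          HasDerivAt (fun Z => Z * g α (Z ^ 2))
            (DelV γ Z (Z * g α (Z ^ 2)) / DelZ Z (Z * g α (Z ^ 2))) Z := by
  have hQ : ∀ q ∈ Icc (1 / 2 : ℝ) 0.57 ×ˢ Icc (-(1 / 10) : ℝ) (1 / 10) ×ˢ
      Icc (-(1 / 10) : ℝ) (1 / 10), 0 < 1 + q.2.1 * originQ q.2.1 (3 * q.1 / 4 + q.2.2) := by
    rintro ⟨α, x, y⟩ ⟨hα, hx, hy⟩
    exact one_add_mul_originQ_pos hx
      ⟨by simp only; linarith [hα.1, hy.1], by simp only; norm_num at hα; linarith [hα.2, hy.2]⟩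
  have hG : ContDiffOn ℝ (⊤ : ℕ∞) originG
      (Icc (1 / 2 : ℝ) 0.57 ×ˢ Icc (-(1 / 10) : ℝ) (1 / 10) ×ˢ Icc (-(1 / 10) : ℝ) (1 / 10)) := by
    unfold originG
    refine ContDiffOn.div ?_ ?_ fun q hq => (mul_pos two_pos (hQ q hq)).ne'
    · unfold originQ; fun_prop
    · unfold originQ; fun_prop
  obtain ⟨δ, hδ, v, hv1, hv2, hv3, hv4⟩ := exists_briotBouquet_solution (μ := 2) two_pos
    (by norm_num : (0 : ℝ) < 1 / 10) (by norm_num : (1 / 2 : ℝ) ≤ 0.57) hG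
  have hg : ∀ α ∈ Icc (1 / 2 : ℝ) 0.57, ∀ x ∈ Ioo (-δ) δ,
      3 * α / 4 + x * v α x ∈ Icc 0.3 (α - 0.07) := fun α hα x hx => by
    have := abs_le.1 (hv1 α hα x hx)
    norm_num at hα this ⊢
    constructor <;> linarith
  refine ⟨δ, hδ, fun α x => 3 * α / 4 + x * v α x, fun x => ?_, fun α hα => ⟨?_, hg α hα, ?_⟩⟩
  · exact (by fun_prop : Continuous fun α : ℝ => 3 * α / 4).continuousOn.add
      (continuousOn_const.mul (hv4 x))
  · exact contDiffOn_const.add (contDiffOn_id.mul (hv2 α hα))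
  · intro γ hγ Z hZ hZδ
    have hx : Z ^ 2 ∈ Ioo (-δ) δ := ⟨by nlinarith [hδ.1], hZδ⟩
    have hx' : Z ^ 2 ∈ Icc (-(1 / 10) : ℝ) (1 / 10) := ⟨by linarith [hx.1, hδ.2], by linarith [hx.2, hδ.2]⟩
    have hy := abs_le.1 (hv1 α hα _ hx)
    have hQ' := hQ (α, Z ^ 2, Z ^ 2 * v α (Z ^ 2))
      ⟨hα, hx', by simp only; linarith [hy.1], by simp only; linarith [hy.2]⟩
    simp only at hQ'
    have hD : 0 < DelZ Z (Z * (3 * α / 4 + Z ^ 2 * v α (Z ^ 2))) := by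
      rw [delZ_origin]
      exact mul_pos hZ hQ'
    refine ⟨hD, ?_⟩
    have hsq : HasDerivAt (fun Z : ℝ => Z ^ 2) (2 * Z) Z := by simpa using hasDerivAt_pow 2 Z
    have h1 := HasDerivAt.comp (h := fun Z : ℝ => Z ^ 2) (h₂ := fun x => x * v α x) Z
      (hv3 α hα _ hx) hsq
    have h2 := (hasDerivAt_id Z).mul (h1.const_add (3 * α / 4))
    refine h2.congr_deriv ?_
    rw [delZ_origin] at hD ⊢
    simp only [id, Function.comp_apply, one_mul, originG]
    rw [DelV, hγ]
    have hZ' := hZ.ne'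
    generalize v α (Z ^ 2) = w at *
    have hQ₀ := hQ'.ne'
    clear hQ hD h1 h2 hv3 hQ'
    obtain ⟨u, hu⟩ : ∃ u, u = 3 * α / 4 + Z ^ 2 * w := ⟨_, rfl⟩
    rw [← hu] at hQ₀ ⊢
    generalize originQ (Z ^ 2) u = Q at *
    have hα' : α = 4 * (u - Z ^ 2 * w) / 3 := by rw [hu]; ring
    rw [hα']
    field_simp
    ring

/-- The parameter `m = (1 - γ) / (1 + γ)`. -/
def mPar (p : ℝ) : ℝ := (r0 - p) / (1 - r0 * p)

/-- The denominator in the coordinate change from `θ` to `z / v`. -/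
def phi (p X θ : ℝ) : ℝ := 1 + (1 - p ^ 2 + (r0 - p) * X) * θ

/-- The value of `z / v` in terms of `X` and `θ`. -/
def qOf (p X θ : ℝ) : ℝ := r0 + (1 - r0 ^ 2) * θ * X / phi p X θ

lemma rhs_fCoef (p X θ : ℝ) : rhs (fCoef p) X θ =
    (1 - r0 * p) * θ * (phi p X θ - (p + X) * (r0 * phi p X θ + (1 - r0 ^ 2) * θ * X)) *
      (phi p X θ - r0 * θ * X) * ((8 - r0) / 9) - (4 - r0) / 30 * phi p X θ ^ 2 -
      phi p X θ * θ * X - (p + X) * θ * (1 + (1 - p ^ 2) * θ) := by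
  simp only [rhs, eval_cubic, fCoef, phi]
  ring

lemma rhs_aCoef (p X ψ : ℝ) : rhs (aCoef p) X ψ = rhs (fCoef p) X (th0 p + ψ) := by
  simp only [rhs, eval_cubic, aCoef]
  ring

/-- The curve `s ↦ (Z s, V s)` is a graph when `Z` has negative derivative. -/
lemma exists_graph_of_deriv_neg {Z V Z' V' : ℝ → ℝ} {a b : ℝ} (hab : a ≤ b)
    (hZ : ∀ s ∈ Icc a b, HasDerivAt Z (Z' s) s) (hZ' : ∀ s ∈ Icc a b, Z' s < 0)
    (hV : ∀ s ∈ Icc a b, HasDerivAt V (V' s) s) :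
    Z '' Icc a b = Icc (Z b) (Z a) ∧ ∃ W : ℝ → ℝ, ∀ s ∈ Icc a b, W (Z s) = V s ∧
      HasDerivWithinAt W (V' s * (Z' s)⁻¹) (Icc (Z b) (Z a)) (Z s) := by
  have hcont : ContinuousOn Z (Icc a b) := fun s hs => (hZ s hs).continuousAt.continuousWithinAt
  have hanti : StrictAntiOn Z (Icc a b) :=
    strictAntiOn_of_hasDerivWithinAt_neg (convex_Icc a b) hcont
      (fun s hs => (hZ s (interior_subset hs)).hasDerivWithinAt)
      (fun s hs => hZ' s (interior_subset hs))
  have himg : Z '' Icc a b = Icc (Z b) (Z a) := by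
    refine subset_antisymm ?_ (intermediate_value_Icc' hab hcont)
    rintro _ ⟨s, hs, rfl⟩
    exact ⟨hanti.antitoneOn hs (right_mem_Icc.2 hab) hs.2,
      hanti.antitoneOn (left_mem_Icc.2 hab) hs hs.1⟩
  refine ⟨himg, fun x => V (Function.invFunOn Z (Icc a b) x), fun s hs => ?_⟩
  set τ := Function.invFunOn Z (Icc a b) with hτ
  have hleft : ∀ s ∈ Icc a b, τ (Z s) = s := hanti.injOn.leftInvOn_invFunOn
  have hright : ∀ x ∈ Icc (Z b) (Z a), Z (τ x) = x ∧ τ x ∈ Icc a b := by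
    intro x hx
    rw [← himg] at hx
    exact ⟨Function.invFunOn_eq hx, Function.invFunOn_mem hx⟩
  have hind : IsInducing ((Icc a b).domRestrict Z) :=
    (hcont.domRestrict.isClosedEmbedding hanti.injOn.injective).isInducing
  have htend : Tendsto τ (𝓝[Icc (Z b) (Z a)] (Z s)) (𝓝[Icc a b] s) := by
    have hn := hind.nhds_eq_comap ⟨s, hs⟩
    have hmap : 𝓝[Icc a b] s = Filter.map Subtype.val (𝓝 (⟨s, hs⟩ : Icc a b)) :=
      nhdsWithin_eq_map_subtype_coe hs
    rw [hmap, hn]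
    intro A hA
    rw [Filter.mem_map, Filter.mem_comap] at hA
    obtain ⟨B, hB, hBA⟩ := hA
    rw [Filter.mem_map]
    filter_upwards [nhdsWithin_le_nhds hB, self_mem_nhdsWithin] with x hx hx'
    obtain ⟨h1, h2⟩ := hright x hx'
    have : (⟨τ x, h2⟩ : Icc a b) ∈ (Icc a b).domRestrict Z ⁻¹' B := by
      simpa [Set.domRestrict, h1] using hx
    exact hBA this
  have hmem : Z s ∈ Icc (Z b) (Z a) := himg ▸ mem_image_of_mem Z hs
  have hinv : HasDerivWithinAt τ (Z' s)⁻¹ (Icc (Z b) (Z a)) (Z s) := by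
    have h1 : HasFDerivWithinAt Z
        ((ContinuousLinearEquiv.unitsEquivAut ℝ (Units.mk0 (Z' s) (hZ' s hs).ne) : ℝ ≃L[ℝ] ℝ) :
          ℝ →L[ℝ] ℝ) (Icc a b) (τ (Z s)) := by
      rw [hleft s hs]
      exact ((hZ s hs).hasFDerivAt_equiv (hZ' s hs).ne).hasFDerivWithinAt
    have h2 := HasFDerivWithinAt.of_local_left_inverse
      (g := τ) (s := Icc (Z b) (Z a)) (a := Z s) (t := Icc a b) (by rwa [hleft s hs]) h1 hmem
      (by filter_upwards [self_mem_nhdsWithin] with x hx using (hright x hx).1)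
    exact h2
  refine ⟨congrArg V (hleft s hs), ?_⟩
  have h3 : HasDerivAt V (V' s) (τ (Z s)) := by rw [hleft s hs]; exact hV s hs
  exact HasDerivAt.comp_hasDerivWithinAt (h₂ := V) (h := τ) (Z s) h3 hinv

/-- `f` solves the equation on `I` inside the admissible region and is smooth at its sonic
points. -/
def IsProfileOn (γ : ℝ) (I : Set ℝ) (f : ℝ → ℝ) : Prop :=
  ∀ Z ∈ I, f Z ∈ Ioo (-1 : ℝ) 1 ∧ f Z < Z ∧
    (∃ d, HasDerivWithinAt f d I Z ∧ DelZ Z (f Z) * d = DelV γ Z (f Z)) ∧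
    (DelZ Z (f Z) ≠ 0 ∨ ContDiffAt ℝ (⊤ : ℕ∞) f Z)

lemma IsProfileOn.glue {γ a : ℝ} {s t : Set ℝ} {f g : ℝ → ℝ} (hf : IsProfileOn γ s f)
    (hg : IsProfileOn γ t g) (hs : s ⊆ Iic a) (ht : t ⊆ Ici a) (has : a ∈ s) (hat : a ∈ t)
    (hfg : f a = g a) (hD : DelZ a (f a) ≠ 0) :
    IsProfileOn γ (s ∪ t) (fun Z => if Z ≤ a then f Z else g Z) := by
  set h : ℝ → ℝ := fun Z => if Z ≤ a then f Z else g Z with hh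
  have hl : ∀ Z, Z ≤ a → h Z = f Z := fun Z hZ => if_pos hZ
  have hr : ∀ Z, a ≤ Z → h Z = g Z := by
    intro Z hZ
    rcases hZ.eq_or_lt with rfl | hZ
    · rw [hl _ le_rfl, hfg]
    · exact if_neg (not_le.2 hZ)
  intro Z hZ
  rcases lt_trichotomy Z a with hlt | rfl | hgt
  · have hZs : Z ∈ s := hZ.resolve_right fun hc => absurd (ht hc) (not_le.2 hlt)
    have heq : h =ᶠ[𝓝 Z] f := by
      filter_upwards [Iio_mem_nhds hlt] with w hw using hl w hw.le
    obtain ⟨h1, h2, ⟨d, hd, hdd⟩, h4⟩ := hf Z hZs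
    rw [hl Z hlt.le]
    refine ⟨h1, h2, ⟨d, ?_, hdd⟩, h4.imp_right fun hc => hc.congr_of_eventuallyEq heq⟩
    have : 𝓝[s ∪ t] Z = 𝓝[s] Z := by
      refine nhdsWithin_eq_nhdsWithin (mem_Iio.2 hlt) isOpen_Iio ?_
      ext w
      exact ⟨fun hw => ⟨hw.1.resolve_right fun hc => absurd (mem_Ici.1 (ht hc)) (not_le.2 hw.2), hw.2⟩,
        fun hw => ⟨Or.inl hw.1, hw.2⟩⟩
    rw [HasDerivWithinAt, this]
    exact hd.congr_of_eventuallyEq (heq.filter_mono nhdsWithin_le_nhds) (hl Z hlt.le)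
  · obtain ⟨h1, h2, ⟨d, hd, hdd⟩, h4⟩ := hf Z has
    obtain ⟨-, -, ⟨e, he, hee⟩, -⟩ := hg Z hat
    have hde : e = d := by
      rw [← hfg, ← hdd] at hee
      exact mul_left_cancel₀ hD hee
    rw [hl Z le_rfl]
    refine ⟨h1, h2, ⟨d, ?_, hdd⟩, Or.inl hD⟩
    exact (hd.congr (fun w hw => hl w (hs hw)) (hl Z le_rfl)).union
      ((hde ▸ he).congr (fun w hw => hr w (ht hw)) (hr Z le_rfl))
  · have hZt : Z ∈ t := hZ.resolve_left fun hc => absurd (hs hc) (not_le.2 hgt)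
    have heq : h =ᶠ[𝓝 Z] g := by
      filter_upwards [Ioi_mem_nhds hgt] with w hw using hr w (le_of_lt hw)
    obtain ⟨h1, h2, ⟨d, hd, hdd⟩, h4⟩ := hg Z hZt
    rw [hr Z hgt.le]
    refine ⟨h1, h2, ⟨d, ?_, hdd⟩, h4.imp_right fun hc => hc.congr_of_eventuallyEq heq⟩
    have : 𝓝[s ∪ t] Z = 𝓝[t] Z := by
      refine nhdsWithin_eq_nhdsWithin (mem_Ioi.2 hgt) isOpen_Ioi ?_
      ext w
      exact ⟨fun hw => ⟨hw.1.resolve_left fun hc => absurd (mem_Iic.1 (hs hc)) (not_le.2 hw.2), hw.2⟩,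
        fun hw => ⟨Or.inr hw.1, hw.2⟩⟩
    rw [HasDerivWithinAt, this]
    exact hd.congr_of_eventuallyEq (heq.filter_mono nhdsWithin_le_nhds) (hr Z hgt.le)

/-- The involution relating `Z` to `z` and `V` to `v`. -/
def cayley (x : ℝ) : ℝ := (1 - x) / (1 + x)

lemma hasDerivAt_cayley_comp {f : ℝ → ℝ} {f' s : ℝ} (hf : HasDerivAt f f' s) (h : 1 + f s ≠ 0) :
    HasDerivAt (fun s => cayley (f s)) (-2 * f' / (1 + f s) ^ 2) s := by
  refine ((hf.const_sub 1).div (hf.const_add 1) h).congr_deriv ?_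
  congr 1
  ring

lemma delZ_cayley {z v : ℝ} (hz : 1 + z ≠ 0) (hv : 1 + v ≠ 0) :
    DelZ (cayley z) (cayley v) * (6 * r0 * (1 + v) ^ 2 * (1 + z) ^ 3) =
      16 * (1 - z) * (v - r0 * z) * (z - r0 * v) := by
  have h := r0_sq
  have h5 : r0 * v ^ 2 + r0 * z ^ 2 - r0 ^ 2 * (v * z) - v * z
      = r0 * v ^ 2 + r0 * z ^ 2 - 8 * r0 * (v * z) := by rw [h]; ring
  unfold DelZ cayley
  field_simp
  linear_combination (-48 * (1 - z) * (v * z)) * h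

lemma delV_cayley {γ m z v : ℝ} (hγ : 1 / (γ + 1) = (1 + m) / 2) (hz : 1 + z ≠ 0)
    (hv : 1 + v ≠ 0) :
    DelV γ (cayley z) (cayley v) * ((1 + v) ^ 4 * (1 + z)) =
      24 * v * (v ^ 2 + m * v - m * v * z - z) := by
  unfold DelV cayley
  rw [hγ]
  field_simp
  ring

lemma cayley_ode {γ m z v z' v' : ℝ} (hγ : 1 / (γ + 1) = (1 + m) / 2) (hz : 1 + z ≠ 0)
    (hv : 1 + v ≠ 0) (h : (1 - z) * (v - r0 * z) * (z - r0 * v) * v' =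
      9 * r0 * v * (v ^ 2 + m * v - m * v * z - z) * z') :
    DelZ (cayley z) (cayley v) * (-2 * v' / (1 + v) ^ 2) =
      DelV γ (cayley z) (cayley v) * (-2 * z' / (1 + z) ^ 2) := by
  have h1 := delZ_cayley hz hv
  have h2 := delV_cayley hγ hz hv
  have hr := r0_pos
  have e1 : DelZ (cayley z) (cayley v) = 16 * (1 - z) * (v - r0 * z) * (z - r0 * v) /
      (6 * r0 * (1 + v) ^ 2 * (1 + z) ^ 3) := by
    rw [eq_div_iff (by positivity), h1]
  have e2 : DelV γ (cayley z) (cayley v) = 24 * v * (v ^ 2 + m * v - m * v * z - z) /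
      ((1 + v) ^ 4 * (1 + z)) := by
    rw [eq_div_iff (by positivity), h2]
  rw [e1, e2]
  field_simp
  linear_combination (-16) * h

lemma cayley_mem {v : ℝ} (hv : 0 < v) : cayley v ∈ Ioo (-1 : ℝ) 1 := by
  unfold cayley
  constructor
  · rw [lt_div_iff₀ (by linarith)]; linarith
  · rw [div_lt_iff₀ (by linarith)]; linarith

lemma cayley_lt_cayley {z v : ℝ} (hz : -1 < z) (hzv : z < v) : cayley v < cayley z := by
  unfold cayley
  rw [div_lt_div_iff₀ (by linarith) (by linarith)]
  nlinarith

lemma cayley_cayley {x : ℝ} (hx : 1 + x ≠ 0) : cayley (cayley x) = x := by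
  unfold cayley
  field_simp
  ring

section

variable {p m κ U γ : ℝ}

lemma delZ_cayley_ne_zero {z v : ℝ} (hz : -1 < z) (hv : 0 < v) (h1 : z < 1)
    (h2 : v ≠ r0 * z) (h3 : z ≠ r0 * v) : DelZ (cayley z) (cayley v) ≠ 0 := by
  intro h
  have := delZ_cayley (z := z) (v := v) (by linarith) (by linarith)
  rw [h, zero_mul] at this
  have h1' : (1 - z) ≠ 0 := by linarith
  have : 16 * (1 - z) * (v - r0 * z) * (z - r0 * v) ≠ 0 :=
    mul_ne_zero (mul_ne_zero (mul_ne_zero (by norm_num) h1') (sub_ne_zero.2 h2))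
      (sub_ne_zero.2 h3)
  simp_all

lemma exists_cone_graph (hγ : 1 / (γ + 1) = (1 + m) / 2) (hm : m ∈ Icc 0 r0)
    (hmp : r0 - m = p * (1 - m * r0)) (hp : 0 ≤ p) (hp1 : p ≤ 1) (hU : U ∈ Ioc (0 : ℝ) 7)
    (hκ0 : 0 < κ) (hκ : κ ≤ (1 - r0 * p) * (1 - r0 ^ 2) - 9 * r0 ^ 2 * U)
    (hpκ : 18 * r0 * U * p ≤ κ) {qe ue : ℝ} (hqe : qe ∈ Ioo 0 r0) (hue : ue ∈ Ioo (-2) U)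
    (hve : 0 < coneV m qe ue) :
    cayley (qe * coneV m qe ue) ≤ 1 ∧ ∃ W : ℝ → ℝ,
      W (cayley (qe * coneV m qe ue)) = cayley (coneV m qe ue) ∧
      IsProfileOn γ (Icc (cayley (qe * coneV m qe ue)) 1) W := by
  obtain ⟨v, v', hv0, hv⟩ := exists_cone_profile hm hmp hp hp1 hU hκ0 hκ hpκ hqe hue hve
  have hr := r0_pos
  have hr1 := r0_lt
  have hder : ∀ q ∈ Icc 0 qe, HasDerivAt (fun q => q * v q) (v q + q * v' q) q := by
    intro q hq
    exact ((hasDerivAt_id q).mul (hv q hq).2.2.1).congr_deriv (by simp)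
  have hz : ∀ q ∈ Icc 0 qe, 0 ≤ q * v q := fun q hq => mul_nonneg hq.1 (hv q hq).1.le
  have hdZ : ∀ q ∈ Icc 0 qe, HasDerivAt (fun q => cayley (q * v q))
      (-2 * (v q + q * v' q) / (1 + q * v q) ^ 2) q := fun q hq =>
    hasDerivAt_cayley_comp (hder q hq) (by linarith [hz q hq])
  have hdV : ∀ q ∈ Icc 0 qe, HasDerivAt (fun q => cayley (v q))
      (-2 * v' q / (1 + v q) ^ 2) q := fun q hq =>
    hasDerivAt_cayley_comp (hv q hq).2.2.1 (by linarith [(hv q hq).1])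
  have hZneg : ∀ q ∈ Icc 0 qe, -2 * (v q + q * v' q) / (1 + q * v q) ^ 2 < 0 := by
    intro q hq
    have h1 := (hv q hq).2.2.2.1
    have h2 := hz q hq
    rw [div_lt_iff₀ (by positivity)]
    linarith
  obtain ⟨himg, W, hW⟩ := exists_graph_of_deriv_neg hqe.1.le hdZ hZneg hdV
  have hc0 : cayley (0 * v 0) = 1 := by simp [cayley]
  rw [hc0, hv0] at himg hW
  have hmem : ∀ q ∈ Icc 0 qe, cayley (q * v q) ∈ Icc (cayley (qe * coneV m qe ue)) 1 :=
    fun q hq => himg ▸ mem_image_of_mem (fun q => cayley (q * v q)) hq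
  refine ⟨(hmem 0 ⟨le_rfl, hqe.1.le⟩).1.trans_eq hc0, W, ?_, ?_⟩
  · have := (hW qe ⟨hqe.1.le, le_rfl⟩).1
    rwa [hv0] at this
  · intro Z hZ
    rw [← himg] at hZ
    obtain ⟨q, hq, rfl⟩ := hZ
    obtain ⟨h1, h2⟩ := hW q hq
    obtain ⟨hvp, hqv, -, hpos, hode⟩ := hv q hq
    have hz0 := hz q hq
    have hq1 : q < r0 := hq.2.trans_lt hqe.2
    have hqr : q * v q < r0 * v q := mul_lt_mul_of_pos_right hq1 hvp
    have hrq : r0 * (q * v q) < v q := by nlinarith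
    simp only [] at h1 h2 ⊢
    rw [h1]
    refine ⟨cayley_mem hvp, cayley_lt_cayley (by linarith) (by nlinarith),
      ⟨_, h2, ?_⟩, Or.inl (delZ_cayley_ne_zero (by linarith) hvp hqv hrq.ne' hqr.ne)⟩
    have := cayley_ode (z' := v q + q * v' q) (v' := v' q) hγ (by linarith : 1 + q * v q ≠ 0)
      (by linarith : 1 + v q ≠ 0) (by linarith)
    rw [← mul_assoc, this, mul_assoc, mul_inv_cancel₀ (hZneg q hq).ne, mul_one]

lemma exists_far_graph (hm : 0 ≤ m) (hγ : 1 / (γ + 1) = (1 + m) / 2) {V₁ : ℝ}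
    (hV₁ : V₁ ∈ Ioo (-1 : ℝ) 1) : ∃ V : ℝ → ℝ, V 1 = V₁ ∧ IsProfileOn γ (Ici 1) V := by
  obtain ⟨V, h1, h2⟩ := exists_far_profile hm hγ hV₁
  refine ⟨V, h1, fun Z hZ => ?_⟩
  obtain ⟨h3, h4⟩ := h2 Z hZ
  have hD := (delZ_neg_of_far hZ h3).ne
  exact ⟨h3, h3.2.trans_le hZ, ⟨_, h4.hasDerivWithinAt, mul_div_cancel₀ _ hD⟩, Or.inl hD⟩

end

section

variable {p X θ γ : ℝ}

lemma phi_mul_qOf (h : phi p X θ ≠ 0) :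
    phi p X θ * qOf p X θ = r0 * phi p X θ + (1 - r0 ^ 2) * θ * X := by
  unfold qOf
  field_simp

lemma phi_pos_and_qOf_mem (hp : p ∈ Ioc (0 : ℝ) (1 / 100)) (hX : -p < X) (hv : p + X < 1)
    (hθ : 0 < θ) (hθ1 : X ≤ 0 → θ ≤ 1) :
    0 < phi p X θ ∧ qOf p X θ ∈ Ioo 0 1 ∧ (X < 0 → qOf p X θ < r0) ∧ (0 < X → r0 < qOf p X θ) := by
  obtain ⟨hp0, hp1⟩ := hp
  obtain ⟨hr1, hr2⟩ := r0_bounds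
  have hc : 0 < 1 - p ^ 2 + (r0 - p) * X := by
    rcases le_or_gt 0 X with h | h
    · have : 0 ≤ (r0 - p) * X := mul_nonneg (by linarith) h
      nlinarith
    · nlinarith
  have hΦ : 0 < phi p X θ := by
    unfold phi
    positivity
  have hk : 0 < 1 - r0 ^ 2 := by nlinarith
  have hq := phi_mul_qOf hΦ.ne'
  have hpos : 0 < phi p X θ * qOf p X θ := by
    rw [hq]
    rcases le_or_gt 0 X with h | h
    · have := mul_nonneg (mul_pos hk hθ).le h
      nlinarith [r0_pos]
    · have h1 : 1 ≤ phi p X θ := by unfold phi; nlinarith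
      have h2 : (1 - r0 ^ 2) * θ ≤ 1 := by nlinarith [hθ1 h.le]
      nlinarith [mul_pos hk hθ]
  have hlt : phi p X θ * qOf p X θ < phi p X θ * 1 := by
    rw [hq]
    have h1 : phi p X θ - (1 + r0) * θ * X = 1 + θ * ((1 + p) * (1 - p - X)) := by
      unfold phi; ring
    have h2 : 0 < θ * ((1 + p) * (1 - p - X)) :=
      mul_pos hθ (mul_pos (by linarith) (by linarith))
    nlinarith
  refine ⟨hΦ, ⟨pos_of_mul_pos_right hpos hΦ.le, lt_of_mul_lt_mul_left hlt hΦ.le⟩, fun h => ?_,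
    fun h => ?_⟩
  · have : (1 - r0 ^ 2) * θ * X / phi p X θ < 0 :=
      div_neg_of_neg_of_pos (mul_neg_of_pos_of_neg (mul_pos hk hθ) h) hΦ
    unfold qOf
    linarith
  · have : 0 < (1 - r0 ^ 2) * θ * X / phi p X θ :=
      div_pos (mul_pos (mul_pos hk hθ) h) hΦ
    unfold qOf
    linarith

lemma hasDerivAt_mul_qOf {Θ : ℝ → ℝ} {d : ℝ} (hΘ : HasDerivAt Θ d X)
    (hd : (p + X) * X * d = rhs (fCoef p) X (Θ X)) (hΦ : phi p X (Θ X) ≠ 0) :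
    HasDerivAt (fun X => (p + X) * qOf p X (Θ X))
      ((1 - r0 * p) * Θ X * (1 - (p + X) * qOf p X (Θ X)) * (1 - r0 * qOf p X (Θ X)) *
        ((8 - r0) / 9)) X := by
  have hΦd : HasDerivAt (fun X => phi p X (Θ X))
      ((r0 - p) * Θ X + (1 - p ^ 2 + (r0 - p) * X) * d) X := by
    have h1 : HasDerivAt (fun X => 1 - p ^ 2 + (r0 - p) * X) (r0 - p) X := by
      simpa using ((hasDerivAt_id X).const_mul (r0 - p)).const_add (1 - p ^ 2)
    exact (h1.mul hΘ).const_add 1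
  have hnum : HasDerivAt (fun X => (1 - r0 ^ 2) * Θ X * X)
      ((1 - r0 ^ 2) * d * X + (1 - r0 ^ 2) * Θ X) X := by
    exact ((hΘ.const_mul (1 - r0 ^ 2)).mul (hasDerivAt_id X)).congr_deriv (by simp)
  have hq := (hnum.div hΦd hΦ).const_add r0
  have hz := ((hasDerivAt_id X).const_add p).mul hq
  refine hz.congr_deriv ?_
  simp only [id, Pi.div_apply]
  have hq' := phi_mul_qOf hΦ
  rw [rhs_fCoef, ← hq'] at hd
  have hqd : r0 + (1 - r0 ^ 2) * Θ X * X / phi p X (Θ X) = qOf p X (Θ X) := rfl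
  rw [hqd]
  have hr := r0_sq
  set q := qOf p X (Θ X) with hqdef
  set f := phi p X (Θ X) with hf
  have hfe : f = 1 + (1 - p ^ 2 + (r0 - p) * X) * Θ X := rfl
  set θ := Θ X with hθ
  have hk30 : (1 - r0 ^ 2) * (4 - r0) = 30 * r0 := by
    rw [show (1 - r0 ^ 2) = 2 - 8 * r0 by rw [hr]; ring]; linear_combination 8 * hr
  have hnumer : ((1 - r0 ^ 2) * d * X + (1 - r0 ^ 2) * θ) * f -
      (1 - r0 ^ 2) * θ * X * ((r0 - p) * θ + (1 - p ^ 2 + (r0 - p) * X) * d)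
      = (1 - r0 ^ 2) * (X * d + θ * (1 + (1 - p ^ 2) * θ)) := by rw [hfe]; ring
  rw [hnumer]
  have hgoal : (p + X) * ((1 - r0 ^ 2) * (X * d + θ * (1 + (1 - p ^ 2) * θ)) / f ^ 2) =
      (1 - r0 ^ 2) * ((1 - r0 * p) * θ * (1 - (p + X) * q) * (f - r0 * θ * X) * ((8 - r0) / 9) -
        (4 - r0) / 30 * f - θ * X) / f := by
    rw [mul_div_assoc', div_eq_div_iff (pow_ne_zero 2 hΦ) hΦ]
    linear_combination (1 - r0 ^ 2) * f * hd
  have hθX : (1 - r0 ^ 2) * (θ * X) = f * (q - r0) := by linear_combination -hq'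
  rw [hgoal]
  rw [eq_comm, ← sub_eq_iff_eq_add', eq_div_iff hΦ]
  linear_combination f / 30 * hk30 + (1 + (1 - r0 * p) * θ * (1 - (p + X) * q) * r0 * ((8 - r0) / 9)) * hθX

lemma theta_curve_ode (hΦ : phi p X θ ≠ 0) (hR : 1 - r0 * p ≠ 0) :
    (1 - (p + X) * qOf p X θ) * (p + X - r0 * ((p + X) * qOf p X θ)) *
        ((p + X) * qOf p X θ - r0 * (p + X)) * 1 =
      9 * r0 * (p + X) * ((p + X) ^ 2 + mPar p * (p + X) -
        mPar p * (p + X) * ((p + X) * qOf p X θ) - (p + X) * qOf p X θ) *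
      ((1 - r0 * p) * θ * (1 - (p + X) * qOf p X θ) * (1 - r0 * qOf p X θ) * ((8 - r0) / 9)) := by
  have hq := phi_mul_qOf hΦ
  set q := qOf p X θ
  have hfe : phi p X θ = 1 + (1 - p ^ 2 + (r0 - p) * X) * θ := rfl
  have hm : mPar p * (1 - r0 * p) = r0 - p := by unfold mPar; field_simp
  have hh : (1 - r0 * p) * (p + X + mPar p - mPar p * ((p + X) * q) - q) * phi p X θ
      = (1 - r0 ^ 2) * X := by
    linear_combination (phi p X θ * (1 - (p + X) * q)) * hm -
      (1 - r0 * p + (r0 - p) * (p + X)) * hq + ((1 - r0 ^ 2) * X) * hfe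
  have ht : (q - r0) * phi p X θ = (1 - r0 ^ 2) * θ * X := by linear_combination hq
  have hr9 : r0 * (8 - r0) = 1 := by linear_combination -r0_sq
  have hkey : q - r0 = (1 - r0 * p) * (p + X + mPar p - mPar p * ((p + X) * q) - q) * θ := by
    apply mul_right_cancel₀ hΦ
    linear_combination ht - θ * hh
  linear_combination (1 - (p + X) * q) * (p + X) ^ 2 * (1 - r0 * q) * hkey -
    (1 - (p + X) * q) * (p + X) ^ 2 * (1 - r0 * q) *
    ((1 - r0 * p) * (p + X + mPar p - mPar p * ((p + X) * q) - q) * θ) * hr9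

end

section

variable {p X θ γ : ℝ}

lemma exists_theta_graph (hp : p ∈ Ioc (0 : ℝ) (1 / 100)) (hγ : 1 / (γ + 1) = (1 + mPar p) / 2)
    {a b : ℝ} (ha : -p ≤ a) (hb : p + b ≤ 1) {Θ : ℝ → ℝ} (hΘ : ContDiffOn ℝ (⊤ : ℕ∞) Θ (Ioo a b))
    (hpos : ∀ X ∈ Ioo a b, 0 < Θ X ∧ (X ≤ 0 → Θ X ≤ 1))
    (hode : ∀ X ∈ Ioo a b, ∃ d, HasDerivAt Θ d X ∧ (p + X) * X * d = rhs (fCoef p) X (Θ X))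
    {e x₁ : ℝ} (he : e ∈ Ioo a b) (hx₁ : x₁ ∈ Ioo a b) (hex : e ≤ x₁) :
    cayley ((p + x₁) * qOf p x₁ (Θ x₁)) ≤ cayley ((p + e) * qOf p e (Θ e)) ∧
    ∃ W : ℝ → ℝ, W (cayley ((p + x₁) * qOf p x₁ (Θ x₁))) = cayley (p + x₁) ∧
      W (cayley ((p + e) * qOf p e (Θ e))) = cayley (p + e) ∧
      IsProfileOn γ (Icc (cayley ((p + x₁) * qOf p x₁ (Θ x₁)))
        (cayley ((p + e) * qOf p e (Θ e)))) W := by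
  set z : ℝ → ℝ := fun X => (p + X) * qOf p X (Θ X) with hz
  have hr := r0_bounds
  have hR : 0 < 1 - r0 * p := by nlinarith [hp.1, hp.2, hr.1, hr.2]
  have hfacts : ∀ X ∈ Ioo a b, 0 < phi p X (Θ X) ∧ qOf p X (Θ X) ∈ Ioo 0 1 := by
    intro X hX
    have h := phi_pos_and_qOf_mem hp (X := X) (θ := Θ X) (by linarith [hX.1]) (by linarith [hX.2])
      (hpos X hX).1 (hpos X hX).2
    exact ⟨h.1, h.2.1⟩
  have hzmem : ∀ X ∈ Ioo a b, 0 < z X ∧ z X < p + X ∧ p + X < 1 := by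
    intro X hX
    have h := (hfacts X hX).2
    have hv : 0 < p + X := by linarith [hX.1]
    exact ⟨mul_pos hv h.1, mul_lt_of_lt_one_right hv h.2, by linarith [hX.2]⟩
  have hzd : ∀ X ∈ Ioo a b, ∃ z', 0 < z' ∧ HasDerivAt z z' X ∧
      (1 - z X) * (p + X - r0 * z X) * (z X - r0 * (p + X)) * 1 =
      9 * r0 * (p + X) * ((p + X) ^ 2 + mPar p * (p + X) - mPar p * (p + X) * z X - z X) * z' := by
    intro X hX
    obtain ⟨d, hd, hdd⟩ := hode X hX
    obtain ⟨hΦ, hq⟩ := hfacts X hX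
    refine ⟨_, ?_, hasDerivAt_mul_qOf hd hdd hΦ.ne', theta_curve_ode hΦ.ne' hR.ne'⟩
    have h1 : 0 < 1 - z X := by linarith [(hzmem X hX).2.1, (hzmem X hX).2.2]
    have h2 : 0 < 1 - r0 * qOf p X (Θ X) := by nlinarith [hq.1, hq.2, hr.1, hr.2]
    exact mul_pos (mul_pos (mul_pos (mul_pos hR (hpos X hX).1) h1) h2) (by linarith [hr.2])
  set Zc : ℝ → ℝ := fun X => cayley (z X) with hZc
  have hZd : ∀ X ∈ Ioo a b, ∃ Z', Z' < 0 ∧ HasDerivAt Zc Z' X ∧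
      DelZ (Zc X) (cayley (p + X)) * (-2 * 1 / (1 + (p + X)) ^ 2) =
        DelV γ (Zc X) (cayley (p + X)) * Z' := by
    intro X hX
    obtain ⟨z', hz', hd, hrel⟩ := hzd X hX
    obtain ⟨h1, h2, h3⟩ := hzmem X hX
    refine ⟨_, ?_, hasDerivAt_cayley_comp hd (by linarith),
      cayley_ode hγ (by linarith) (by linarith) hrel⟩
    rw [div_lt_iff₀ (by positivity)]
    linarith
  have hsm : ContDiffOn ℝ (⊤ : ℕ∞) Zc (Ioo a b) := by
    have hv : ContDiffOn ℝ (⊤ : ℕ∞) (fun X : ℝ => p + X) (Ioo a b) :=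
      (contDiff_const.add contDiff_id).contDiffOn
    have hi : ContDiffOn ℝ (⊤ : ℕ∞) (fun X : ℝ => X) (Ioo a b) := contDiff_id.contDiffOn
    have hΦ : ContDiffOn ℝ (⊤ : ℕ∞) (fun X => phi p X (Θ X)) (Ioo a b) := by
      unfold phi
      exact contDiffOn_const.add ((contDiffOn_const.add (contDiffOn_const.mul hi)).mul hΘ)
    have hq : ContDiffOn ℝ (⊤ : ℕ∞) (fun X => qOf p X (Θ X)) (Ioo a b) := by
      unfold qOf
      exact contDiffOn_const.add (((contDiffOn_const.mul hΘ).mul hi).div hΦ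
        fun X hX => (hfacts X hX).1.ne')
    have hzs : ContDiffOn ℝ (⊤ : ℕ∞) z (Ioo a b) := hv.mul hq
    exact (contDiffOn_const.sub hzs).div (contDiffOn_const.add hzs) fun X hX => by
      linarith [(hzmem X hX).1]
  have hanti : StrictAntiOn Zc (Ioo a b) := by
    refine strictAntiOn_of_deriv_neg (convex_Ioo a b) hsm.continuousOn fun X hX => ?_
    obtain ⟨Z', hZ', hd, -⟩ := hZd X (interior_subset hX)
    rwa [hd.deriv]
  set τ := Function.invFunOn Zc (Ioo a b) with hτ
  have hleft : ∀ X ∈ Ioo a b, τ (Zc X) = X := hanti.injOn.leftInvOn_invFunOn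
  have hsub : Icc e x₁ ⊆ Ioo a b := fun X hX => ⟨he.1.trans_le hX.1, hX.2.trans_lt hx₁.2⟩
  refine ⟨hanti.antitoneOn he hx₁ hex, fun w => cayley (p + τ w),
    congrArg (fun x => cayley (p + x)) (hleft x₁ hx₁),
    congrArg (fun x => cayley (p + x)) (hleft e he), ?_⟩
  intro w hw
  obtain ⟨X, hX, rfl⟩ := intermediate_value_Icc' hex (hsm.continuousOn.mono hsub) hw
  have hXI := hsub hX
  obtain ⟨Z', hZ', hd, hrel⟩ := hZd X hXI
  obtain ⟨h1, h2, h3⟩ := hzmem X hXI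
  obtain ⟨hτs, -, hτd⟩ := contDiffAt_leftInverse isOpen_Ioo hsm hleft hXI hd hZ'.ne
  simp only [hleft X hXI]
  refine ⟨cayley_mem (by linarith), cayley_lt_cayley (by linarith) h2,
    ⟨_, (hasDerivAt_cayley_comp (hτd.const_add p)
      (by rw [hleft X hXI]; linarith)).hasDerivWithinAt, ?_⟩, Or.inr ?_⟩
  · rw [hleft X hXI]
    have : -2 * Z'⁻¹ / (1 + (p + X)) ^ 2 = -2 * 1 / (1 + (p + X)) ^ 2 * Z'⁻¹ := by ring
    rw [this, ← mul_assoc, hrel, mul_assoc, mul_inv_cancel₀ hZ'.ne, mul_one]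
  · have hv : ContDiffAt ℝ (⊤ : ℕ∞) (fun w => p + τ w) (Zc X) := contDiffAt_const.add hτs
    exact (contDiffAt_const.sub hv).div (contDiffAt_const.add hv)
      (by rw [hleft X hXI]; linarith)

end

section

variable {γ δ : ℝ} {V g : ℝ → ℝ}

lemma IsProfileOn.hasDerivAt (hV : IsProfileOn γ (Ioi 0) V) {Z : ℝ} (hZ : 0 < Z) :
    ∃ d, HasDerivAt V d Z ∧ DelZ Z (V Z) * d = DelV γ Z (V Z) := by
  obtain ⟨-, -, ⟨d, hd, hdd⟩, -⟩ := hV Z hZ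
  exact ⟨d, hd.hasDerivAt (Ioi_mem_nhds hZ), hdd⟩

lemma IsProfileOn.contDiffOn (hV : IsProfileOn γ (Ioi 0) V) :
    ContDiffOn ℝ (⊤ : ℕ∞) V (Ioi 0) := by
  intro Z hZ
  refine ContDiffAt.contDiffWithinAt ?_
  rcases (hV Z hZ).2.2.2 with h | h
  swap
  · exact h
  have hDc : Continuous fun x : ℝ × ℝ => DelZ x.1 x.2 := by unfold DelZ; fun_prop
  have hVc : ContinuousOn V (Ioi 0) := fun Z hZ =>
    (hV.hasDerivAt hZ).choose_spec.1.continuousAt.continuousWithinAt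
  set I : Set ℝ := Ioi 0 ∩ (fun Z => DelZ Z (V Z)) ⁻¹' {0}ᶜ with hI
  have hIo : IsOpen I := by
    refine ContinuousOn.isOpen_inter_preimage ?_ isOpen_Ioi isOpen_compl_singleton
    exact hDc.comp_continuousOn (continuousOn_id.prodMk hVc)
  set U : Set (ℝ × ℝ) := {x | DelZ x.1 x.2 ≠ 0} with hU
  have hf : ContDiffOn ℝ (⊤ : ℕ∞) (fun x : ℝ × ℝ => DelV γ x.1 x.2 / DelZ x.1 x.2) U := by
    refine ContDiffOn.div ?_ ?_ fun x hx => hx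
    · unfold DelV; fun_prop
    · unfold DelZ; fun_prop
  have hs := contDiffOn_of_hasDerivAt (I := I) (U := U) (y := V) hIo hf (fun t ht => ht.2)
    fun t ht => by
      obtain ⟨d, hd, hdd⟩ := hV.hasDerivAt ht.1
      refine hd.congr_deriv ?_
      rw [eq_div_iff ht.2, mul_comm]
      exact hdd
  exact hs.contDiffAt (hIo.mem_nhds ⟨hZ, h⟩)

/-- A profile on `(0, ∞)` which is an odd smooth function near the origin is globally smooth. -/
lemma IsProfileOn.exists_smooth (hV : IsProfileOn γ (Ioi 0) V) (hδ : 0 < δ)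
    (hg : ContDiffOn ℝ (⊤ : ℕ∞) g (Ioo (-δ) δ))
    (h : ∀ Z, 0 < Z → Z ^ 2 < δ → V Z = Z * g (Z ^ 2)) :
    ∃ V : ℝ → ℝ, ContDiffOn ℝ (⊤ : ℕ∞) V (Ici 0) ∧ V 0 = 0 ∧
      (∀ Z ∈ Ici (0 : ℝ), DelZ Z (V Z) * derivWithin V (Ici 0) Z = DelV γ Z (V Z)) ∧
      (∀ Z, 0 < Z → V Z ∈ Ioo (-1) 1 ∧ V Z < Z) ∧
      ∃ g : ℝ → ℝ, ContDiffOn ℝ (⊤ : ℕ∞) g (Ici 0) ∧ ∀ Z ∈ Ici (0 : ℝ), V Z = Z * g (Z ^ 2) := by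
  set G : ℝ → ℝ := fun x => if x < δ then g x else V (√x) / √x with hG
  have hGr : ∀ x, 0 < x → G x = V (√x) / √x := by
    intro x hx
    by_cases hxδ : x < δ
    · have hs := Real.sqrt_pos.2 hx
      have h1 := h (√x) hs (by rwa [Real.sq_sqrt hx.le])
      rw [Real.sq_sqrt hx.le] at h1
      rw [h1, mul_div_cancel_left₀ _ hs.ne']
      exact if_pos hxδ
    · exact if_neg hxδ
  have hGs : ContDiffOn ℝ (⊤ : ℕ∞) G (Ici 0) := by
    intro x hx
    refine ContDiffAt.contDiffWithinAt ?_
    rcases (mem_Ici.1 hx).eq_or_lt with rfl | hx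
    · refine (hg.contDiffAt (Ioo_mem_nhds (by linarith) hδ)).congr_of_eventuallyEq ?_
      filter_upwards [Iio_mem_nhds hδ] with w hw using if_pos hw
    · have hs := Real.sqrt_pos.2 hx
      have h1 : ContDiffAt ℝ (⊤ : ℕ∞) Real.sqrt x := Real.contDiffAt_sqrt hx.ne'
      have h2 : ContDiffAt ℝ (⊤ : ℕ∞) V (√x) := hV.contDiffOn.contDiffAt (Ioi_mem_nhds hs)
      refine ContDiffAt.congr_of_eventuallyEq ((h2.comp x h1).div h1 hs.ne') ?_
      filter_upwards [Ioi_mem_nhds hx] with w hw using hGr w hw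
  have hval : ∀ Z, 0 < Z → Z * G (Z ^ 2) = V Z := by
    intro Z hZ
    rw [hGr _ (by positivity), Real.sqrt_sq hZ.le, mul_div_cancel₀ _ hZ.ne']
  refine ⟨fun Z => Z * G (Z ^ 2), ?_, by simp, ?_, ?_, G, hGs, fun Z _ => rfl⟩
  · exact contDiffOn_id.mul (hGs.comp (contDiff_id.pow 2).contDiffOn fun Z _ => by simp [sq_nonneg])
  · intro Z hZ
    rcases (mem_Ici.1 hZ).eq_or_lt with rfl | hZ
    · simp [DelZ, DelV]
    · obtain ⟨d, hd, hdd⟩ := hV.hasDerivAt hZ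
      have h1 : HasDerivAt (fun Z => Z * G (Z ^ 2)) d Z := by
        refine hd.congr_of_eventuallyEq ?_
        filter_upwards [Ioi_mem_nhds hZ] with w hw using hval w hw
      rw [(h1.hasDerivWithinAt).derivWithin ((uniqueDiffOn_Ici 0) Z hZ.le)]
      simp only [hval Z hZ]
      exact hdd
  · intro Z hZ
    simp only [hval Z hZ]
    exact ⟨(hV Z hZ).1, (hV Z hZ).2.1⟩

end

section

/-- A family of integral curves depends continuously on the parameter, backwards in time. -/
lemma exists_continuous_family {F : ℝ → ℝ → ℝ → ℝ} {K L : ℝ≥0}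
    (hK : ∀ s, LipschitzWith K (fun w : ℝ × ℝ => F w.1 s w.2))
    (hc : ∀ p y, Continuous fun s => F p s y) (hL : ∀ p s y, |F p s y| ≤ L) (s₁ y₁ : ℝ → ℝ) :
    ∃ Y : ℝ → ℝ → ℝ, (∀ p, Y p (s₁ p) = y₁ p ∧ ∀ s, HasDerivAt (Y p) (F p s (Y p s)) s) ∧
      ∀ S p₀, ContinuousWithinAt s₁ S p₀ → ContinuousWithinAt y₁ S p₀ →
        ∀ s ≤ s₁ p₀, ContinuousWithinAt (fun p => Y p s) S p₀ := by
  have hex : ∀ p, ∃ y : ℝ → ℝ, y (s₁ p) = y₁ p ∧ ∀ s, HasDerivAt y (F p s (y s)) s := by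
    intro p
    refine exists_global_solution (f := F p) (K := K) (L := L) (fun s => ?_) (hc p) (hL p) _ _
    have h1 : LipschitzWith 1 (fun y : ℝ => (p, y)) := LipschitzWith.prodMk_left p
    simpa [Function.comp_def] using (hK s).comp h1
  choose Y hY0 hY using hex
  refine ⟨Y, fun p => ⟨hY0 p, hY p⟩, fun S p₀ hs hy s hsT => ?_⟩
  set T := s₁ p₀ with hT
  have hlip : ∀ p, LipschitzWith L (Y p) := fun p => by
    refine lipschitzWith_of_nnnorm_deriv_le (fun t => (hY p t).differentiableAt) fun t => ?_
    rw [(hY p t).deriv, ← NNReal.coe_le_coe, coe_nnnorm]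
    exact hL p t _
  set d : ℝ → ℝ := fun p => |p - p₀| + (L * |T - s₁ p| + |y₁ p - y₁ p₀|) with hd
  have hdist : ∀ p, dist (p, Y p T) (p₀, Y p₀ T) ≤ d p := by
    intro p
    have h1 : |Y p T - y₁ p| ≤ L * |T - s₁ p| := by
      have := (hlip p).dist_le_mul T (s₁ p)
      rwa [hY0 p] at this
    have h2 : |Y p T - Y p₀ T| ≤ L * |T - s₁ p| + |y₁ p - y₁ p₀| := by
      rw [hT, hY0 p₀, ← hT]
      linarith [abs_sub_le (Y p T) (y₁ p) (y₁ p₀)]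
    rw [Prod.dist_eq]
    refine max_le ?_ ?_
    · simp only [Real.dist_eq, hd]
      linarith [(abs_nonneg _).trans h2]
    · simp only [Real.dist_eq, hd]
      linarith [abs_nonneg (p - p₀)]
  have hv : ∀ t, LipschitzWith (max 0 K) (fun w : ℝ × ℝ => ((0 : ℝ), -F w.1 (T - t) w.2)) :=
    fun t => (LipschitzWith.const (0 : ℝ)).prodMk (hK (T - t)).neg
  have htraj : ∀ p t, HasDerivAt (fun t => (p, Y p (T - t))) ((0 : ℝ), -F p (T - t) (Y p (T - t))) t := by
    intro p t
    refine (hasDerivAt_const t p).prodMk ?_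
    have h1 : HasDerivAt (fun t : ℝ => T - t) (-1) t := by
      simpa using (hasDerivAt_id t).const_sub T
    exact ((hY p (T - t)).comp (h := fun t => T - t) t h1).congr_deriv (by ring)
  have hcont : ∀ p, Continuous (fun t => (p, Y p (T - t))) := fun p =>
    continuous_iff_continuousAt.2 fun t => (htraj p t).continuousAt
  have hbound : ∀ p, dist (Y p s) (Y p₀ s) ≤ d p * Real.exp (max 0 K * (T - s)) := by
    intro p
    have h := dist_le_of_trajectories_ODE (a := 0) (b := T - s) (δ := d p) hv
      (hcont p).continuousOn (fun t _ => (htraj p t).hasDerivWithinAt)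
      (hcont p₀).continuousOn (fun t _ => (htraj p₀ t).hasDerivWithinAt)
      (by simpa using hdist p) (T - s) ⟨by linarith, le_rfl⟩
    simp only [sub_sub_cancel, sub_zero, NNReal.coe_max, NNReal.coe_zero] at h
    refine le_trans ?_ h
    rw [Prod.dist_eq]
    exact le_max_right _ _
  have hd0 : Tendsto d (𝓝[S] p₀) (𝓝 0) := by
    have h1 : ContinuousWithinAt d S p₀ :=
      ((continuousWithinAt_id.sub continuousWithinAt_const).abs).add
        ((continuousWithinAt_const.mul (continuousWithinAt_const.sub hs).abs).add
          (hy.sub continuousWithinAt_const).abs)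
    have h2 : d p₀ = 0 := by simp [hd, hT]
    rw [← h2]
    exact h1
  refine tendsto_iff_dist_tendsto_zero.2 (squeeze_zero (fun p => dist_nonneg) hbound ?_)
  simpa using hd0.mul_const (Real.exp (max 0 K * (T - s)))

variable {p : ℝ}

lemma rhs_fCoef_zero_neg (X : ℝ) : rhs (fCoef p) X 0 < 0 := by
  rw [rhs_fCoef]
  simp only [phi]
  linarith [r0_lt]

lemma rhs_fCoef_pos {X v M : ℝ} (hp : p ∈ Icc (0 : ℝ) (1 / 100)) (hX : 0 ≤ X) (hXv : p + X ≤ v)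
    (hv : v < 1) (hM : 10 ≤ M * (1 - v ^ 2)) : 0 < rhs (fCoef p) X M := by
  obtain ⟨hp0, hp1⟩ := hp
  obtain ⟨hr1, hr2⟩ := r0_bounds
  set w := p + X with hw
  have hw0 : 0 ≤ w := by linarith
  have hw1 : w < 1 := by linarith
  have hv2 : 0 < 1 - v ^ 2 := by
    have : 0 < (1 - v) * (1 + v) := mul_pos (by linarith) (by linarith)
    linarith
  have hM0 : 0 < M := by
    by_contra! h
    linarith [mul_nonpos_of_nonpos_of_nonneg h hv2.le]
  have hwv : w ^ 2 ≤ v ^ 2 := by gcongr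
  have hM' : 10 ≤ M * (1 - w ^ 2) := hM.trans (by gcongr)
  have hM1 : 10 ≤ M := hM'.trans (by linarith only [mul_nonneg hM0.le (sq_nonneg w)])
  have hR : 99 / 100 ≤ 1 - r0 * p := by nlinarith
  have hXw : X = w - p := by rw [hw]; ring
  have hA : 0 ≤ 1 - p ^ 2 + (r0 - p) * X := by
    have : 0 ≤ (r0 - p) * X := mul_nonneg (by linarith) hX
    nlinarith only [this, hp0, hp1]
  have hΦ0 : 0 ≤ phi p X M := by
    unfold phi
    have := mul_nonneg hA (by linarith : 0 ≤ M)
    linarith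
  have hΦ : phi p X M ≤ 2 * M := by
    have h1 : (r0 - p) * X ≤ 1 / 5 * 1 :=
      mul_le_mul (by linarith) (by linarith) hX (by norm_num)
    have h2 : (1 - p ^ 2 + (r0 - p) * X) * M ≤ 1.5 * M :=
      mul_le_mul_of_nonneg_right (by linarith [sq_nonneg p]) hM0.le
    unfold phi
    linarith
  have h1 : (4 - r0) / 30 * phi p X M ^ 2 ≤ 0.14 * (2 * M) ^ 2 := by
    have : phi p X M ^ 2 ≤ (2 * M) ^ 2 := by gcongr
    exact mul_le_mul (by linarith) this (sq_nonneg _) (by norm_num)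
  have h2 : phi p X M * M * X ≤ 2 * M * M * 1 := by
    have : X ≤ 1 := by linarith
    gcongr
  have h3 : w * M * (1 + (1 - p ^ 2) * M) ≤ 1 * M * (2 * M) := by
    have : 1 + (1 - p ^ 2) * M ≤ 2 * M := by linarith [mul_nonneg (sq_nonneg p) hM0.le]
    have h4 : 0 ≤ 1 + (1 - p ^ 2) * M := by
      have : 0 ≤ (1 - p ^ 2) * M := mul_nonneg (by nlinarith) (by linarith)
      linarith
    exact mul_le_mul (mul_le_mul_of_nonneg_right hw1.le hM0.le) this h4 (by linarith)
  have h4 : 9.9 ≤ (1 - r0 * w) + (1 - r0 * p) * (1 - w ^ 2) * M := by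
    have : 0 ≤ 1 - r0 * w := by nlinarith
    have h5 : (1 - r0 * p) * (1 - w ^ 2) * M = (1 - r0 * p) * (M * (1 - w ^ 2)) := by ring
    rw [h5]
    linarith [mul_le_mul hR hM' (by norm_num) (by linarith)]
  have h5 : 0.98 * M ≤ 1 + (1 - p * w) * M := by
    have : p * w ≤ 1 / 100 * 1 := mul_le_mul hp1 hw1.le hw0 (by norm_num)
    linarith [mul_le_mul_of_nonneg_right this hM0.le]
  have h6 : (99 / 100) * M * 9.9 * (0.98 * M) * 0.8 ≤
      (1 - r0 * p) * M * ((1 - r0 * w) + (1 - r0 * p) * (1 - w ^ 2) * M) *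
        (1 + (1 - p * w) * M) * ((8 - r0) / 9) := by
    have : 0.8 ≤ (8 - r0) / 9 := by linarith
    have h7 : 0 ≤ (1 - r0 * p) * M * ((1 - r0 * w) + (1 - r0 * p) * (1 - w ^ 2) * M) *
        (1 + (1 - p * w) * M) :=
      mul_nonneg (mul_nonneg (mul_nonneg (by linarith) hM0.le) (by linarith)) (by linarith)
    gcongr
  have hform : rhs (fCoef p) X M =
      (1 - r0 * p) * M * ((1 - r0 * w) + (1 - r0 * p) * (1 - w ^ 2) * M) *
        (1 + (1 - p * w) * M) * ((8 - r0) / 9) -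
      (4 - r0) / 30 * phi p X M ^ 2 - phi p X M * M * X - w * M * (1 + (1 - p ^ 2) * M) := by
    rw [rhs_fCoef, phi, hXw]
    ring
  rw [hform]
  linarith only [h1, h2, h3, h6, mul_pos hM0 hM0]

end

lemma contDiffOn_rhs_fCoef_div {pb pa M : ℝ} (hpb : 0 < pb) :
    ContDiffOn ℝ 1 (fun w : ℝ × ℝ × ℝ => rhs (fCoef w.1) w.2.1 w.2.2 / (w.1 + w.2.1))
      (Icc pb pa ×ˢ Icc 0 1 ×ˢ Icc 0 M) := by
  refine ContDiffOn.div ?_ (by fun_prop) fun w hw => ?_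
  · simp only [rhs_fCoef, phi]
    fun_prop
  · have h1 := hw.1.1
    have h2 := hw.2.1.1
    linarith

/-- Solutions leaving the origin-side data `(x₁ p, θ₁ p)` extend to the sonic point. -/
lemma exists_left_family {pb pa v : ℝ} (hpb : 0 < pb) (hab : pb ≤ pa) (hpa : pa ≤ 1 / 100)
    (hv : v < 1) {x₁ θ₁ : ℝ → ℝ} (hx₁ : ContinuousOn x₁ (Icc pb pa))
    (hθ₁ : ContinuousOn θ₁ (Icc pb pa))
    (h1 : ∀ p ∈ Icc pb pa, 1 / 2 ≤ x₁ p ∧ p + x₁ p ≤ v ∧ 0 < θ₁ p) :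
    ∃ (M : ℝ) (Θ : ℝ → ℝ → ℝ),
      (∀ x ∈ Ioc (0 : ℝ) (1 / 2), ContinuousOn (fun p => Θ p x) (Icc pb pa)) ∧
      ∀ p ∈ Icc pb pa, Θ p (x₁ p) = θ₁ p ∧ ∃ b, x₁ p < b ∧ p + b ≤ 1 ∧ ∀ x ∈ Ioo 0 b,
        0 < Θ p x ∧ Θ p x < M ∧
        HasDerivAt (Θ p) (rhs (fCoef p) x (Θ p x) / ((p + x) * x)) x := by
  obtain ⟨C, hC⟩ := isCompact_Icc.exists_bound_of_continuousOn hθ₁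
  have hv0 : 0 < v := by
    have := h1 pb ⟨le_rfl, hab⟩
    linarith
  have hv2 : 0 < 1 - v ^ 2 := by
    have : 0 < (1 - v) * (1 + v) := mul_pos (by linarith) (by linarith)
    linarith
  set M := max (C + 1) (10 / (1 - v ^ 2)) with hM
  have hM1 : ∀ p ∈ Icc pb pa, θ₁ p < M := fun p hp => by
    have := hC p hp
    rw [Real.norm_eq_abs] at this
    exact (le_abs_self _).trans_lt (lt_of_lt_of_le (by linarith) (le_max_left _ _))
  have hM2 : 10 ≤ M * (1 - v ^ 2) := by
    rw [← div_le_iff₀ hv2]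
    exact le_max_right _ _
  have hM0 : 0 ≤ M := ((h1 pb ⟨le_rfl, hab⟩).2.2.trans (hM1 pb ⟨le_rfl, hab⟩)).le
  set H : ℝ × ℝ × ℝ → ℝ := fun w => rhs (fCoef w.1) w.2.1 w.2.2 / (w.1 + w.2.1) with hH
  have hHs := contDiffOn_rhs_fCoef_div (pa := pa) (M := M) hpb
  have hcomp : IsCompact (Icc pb pa ×ˢ Icc (0 : ℝ) 1 ×ˢ Icc 0 M) :=
    isCompact_Icc.prod (isCompact_Icc.prod isCompact_Icc)
  obtain ⟨K, hK⟩ := hHs.exists_lipschitzOnWith one_ne_zero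
    ((convex_Icc pb pa).prod ((convex_Icc 0 1).prod (convex_Icc 0 M))) hcomp
  obtain ⟨L, hL⟩ := hcomp.exists_bound_of_continuousOn hHs.continuousOn
  set cl : ℝ → ℝ → ℝ → ℝ × ℝ × ℝ := fun p s y =>
    (clamp pb pa p, clamp 0 1 (Real.exp s), clamp 0 M y) with hcl
  have hclm : ∀ p s y, cl p s y ∈ Icc pb pa ×ˢ Icc (0 : ℝ) 1 ×ˢ Icc 0 M := fun p s y =>
    ⟨clamp_mem hab p, clamp_mem zero_le_one _, clamp_mem hM0 y⟩
  obtain ⟨Y, hY, hYc⟩ := exists_continuous_family (F := fun p s y => H (cl p s y)) (K := K)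
    (L := L.toNNReal) (fun s => by
      refine LipschitzWith.of_dist_le_mul fun w w' => ?_
      refine (hK.dist_le_mul _ (hclm _ _ _) _ (hclm _ _ _)).trans ?_
      gcongr
      have e1 := (lipschitz_clamp pb pa).dist_le_mul w.1 w'.1
      have e2 := (lipschitz_clamp 0 M).dist_le_mul w.2 w'.2
      rw [NNReal.coe_one, one_mul] at e1 e2
      simp only [hcl, Prod.dist_eq, dist_self]
      exact max_le (e1.trans (le_max_left _ _))
        (max_le (dist_nonneg.trans (le_max_left (dist w.1 w'.1) _)) (e2.trans (le_max_right _ _))))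
    (fun p y => hHs.continuousOn.comp_continuous (f := fun s => cl p s y)
      (continuous_const.prodMk (((continuous_clamp 0 1).comp Real.continuous_exp).prodMk
        continuous_const)) fun s => hclm p s y)
    (fun p s y => (hL _ (hclm p s y)).trans (Real.le_coe_toNNReal L))
    (fun p => Real.log (x₁ p)) θ₁
  refine ⟨M, fun p x => Y p (Real.log x), fun x hx p hp => ?_, fun p hp => ?_⟩
  · have hx1 := (h1 p hp).1
    exact hYc _ p ((hx₁ p hp).log (by linarith)) (hθ₁ p hp) _
      (Real.log_le_log hx.1 (by linarith [hx.2]))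
  obtain ⟨hx, hxv, hθ⟩ := h1 p hp
  obtain ⟨hY0, hYd⟩ := hY p
  refine ⟨hY0, ?_⟩
  have hp0 : 0 < p := hpb.trans_le hp.1
  have hval : ∀ s, s ≤ 0 → ∀ y ∈ Icc 0 M,
      H (cl p s y) = rhs (fCoef p) (Real.exp s) y / (p + Real.exp s) := by
    intro s hs y hy
    have := Real.exp_pos s
    simp only [hH, hcl]
    rw [clamp_of_mem hp, clamp_of_mem hy, clamp_of_mem ⟨this.le, Real.exp_le_one_iff.2 hs⟩]
  have hYcont : Continuous (Y p) := continuous_iff_continuousAt.2 fun s => (hYd s).continuousAt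
  have hexp : ∀ t < Real.log (x₁ p), Real.exp t ≤ x₁ p := fun t ht =>
    ((Real.lt_log_iff_exp_lt (by linarith)).1 ht).le
  have hneg : ∀ t < Real.log (x₁ p), t ≤ 0 := fun t ht =>
    Real.exp_le_one_iff.1 (by linarith [hexp t ht])
  have hin : ∀ s ≤ Real.log (x₁ p), 0 < Y p s ∧ Y p s < M := by
    intro s hs
    constructor
    · refine pos_of_deriv_neg_at_zeros (g := Y p) (a := s) (b := Real.log (x₁ p))
        hYcont.continuousOn (by rw [hY0]; exact hθ) (fun t ht h0 => ⟨_, ?_, hYd t⟩) s ⟨le_rfl, hs⟩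
      rw [h0, hval t (hneg t ht.2) 0 ⟨le_rfl, hM0⟩]
      exact div_neg_of_neg_of_pos (rhs_fCoef_zero_neg _) (by positivity)
    · have := pos_of_deriv_neg_at_zeros (g := fun t => M - Y p t) (a := s) (b := Real.log (x₁ p))
        (continuous_const.sub hYcont).continuousOn (by
          simp only [hY0]; linarith [hM1 p hp]) (fun t ht h0 => ⟨_, ?_, (hYd t).const_sub M⟩) s
          ⟨le_rfl, hs⟩
      · linarith
      · have h2 : Y p t = M := by have h4 : M - Y p t = 0 := h0; linarith
        rw [h2, hval t (hneg t ht.2) M ⟨hM0, le_rfl⟩]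
        have h3 := rhs_fCoef_pos ⟨hp0.le, hp.2.trans hpa⟩ (Real.exp_pos t).le
          (by linarith [hexp t ht.2]) hv hM2
        have : 0 < rhs (fCoef p) (Real.exp t) M / (p + Real.exp t) := div_pos h3 (by positivity)
        linarith
  have hx0 : 0 < x₁ p := by linarith
  have hlogc : ContinuousAt (fun x => Y p (Real.log x)) (x₁ p) :=
    hYcont.continuousAt.comp (Real.continuousAt_log hx0.ne')
  have hev : ∀ᶠ x in 𝓝 (x₁ p), (0 < Y p (Real.log x) ∧ Y p (Real.log x) < M) ∧ p + x < 1 := by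
    have h2 := hin _ le_rfl
    exact ((hlogc.eventually_const_lt h2.1).and (hlogc.eventually_lt_const h2.2)).and
      ((by fun_prop : Continuous fun x => p + x).continuousAt.eventually_lt_const (by linarith))
  obtain ⟨l, u, hlu, hsub⟩ := mem_nhds_iff_exists_Ioo_subset.1 hev
  refine ⟨(x₁ p + u) / 2, by linarith [hlu.2], ?_, fun x hxb => ?_⟩
  · exact (hsub ⟨by linarith [hlu.1, hlu.2], by linarith [hlu.2]⟩ : _ ∧ _).2.le
  have hall : (0 < Y p (Real.log x) ∧ Y p (Real.log x) < M) ∧ p + x < 1 := by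
    rcases le_or_gt x (x₁ p) with h | h
    · exact ⟨hin _ (Real.log_le_log hxb.1 h), by linarith⟩
    · exact hsub ⟨by linarith [hlu.1], by linarith [hxb.2, hlu.2]⟩
  refine ⟨hall.1.1, hall.1.2, ?_⟩
  have hlog : Real.log x ≤ 0 := Real.log_nonpos hxb.1.le (by linarith [hall.2])
  have hd := (hYd (Real.log x)).comp x (Real.hasDerivAt_log hxb.1.ne')
  rw [hval _ hlog _ ⟨hall.1.1.le, hall.1.2.le⟩, Real.exp_log hxb.1] at hd
  refine hd.congr_deriv ?_
  rw [div_mul_eq_div_div]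
  exact (div_eq_mul_inv _ _).symm

section

variable {p : ℝ}

lemma mPar_bounds (hp : p ∈ Icc (0 : ℝ) (1 / 100)) : mPar p ∈ Icc 0 0.14 := by
  obtain ⟨hr1, hr2⟩ := r0_bounds
  have hR : 0 < 1 - r0 * p := by nlinarith [hp.1, hp.2]
  unfold mPar
  constructor
  · exact div_nonneg (by linarith [hp.2]) hR.le
  · rw [div_le_iff₀ hR]
    nlinarith [hp.1, hp.2]

lemma qOf_of_point {v z h : ℝ} (hR : 1 - r0 * p ≠ 0) (hh : h ≠ 0) (hX : v - p ≠ 0) (hv : v ≠ 0)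
    (hdef : h = v + mPar p - mPar p * z - z / v) :
    qOf p (v - p) ((z / v - r0) / ((1 - r0 * p) * h)) = z / v := by
  set q := z / v with hq
  have hz : z = q * v := by rw [hq]; field_simp
  have hm : mPar p * (1 - r0 * p) = r0 - p := by unfold mPar; field_simp
  set θ := (q - r0) / ((1 - r0 * p) * h) with hθ
  have hRh : (1 - r0 * p) * h ≠ 0 := mul_ne_zero hR hh
  have hθ' : θ * ((1 - r0 * p) * h) = q - r0 := by rw [hθ]; field_simp
  have hk : 1 - r0 ^ 2 ≠ 0 := by have := r0_bounds; nlinarith [this.1, this.2]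
  have hΦ : phi p (v - p) θ * ((1 - r0 * p) * h) = (1 - r0 ^ 2) * (v - p) := by
    unfold phi
    rw [hz] at hdef
    linear_combination (1 - p ^ 2 + (r0 - p) * (v - p)) * hθ' + (1 - r0 * p) * hdef +
      (1 - q * v) * hm
  have hΦ0 : phi p (v - p) θ ≠ 0 := by
    intro h0
    rw [h0, zero_mul] at hΦ
    exact mul_ne_zero hk hX hΦ.symm
  have h2 : (1 - r0 ^ 2) * θ * (v - p) / phi p (v - p) θ = q - r0 := by
    rw [div_eq_iff hΦ0]
    linear_combination -θ * hΦ + phi p (v - p) θ * hθ'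
  unfold qOf
  rw [h2]
  ring

lemma cayley_involutive {x : ℝ} (hx : 0 ≤ x) : cayley (cayley x) = x :=
  cayley_cayley (by linarith)

lemma delV_pos_of_origin {γ α Z g : ℝ} (hγ : 1 / (γ + 1) = α) (hα : α ≤ 0.57)
    (hZ : 0 < Z) (hZ1 : Z ^ 2 ≤ 1 / 20) (hg : g ∈ Icc 0.3 (α - 0.07)) :
    0 < DelV γ Z (Z * g) := by
  have hg0 : 0 ≤ g := by linarith [hg.1]
  have hg2 : g ≤ 1 / 2 := by linarith [hg.2]
  have hV2 : (Z * g) ^ 2 ≤ 1 / 80 := by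
    have : g ^ 2 ≤ (1 / 2) ^ 2 := by gcongr
    rw [mul_pow]
    nlinarith [sq_nonneg Z, sq_nonneg g]
  unfold DelV
  rw [hγ]
  have h1 : 0 < α * (1 - (Z * g) ^ 2) - g * (1 - Z * g * Z) := by
    have h2 : 0 ≤ g * (Z * g * Z) := by positivity
    nlinarith [hg.2, hg.1]
  have h3 : α * (1 - (Z * g) ^ 2) * Z - Z * g * (1 - Z * g * Z) =
      Z * (α * (1 - (Z * g) ^ 2) - g * (1 - Z * g * Z)) := by ring
  rw [h3]
  exact mul_pos (mul_pos (by norm_num) (by linarith)) (mul_pos hZ h1)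

/-- Initial data, at a fixed distance from the origin, for the curves entering the sonic point. -/
lemma exists_origin_data : ∃ (δ v₀ : ℝ) (g : ℝ → ℝ → ℝ) (x₁ θ₁ : ℝ → ℝ), 0 < δ ∧ v₀ < 1 ∧
    ContinuousOn x₁ (Icc 0 (1 / 100)) ∧ ContinuousOn θ₁ (Icc 0 (1 / 100)) ∧
    ∀ p ∈ Icc (0 : ℝ) (1 / 100), 1 / 2 ≤ x₁ p ∧ p + x₁ p ≤ v₀ ∧ 0 < θ₁ p ∧
      ContDiffOn ℝ (⊤ : ℕ∞) (g p) (Ioo (-δ) δ) ∧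
      ∀ γ, 1 / (γ + 1) = (1 + mPar p) / 2 → ∃ Z₁, 0 < Z₁ ∧
        IsProfileOn γ (Ioc 0 Z₁) (fun Z => Z * g p (Z ^ 2)) ∧
        DelZ Z₁ (Z₁ * g p (Z₁ ^ 2)) ≠ 0 ∧
        cayley ((p + x₁ p) * qOf p (x₁ p) (θ₁ p)) = Z₁ ∧
        cayley (p + x₁ p) = Z₁ * g p (Z₁ ^ 2) ∧ δ ≤ 2 * Z₁ ^ 2 := by
  obtain ⟨δ, hδ, g, hgc, hg⟩ := exists_origin_profiles
  obtain ⟨hr1, hr2⟩ := r0_bounds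
  set α : ℝ → ℝ := fun p => (1 + mPar p) / 2 with hα
  have hαm : ∀ p ∈ Icc (0 : ℝ) (1 / 100), α p ∈ Icc (1 / 2) 0.57 := fun p hp => by
    have := mPar_bounds hp
    constructor <;> simp only [hα] <;> linarith [this.1, this.2]
  have hRp : ∀ p ∈ Icc (0 : ℝ) (1 / 100), 0 < 1 - r0 * p := fun p hp => by
    nlinarith [hp.1, hp.2]
  have hmc : ContinuousOn mPar (Icc 0 (1 / 100)) := by
    unfold mPar
    exact ContinuousOn.div (by fun_prop) (by fun_prop) fun p hp => (hRp p hp).ne'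
  have hαc : ContinuousOn α (Icc 0 (1 / 100)) := (continuousOn_const.add hmc).div_const 2
  set Z₁ := √(δ / 2) with hZ₁
  have hZ0 : 0 < Z₁ := Real.sqrt_pos.2 (by linarith [hδ.1])
  have hZs : Z₁ ^ 2 = δ / 2 := Real.sq_sqrt (by linarith [hδ.1])
  have hZ20 : Z₁ ^ 2 ≤ 1 / 20 := by linarith [hδ.2]
  have hZq : Z₁ ≤ 1 / 4 := by nlinarith
  set z₁ := cayley Z₁ with hz₁
  have hz1 : 3 / 5 ≤ z₁ := by
    rw [hz₁, cayley, le_div_iff₀ (by linarith)]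
    linarith
  set V₁ : ℝ → ℝ := fun p => Z₁ * g (α p) (δ / 2) with hV₁
  have hgm : ∀ p ∈ Icc (0 : ℝ) (1 / 100), ∀ x ∈ Ioo (-δ) δ,
      g (α p) x ∈ Icc 0.3 (α p - 0.07) := fun p hp => (hg (α p) (hαm p hp)).2.1
  have hδ2 : δ / 2 ∈ Ioo (-δ) δ := ⟨by linarith [hδ.1], by linarith [hδ.1]⟩
  have hV₁m : ∀ p ∈ Icc (0 : ℝ) (1 / 100), 0.3 * Z₁ ≤ V₁ p ∧ V₁ p < Z₁ := fun p hp => by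
    have h1 := hgm p hp _ hδ2
    have h2 := (hαm p hp).2
    exact ⟨by simp only [hV₁]; nlinarith [h1.1], by simp only [hV₁]; nlinarith [h1.2]⟩
  set v₁ : ℝ → ℝ := fun p => cayley (V₁ p) with hv₁
  have hVc : ContinuousOn V₁ (Icc 0 (1 / 100)) :=
    continuousOn_const.mul ((hgc (δ / 2)).comp hαc hαm)
  have hvc : ContinuousOn v₁ (Icc 0 (1 / 100)) :=
    (continuousOn_const.sub hVc).div (continuousOn_const.add hVc) fun p hp => by
      linarith [(hV₁m p hp).1]
  have hv1 : ∀ p ∈ Icc (0 : ℝ) (1 / 100), z₁ < v₁ p ∧ v₁ p ≤ cayley (0.3 * Z₁) := fun p hp => by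
    obtain ⟨h1, h2⟩ := hV₁m p hp
    refine ⟨cayley_lt_cayley (by linarith) h2, ?_⟩
    rcases h1.eq_or_lt with h | h
    · simp only [hv₁, ← h, le_refl]
    · exact (cayley_lt_cayley (by linarith) h).le
  have hv0 : cayley (0.3 * Z₁) < 1 := (cayley_mem (by linarith)).2 |> fun h => by
    rw [cayley, div_lt_one (by linarith)]
    linarith
  set h₁ : ℝ → ℝ := fun p => v₁ p + mPar p - mPar p * z₁ - z₁ / v₁ p with hh₁
  have hhpos : ∀ p ∈ Icc (0 : ℝ) (1 / 100), 0 < h₁ p := fun p hp => by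
    have hγ : 1 / ((1 / α p - 1) + 1) = α p := by
      have := (hαm p hp).1
      field_simp
      ring
    have h1 := delV_pos_of_origin hγ (hαm p hp).2 hZ0 hZ20 (hgm p hp _ hδ2)
    have h2 := hv1 p hp
    have h3 := delV_cayley (m := mPar p) (z := z₁) (v := v₁ p) hγ (by linarith) (by linarith)
    rw [hz₁, hv₁] at h3
    simp only [] at h3
    rw [cayley_involutive hZ0.le, cayley_involutive (by linarith [(hV₁m p hp).1])] at h3
    have hv0 : 0 < v₁ p := by linarith
    have h4 : v₁ p * h₁ p = v₁ p ^ 2 + mPar p * v₁ p - mPar p * v₁ p * z₁ - z₁ := by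
      simp only [hh₁]
      field_simp
    have h5 : 0 < 24 * v₁ p * (v₁ p * h₁ p) := by
      rw [h4]
      refine lt_of_lt_of_eq (mul_pos h1 ?_) h3
      change 0 < (1 + v₁ p) ^ 4 * (1 + z₁)
      have : 0 < 1 + z₁ := by linarith
      positivity
    have h6 := pos_of_mul_pos_right h5 (by positivity)
    exact pos_of_mul_pos_right h6 hv0.le
  refine ⟨δ, cayley (0.3 * Z₁), fun p => g (α p), fun p => v₁ p - p,
    fun p => (z₁ / v₁ p - r0) / ((1 - r0 * p) * h₁ p), hδ.1, hv0, hvc.sub continuousOn_id,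
    ?_, fun p hp => ?_⟩
  · have hq : ContinuousOn (fun p => z₁ / v₁ p) (Icc 0 (1 / 100)) :=
      continuousOn_const.div hvc fun p hp => by linarith [(hv1 p hp).1]
    refine (hq.sub continuousOn_const).div (ContinuousOn.mul (by fun_prop) ?_) fun p hp =>
      (mul_pos (hRp p hp) (hhpos p hp)).ne'
    exact ((hvc.add hmc).sub (hmc.mul continuousOn_const)).sub hq
  obtain ⟨h1, h2⟩ := hv1 p hp
  obtain ⟨hs, hm, hode⟩ := hg (α p) (hαm p hp)
  have hvp : 0 < v₁ p := by linarith
  have hq := qOf_of_point (v := v₁ p) (z := z₁) (hRp p hp).ne' (hhpos p hp).ne'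
    (by linarith [hp.2] : v₁ p - p ≠ 0) hvp.ne' rfl
  refine ⟨by linarith [hp.2], by linarith, ?_, hs, fun γ hγ => ⟨Z₁, hZ0, ?_, ?_, ?_, ?_, ?_⟩⟩
  · refine div_pos (sub_pos.2 ?_) (mul_pos (hRp p hp) (hhpos p hp))
    rw [lt_div_iff₀ hvp]
    nlinarith
  · intro Z hZ
    have hZ2 : Z ^ 2 < δ := by
      have : Z ^ 2 ≤ Z₁ ^ 2 := by have := hZ.1; have := hZ.2; gcongr
      linarith [hδ.1]
    obtain ⟨hD, hd⟩ := hode γ hγ Z hZ.1 hZ2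
    have hgZ := hm (Z ^ 2) ⟨by nlinarith [hδ.1, sq_nonneg Z], hZ2⟩
    have hα2 := (hαm p hp).2
    have hlt : Z * g (α p) (Z ^ 2) < Z := by nlinarith [hgZ.2, hZ.1]
    have h0 : 0 < Z * g (α p) (Z ^ 2) := mul_pos hZ.1 (by linarith [hgZ.1])
    exact ⟨⟨by linarith, by linarith [hZ.2]⟩, hlt,
      ⟨_, hd.hasDerivWithinAt, mul_div_cancel₀ _ hD.ne'⟩, Or.inl hD.ne'⟩
  · exact (hode γ hγ Z₁ hZ0 (by linarith [hδ.1])).1.ne'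
  · simp only []
    rw [hq, add_sub_cancel, mul_div_cancel₀ _ hvp.ne', hz₁, cayley_involutive hZ0.le]
  · simp only [add_sub_cancel]
    rw [hv₁, hZs]
    exact cayley_involutive (by linarith [(hV₁m p hp).1])
  · linarith

end

section

variable {p : ℝ}

lemma aCoef_secant (hp : |p| < 1) (y : ℝ) :
    aCoef p 0 1 + aCoef p 0 2 * y + aCoef p 0 3 * y ^ 2 =
      (1 + (1 - p ^ 2) * (th0 p + y)) * (quadA p * (th0 p + y) + (4 - r0) / 30 / th0 p) := by
  have h0 := th0_pos hp
  have h := quad_th0 hp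
  have h1 : (4 - r0) / 30 / th0 p = quadA p * th0 p + quadB p := by
    rw [div_eq_iff h0.ne']; linear_combination -h
  rw [h1]
  simp only [aCoef, fCoef, quadA, quadB] at h ⊢
  linear_combination (1 - p ^ 2) * h

lemma le_aCoef_secant (hp : |p| < 1) {y : ℝ} (hy : -th0 p ≤ y) :
    (4 - r0) / 30 / th0 p ≤ aCoef p 0 1 + aCoef p 0 2 * y + aCoef p 0 3 * y ^ 2 := by
  have h0 := th0_pos hp
  have hr : 0 < 4 - r0 := by linarith [r0_lt]
  have hA := quadA_pos hp
  have hp2 : 0 ≤ 1 - p ^ 2 := by nlinarith [abs_lt.mp hp]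
  have hθ : 0 ≤ th0 p + y := by linarith
  rw [aCoef_secant hp]
  have h1 : 0 ≤ (1 - p ^ 2) * (th0 p + y) := mul_nonneg hp2 hθ
  have h2 : 0 ≤ quadA p * (th0 p + y) := mul_nonneg hA.le hθ
  have h3 : 0 < (4 - r0) / 30 / th0 p := by positivity
  nlinarith [mul_nonneg h1 h2, mul_nonneg h1 h3.le]

/-- The resonance parameter can be tuned so that the solution fixed by its data at `x₁ p` is
smooth across the sonic point and rises to the prescribed height on its left. -/
lemma exists_smooth_theta {p₀ v₀ : ℝ} (hp₀ : p₀ ∈ Ioc (0 : ℝ) (barrierHeight / 10 ^ 6))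
    (hbase : ∀ p ∈ Icc 0 p₀, SeriesBase (aCoef p) p)
    (hth : ∀ p ∈ Icc 0 p₀, th0 p ∈ Ioo (0.1 : ℝ) 0.2) (hv₀ : v₀ < 1) {x₁ θ₁ : ℝ → ℝ}
    (hx₁ : ContinuousOn x₁ (Icc 0 (1 / 100))) (hθ₁ : ContinuousOn θ₁ (Icc 0 (1 / 100)))
    (h1 : ∀ p ∈ Icc (0 : ℝ) (1 / 100), 1 / 2 ≤ x₁ p ∧ p + x₁ p ≤ v₀ ∧ 0 < θ₁ p) :
    ∃ p ∈ Ioo 0 p₀, ∃ (Xe a b : ℝ) (Θ : ℝ → ℝ), 0 < Xe ∧ Xe < p ∧ -p ≤ a ∧ a < -Xe ∧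
      x₁ p < b ∧ p + b ≤ 1 ∧ ContDiffOn ℝ (⊤ : ℕ∞) Θ (Ioo a b) ∧
      (∀ X ∈ Ioo a b, 0 < Θ X ∧ (X ≤ 0 → Θ X ≤ 1)) ∧
      (∀ X ∈ Ioo a b, ∃ d, HasDerivAt Θ d X ∧ (p + X) * X * d = rhs (fCoef p) X (Θ X)) ∧
      Θ (-Xe) = th0 p + barrierHeight / 2 ∧ Θ (x₁ p) = θ₁ p := by
  have hH := barrierHeight_pos
  have hH' := barrierHeight_le
  have hp₀1 : p₀ ≤ 1 / 100 := hp₀.2.trans (by linarith)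
  have habs : ∀ p ∈ Icc 0 p₀, |p| < 1 := fun p hp => by
    rw [abs_of_nonneg hp.1]; linarith [hp.2]
  obtain ⟨k, hk⟩ := exists_nat_gt (aCoef p₀ 0 1 / p₀)
  rw [div_lt_iff₀ hp₀.1] at hk
  set n : ℕ := 2 * k + 13 with hn
  have hnk : (k : ℝ) ≤ n + 1 := by rw [hn]; push_cast; linarith [k.cast_nonneg (α := ℝ)]
  obtain ⟨pb, pa, hpb0, hba, hpa, hKb, hKa, hK⟩ := exists_resonance_interval
    (K := fun p => aCoef p 0 1) (m := n + 1) hp₀.1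
    (fun p hp => (continuousAt_aCoef (habs p hp) 0 1).continuousWithinAt)
    (fun p hp => by linarith [(hbase p hp).a01.1])
    (hk.trans_le (by nlinarith [hp₀.1]))
  have hsub : Icc pb pa ⊆ Icc 0 p₀ := Icc_subset_Icc hpb0.le hpa
  have hsub' : Icc pb pa ⊆ Icc 0 (1 / 100) := hsub.trans (Icc_subset_Icc_right hp₀1)
  obtain ⟨M, Θ, hΘc, hΘ⟩ := exists_left_family hpb0 hba.le (hpa.trans hp₀1) hv₀
    (hx₁.mono hsub') (hθ₁.mono hsub') fun p hp => h1 p (hsub' hp)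
  have hΘq : ∀ p ∈ Icc pb pa, ∀ x ∈ Ioc (0 : ℝ) (1 / 4), 0 < Θ p x ∧ Θ p x < M ∧
      HasDerivAt (Θ p) (rhs (fCoef p) x (Θ p x) / ((p + x) * x)) x := by
    intro p hp x hx
    obtain ⟨-, b, hb, -, h⟩ := hΘ p hp
    exact h x ⟨hx.1, by linarith [hx.2, (h1 p (hsub' hp)).1]⟩
  have hpbm : pb ∈ Icc pb pa := ⟨le_rfl, hba.le⟩
  have hsol : ∀ p ∈ Icc pb pa, IsSol (aCoef p) p (fun x => Θ p x - th0 p) (1 / 4) := by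
    intro p hp x hx
    rw [rhs_aCoef, add_sub_cancel]
    exact ((hΘq p hp x hx).2.2).sub_const _
  obtain ⟨p, hp, D, x₀, hx₀, hD⟩ := exists_parameter_of_resonances (a := aCoef)
    (ψ := fun p x => Θ p x - th0 p) (c := 1 / 4) (n := n) (θ := th0 pb) (M := M)
    (q := (4 - r0) / 30 / th0 pb) hpb0 hba (by norm_num) (by omega)
    (fun p hp => hbase p (hsub hp)) (fun p hp => aCoef_zero_zero (habs p (hsub hp)))
    (fun p hp i j => continuousAt_aCoef (habs p (hsub hp)) i j)
    (by linear_combination hKb) hKa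
    (fun p hp => by have := hK p hp; rwa [show (n : ℝ) + 1 + 1 = n + 2 by ring] at this) hsol
    (fun x hx => (hΘc x ⟨hx.1, by linarith [hx.2]⟩).sub fun p hp =>
      (continuousAt_th0 (habs p (hsub hp))).continuousWithinAt)
    (div_pos (by linarith [r0_lt]) (th0_pos (habs pb (hsub hpbm))))
    (fun x hx => by linarith [(hΘq pb hpbm x hx).1])
    (fun p hp x hx => by linarith [(hΘq p hp x hx).2.1, th0_pos (habs p (hsub hp))])
    (fun y hy => le_aCoef_secant (habs pb (hsub hpbm)) hy)
  have hpI : p ∈ Icc pb pa := ⟨hp.1.le, hp.2.le⟩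
  have hp0 : 0 < p := hpb0.trans hp.1
  have hB := hbase p (hsub hpI)
  have hKp := hK p hp
  obtain ⟨Xe, η, Φ, hXe, hη, hXη, hΦs, hΦψ, hΦ0, hΦd, hΦe, hΦb⟩ := hB.exists_left_extension
    (aCoef_zero_zero (habs p (hsub hpI))) (n := n) (by rw [hn]; exact ⟨k + 7, by ring⟩)
    (fun j hj => by
      have hj' : (j : ℝ) ≤ n + 1 := by exact_mod_cast hj
      nlinarith [hKp.1, mul_le_mul_of_nonneg_left hj' hp0.le])
    hp0 hKp.2 (hp.2.le.trans (hpa.trans hp₀.2)) (hsol p hpI) hx₀ hD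
  obtain ⟨hΘ1, b, hb, hpb, hΘb⟩ := hΘ p hpI
  have hx1 := (h1 p (hsub' hpI)).1
  have hthp := hth p (hsub hpI)
  set F : ℝ → ℝ := fun X => if X < 1 / 4 then th0 p + Φ X else Θ p X with hF
  have hFΦ : ∀ X < 1 / 4, F X = th0 p + Φ X := fun X hX => if_pos hX
  have hFΘ : ∀ X, 0 < X → F X = Θ p X := by
    intro X hX
    by_cases h : X < 1 / 4
    · rw [hFΦ X h, hΦψ X ⟨hX, h⟩]; ring
    · exact if_neg h
  have hFΦn : ∀ X < 1 / 4, F =ᶠ[𝓝 X] fun X => th0 p + Φ X := fun X hX =>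
    (eventually_lt_nhds hX).mono hFΦ
  have hFΘn : ∀ X, 0 < X → F =ᶠ[𝓝 X] Θ p := fun X hX => (eventually_gt_nhds hX).mono hFΘ
  have hΘs : ContDiffOn ℝ (⊤ : ℕ∞) (Θ p) (Ioo 0 b) := by
    refine contDiffOn_of_hasDerivAt (U := Ioi 0 ×ˢ univ)
      (f := fun q => rhs (fCoef p) q.1 q.2 / ((p + q.1) * q.1)) isOpen_Ioo ?_
      (fun t ht => ⟨ht.1, mem_univ _⟩) fun t ht => (hΘb t ht).2.2
    refine ContDiffOn.div (contDiff_rhs (fCoef p)).contDiffOn (by fun_prop) fun q hq => ?_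
    have hq : 0 < q.1 := hq.1
    positivity
  have hFs : ∀ X ∈ Ioo (-Xe - η) b, ContDiffAt ℝ (⊤ : ℕ∞) F X := by
    intro X hX
    rcases lt_or_ge X (1 / 4) with h | h
    · refine ContDiffAt.congr_of_eventuallyEq ?_ (hFΦn X h)
      exact contDiffAt_const.add (hΦs.contDiffAt (isOpen_Ioo.mem_nhds ⟨hX.1, h⟩))
    · exact (hΘs.contDiffAt (isOpen_Ioo.mem_nhds ⟨by linarith, hX.2⟩)).congr_of_eventuallyEq
        (hFΘn X (by linarith))
  refine ⟨p, ⟨hp0, hp.2.trans_le hpa⟩, Xe, -Xe - η, b, F, hXe, by linarith, by linarith,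
    by linarith, hb, hpb, fun X hX => (hFs X hX).contDiffWithinAt, fun X hX => ?_,
    fun X hX => ?_, ?_, ?_⟩
  · rcases lt_trichotomy X 0 with h | rfl | h
    · rw [hFΦ X (by linarith)]
      have := abs_le.mp (hΦb X ⟨hX.1, h⟩)
      exact ⟨by linarith [hthp.1], fun _ => by linarith [hthp.2]⟩
    · rw [hFΦ 0 (by norm_num), hΦ0]
      exact ⟨by linarith [hthp.1], fun _ => by linarith [hthp.2]⟩
    · rw [hFΘ X h]
      exact ⟨(hΘb X ⟨h, hX.2⟩).1, fun h' => absurd h' h.not_ge⟩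
  · have hpX : 0 < p + X := by linarith [hX.1]
    rcases lt_trichotomy X 0 with h | rfl | h
    · have h4 : X < 1 / 4 := by linarith
      refine ⟨_, ((hΦd X ⟨hX.1, h4⟩ h.ne).const_add (th0 p)).congr_of_eventuallyEq (hFΦn X h4), ?_⟩
      rw [rhs_aCoef, hFΦ X h4, mul_div_cancel₀ _ (mul_ne_zero hpX.ne' h.ne)]
    · refine ⟨_, ((hFs 0 hX).differentiableAt (by simp)).hasDerivAt, ?_⟩
      have h0 := aCoef_zero_zero (habs p (hsub hpI))
      rw [hFΦ 0 (by norm_num), hΦ0, ← rhs_aCoef]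
      simp [rhs, eval_cubic, h0]
    · refine ⟨_, ((hΘb X ⟨h, hX.2⟩).2.2).congr_of_eventuallyEq (hFΘn X h), ?_⟩
      rw [hFΘ X h, mul_div_cancel₀ _ (mul_ne_zero hpX.ne' h.ne')]
  · rw [hFΦ _ (by linarith), hΦe]
  · rw [hFΘ _ (by linarith), hΘ1]

end

section

variable {p X θ : ℝ}

lemma r0_sub_mPar (hR : 1 - r0 * p ≠ 0) : r0 - mPar p = p * (1 - mPar p * r0) := by
  unfold mPar
  field_simp
  ring

lemma coneV_qOf (hR : 1 - r0 * p ≠ 0) (hθ : θ ≠ 0) (hφ : phi p X θ ≠ 0)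
    (hφ0 : 1 + (1 - p ^ 2) * θ ≠ 0) :
    coneV (mPar p) (qOf p X θ) (1 / ((1 - r0 * p) * θ)) = p + X := by
  have hr : 1 - r0 ^ 2 ≠ 0 := by
    rw [r0_sq]; linarith [r0_lt]
  have hden : 1 - mPar p * qOf p X θ =
      (1 - r0 ^ 2) * (1 + (1 - p ^ 2) * θ) / ((1 - r0 * p) * phi p X θ) := by
    rw [mPar, qOf, eq_div_iff (mul_ne_zero hR hφ)]
    field_simp
    rw [phi]
    ring
  rw [coneV, hden, div_eq_iff (div_ne_zero (mul_ne_zero hr hφ0) (mul_ne_zero hR hφ)), mPar, qOf]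
  field_simp
  rw [phi]
  ring

/-- An upper bound for the inverse slope of the profile at its exit from the sonic point. -/
def exitSlope (p : ℝ) : ℝ := 1 / ((1 - r0 * p) * (th0 p + barrierHeight / 4))

lemma eventually_exit_conditions : ∀ᶠ p in 𝓝 (0 : ℝ), th0 p ∈ Ioo (0.1 : ℝ) 0.2 ∧
    exitSlope p < 7 ∧ 0 < (1 - r0 * p) * (1 - r0 ^ 2) - 9 * r0 ^ 2 * exitSlope p ∧
    18 * r0 * exitSlope p * p < (1 - r0 * p) * (1 - r0 ^ 2) - 9 * r0 ^ 2 * exitSlope p := by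
  have hH := barrierHeight_pos
  obtain ⟨hr1, hr2⟩ := r0_bounds
  have hθc : ContinuousAt th0 0 := continuousAt_th0 (by norm_num)
  have hθ1 : 0.1475 < th0 0 := by rw [th0_zero]; linarith
  have hθ2 : th0 0 < 0.2 := by rw [th0_zero]; linarith
  have hU0 : exitSlope 0 = 1 / (th0 0 + barrierHeight / 4) := by simp [exitSlope]
  have hUc : ContinuousAt exitSlope 0 := by
    unfold exitSlope
    refine ContinuousAt.div continuousAt_const (by fun_prop) ?_
    rw [mul_zero, sub_zero, one_mul]
    positivity
  have hU7 : exitSlope 0 < 7 := by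
    rw [hU0, div_lt_iff₀ (by linarith)]
    linarith
  have hκ : 0 < (1 - r0 ^ 2) - 9 * r0 ^ 2 * exitSlope 0 := by
    rw [hU0, mul_one_div, sub_pos, div_lt_iff₀ (by linarith), th0_zero]
    have h := r0_sq
    have h1 : (1 - r0 ^ 2) * (3 / 10 - 6 / 5 * r0) = 9 * r0 ^ 2 := by
      linear_combination (3 / 10 + 6 / 5 * r0) * h
    have h2 : 0 < (1 - r0 ^ 2) * (barrierHeight / 4) :=
      mul_pos (by rw [r0_sq]; linarith) (by linarith)
    linarith
  have hκc : ContinuousAt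
      (fun p => (1 - r0 * p) * (1 - r0 ^ 2) - 9 * r0 ^ 2 * exitSlope p) 0 := by fun_prop
  have hl : ContinuousAt (fun p => 18 * r0 * exitSlope p * p) 0 := by fun_prop
  have hκ' : 0 < (1 - r0 * 0) * (1 - r0 ^ 2) - 9 * r0 ^ 2 * exitSlope 0 := by
    rwa [mul_zero, sub_zero, one_mul]
  filter_upwards [hθc.eventually_const_lt (show (0.1 : ℝ) < th0 0 by linarith),
    hθc.eventually_lt_const hθ2, hUc.eventually_lt_const hU7,
    hκc.eventually_const_lt hκ', hl.eventually_lt hκc (by simpa only [mul_zero] using hκ')] with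
    p h1 h2 h3 h4 h5
  exact ⟨⟨h1, h2⟩, h3, h4, h5⟩

end

lemma IsProfileOn.exists_glue {γ a : ℝ} {s t : Set ℝ} {f g : ℝ → ℝ} (hf : IsProfileOn γ s f)
    (hg : IsProfileOn γ t g) (hs : s ⊆ Iic a) (ht : t ⊆ Ici a) (has : a ∈ s) (hat : a ∈ t)
    (hfg : f a = g a) (hD : DelZ a (f a) ≠ 0) :
    ∃ h, IsProfileOn γ (s ∪ t) h ∧ EqOn h f s ∧ EqOn h g t := by
  refine ⟨_, hf.glue hg hs ht has hat hfg hD, fun Z hZ => if_pos (hs hZ), fun Z hZ => ?_⟩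
  rcases (mem_Ici.1 (ht hZ)).eq_or_lt with rfl | h
  · simpa using hfg
  · exact if_neg h.not_ge

/-- Arbitrarily close to `p = 0` there are parameters with a global smooth profile. -/
lemma exists_parameter_with_profile {ε : ℝ} (hε : 0 < ε) :
    ∃ p ∈ Ioo 0 ε, ∀ γ, 1 / (γ + 1) = (1 + mPar p) / 2 →
      ∃ V : ℝ → ℝ, ContDiffOn ℝ (⊤ : ℕ∞) V (Ici 0) ∧ V 0 = 0 ∧
        (∀ Z ∈ Ici (0 : ℝ), DelZ Z (V Z) * derivWithin V (Ici 0) Z = DelV γ Z (V Z)) ∧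
        (∀ Z, 0 < Z → V Z ∈ Ioo (-1) 1 ∧ V Z < Z) ∧
        ∃ g : ℝ → ℝ, ContDiffOn ℝ (⊤ : ℕ∞) g (Ici 0) ∧
          ∀ Z ∈ Ici (0 : ℝ), V Z = Z * g (Z ^ 2) := by
  have hH := barrierHeight_pos
  have hH' := barrierHeight_le
  have hr := r0_pos
  have hr1 := r0_lt
  obtain ⟨p₁, hp₁, hnear⟩ := mem_nhdsGE_iff_exists_Ico_subset.1
    (eventually_seriesBase.and (nhdsWithin_le_nhds eventually_exit_conditions))
  have hp₁ : 0 < p₁ := hp₁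
  obtain ⟨δ, v₀, g, x₁, θ₁, hδ, hv₀, hx₁, hθ₁, horigin⟩ := exists_origin_data
  set p₀ := min (min ε (p₁ / 2)) (barrierHeight / 10 ^ 6) with hp₀
  have hp₀0 : 0 < p₀ := lt_min (lt_min hε (by linarith)) (by positivity)
  have hp₀ε : p₀ ≤ ε := (min_le_left _ _).trans (min_le_left _ _)
  have hp₀1 : p₀ ≤ p₁ / 2 := (min_le_left _ _).trans (min_le_right _ _)
  have hp₀H : p₀ ≤ barrierHeight / 10 ^ 6 := min_le_right _ _
  have hnear' : ∀ p ∈ Icc 0 p₀, p ∈ Ico 0 p₁ := fun p hp => ⟨hp.1, by linarith [hp.2]⟩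
  obtain ⟨p, hp, Xe, a, b, Θ, hXe, hXep, hpa, haX, hxb, hpb, hΘs, hΘpos, hΘode, hΘe, hΘ1⟩ :=
    exists_smooth_theta ⟨hp₀0, hp₀H⟩ (fun p hp => (hnear (hnear' p hp)).1)
      (fun p hp => (hnear (hnear' p hp)).2.1) hv₀ hx₁ hθ₁
      fun p hp => ⟨(horigin p hp).1, (horigin p hp).2.1, (horigin p hp).2.2.1⟩
  have hp2 : p ≤ 1 / 10 ^ 6 := hp.2.le.trans (hp₀H.trans (by gcongr; linarith))
  have hpI : p ∈ Ioc (0 : ℝ) (1 / 100) := ⟨hp.1, by linarith⟩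
  have hpI' : p ∈ Icc (0 : ℝ) (1 / 100) := ⟨hp.1.le, hpI.2⟩
  obtain ⟨-, hth, hU7, hκ0, hpκ⟩ := hnear (hnear' p ⟨hp.1.le, hp.2.le⟩)
  obtain ⟨hx1, hxv, hθ1, hgs, hZ₁⟩ := horigin p hpI'
  refine ⟨p, ⟨hp.1, hp.2.trans_le hp₀ε⟩, fun γ hγ => ?_⟩
  obtain ⟨Z₁, hZ₁0, hP₁, hD₁, hzZ, hvZ, hδZ⟩ := hZ₁ γ hγ
  have hR : 0 < 1 - r0 * p :=
    sub_pos.2 (mul_lt_one_of_nonneg_of_lt_one_left hr.le (by linarith) (by linarith))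
  have hm := mPar_bounds hpI'
  set θe := th0 p + barrierHeight / 2 with hθe
  have hθe0 : 0 < θe := by linarith [hth.1]
  obtain ⟨hφ, hq, hqr, -⟩ := phi_pos_and_qOf_mem hpI (X := -Xe) (θ := θe) (by linarith)
    (by linarith) hθe0 fun _ => by linarith [hth.2]
  have hqr := hqr (by linarith)
  set qe := qOf p (-Xe) θe with hqe
  have hφ0 : 1 + (1 - p ^ 2) * θe ≠ 0 := by
    have : 0 ≤ 1 - p ^ 2 := sub_nonneg.2 (pow_le_one₀ hp.1.le (by linarith))
    positivity
  have hcone : coneV (mPar p) qe (1 / ((1 - r0 * p) * θe)) = p + -Xe :=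
    coneV_qOf hR.ne' hθe0.ne' hφ.ne' hφ0
  obtain ⟨hle, W, hW1, hWe, hP₂⟩ := exists_theta_graph hpI hγ hpa hpb hΘs hΘpos hΘode
    (e := -Xe) (x₁ := x₁ p) ⟨haX, by linarith⟩ ⟨by linarith, hxb⟩ (by linarith)
  rw [hΘ1, hzZ, hΘe] at hle hP₂
  rw [hΘ1, hzZ] at hW1
  rw [hΘe] at hWe
  have hU0 : 0 < exitSlope p := by
    have := hth.1
    unfold exitSlope
    positivity
  have hue : 1 / ((1 - r0 * p) * θe) ∈ Ioo (-2) (exitSlope p) := by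
    refine ⟨lt_trans (by norm_num) (by positivity : 0 < 1 / ((1 - r0 * p) * θe)), ?_⟩
    have := hth.1
    refine one_div_lt_one_div_of_lt (by positivity) (mul_lt_mul_of_pos_left ?_ hR)
    linarith
  have hmr : mPar p ≤ r0 := by
    have h := r0_sub_mPar hR.ne'
    have : 0 ≤ p * (1 - mPar p * r0) := mul_nonneg hp.1.le
      (sub_nonneg.2 (mul_le_one₀ (by linarith [hm.2]) hr.le (by linarith)))
    linarith
  obtain ⟨hle1, W', hWe', hP₃⟩ := exists_cone_graph hγ ⟨hm.1, hmr⟩ (r0_sub_mPar hR.ne') hp.1.le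
    (by linarith) ⟨hU0, hU7.le⟩ hκ0 le_rfl hpκ.le ⟨hq.1, hqr⟩ hue (by rw [hcone]; linarith)
  rw [hcone, mul_comm] at hle1 hWe' hP₃
  have hv : 0 < p + -Xe := by linarith
  have hDe : DelZ (cayley ((p + -Xe) * qe)) (cayley (p + -Xe)) ≠ 0 := by
    have h0 : 0 < (p + -Xe) * qe := mul_pos hv hq.1
    have h1 : (p + -Xe) * qe < p + -Xe := mul_lt_of_lt_one_right hv hq.2
    refine delZ_cayley_ne_zero (by linarith) hv (by linarith) ?_ ?_
    · exact ((mul_lt_of_lt_one_left h0 (by linarith)).trans h1).ne'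
    · rw [mul_comm r0]
      exact (mul_lt_mul_of_pos_left hqr hv).ne
  set Ze := cayley ((p + -Xe) * qe) with hZe
  obtain ⟨F, hF, hF1, hF2⟩ := hP₁.exists_glue hP₂ (fun Z hZ => hZ.2) (fun Z hZ => hZ.1)
    ⟨hZ₁0, le_rfl⟩ ⟨le_rfl, hle⟩ (hvZ.symm.trans hW1.symm) hD₁
  rw [Ioc_union_Icc_eq_Ioc hZ₁0 hle] at hF
  have hFe : F Ze = cayley (p + -Xe) := (hF2 ⟨hle, le_rfl⟩).trans hWe
  obtain ⟨G, hG, hG1, hG2⟩ := hF.exists_glue hP₃ (fun Z hZ => hZ.2) (fun Z hZ => hZ.1)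
    ⟨hZ₁0.trans_le hle, le_rfl⟩ ⟨le_rfl, hle1⟩ (hFe.trans hWe'.symm) (by rwa [hFe])
  rw [Ioc_union_Icc_eq_Ioc (hZ₁0.trans_le hle) hle1] at hG
  have hone : (1 : ℝ) ∈ Ioc (0 : ℝ) 1 := ⟨one_pos, le_rfl⟩
  have hG1m := (hG 1 hone).1
  obtain ⟨E, hE1, hE⟩ := exists_far_graph hm.1 hγ hG1m
  obtain ⟨V, hV, hV1, -⟩ := hG.exists_glue hE (fun Z hZ => hZ.2) (fun Z hZ => hZ) hone
    (mem_Ici.2 le_rfl) hE1.symm (delZ_neg_of_far le_rfl hG1m).ne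
  rw [Ioc_union_Ici_eq_Ioi one_pos] at hV
  refine hV.exists_smooth (g := g p) (half_pos hδ)
    (hgs.mono (Ioo_subset_Ioo (by linarith) (by linarith))) fun Z hZ hZδ => ?_
  have hZ1 : Z ≤ Z₁ := by
    by_contra! h
    have := pow_lt_pow_left₀ h hZ₁0.le two_ne_zero
    linarith
  rw [hV1 ⟨hZ, hZ1.trans (hle.trans hle1)⟩, hG1 ⟨hZ, hZ1.trans hle⟩, hF1 ⟨hZ, hZ1⟩]

lemma inv_sqrt_eq : (√(5 / 3))⁻¹ = (1 - r0) / (1 + r0) := by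
  have hr := r0_pos
  have hr1 := r0_lt
  rw [inv_eq_iff_eq_inv, inv_div, Real.sqrt_eq_iff_mul_self_eq (by norm_num)
    (div_nonneg (by linarith) (by linarith)), ← pow_two, div_pow,
    eq_div_iff (pow_ne_zero 2 (by linarith))]
  linear_combination 2 / 3 * r0_sq

end

/-- For `d = 4`, `p = 7`, `ℓ = 5/3`, there is a strictly decreasing sequence of parameters
`γ_k > ℓ^{-1/2}` converging to `ℓ^{-1/2}` for which `b_k > 0` and the `(Z,V)`-ODE admits a
global smooth solution with the stated properties. -/
theorem exists_gamma_seq_with_smooth_profiles :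
    ∃ γseq : ℕ → ℝ,
      StrictAnti γseq ∧
      (∀ k, (Real.sqrt (5/3))⁻¹ < γseq k) ∧
      Filter.Tendsto γseq Filter.atTop (nhds ((Real.sqrt (5/3))⁻¹)) ∧
      ∀ k, (0 < ((4 : ℝ) - 1) / ((5/3) * (γseq k + 1)) - 1) ∧
        ∃ V : ℝ → ℝ,
          ContDiffOn ℝ (⊤ : ℕ∞) V (Ici 0) ∧
          V 0 = 0 ∧
          (∀ Z ∈ Ici (0 : ℝ),
            DelZ Z (V Z) * derivWithin V (Ici 0) Z = DelV (γseq k) Z (V Z)) ∧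
          (∀ Z : ℝ, 0 < Z → V Z ∈ Ioo (-1 : ℝ) 1 ∧ V Z < Z) ∧
          ∃ g : ℝ → ℝ, ContDiffOn ℝ (⊤ : ℕ∞) g (Ici 0) ∧
            ∀ Z ∈ Ici (0 : ℝ), V Z = Z * g (Z ^ 2) := by
  obtain ⟨hr, hr1⟩ := r0_bounds
  set γ₀ := (√(5 / 3))⁻¹ with hγ₀
  set S : Set ℝ := {γ | γ₀ < γ ∧ 0 < ((4 : ℝ) - 1) / ((5 / 3) * (γ + 1)) - 1 ∧
    ∃ V : ℝ → ℝ, ContDiffOn ℝ (⊤ : ℕ∞) V (Ici 0) ∧ V 0 = 0 ∧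
      (∀ Z ∈ Ici (0 : ℝ), DelZ Z (V Z) * derivWithin V (Ici 0) Z = DelV γ Z (V Z)) ∧
      (∀ Z, 0 < Z → V Z ∈ Ioo (-1) 1 ∧ V Z < Z) ∧
      ∃ g : ℝ → ℝ, ContDiffOn ℝ (⊤ : ℕ∞) g (Ici 0) ∧
        ∀ Z ∈ Ici (0 : ℝ), V Z = Z * g (Z ^ 2)} with hS
  have hnear : ∀ ε > 0, ∃ γ ∈ S, γ < γ₀ + ε := by
    intro ε hε
    obtain ⟨p, hp, h⟩ := exists_parameter_with_profile
      (lt_min (half_pos hε) (by norm_num : (0 : ℝ) < 1 / 100))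
    have hpε := hp.2.trans_le (min_le_left _ _)
    have hp1 := hp.2.trans_le (min_le_right _ _)
    have hm := mPar_bounds ⟨hp.1.le, hp1.le⟩
    have hR : 1 - r0 * p ≠ 0 := by nlinarith [hp.1]
    have hrm := r0_sub_mPar hR
    have hmr : 0 < 1 - mPar p * r0 := by nlinarith [hm.1, hm.2]
    have hmr1 : 1 - mPar p * r0 ≤ 1 := sub_le_self _ (mul_nonneg hm.1 (by linarith))
    have hd0 : 0 < r0 - mPar p := hrm ▸ mul_pos hp.1 hmr
    have hdp : r0 - mPar p ≤ p := hrm ▸ mul_le_of_le_one_right hp.1.le hmr1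
    have hm1 : 1 + mPar p ≠ 0 := by linarith [hm.1]
    set γ := (1 - mPar p) / (1 + mPar p) with hγ
    have hγ1 : γ + 1 = 2 / (1 + mPar p) := by
      rw [hγ]; field_simp; ring
    have hdiff : γ - γ₀ = 2 * (r0 - mPar p) / ((1 + mPar p) * (1 + r0)) := by
      rw [hγ, hγ₀, inv_sqrt_eq]
      have : 1 + r0 ≠ 0 := by linarith
      field_simp
      ring
    have hden : 1 ≤ (1 + mPar p) * (1 + r0) := by nlinarith [hm.1]
    have hdiff0 : 0 < γ - γ₀ := by
      rw [hdiff]; positivity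
    have hdiff1 : γ - γ₀ ≤ 2 * (r0 - mPar p) := by
      rw [hdiff]; exact div_le_self (by linarith) hden
    refine ⟨γ, ⟨by linarith, ?_, h γ (by rw [hγ1, one_div_div])⟩, by linarith⟩
    have : ((4 : ℝ) - 1) / ((5 / 3) * (γ + 1)) - 1 = 9 / 10 * (1 + mPar p) - 1 := by
      rw [hγ1]; field_simp; ring
    linarith
  have hGLB : IsGLB S γ₀ := by
    refine ⟨fun γ hγ => hγ.1.le, fun x hx => le_of_forall_pos_lt_add fun ε hε => ?_⟩
    obtain ⟨γ, hγ, hlt⟩ := hnear ε hε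
    exact (hx hγ).trans_lt hlt
  obtain ⟨γ, hγ, -⟩ := hnear 1 one_pos
  obtain ⟨u, hanti, -, hu, hmem⟩ :=
    hGLB.exists_seq_strictAnti_tendsto_of_notMem (fun h => lt_irrefl _ h.1) ⟨γ, hγ⟩
  exact ⟨u, hanti, fun k => (hmem k).1, hu, fun k => (hmem k).2⟩

end Stmt0
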